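/- Under the hypotheses of the main existence theorem (conditions (H1), (H3), existence of an exponential dichotomy on ℝ for the evolution family generated by the linearized problem, and ‖f‖_{BC²} ≤ ε), assume additionally that there is T > 0 such that A(x,t+T,v) = A(x,t,v) and B(x,t+T,v) = B(x,t,v) for all (x,t) ∈ [0,1]×ℝ and ‖v‖ ≤ δ₀, and f(x,t+T) = f(x,t) for all (x,t). Then the unique classical solution u ∈ C¹([0,1]×ℝ;ℝⁿ) of the quasilinear problem with ‖u‖_{BC¹} ≤ δ is T-periodic in t: u(x,t+T) = u(x,t) for all (x,t) ∈ [0,1]×ℝ. -/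

import Mathlib

noncomputable section

open MeasureTheory Set Filter

/-- `ℝⁿ` with the Euclidean norm. -/
abbrev Vn (n : ℕ) : Type := EuclideanSpace ℝ (Fin n)

/-- The strip `[0,1] × ℝ`. -/
def strip : Set (ℝ × ℝ) := Set.Icc (0:ℝ) 1 ×ˢ (Set.univ : Set ℝ)

/-- `g` is `C^k` on the strip `[0,1] × ℝ` with the function and all its partial
derivatives up to order `k` bounded by `C` there (the `BC^k`-norm is `≤ C`). -/
def BCle (k : ℕ) (g : ℝ → ℝ → ℝ) (C : ℝ) : Prop :=
  ContDiffOn ℝ k (fun q : ℝ × ℝ => g q.1 q.2) strip ∧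
  ∀ i : ℕ, i ≤ k → ∀ q ∈ strip,
    ‖iteratedFDerivWithin ℝ i (fun q : ℝ × ℝ => g q.1 q.2) strip q‖ ≤ C

/-- The reflection boundary conditions relating the boundary values
`w0 = u(0,t)` and `w1 = u(1,t)`. -/
def BCrel (n m : ℕ) (p : Fin n → Fin n → ℝ) (w0 w1 : Vn n) : Prop :=
  ∀ j : Fin n,
    ((j : ℕ) < m →
      w0 j = ∑ k : Fin n, if m ≤ (k : ℕ) then p j k * w0 k else p j k * w1 k) ∧
    (m ≤ (j : ℕ) →
      w1 j = ∑ k : Fin n, if m ≤ (k : ℕ) then p j k * w0 k else p j k * w1 k)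

/-- Assumption (H3). -/
def H3cond (n : ℕ) (p : Fin n → Fin n → ℝ) : Prop :=
  ∀ i : Fin (n + 1) → Fin n, ∏ l : Fin n, p (i l.castSucc) (i l.succ) = 0

/-- The `Λ₀`-condition on the diagonal coefficients `a`. -/
def LamCond (n m : ℕ) (Λ₀ : ℝ) (a : ℝ → ℝ → Fin n → ℝ) : Prop :=
  ∀ x ∈ Set.Icc (0:ℝ) 1, ∀ t : ℝ,
    (∀ j : Fin n, ((j : ℕ) < m → Λ₀ ≤ a x t j) ∧ (m ≤ (j : ℕ) → a x t j ≤ -Λ₀)) ∧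
    ∀ j k : Fin n, j ≠ k → Λ₀ ≤ |a x t j - a x t k|

/-- A classical solution `u` (with partial derivatives `ux`, `ut`) of the linear
problem `∂ₜu + a ∂ₓu + b u = f` on `[0,1] × [s,∞)` with the reflection boundary
conditions and initial datum `φ` at time `s`. -/
def IsLinSol (n m : ℕ) (p : Fin n → Fin n → ℝ)
    (a : ℝ → ℝ → Fin n → ℝ) (b : ℝ → ℝ → Fin n → Fin n → ℝ)
    (f : ℝ → ℝ → Fin n → ℝ) (s : ℝ) (φ : ℝ → Vn n)
    (u ux ut : ℝ → ℝ → Vn n) : Prop :=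
  ContinuousOn (fun q : ℝ × ℝ => u q.1 q.2) (Set.Icc 0 1 ×ˢ Set.Ici s) ∧
  ContinuousOn (fun q : ℝ × ℝ => ux q.1 q.2) (Set.Icc 0 1 ×ˢ Set.Ici s) ∧
  ContinuousOn (fun q : ℝ × ℝ => ut q.1 q.2) (Set.Icc 0 1 ×ˢ Set.Ici s) ∧
  (∀ x ∈ Set.Icc (0:ℝ) 1, ∀ t ∈ Set.Ici s, ∀ j : Fin n,
    HasDerivWithinAt (fun y => u y t j) (ux x t j) (Set.Icc 0 1) x ∧
    HasDerivWithinAt (fun τ => u x τ j) (ut x t j) (Set.Ici s) t) ∧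
  (∀ x ∈ Set.Icc (0:ℝ) 1, ∀ t ∈ Set.Ici s, ∀ j : Fin n,
    ut x t j + a x t j * ux x t j + ∑ k : Fin n, b x t j k * u x t k = f x t j) ∧
  (∀ t ∈ Set.Ici s, BCrel n m p (u 0 t) (u 1 t)) ∧
  (∀ x ∈ Set.Icc (0:ℝ) 1, u x s = φ x)

/-- Lebesgue measure restricted to `(0,1)`. -/
abbrev μ01 : Measure ℝ := volume.restrict (Set.Ioo (0:ℝ) 1)

/-- The space `L²((0,1); ℝⁿ)`. -/
abbrev L2 (n : ℕ) := Lp (Vn n) 2 μ01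

/-- An evolution family of bounded linear operators. -/
def IsEvoFam {X : Type*} [NormedAddCommGroup X] [NormedSpace ℝ X]
    (U : ℝ → ℝ → X →L[ℝ] X) : Prop :=
  (∀ t : ℝ, U t t = ContinuousLinearMap.id ℝ X) ∧
  (∀ s r t : ℝ, s ≤ r → r ≤ t → ∀ x : X, U t r (U r s x) = U t s x)

/-- `U` is the evolution family on `L²((0,1);ℝⁿ)` generated by the linear
problem with coefficients `a`, `b`: it is a strongly continuous, exponentially
bounded evolution family which, on `C¹` data with compact support in `(0,1)`,
is given by the classical solutions. -/
def GeneratedBy (n m : ℕ) (p : Fin n → Fin n → ℝ)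
    (a : ℝ → ℝ → Fin n → ℝ) (b : ℝ → ℝ → Fin n → Fin n → ℝ)
    (U : ℝ → ℝ → L2 n →L[ℝ] L2 n) : Prop :=
  IsEvoFam U ∧
  (∀ φ : L2 n, ContinuousOn (fun q : ℝ × ℝ => U q.1 q.2 φ) {q : ℝ × ℝ | q.2 ≤ q.1}) ∧
  (∃ K : ℝ, 1 ≤ K ∧ ∃ ν : ℝ, ∀ s t : ℝ, s ≤ t →
    ‖U t s‖ ≤ K * Real.exp (ν * (t - s))) ∧
  ∀ s : ℝ, ∀ φ : ℝ → Vn n, ContDiff ℝ 1 φ → tsupport φ ⊆ Set.Ioo 0 1 →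
    ∀ φh : L2 n, (∀ᵐ x ∂μ01, φh x = φ x) →
    ∀ u ux ut : ℝ → ℝ → Vn n,
      IsLinSol n m p a b (fun _ _ _ => 0) s φ u ux ut →
      ∀ t : ℝ, s ≤ t → ∀ᵐ x ∂μ01, (U t s φh) x = u x t

/-- Exponential dichotomy on `ℝ` with exponent `α` and bound `M`. -/
def HasExpDichotomy {X : Type*} [NormedAddCommGroup X] [NormedSpace ℝ X]
    (U : ℝ → ℝ → X →L[ℝ] X) (α M : ℝ) : Prop :=
  ∃ P : ℝ → X →L[ℝ] X, ∃ W : ℝ → ℝ → X →L[ℝ] X,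
    (∀ t, (P t).comp (P t) = P t) ∧
    (∀ x : X, Continuous fun t => P t x) ∧
    (∀ x : X, ∃ C : ℝ, ∀ t, ‖P t x‖ ≤ C) ∧
    (∀ s t : ℝ, s ≤ t → (U t s).comp (P s) = (P t).comp (U t s)) ∧
    (∀ s t : ℝ, s ≤ t → ∀ x : X, W s t (U t s (x - P s x)) = x - P s x) ∧
    (∀ s t : ℝ, s ≤ t → ∀ x : X, U t s (W s t (x - P t x)) = x - P t x) ∧
    (∀ s t : ℝ, s ≤ t → ∀ x : X, P s (W s t (x - P t x)) = 0) ∧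
    (∀ s t : ℝ, s ≤ t → ‖(U t s).comp (P s)‖ ≤ M * Real.exp (-α * (t - s))) ∧
    (∀ s t : ℝ, s ≤ t →
      ‖(W s t).comp (ContinuousLinearMap.id ℝ X - P t)‖ ≤ M * Real.exp (-α * (t - s)))

/-- The domain `[0,1] × ℝ × {‖v‖ ≤ δ₀}`. -/
def qdom (n : ℕ) (δ₀ : ℝ) : Set (ℝ × ℝ × Vn n) :=
  Set.Icc (0:ℝ) 1 ×ˢ (Set.univ : Set ℝ) ×ˢ Metric.closedBall (0 : Vn n) δ₀

/-- (H1)-type smoothness: `g(x,t,v)` has continuous partial derivatives up to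
second order, bounded by `C`, on `[0,1] × ℝ × {‖v‖ ≤ δ₀}`. -/
def H1smooth (n : ℕ) (δ₀ : ℝ) (g : ℝ → ℝ → Vn n → ℝ) (C : ℝ) : Prop :=
  ContDiffOn ℝ 2 (fun q : ℝ × ℝ × Vn n => g q.1 q.2.1 q.2.2) (qdom n δ₀) ∧
  ∀ i : ℕ, i ≤ 2 → ∀ q ∈ qdom n δ₀,
    ‖iteratedFDerivWithin ℝ i (fun q : ℝ × ℝ × Vn n => g q.1 q.2.1 q.2.2)
      (qdom n δ₀) q‖ ≤ C

/-- The sign/separation conditions of (H1) on the diagonal coefficients `A`. -/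
def H1sign (n m : ℕ) (δ₀ Λ₀ : ℝ) (A : ℝ → ℝ → Vn n → Fin n → ℝ) : Prop :=
  ∀ x ∈ Set.Icc (0:ℝ) 1, ∀ t : ℝ, ∀ v : Vn n, ‖v‖ ≤ δ₀ →
    (∀ j : Fin n, ((j : ℕ) < m → Λ₀ ≤ A x t v j) ∧ (m ≤ (j : ℕ) → A x t v j ≤ -Λ₀)) ∧
    ∀ j k : Fin n, j ≠ k → Λ₀ ≤ |A x t v j - A x t v k|

/-- A classical (C¹) solution `u` (with partial derivatives `ux`, `ut`) of the
quasilinear problem `∂ₜu + A(x,t,u)∂ₓu + B(x,t,u)u = f` on the strip `[0,1] × ℝ`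
with the reflection boundary conditions. -/
def IsQLSol (n m : ℕ) (p : Fin n → Fin n → ℝ)
    (A : ℝ → ℝ → Vn n → Fin n → ℝ) (B : ℝ → ℝ → Vn n → Fin n → Fin n → ℝ)
    (f : ℝ → ℝ → Fin n → ℝ) (u ux ut : ℝ → ℝ → Vn n) : Prop :=
  ContinuousOn (fun q : ℝ × ℝ => u q.1 q.2) strip ∧
  ContinuousOn (fun q : ℝ × ℝ => ux q.1 q.2) strip ∧
  ContinuousOn (fun q : ℝ × ℝ => ut q.1 q.2) strip ∧
  (∀ x ∈ Set.Icc (0:ℝ) 1, ∀ t : ℝ, ∀ j : Fin n,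
    HasDerivWithinAt (fun y => u y t j) (ux x t j) (Set.Icc 0 1) x ∧
    HasDerivAt (fun τ => u x τ j) (ut x t j) t) ∧
  (∀ x ∈ Set.Icc (0:ℝ) 1, ∀ t : ℝ, ∀ j : Fin n,
    ut x t j + A x t (u x t) j * ux x t j
      + ∑ k : Fin n, B x t (u x t) j k * u x t k = f x t j) ∧
  (∀ t : ℝ, BCrel n m p (u 0 t) (u 1 t))

/-- `‖u‖_{BC¹} ≤ δ` on the strip. -/
def BC1le (n : ℕ) (u ux ut : ℝ → ℝ → Vn n) (δ : ℝ) : Prop :=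
  ∀ x ∈ Set.Icc (0:ℝ) 1, ∀ t : ℝ, ‖u x t‖ ≤ δ ∧ ‖ux x t‖ ≤ δ ∧ ‖ut x t‖ ≤ δ

/-- `f` has bounded continuous partial derivatives up to second order on the
strip, with `‖f‖_{BC²} ≤ ε`. -/
def FBC2le (n : ℕ) (f : ℝ → ℝ → Fin n → ℝ) (ε : ℝ) : Prop :=
  (∀ j : Fin n, ContDiffOn ℝ 2 (fun q : ℝ × ℝ => f q.1 q.2 j) strip) ∧
  ∀ j : Fin n, ∀ i : ℕ, i ≤ 2 → ∀ q ∈ strip,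
    ‖iteratedFDerivWithin ℝ i (fun q : ℝ × ℝ => f q.1 q.2 j) strip q‖ ≤ ε

section
namespace QL
open scoped Topology

/-- clamp to `[0,1]` -/
def cl (x : ℝ) : ℝ := max 0 (min 1 x)

lemma cl_mem (x : ℝ) : cl x ∈ Icc (0:ℝ) 1 := by
  unfold cl; constructor
  · exact le_max_left _ _
  · exact max_le (by norm_num) (min_le_left _ _)

lemma cl_eq {x : ℝ} (hx : x ∈ Icc (0:ℝ) 1) : cl x = x := by
  unfold cl; rw [min_eq_right hx.2, max_eq_right hx.1]

@[simp] lemma cl_cl (x : ℝ) : cl (cl x) = cl x := cl_eq (cl_mem x)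

lemma cl_cont : Continuous cl := by unfold cl; fun_prop

lemma cl_lip (x y : ℝ) : |cl x - cl y| ≤ |x - y| := by
  unfold cl
  refine (abs_max_sub_max_le_max _ _ _ _).trans ?_
  refine max_le (by simp) ((abs_min_sub_min_le_max _ _ _ _).trans (by simp))

/-- joint continuity -/
def CC (f : ℝ → ℝ → ℝ) : Prop := Continuous (fun q : ℝ × ℝ => f q.1 q.2)

lemma CC.comp {f : ℝ → ℝ → ℝ} (h : CC f) {X : Type*} [TopologicalSpace X] {a b : X → ℝ}
    (ha : Continuous a) (hb : Continuous b) : Continuous fun z => f (a z) (b z) :=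
  Continuous.comp (g := fun q : ℝ × ℝ => f q.1 q.2) h (ha.prodMk hb)

/-- `f` is `C¹` in `t` with derivative `ft` -/
structure TD (f ft : ℝ → ℝ → ℝ) : Prop where
  c : CC f
  ct : CC ft
  dt : ∀ x t, HasDerivAt (f x) (ft x t) t

/-- `f` is `C¹` in `(x,t)` -/
structure XT (f fx ft : ℝ → ℝ → ℝ) : Prop extends TD f ft where
  cx : CC fx
  dx : ∀ x ∈ Icc (0:ℝ) 1, ∀ t, HasDerivWithinAt (fun y => f y t) (fx x t) (Icc 0 1) x

/-- Hadamard quotient -/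
def Hq (ft : ℝ → ℝ → ℝ) (x t1 t2 : ℝ) : ℝ := ∫ θ in (0:ℝ)..1, ft x (t1 + θ * (t2 - t1))

lemma Hq_cont {ft : ℝ → ℝ → ℝ} (h : CC ft) {X : Type*} [TopologicalSpace X]
    {a b c : X → ℝ} (ha : Continuous a) (hb : Continuous b) (hc : Continuous c) :
    Continuous fun z => Hq ft (a z) (b z) (c z) := by
  unfold Hq
  apply intervalIntegral.continuous_parametric_intervalIntegral_of_continuous'
  unfold Function.uncurry
  exact h.comp (by fun_prop) (by fun_prop)

lemma Hq_contOn {ft : ℝ → ℝ → ℝ} (h : CC ft) {X : Type*} [TopologicalSpace X] {s : Set X}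
    {a b c : X → ℝ} (ha : ContinuousOn a s) (hb : ContinuousOn b s) (hc : ContinuousOn c s) :
    ContinuousOn (fun z => Hq ft (a z) (b z) (c z)) s := by
  have := Hq_cont h (X := ℝ × ℝ × ℝ) (a := fun z => z.1) (b := fun z => z.2.1) (c := fun z => z.2.2)
    (by fun_prop) (by fun_prop) (by fun_prop)
  exact this.comp_continuousOn (ha.prodMk (hb.prodMk hc))

lemma Hq_self {ft : ℝ → ℝ → ℝ} (x t : ℝ) : Hq ft x t t = ft x t := by
  simp [Hq]

lemma TD.hadamard {f ft : ℝ → ℝ → ℝ} (h : TD f ft) (x t1 t2 : ℝ) :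
    f x t2 - f x t1 = (t2 - t1) * Hq ft x t1 t2 := by
  unfold Hq
  have h1 : ∀ θ ∈ uIcc (0:ℝ) 1, HasDerivAt (fun θ => f x (t1 + θ * (t2 - t1)))
      (ft x (t1 + θ * (t2 - t1)) * (t2 - t1)) θ := by
    intro θ _
    have h2 : HasDerivAt (fun θ : ℝ => t1 + θ * (t2 - t1)) (t2 - t1) θ := by
      simpa using ((hasDerivAt_id θ).mul_const (t2 - t1)).const_add t1
    exact (h.dt x _).comp θ h2
  have h3 := intervalIntegral.integral_eq_sub_of_hasDerivAt h1 (by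
    apply Continuous.intervalIntegrable
    exact (h.ct.comp (by fun_prop) (by fun_prop)).mul continuous_const)
  rw [intervalIntegral.integral_mul_const] at h3
  simp only [one_mul, zero_mul, add_zero, add_sub_cancel] at h3
  linarith

lemma Hq_bound {ft : ℝ → ℝ → ℝ} {M : ℝ} (h : ∀ x t, |ft x t| ≤ M) (x t1 t2 : ℝ) :
    |Hq ft x t1 t2| ≤ M := by
  unfold Hq
  have := intervalIntegral.norm_integral_le_of_norm_le_const (a := (0:ℝ)) (b := 1)
    (f := fun θ => ft x (t1 + θ * (t2 - t1))) (C := M) (fun θ _ => h _ _)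
  simpa using this

/-- product with a vanishing factor -/
lemma hasDeriv_mul_vanish {F g : ℝ → ℝ} {F' : ℝ} {s : Set ℝ} {ξ : ℝ}
    (hF : HasDerivWithinAt F F' s ξ) (h0 : F ξ = 0) (hg : ContinuousWithinAt g s ξ) :
    HasDerivWithinAt (fun x => F x * g x) (F' * g ξ) s ξ := by
  rw [hasDerivWithinAt_iff_tendsto_slope] at hF ⊢
  have : slope (fun x => F x * g x) ξ = fun x => slope F ξ x * g x := by
    funext x
    simp [slope_def_field, h0]; ring
  rw [this]
  exact hF.mul (hg.mono_left (nhdsWithin_mono _ sdiff_subset))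

lemma XT.chain {f fx ft : ℝ → ℝ → ℝ} (h : XT f fx ft) {α : ℝ → ℝ} {α' ξ : ℝ}
    (hξ : ξ ∈ Icc (0:ℝ) 1) (hα : HasDerivWithinAt α α' (Icc 0 1) ξ) :
    HasDerivWithinAt (fun s => f s (α s)) (fx ξ (α ξ) + α' * ft ξ (α ξ)) (Icc 0 1) ξ := by
  have e : (fun s => f s (α s)) = fun s => f s (α ξ) + (α s - α ξ) * Hq ft s (α ξ) (α s) := by
    funext s; rw [← h.hadamard]; ring
  rw [e]
  refine (h.dx ξ hξ (α ξ)).add ?_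
  have h1 := hasDeriv_mul_vanish (hα.sub_const (α ξ)) (by simp)
    (g := fun s => Hq ft s (α ξ) (α s)) ?_
  · simpa [Hq_self] using h1
  · have := Hq_cont h.ct (X := ℝ × ℝ × ℝ) (a := fun z => z.1) (b := fun z => z.2.1)
      (c := fun z => z.2.2) (by fun_prop) (by fun_prop) (by fun_prop)
    exact this.continuousAt.comp_continuousWithinAt (f := fun s => (s, α ξ, α s))
      (continuousWithinAt_id.prodMk (continuousWithinAt_const.prodMk hα.continuousWithinAt))

/-- converse: derivative along a curve gives the `x`-derivative -/
lemma TD.dx_of_along {f ft : ℝ → ℝ → ℝ} (h : TD f ft) {α : ℝ → ℝ} {α' r ξ : ℝ}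
    (hα : HasDerivWithinAt α α' (Icc 0 1) ξ)
    (hr : HasDerivWithinAt (fun s => f s (α s)) r (Icc 0 1) ξ) :
    HasDerivWithinAt (fun s => f s (α ξ)) (r - α' * ft ξ (α ξ)) (Icc 0 1) ξ := by
  have e : (fun s => f s (α ξ)) = fun s => f s (α s) - (α s - α ξ) * Hq ft s (α ξ) (α s) := by
    funext s; rw [← h.hadamard]; ring
  rw [e]
  refine hr.sub ?_
  have h1 := hasDeriv_mul_vanish (hα.sub_const (α ξ)) (by simp)
    (g := fun s => Hq ft s (α ξ) (α s)) ?_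
  · simpa [Hq_self] using h1
  · have := Hq_cont h.ct (X := ℝ × ℝ × ℝ) (a := fun z => z.1) (b := fun z => z.2.1)
      (c := fun z => z.2.2) (by fun_prop) (by fun_prop) (by fun_prop)
    exact this.continuousAt.comp_continuousWithinAt (f := fun s => (s, α ξ, α s))
      (continuousWithinAt_id.prodMk (continuousWithinAt_const.prodMk hα.continuousWithinAt))

/-- FTC on subintervals of `[0,1]` -/
lemma ftc_Icc {f f' : ℝ → ℝ} (hf : ∀ x ∈ Icc (0:ℝ) 1, HasDerivWithinAt f (f' x) (Icc 0 1) x)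
    (hf' : ContinuousOn f' (Icc 0 1)) {a b : ℝ} (ha : a ∈ Icc (0:ℝ) 1) (hb : b ∈ Icc (0:ℝ) 1) :
    ∫ x in a..b, f' x = f b - f a := by
  have hsub : uIcc a b ⊆ Icc 0 1 := (convex_Icc (0:ℝ) 1).ordConnected.uIcc_subset ha hb
  apply intervalIntegral.integral_eq_sub_of_hasDeriv_right
  · exact fun x hx => (hf x (hsub hx)).continuousWithinAt.mono hsub
  · intro x hx
    have hx' : x ∈ Ioo (0:ℝ) 1 := by
      constructor
      · exact lt_of_le_of_lt (le_min ha.1 hb.1) hx.1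
      · exact lt_of_lt_of_le hx.2 (max_le ha.2 hb.2)
    exact ((hf x (Ioo_subset_Icc_self hx')).hasDerivAt (Icc_mem_nhds hx'.1 hx'.2)).hasDerivWithinAt
  · exact (hf'.mono hsub).intervalIntegrable

/-- linear ODE on `[0,1]` -/
lemma lin_ode {f R : ℝ → ℝ} (hR : ContinuousOn R (Icc 0 1))
    (hf : ∀ x ∈ Icc (0:ℝ) 1, HasDerivWithinAt f (R x * f x) (Icc 0 1) x) {a b : ℝ}
    (ha : a ∈ Icc (0:ℝ) 1) (hb : b ∈ Icc (0:ℝ) 1) :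
    f b = f a * Real.exp (∫ s in a..b, R s) := by
  -- replace `R` by its clamped version
  have hRc : Continuous fun s => R (cl s) :=
    hR.comp_continuous cl_cont cl_mem
  have hInt : ∀ c ∈ Icc (0:ℝ) 1, ∫ s in a..c, R (cl s) = ∫ s in a..c, R s := by
    intro c hc
    apply intervalIntegral.integral_congr
    intro s hs
    have : s ∈ Icc (0:ℝ) 1 := (convex_Icc (0:ℝ) 1).ordConnected.uIcc_subset ha hc hs
    simp [cl_eq this]
  have hd : ∀ x, HasDerivAt (fun x => ∫ s in a..x, R (cl s)) (R (cl x)) x := fun x =>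
    intervalIntegral.integral_hasDerivAt_right (hRc.intervalIntegrable _ _)
      (hRc.stronglyMeasurableAtFilter _ _) hRc.continuousAt
  have h1 : ∀ x ∈ Icc (0:ℝ) 1, HasDerivWithinAt
      (fun x => f x * Real.exp (-∫ s in a..x, R (cl s))) 0 (Icc 0 1) x := by
    intro x hx
    have := (hf x hx).mul ((hd x).neg.exp.hasDerivWithinAt)
    refine HasDerivWithinAt.congr_deriv this ?_
    rw [cl_eq hx]; simp only [Pi.neg_apply]; ring
  have h2 := ftc_Icc h1 continuousOn_const ha hb
  simp only [intervalIntegral.integral_zero, intervalIntegral.integral_same, neg_zero,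
    Real.exp_zero, mul_one] at h2
  rw [hInt b hb] at h2
  have h3 : f a = f b * Real.exp (-∫ s in a..b, R s) := by linarith
  rw [h3, mul_assoc, ← Real.exp_add]; simp

end QL
end

section
namespace QL
open scoped Topology

lemma continuous_paramInt {X : Type*} [TopologicalSpace X] {f : X → ℝ → ℝ}
    (hf : Continuous (fun z : X × ℝ => f z.1 z.2)) {a b : X → ℝ} (ha : Continuous a)
    (hb : Continuous b) : Continuous fun z => ∫ s in (a z)..(b z), f z s := by
  have hi : ∀ z c e, IntervalIntegrable (f z) volume c e := fun z c e =>
    Continuous.intervalIntegrable (by fun_prop) _ _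
  have : (fun z => ∫ s in (a z)..(b z), f z s)
      = fun z => (∫ s in (0:ℝ)..(b z), f z s) - ∫ s in (0:ℝ)..(a z), f z s := by
    funext z
    rw [intervalIntegral.integral_interval_sub_left (hi _ _ _) (hi _ _ _)]
  rw [this]
  exact (intervalIntegral.continuous_parametric_intervalIntegral_of_continuous hf hb).sub
    (intervalIntegral.continuous_parametric_intervalIntegral_of_continuous hf ha)

lemma TD.integral {F Ft : ℝ → ℝ → ℝ} (h : TD F Ft) (a b t : ℝ) :
    HasDerivAt (fun t => ∫ s in a..b, F s t) (∫ s in a..b, Ft s t) t := by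
  have hi : ∀ t, IntervalIntegrable (fun s => F s t) volume a b := fun t =>
    Continuous.intervalIntegrable (h.c.comp (by fun_prop) (by fun_prop)) _ _
  have e : (fun t' => ∫ s in a..b, F s t')
      = fun t' => (∫ s in a..b, F s t) + (t' - t) * ∫ s in a..b, Hq Ft s t t' := by
    funext t'
    rw [← intervalIntegral.integral_const_mul]
    simp_rw [← h.hadamard]
    rw [intervalIntegral.integral_sub (hi _) (hi _)]; ring
  rw [e]
  have h1 := hasDeriv_mul_vanish (s := univ) (ξ := t) (F := fun t' => t' - t) (F' := 1)
    ((hasDerivAt_id t).sub_const t).hasDerivWithinAt (by simp)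
    (g := fun t' => ∫ s in a..b, Hq Ft s t t') (by
      apply Continuous.continuousWithinAt
      apply continuous_paramInt _ continuous_const continuous_const
      exact Hq_cont h.ct (by fun_prop) (by fun_prop) (by fun_prop))
  simp only [Hq_self, one_mul, hasDerivWithinAt_univ] at h1
  exact h1.const_add _

/-- characteristic curves -/
def IsCurve (q : ℝ → ℝ → ℝ) (α : ℝ → ℝ) : Prop :=
  ∀ ξ ∈ Icc (0:ℝ) 1, HasDerivWithinAt α (q ξ (α ξ)) (Icc 0 1) ξ

/-- admissible speed -/
structure Qok (q qt : ℝ → ℝ → ℝ) (M : ℝ) : Prop where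
  td : TD q qt
  b : ∀ x t, |q x t| ≤ M
  bt : ∀ x t, |qt x t| ≤ M

lemma IsCurve.cont {q α} (h : IsCurve q α) : ContinuousOn α (Icc 0 1) :=
  fun x hx => (h x hx).continuousWithinAt

lemma IsCurve.diff {q qt : ℝ → ℝ → ℝ} (hq : TD q qt) {α β : ℝ → ℝ} (hα : IsCurve q α)
    (hβ : IsCurve q β) {x ξ : ℝ} (hx : x ∈ Icc (0:ℝ) 1) (hξ : ξ ∈ Icc (0:ℝ) 1) :
    β ξ - α ξ = (β x - α x) * Real.exp (∫ s in x..ξ, Hq qt s (α s) (β s)) := by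
  refine lin_ode (f := fun s => β s - α s) (Hq_contOn hq.ct continuousOn_id hα.cont hβ.cont) ?_ hx hξ
  intro s hs
  have := (hβ s hs).sub (hα s hs)
  refine HasDerivWithinAt.congr_deriv this ?_
  rw [hq.hadamard]; simp only [id]; ring

lemma TD.lip {q qt : ℝ → ℝ → ℝ} (hq : TD q qt) {M : ℝ} (hM : ∀ x t, |qt x t| ≤ M) (x s t : ℝ) :
    |q x s - q x t| ≤ M * |s - t| := by
  rw [hq.hadamard, abs_mul, mul_comm]
  exact mul_le_mul_of_nonneg_right (Hq_bound hM _ _ _) (abs_nonneg _)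

lemma exists_curve {q qt : ℝ → ℝ → ℝ} {M : ℝ} (hq : Qok q qt M) {x : ℝ} (hx : x ∈ Icc (0:ℝ) 1)
    (t : ℝ) : ∃ α : ℝ → ℝ, α x = t ∧ IsCurve q α := by
  have hM : 0 ≤ M := (abs_nonneg _).trans (hq.b 0 0)
  have hPL : IsPicardLindelof q (tmin := 0) (tmax := 1) ⟨x, hx⟩ t ⟨M, hM⟩ 0 ⟨M, hM⟩ ⟨M, hM⟩ := by
    refine ⟨?_, ?_, ?_, ?_⟩
    · intro s _
      apply LipschitzOnWith.of_dist_le_mul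
      intro a _ b _
      simp only [Real.dist_eq]
      exact hq.td.lip hq.bt _ _ _
    · intro y _
      exact (hq.td.c.comp (by fun_prop) (by fun_prop)).continuousOn
    · intro s _ y _
      exact hq.b _ _
    · simp only [NNReal.coe_zero, sub_zero]
      have : max (1 - x) x ≤ 1 := max_le (by linarith [hx.1]) hx.2
      nlinarith
  obtain ⟨α, h1, h2⟩ := hPL.exists_eq_forall_mem_Icc_hasDerivWithinAt₀
  exact ⟨α, h1, h2⟩

open Classical in
/-- the characteristic flow -/
def om (q : ℝ → ℝ → ℝ) (ξ x t : ℝ) : ℝ :=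
  if h : ∃ α : ℝ → ℝ, α (cl x) = t ∧ IsCurve q α then h.choose (cl ξ) else 0

section flow
variable {q qt : ℝ → ℝ → ℝ} {M : ℝ} (hq : Qok q qt M)
include hq

lemma om_curve (x t : ℝ) : IsCurve q (fun ξ => om q ξ x t) := by
  have h := exists_curve hq (cl_mem x) t
  intro ξ hξ
  have h1 := h.choose_spec.2 ξ hξ
  have e : ∀ s ∈ Icc (0:ℝ) 1, om q s x t = h.choose s := by
    intro s hs; unfold om; rw [dif_pos h, cl_eq hs]
  have h2 := h1.congr e (e ξ hξ)
  rw [← e ξ hξ] at h2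
  exact h2

lemma om_self (x t : ℝ) : om q x x t = t := by
  have h := exists_curve hq (cl_mem x) t
  unfold om; rw [dif_pos h]; exact h.choose_spec.1

omit hq in
lemma om_cl1 (ξ x t : ℝ) : om q (cl ξ) x t = om q ξ x t := by unfold om; rw [cl_cl]
omit hq in
lemma om_cl2 (ξ x t : ℝ) : om q ξ (cl x) t = om q ξ x t := by unfold om; rw [cl_cl]

lemma om_uniq {α : ℝ → ℝ} (hα : IsCurve q α) {x ξ : ℝ} (hx : x ∈ Icc (0:ℝ) 1)
    (hξ : ξ ∈ Icc (0:ℝ) 1) : om q ξ x (α x) = α ξ := by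
  have := hα.diff hq.td (om_curve hq x (α x)) hx hξ
  simp only [om_self hq, sub_self, zero_mul] at this
  linarith

lemma om_om (ξ η x t : ℝ) : om q ξ η (om q η x t) = om q ξ x t := by
  rw [← om_cl1 ξ η, ← om_cl1 ξ x, ← om_cl2 _ η, ← om_cl1 η x]
  exact om_uniq hq (om_curve hq x t) (cl_mem η) (cl_mem ξ)

lemma om_diff (ξ x t t' : ℝ) : om q ξ x t' - om q ξ x t
    = (t' - t) * Real.exp (∫ s in (cl x)..(cl ξ), Hq qt s (om q s x t) (om q s x t')) := by
  have := (om_curve hq x t).diff hq.td (om_curve hq x t') (cl_mem x) (cl_mem ξ)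
  simpa only [om_cl1, om_self hq] using this

omit hq in
lemma abs_int_le {f : ℝ → ℝ} {M : ℝ} (hM : 0 ≤ M) (h : ∀ s, |f s| ≤ M) (x ξ : ℝ) :
    |∫ s in (cl x)..(cl ξ), f s| ≤ M := by
  have := intervalIntegral.norm_integral_le_of_norm_le_const (a := cl x) (b := cl ξ)
    (f := f) (C := M) (fun θ _ => h θ)
  refine this.trans ?_
  have h1 := cl_mem x; have h2 := cl_mem ξ
  have : |cl ξ - cl x| ≤ 1 := by rw [abs_le]; constructor <;> linarith [h1.1, h1.2, h2.1, h2.2]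
  nlinarith

lemma Qok.nonneg : 0 ≤ M := (abs_nonneg _).trans (hq.b 0 0)

lemma om_lip_t (ξ x t t' : ℝ) : |om q ξ x t' - om q ξ x t| ≤ Real.exp M * |t' - t| := by
  rw [om_diff hq, abs_mul, mul_comm, Real.abs_exp]
  gcongr
  exact (le_abs_self _).trans (abs_int_le hq.nonneg (fun s => Hq_bound hq.bt _ _ _) _ _)

lemma om_lip_ξ (ξ ξ' x t : ℝ) : |om q ξ' x t - om q ξ x t| ≤ M * |ξ' - ξ| := by
  have h := ftc_Icc (om_curve hq x t) (f' := fun ξ => q ξ (om q ξ x t)) (by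
    have h2 : Continuous fun z : ℝ × ℝ => q z.1 z.2 := hq.td.c
    exact h2.comp_continuousOn (continuousOn_id.prodMk (om_curve hq x t).cont))
    (cl_mem ξ) (cl_mem ξ')
  simp only [om_cl1] at h
  rw [← h]
  refine (intervalIntegral.norm_integral_le_of_norm_le_const (C := M)
    (f := fun θ => q θ (om q θ x t)) (fun θ _ => hq.b _ _)).trans ?_
  exact mul_le_mul_of_nonneg_left (cl_lip _ _) hq.nonneg

lemma om_lip_x (ξ x x' t : ℝ) : |om q ξ x' t - om q ξ x t| ≤ Real.exp M * (M * |x' - x|) := by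
  have h1 : om q ξ x' t = om q ξ x (om q x x' t) := (om_om hq ξ x x' t).symm
  rw [h1]
  refine (om_lip_t hq _ _ _ _).trans ?_
  gcongr
  nth_rw 2 [← om_self hq x' t]
  refine (om_lip_ξ hq _ _ _ _).trans_eq ?_
  rw [abs_sub_comm]

lemma om_cont0 : Continuous fun z : ℝ × ℝ × ℝ => om q z.1 z.2.1 z.2.2 := by
  rw [continuous_iff_continuousAt]
  rintro ⟨ξ, x, t⟩
  rw [ContinuousAt, tendsto_iff_dist_tendsto_zero]
  have hb : ∀ z : ℝ × ℝ × ℝ, dist (om q z.1 z.2.1 z.2.2) (om q ξ x t)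
      ≤ M * |z.1 - ξ| + Real.exp M * (M * |z.2.1 - x|) + Real.exp M * |z.2.2 - t| := by
    rintro ⟨ξ', x', t'⟩
    rw [Real.dist_eq]
    have h1 := om_lip_ξ hq ξ ξ' x' t'
    have h2 := om_lip_x hq ξ x x' t'
    have h3 := om_lip_t hq ξ x t t'
    simp only
    calc |om q ξ' x' t' - om q ξ x t| = |(om q ξ' x' t' - om q ξ x' t') + (om q ξ x' t' - om q ξ x t')
          + (om q ξ x t' - om q ξ x t)| := by ring_nf
      _ ≤ _ := (abs_add_three _ _ _).trans (by linarith)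
  refine squeeze_zero (fun _ => dist_nonneg) hb ?_
  have : Continuous fun z : ℝ × ℝ × ℝ =>
    M * |z.1 - ξ| + Real.exp M * (M * |z.2.1 - x|) + Real.exp M * |z.2.2 - t| := by fun_prop
  have h := this.tendsto (ξ, x, t)
  simpa using h

lemma om_cont {X : Type*} [TopologicalSpace X] {a b c : X → ℝ} (ha : Continuous a)
    (hb : Continuous b) (hc : Continuous c) : Continuous fun z => om q (a z) (b z) (c z) :=
  (om_cont0 hq).comp (ha.prodMk (hb.prodMk hc))

end flow

/-- exponential weights along the characteristics -/
def W (q d : ℝ → ℝ → ℝ) (ξ x t : ℝ) : ℝ :=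
  Real.exp (∫ s in (cl x)..(cl ξ), d s (om q s x t))

lemma W_pos (q d : ℝ → ℝ → ℝ) (ξ x t : ℝ) : 0 < W q d ξ x t := Real.exp_pos _

lemma W_self (q d : ℝ → ℝ → ℝ) (x t : ℝ) : W q d x x t = 1 := by simp [W]

section weights
variable {q qt : ℝ → ℝ → ℝ} {M : ℝ} (hq : Qok q qt M)
include hq

lemma W_cont {d : ℝ → ℝ → ℝ} (hd : CC d) {X : Type*} [TopologicalSpace X] {a b c : X → ℝ}
    (ha : Continuous a) (hb : Continuous b) (hc : Continuous c) :
    Continuous fun z => W q d (a z) (b z) (c z) := by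
  unfold W
  refine Real.continuous_exp.comp ?_
  refine continuous_paramInt ?_ (cl_cont.comp hb) (cl_cont.comp ha)
  exact hd.comp (by fun_prop) (om_cont hq (by fun_prop) (by fun_prop) (by fun_prop))

omit hq in
lemma W_le {d : ℝ → ℝ → ℝ} {N : ℝ} (hN : ∀ x t, |d x t| ≤ N) (ξ x t : ℝ) :
    W q d ξ x t ≤ Real.exp N := by
  unfold W
  have h0 : 0 ≤ N := (abs_nonneg _).trans (hN 0 0)
  exact Real.exp_le_exp.2 ((le_abs_self _).trans (abs_int_le h0 (fun s => hN _ _) _ _))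

omit hq in
lemma W_abs {d : ℝ → ℝ → ℝ} {N : ℝ} (hN : ∀ x t, |d x t| ≤ N) (ξ x t : ℝ) :
    |W q d ξ x t| ≤ Real.exp N := by
  rw [abs_of_pos (W_pos _ _ _ _ _)]; exact W_le hN _ _ _

lemma om_dt (ξ x t : ℝ) : HasDerivAt (fun t => om q ξ x t) (W q qt ξ x t) t := by
  have e : (fun t' => om q ξ x t') = fun t' => om q ξ x t + (t' - t) *
      Real.exp (∫ s in (cl x)..(cl ξ), Hq qt s (om q s x t) (om q s x t')) := by
    funext t'; rw [← om_diff hq]; ring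
  rw [e]
  have h1 := hasDeriv_mul_vanish (s := univ) (ξ := t) (F := fun t' => t' - t) (F' := 1)
    ((hasDerivAt_id t).sub_const t).hasDerivWithinAt (by simp)
    (g := fun t' => Real.exp (∫ s in (cl x)..(cl ξ), Hq qt s (om q s x t) (om q s x t'))) (by
      apply Continuous.continuousWithinAt
      refine Real.continuous_exp.comp ?_
      apply continuous_paramInt _ continuous_const continuous_const
      exact Hq_cont hq.td.ct (by fun_prop) (om_cont hq (by fun_prop) (by fun_prop) (by fun_prop))
        (om_cont hq (by fun_prop) (by fun_prop) (by fun_prop)))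
  simp only [Hq_self, one_mul, hasDerivWithinAt_univ] at h1
  exact h1.const_add _

/-- composition with the flow, as a function of `(ξ,t)` with `x` fixed -/
lemma TD.comp_om {f ft : ℝ → ℝ → ℝ} (hf : TD f ft) (x : ℝ) :
    TD (fun s t => f s (om q s x t)) (fun s t => ft s (om q s x t) * W q qt s x t) where
  c := hf.c.comp (by fun_prop) (om_cont hq (by fun_prop) (by fun_prop) (by fun_prop))
  ct := (hf.ct.comp (by fun_prop) (om_cont hq (by fun_prop) (by fun_prop) (by fun_prop))).mul
    (W_cont hq hq.td.ct (by fun_prop) (by fun_prop) (by fun_prop))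
  dt s t := (hf.dt s _).comp t (om_dt hq s x t)

/-- `t`-derivative of the weight -/
def Wt (q qt d dt : ℝ → ℝ → ℝ) (ξ x t : ℝ) : ℝ :=
  W q d ξ x t * ∫ s in (cl x)..(cl ξ), dt s (om q s x t) * W q qt s x t

lemma W_dt {d dt : ℝ → ℝ → ℝ} (hd : TD d dt) (ξ x t : ℝ) :
    HasDerivAt (fun t => W q d ξ x t) (Wt q qt d dt ξ x t) t :=
  ((hd.comp_om hq x).integral (cl x) (cl ξ) t).exp

lemma Wt_cont {d dt : ℝ → ℝ → ℝ} (hd : CC d) (hdt : CC dt) {X : Type*} [TopologicalSpace X]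
    {a b c : X → ℝ} (ha : Continuous a) (hb : Continuous b) (hc : Continuous c) :
    Continuous fun z => Wt q qt d dt (a z) (b z) (c z) := by
  unfold Wt
  refine (W_cont hq hd ha hb hc).mul (continuous_paramInt ?_ (cl_cont.comp hb) (cl_cont.comp ha))
  exact (hdt.comp (by fun_prop) (om_cont hq (by fun_prop) (by fun_prop) (by fun_prop))).mul
    (W_cont hq hq.td.ct (by fun_prop) (by fun_prop) (by fun_prop))

lemma Wt_abs {d dt : ℝ → ℝ → ℝ} {N N' : ℝ} (hN : ∀ x t, |d x t| ≤ N) (hN' : ∀ x t, |dt x t| ≤ N')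
    (ξ x t : ℝ) : |Wt q qt d dt ξ x t| ≤ Real.exp N * (N' * Real.exp M) := by
  unfold Wt
  have h0 : 0 ≤ N' := (abs_nonneg _).trans (hN' 0 0)
  rw [abs_mul]
  refine mul_le_mul (W_abs hN _ _ _) (abs_int_le (by positivity) ?_ _ _) (abs_nonneg _)
    (Real.exp_pos _).le
  intro s
  rw [abs_mul]
  exact mul_le_mul (hN' _ _) (W_abs hq.bt _ _ _) (abs_nonneg _) h0

lemma W_dξ {d : ℝ → ℝ → ℝ} (hd : CC d) {ξ : ℝ} (hξ : ξ ∈ Icc (0:ℝ) 1) (x t : ℝ) :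
    HasDerivWithinAt (fun ξ => W q d ξ x t) (d ξ (om q ξ x t) * W q d ξ x t) (Icc 0 1) ξ := by
  have hc : Continuous fun s => d s (om q s x t) :=
    hd.comp (by fun_prop) (om_cont hq (by fun_prop) (by fun_prop) (by fun_prop))
  have h1 : HasDerivAt (fun ξ => Real.exp (∫ s in (cl x)..ξ, d s (om q s x t)))
      (Real.exp (∫ s in (cl x)..ξ, d s (om q s x t)) * d ξ (om q ξ x t)) ξ :=
    (intervalIntegral.integral_hasDerivAt_right (hc.intervalIntegrable _ _)
      (hc.stronglyMeasurableAtFilter _ _) hc.continuousAt).exp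
  have e : ∀ ξ ∈ Icc (0:ℝ) 1, W q d ξ x t = Real.exp (∫ s in (cl x)..ξ, d s (om q s x t)) := by
    intro ξ hξ; unfold W; rw [cl_eq hξ]
  rw [e ξ hξ, mul_comm]
  exact h1.hasDerivWithinAt.congr e (e ξ hξ)

/-- cocycle property -/
lemma W_mul {d : ℝ → ℝ → ℝ} (hd : CC d) (ξ η x t : ℝ) :
    W q d ξ η (om q η x t) * W q d η x t = W q d ξ x t := by
  have hc : Continuous fun s => d s (om q s x t) :=
    hd.comp (by fun_prop) (om_cont hq (by fun_prop) (by fun_prop) (by fun_prop))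
  unfold W
  simp only [om_om hq]
  rw [← Real.exp_add, add_comm, intervalIntegral.integral_add_adjacent_intervals
    (hc.intervalIntegrable _ _) (hc.intervalIntegrable _ _)]

lemma om_per {T : ℝ} (hT : ∀ x t, q x (t + T) = q x t) (ξ x t : ℝ) :
    om q ξ x (t + T) = om q ξ x t + T := by
  have h : IsCurve q (fun ξ => om q ξ x t + T) := by
    intro ξ hξ
    rw [hT]
    exact (om_curve hq x t ξ hξ).add_const T
  have := om_uniq hq h (cl_mem x) (cl_mem ξ)
  simpa only [om_cl1, om_cl2, om_self hq] using this

lemma W_per {T : ℝ} (hT : ∀ x t, q x (t + T) = q x t) {d : ℝ → ℝ → ℝ}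
    (hd : ∀ x t, d x (t + T) = d x t) (ξ x t : ℝ) :
    W q d ξ x (t + T) = W q d ξ x t := by
  unfold W; simp only [om_per hq hT, hd]

end weights
end QL
end

section
namespace QL
open scoped Topology

/-- bounded continuous `n`-component functions of `(x,t)` -/
abbrev E (n : ℕ) := BoundedContinuousFunction (Fin n × ℝ × ℝ) ℝ

variable {n : ℕ}

/-- components -/
def cp (u : E n) (j : Fin n) : ℝ → ℝ → ℝ := fun x t => u (j, x, t)

lemma cp_cc (u : E n) (j : Fin n) : CC (cp u j) := by
  unfold CC cp; exact u.continuous.comp (by fun_prop)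

lemma cp_le (u : E n) (j : Fin n) (x t : ℝ) : |cp u j x t| ≤ ‖u‖ := u.norm_coe_le_norm _

lemma cont_of_cc {f : Fin n → ℝ → ℝ → ℝ} (hc : ∀ j, CC (f j)) :
    Continuous fun z : Fin n × ℝ × ℝ => f z.1 z.2.1 z.2.2 := by
  rw [continuous_prod_of_discrete_left]
  exact hc

/-- constructor -/
def mkE (f : Fin n → ℝ → ℝ → ℝ) (hc : ∀ j, CC (f j)) (K : ℝ) (hb : ∀ j x t, |f j x t| ≤ K) : E n :=
  BoundedContinuousFunction.ofNormedAddCommGroup (fun z : Fin n × ℝ × ℝ => f z.1 z.2.1 z.2.2)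
    (cont_of_cc hc) K (fun _ => hb _ _ _)

@[simp] lemma cp_mkE (f : Fin n → ℝ → ℝ → ℝ) (hc) (K) (hb) (j : Fin n) (x t : ℝ) :
    cp (mkE f hc K hb) j x t = f j x t := rfl

@[simp] lemma cp_mkE' (f : Fin n → ℝ → ℝ → ℝ) (hc) (K) (hb) (j : Fin n) :
    cp (mkE f hc K hb) j = f j := rfl

lemma E_norm_le {u : E n} {K : ℝ} (hK : 0 ≤ K) (h : ∀ j x t, |cp u j x t| ≤ K) : ‖u‖ ≤ K :=
  (BoundedContinuousFunction.norm_le hK).2 fun z => h z.1 z.2.1 z.2.2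

lemma E_ext {u v : E n} (h : ∀ j x t, cp u j x t = cp v j x t) : u = v := by
  ext ⟨j, x, t⟩; exact h j x t

@[simp] lemma cp_add (u v : E n) (j x t) : cp (u + v) j x t = cp u j x t + cp v j x t := rfl
@[simp] lemma cp_sub (u v : E n) (j x t) : cp (u - v) j x t = cp u j x t - cp v j x t := rfl
@[simp] lemma cp_neg (u : E n) (j x t) : cp (-u) j x t = - cp u j x t := rfl
@[simp] lemma cp_zero (j x t) : cp (0 : E n) j x t = 0 := rfl
@[simp] lemma cp_smul (a : ℝ) (u : E n) (j x t) : cp (a • u) j x t = a * cp u j x t := rfl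

/-- `v` is the `t`-derivative of `u` -/
def Dt (u v : E n) : Prop := ∀ j x t, HasDerivAt (cp u j x) (cp v j x t) t

lemma Dt.td {u v : E n} (h : Dt u v) (j : Fin n) : TD (cp u j) (cp v j) :=
  ⟨cp_cc u j, cp_cc v j, h j⟩

lemma Dt.add {u v u' v' : E n} (h : Dt u v) (h' : Dt u' v') : Dt (u + u') (v + v') :=
  fun j x t => (h j x t).add (h' j x t)
lemma Dt.sub {u v u' v' : E n} (h : Dt u v) (h' : Dt u' v') : Dt (u - u') (v - v') :=
  fun j x t => (h j x t).sub (h' j x t)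
lemma Dt.neg {u v : E n} (h : Dt u v) : Dt (-u) (-v) := fun j x t => (h j x t).neg
lemma Dt.smul {u v : E n} (a : ℝ) (h : Dt u v) : Dt (a • u) (a • v) :=
  fun j x t => (h j x t).const_mul a
lemma Dt.zero : Dt (0 : E n) 0 := fun _ _ _ => hasDerivAt_const _ _
lemma Dt.unique {u v v' : E n} (h : Dt u v) (h' : Dt u v') : v = v' :=
  E_ext fun j x t => (h j x t).unique (h' j x t)

/-- closedness of the derivative -/
lemma Dt.lim {u v : ℕ → E n} {u0 v0 : E n} (h : ∀ i, Dt (u i) (v i))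
    (hu : Tendsto u atTop (𝓝 u0)) (hv : Tendsto v atTop (𝓝 v0)) : Dt u0 v0 := by
  intro j x t
  have h1 := BoundedContinuousFunction.tendsto_iff_tendstoUniformly.1 hv
  have h2 := BoundedContinuousFunction.tendsto_iff_tendstoUniformly.1 hu
  refine hasDerivAt_of_tendstoUniformly (l := atTop) (f := fun i => cp (u i) j x)
    (f' := fun i => cp (v i) j x) (g := cp u0 j x) (g' := cp v0 j x) ?_ ?_ ?_ t
  · exact h1.comp (fun t : ℝ => (j, x, t))
  · exact Eventually.of_forall fun i t => h i j x t
  · intro t; exact h2.tendsto_at (j, x, t)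

/-- an operator which is bounded in `C⁰` and in `C_t¹` -/
structure Tame (K : ℝ) (L : E n →L[ℝ] E n) : Prop where
  nn : 0 ≤ K
  b : ∀ y, ‖L y‖ ≤ K * ‖y‖
  d : ∀ y yt, Dt y yt → ∃ v, Dt (L y) v ∧ ‖v‖ ≤ K * (‖y‖ + ‖yt‖)

lemma Tame.comp {K K' : ℝ} {L L' : E n →L[ℝ] E n} (h : Tame K L) (h' : Tame K' L') :
    Tame (2 * K * K') (L * L') where
  nn := by have := h.nn; have := h'.nn; positivity
  b y := by
    have h1 := h.nn; have h2 := h'.nn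
    calc ‖L (L' y)‖ ≤ K * ‖L' y‖ := h.b _
      _ ≤ K * (K' * ‖y‖) := by gcongr; exact h'.b _
      _ ≤ 2 * K * K' * ‖y‖ := by
        have : 0 ≤ K * K' * ‖y‖ := by positivity
        linarith
  d y yt hy := by
    have h1 := h.nn; have h2 := h'.nn
    obtain ⟨v, hv, hb⟩ := h'.d y yt hy
    obtain ⟨w, hw, hb'⟩ := h.d _ _ hv
    refine ⟨w, hw, hb'.trans ?_⟩
    calc K * (‖L' y‖ + ‖v‖) ≤ K * (K' * ‖y‖ + K' * (‖y‖ + ‖yt‖)) := by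
          gcongr; exact h'.b _
      _ ≤ 2 * K * K' * (‖y‖ + ‖yt‖) := by
        have : 0 ≤ K * K' * ‖yt‖ := by positivity
        linarith

lemma Tame.add {K K' : ℝ} {L L' : E n →L[ℝ] E n} (h : Tame K L) (h' : Tame K' L') :
    Tame (K + K') (L + L') where
  nn := add_nonneg h.nn h'.nn
  b y := by
    rw [add_apply]
    exact (norm_add_le _ _).trans (by linarith [h.b y, h'.b y])
  d y yt hy := by
    obtain ⟨v, hv, hb⟩ := h.d y yt hy
    obtain ⟨w, hw, hb'⟩ := h'.d y yt hy
    exact ⟨v + w, hv.add hw, (norm_add_le _ _).trans (by linarith)⟩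

lemma Tame.one : Tame 1 (1 : E n →L[ℝ] E n) where
  nn := zero_le_one
  b y := by simp
  d y yt hy := ⟨yt, hy, by linarith [norm_nonneg y]⟩

lemma Tame.zero : Tame 0 (0 : E n →L[ℝ] E n) where
  nn := le_rfl
  b y := by simp
  d y yt hy := ⟨0, Dt.zero, by simp⟩

lemma Tame.mono {K K' : ℝ} {L : E n →L[ℝ] E n} (h : Tame K L) (hK : K ≤ K') : Tame K' L where
  nn := h.nn.trans hK
  b y := (h.b y).trans (by gcongr)
  d y yt hy := by
    obtain ⟨v, hv, hb⟩ := h.d y yt hy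
    exact ⟨v, hv, hb.trans (by gcongr)⟩

/-- starting end of the `j`-th characteristics -/
def xs (m : ℕ) (j : Fin n) : ℝ := if (j : ℕ) < m then 0 else 1

/-- sign -/
def sg (m : ℕ) (j : Fin n) : ℝ := if (j : ℕ) < m then 1 else -1

lemma xs_mem (m : ℕ) (j : Fin n) : xs m j ∈ Icc (0:ℝ) 1 := by
  unfold xs; split_ifs <;> simp

lemma xs_mem' (m : ℕ) (j : Fin n) : 1 - xs m j ∈ Icc (0:ℝ) 1 := by
  unfold xs; split_ifs <;> simp

lemma cl_xs (m : ℕ) (j : Fin n) : cl (xs m j) = xs m j := cl_eq (xs_mem m j)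
lemma cl_xs' (m : ℕ) (j : Fin n) : cl (1 - xs m j) = 1 - xs m j := cl_eq (xs_mem' m j)

/-- coefficients in `x`-form -/
structure Cf (n : ℕ) where
  q : Fin n → ℝ → ℝ → ℝ
  qx : Fin n → ℝ → ℝ → ℝ
  qt : Fin n → ℝ → ℝ → ℝ
  d : Fin n → ℝ → ℝ → ℝ
  dt : Fin n → ℝ → ℝ → ℝ
  c : Fin n → Fin n → ℝ → ℝ → ℝ
  cx : Fin n → Fin n → ℝ → ℝ → ℝ
  ct : Fin n → Fin n → ℝ → ℝ → ℝ

/-- admissible coefficients -/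
structure Cf.OK (cf : Cf n) (m : ℕ) (M : ℝ) : Prop where
  M1 : 1 ≤ M
  qXT : ∀ j, XT (cf.q j) (cf.qx j) (cf.qt j)
  cXT : ∀ j k, XT (cf.c j k) (cf.cx j k) (cf.ct j k)
  dTD : ∀ j, TD (cf.d j) (cf.dt j)
  c0 : ∀ j x t, cf.c j j x t = 0
  bq : ∀ j x t, |cf.q j x t| ≤ M
  bqx : ∀ j x t, |cf.qx j x t| ≤ M
  bqt : ∀ j x t, |cf.qt j x t| ≤ M
  bd : ∀ j x t, |cf.d j x t| ≤ M
  bdt : ∀ j x t, |cf.dt j x t| ≤ M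
  bc : ∀ j k x t, |cf.c j k x t| ≤ M
  bcx : ∀ j k x t, |cf.cx j k x t| ≤ M
  bct : ∀ j k x t, |cf.ct j k x t| ≤ M
  sgn : ∀ j x t, 1 ≤ M * (sg m j * cf.q j x t)
  sep : ∀ j k, j ≠ k → ∀ x t, 1 ≤ M * |cf.q j x t - cf.q k x t|

lemma Cf.OK.qok {cf : Cf n} {m : ℕ} {M : ℝ} (h : cf.OK m M) (j : Fin n) :
    Qok (cf.q j) (cf.qt j) M := ⟨(h.qXT j).toTD, h.bq j, h.bqt j⟩

section ops
variable {cf : Cf n} {m : ℕ} {M : ℝ} (h : cf.OK m M) (p : Fin n → Fin n → ℝ)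

/-- total size of `p` -/
def pb (p : Fin n → Fin n → ℝ) : ℝ := ∑ j, ∑ k, |p j k|

lemma pb_nonneg : 0 ≤ pb p := Finset.sum_nonneg fun _ _ => Finset.sum_nonneg fun _ _ => abs_nonneg _

lemma psum_le {p : Fin n → Fin n → ℝ} {z : Fin n → ℝ} {K : ℝ} (hK : 0 ≤ K)
    (hz : ∀ k, |z k| ≤ K) (j : Fin n) :
    |∑ k, p j k * z k| ≤ pb p * K := by
  calc |∑ k, p j k * z k| ≤ ∑ k, |p j k * z k| := Finset.abs_sum_le_sum_abs _ _
    _ ≤ ∑ k, |p j k| * K := by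
        refine Finset.sum_le_sum fun k _ => ?_
        rw [abs_mul]; gcongr; exact hz k
    _ = (∑ k, |p j k|) * K := by rw [Finset.sum_mul]
    _ ≤ pb p * K := by
        gcongr
        exact Finset.single_le_sum (f := fun j => ∑ k, |p j k|)
          (fun _ _ => Finset.sum_nonneg fun _ _ => abs_nonneg _) (Finset.mem_univ j)

/-- raw integral operator -/
def Dr (cf : Cf n) (m : ℕ) (g : E n) (j : Fin n) (x t : ℝ) : ℝ :=
  ∫ ξ in (xs m j)..(cl x), W (cf.q j) (cf.d j) ξ x t * cp g j ξ (om (cf.q j) ξ x t)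

/-- raw boundary operator -/
def Cr (cf : Cf n) (m : ℕ) (p : Fin n → Fin n → ℝ) (y : E n) (j : Fin n) (x t : ℝ) : ℝ :=
  W (cf.q j) (cf.d j) (xs m j) x t *
    ∑ k, p j k * cp y k (1 - xs m k) (om (cf.q j) (xs m j) x t)

/-- raw off-diagonal operator -/
def Mr (cf : Cf n) (u : E n) (j : Fin n) (x t : ℝ) : ℝ := -∑ k, cf.c j k x t * cp u k x t

lemma xs_cl_int_le {f : ℝ → ℝ} {K : ℝ} (hK : 0 ≤ K) (hf : ∀ s, |f s| ≤ K) (j : Fin n) (x : ℝ) :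
    |∫ s in (xs m j)..(cl x), f s| ≤ K := by
  rw [← cl_xs m j]; exact abs_int_le hK hf _ _

include h

lemma Dr_integrand_cont (g : E n) (j : Fin n) :
    Continuous fun z : (ℝ × ℝ) × ℝ => W (cf.q j) (cf.d j) z.2 z.1.1 z.1.2 *
      cp g j z.2 (om (cf.q j) z.2 z.1.1 z.1.2) :=
  (W_cont (h.qok j) (h.dTD j).c (by fun_prop) (by fun_prop) (by fun_prop)).mul
    ((cp_cc g j).comp (by fun_prop) (om_cont (h.qok j) (by fun_prop) (by fun_prop) (by fun_prop)))

lemma Dr_cc (g : E n) (j : Fin n) : CC (Dr cf m g j) :=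
  continuous_paramInt (f := fun (z : ℝ × ℝ) ξ => W (cf.q j) (cf.d j) ξ z.1 z.2 *
      cp g j ξ (om (cf.q j) ξ z.1 z.2)) (Dr_integrand_cont h g j) continuous_const
    (cl_cont.comp continuous_fst)

lemma Dr_le (g : E n) (j : Fin n) (x t : ℝ) : |Dr cf m g j x t| ≤ Real.exp M * ‖g‖ := by
  refine xs_cl_int_le (by positivity) (fun s => ?_) j x
  rw [abs_mul]
  exact mul_le_mul (W_abs (h.bd j) _ _ _) (cp_le _ _ _ _) (abs_nonneg _) (Real.exp_pos _).le

lemma Dr_ii (g : E n) (j : Fin n) (x t a b : ℝ) : IntervalIntegrable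
    (fun ξ => W (cf.q j) (cf.d j) ξ x t * cp g j ξ (om (cf.q j) ξ x t)) volume a b :=
  ((Dr_integrand_cont h g j).comp (f := fun ξ : ℝ => ((x, t), ξ))
    (by fun_prop)).intervalIntegrable _ _

/-- integral operator -/
def Dop : E n →L[ℝ] E n :=
  LinearMap.mkContinuous
    { toFun := fun g => mkE (Dr cf m g) (Dr_cc h g) _ (Dr_le h g)
      map_add' := fun u v => by
        apply E_ext; intro j x t
        simp only [cp_mkE, cp_add, Dr, mul_add]
        exact intervalIntegral.integral_add (Dr_ii h u j x t _ _) (Dr_ii h v j x t _ _)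
      map_smul' := fun a u => by
        apply E_ext; intro j x t
        simp only [cp_mkE, cp_smul, Dr, RingHom.id_apply]
        rw [← intervalIntegral.integral_const_mul]
        congr 1; funext ξ; ring }
    (Real.exp M) (fun g => E_norm_le (by positivity) (Dr_le h g))

@[simp] lemma cp_Dop (g : E n) : cp (Dop h g) = Dr cf m g := rfl

lemma Cr_cc (y : E n) (j : Fin n) : CC (Cr cf m p y j) := by
  unfold CC Cr
  refine (W_cont (h.qok j) (h.dTD j).c (by fun_prop) (by fun_prop) (by fun_prop)).mul ?_
  refine continuous_finsetSum _ fun k _ => continuous_const.mul ?_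
  exact (cp_cc y k).comp (by fun_prop) (om_cont (h.qok j) (by fun_prop) (by fun_prop) (by fun_prop))

lemma Cr_le (y : E n) (j : Fin n) (x t : ℝ) :
    |Cr cf m p y j x t| ≤ Real.exp M * pb p * ‖y‖ := by
  unfold Cr
  rw [abs_mul, mul_assoc]
  exact mul_le_mul (W_abs (h.bd j) _ _ _) (psum_le (norm_nonneg _) (fun k => cp_le _ _ _ _) _)
    (abs_nonneg _) (Real.exp_pos _).le

/-- boundary operator -/
def Cop : E n →L[ℝ] E n :=
  LinearMap.mkContinuous
    { toFun := fun y => mkE (Cr cf m p y) (Cr_cc h p y) _ (Cr_le h p y)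
      map_add' := fun u v => by
        apply E_ext; intro j x t
        simp only [cp_mkE, cp_add, Cr, mul_add, Finset.sum_add_distrib]
      map_smul' := fun a u => by
        apply E_ext; intro j x t
        simp only [cp_mkE, cp_smul, Cr, RingHom.id_apply, Finset.mul_sum]
        refine Finset.sum_congr rfl fun k _ => ?_
        ring }
    (Real.exp M * pb p) (fun g => E_norm_le (by have := pb_nonneg p; positivity) (Cr_le h p g))

@[simp] lemma cp_Cop (y : E n) : cp (Cop h p y) = Cr cf m p y := rfl

lemma Mr_cc (y : E n) (j : Fin n) : CC (Mr cf y j) := by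
  unfold CC Mr
  refine (continuous_finsetSum _ fun k _ => ?_).neg
  exact Continuous.mul (h.cXT j k).c (cp_cc y k)

omit h in
lemma csum_le {c : Fin n → Fin n → ℝ → ℝ → ℝ} {M : ℝ} (hM : ∀ j k x t, |c j k x t| ≤ M)
    (y : E n) (j : Fin n) (x t : ℝ) :
    |∑ k, c j k x t * cp y k x t| ≤ n * M * ‖y‖ := by
  refine (Finset.abs_sum_le_sum_abs _ _).trans ?_
  have : ∑ _k : Fin n, M * ‖y‖ = n * M * ‖y‖ := by simp [mul_assoc]
  rw [← this]
  refine Finset.sum_le_sum fun k _ => ?_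
  rw [abs_mul]
  exact mul_le_mul (hM _ _ _ _) (cp_le _ _ _ _) (abs_nonneg _) ((abs_nonneg _).trans (hM j k x t))

lemma Mr_le (y : E n) (j : Fin n) (x t : ℝ) : |Mr cf y j x t| ≤ n * M * ‖y‖ := by
  unfold Mr; rw [abs_neg]; exact csum_le h.bc y j x t

/-- off-diagonal operator -/
def Mop : E n →L[ℝ] E n :=
  LinearMap.mkContinuous
    { toFun := fun y => mkE (Mr cf y) (Mr_cc h y) _ (Mr_le h y)
      map_add' := fun u v => by
        apply E_ext; intro j x t
        simp only [cp_mkE, cp_add, Mr, mul_add, Finset.sum_add_distrib]; ring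
      map_smul' := fun a u => by
        apply E_ext; intro j x t
        simp only [cp_mkE, cp_smul, Mr, RingHom.id_apply, Finset.mul_sum, mul_neg]
        congr 1
        refine Finset.sum_congr rfl fun k _ => ?_
        ring }
    (n * M) (fun g => E_norm_le (by have := h.M1; positivity) (Mr_le h g))

@[simp] lemma cp_Mop (y : E n) : cp (Mop h y) = Mr cf y := rfl

/-- the solution operator of the diagonal problem -/
def Sop : E n →L[ℝ] E n := (∑ i ∈ Finset.range n, Cop h p ^ i) * Dop h

/-- the full integral operator -/
def Top : E n →L[ℝ] E n := Sop h p * Mop h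

omit h in
/-- all products over chains of length `r` starting at `j` vanish -/
def Zr (p : Fin n → Fin n → ℝ) (r : ℕ) (j : Fin n) : Prop :=
  ∀ i : Fin (r + 1) → Fin n, i 0 = j → ∏ l : Fin r, p (i l.castSucc) (i l.succ) = 0

omit h in
lemma Zr.succ {p : Fin n → Fin n → ℝ} {r : ℕ} {j k : Fin n} (hz : Zr p (r + 1) j)
    (hp : p j k ≠ 0) : Zr p r k := by
  intro i hi
  have := hz (Fin.cons j i) (by simp)
  rw [Fin.prod_univ_succ] at this
  simp only [Fin.castSucc_zero, Fin.cons_zero, Fin.cons_succ, hi, mul_eq_zero, hp,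
    false_or, Fin.castSucc_succ] at this
  exact this

lemma Cop_pow_zero (r : ℕ) (j : Fin n) (hz : Zr p r j) (y : E n) (x t : ℝ) :
    cp ((Cop h p ^ r) y) j x t = 0 := by
  induction r generalizing j x t with
  | zero => exact absurd (hz (fun _ => j) rfl) (by simp)
  | succ r ih =>
    rw [pow_succ']
    change Cr cf m p ((Cop h p ^ r) y) j x t = 0
    unfold Cr
    rw [Finset.sum_eq_zero, mul_zero]
    intro k _
    by_cases hp : p j k = 0
    · simp [hp]
    · rw [ih k (hz.succ hp), mul_zero]

lemma Cop_nilp (hp : H3cond n p) : Cop h p ^ n = 0 := by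
  ext1 y
  apply E_ext; intro j x t
  rw [Cop_pow_zero h p n j (fun i _ => hp i)]; rfl

lemma one_sub_C (hp : H3cond n p) : (1 - Cop h p) * (∑ i ∈ Finset.range n, Cop h p ^ i) = 1 := by
  refine (mul_neg_geom_sum (Cop h p) n).trans ?_
  rw [Cop_nilp h p hp]; exact sub_zero (1 : E n →L[ℝ] E n)

lemma one_sub_C' (hp : H3cond n p) : (∑ i ∈ Finset.range n, Cop h p ^ i) * (1 - Cop h p) = 1 := by
  refine (geom_sum_mul_neg (Cop h p) n).trans ?_
  rw [Cop_nilp h p hp]; exact sub_zero (1 : E n →L[ℝ] E n)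

lemma mild_iff (hp : H3cond n p) (y g : E n) : y = Sop h p g ↔ y = Cop h p y + Dop h g := by
  constructor
  · intro e
    have h1 : (1 - Cop h p) y = Dop h g := by
      rw [e]
      change ((1 - Cop h p) * ((∑ i ∈ Finset.range n, Cop h p ^ i) * Dop h)) g = _
      rw [← mul_assoc, one_sub_C h p hp, one_mul]
    have h2 : y - Cop h p y = Dop h g := h1
    rw [← h2]; abel
  · intro e
    have h2 : (1 - Cop h p) y = Dop h g := by
      change y - Cop h p y = _
      nth_rw 1 [e]; abel
    have h3 : y = ((∑ i ∈ Finset.range n, Cop h p ^ i) * (1 - Cop h p)) y := by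
      rw [one_sub_C' h p hp]; rfl
    rw [h3]
    change (∑ i ∈ Finset.range n, Cop h p ^ i) ((1 - Cop h p) y) = _
    rw [h2]; rfl

end ops
end QL
end

section
namespace QL
open scoped Topology
variable {n : ℕ}

lemma TD.mul {f ft g gt : ℝ → ℝ → ℝ} (hf : TD f ft) (hg : TD g gt) :
    TD (fun x t => f x t * g x t) (fun x t => ft x t * g x t + f x t * gt x t) where
  c := Continuous.mul hf.c hg.c
  ct := Continuous.add (Continuous.mul hf.ct hg.c) (Continuous.mul hf.c hg.ct)
  dt x t := (hf.dt x t).mul (hg.dt x t)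

lemma W_td {q qt d dt : ℝ → ℝ → ℝ} {M : ℝ} (hq : Qok q qt M) (hd : TD d dt) (x : ℝ) :
    TD (fun s t => W q d s x t) (fun s t => Wt q qt d dt s x t) where
  c := W_cont hq hd.c (by fun_prop) (by fun_prop) (by fun_prop)
  ct := Wt_cont hq hd.c hd.ct (by fun_prop) (by fun_prop) (by fun_prop)
  dt s t := W_dt hq hd s x t

/-- constant for `D` -/
def KD (M : ℝ) : ℝ := (M + 1) * Real.exp M * Real.exp M

lemma KD_ge {M : ℝ} (hM : 1 ≤ M) : Real.exp M ≤ KD M := by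
  unfold KD
  have h1 : 1 ≤ Real.exp M := Real.one_le_exp (by linarith)
  have h2 : 1 * 1 ≤ (M + 1) * Real.exp M := mul_le_mul (by linarith) h1 (by norm_num) (by linarith)
  nlinarith [Real.exp_pos M]

lemma KD_pos {M : ℝ} (hM : 1 ≤ M) : 0 < KD M := (Real.exp_pos M).trans_le (KD_ge hM)

section ops
variable {cf : Cf n} {m : ℕ} {M : ℝ} (h : cf.OK m M) (p : Fin n → Fin n → ℝ)

/-- derivative of `D` -/
def Drt (cf : Cf n) (m : ℕ) (g gt : E n) (j : Fin n) (x t : ℝ) : ℝ :=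
  ∫ ξ in (xs m j)..(cl x), (Wt (cf.q j) (cf.qt j) (cf.d j) (cf.dt j) ξ x t
      * cp g j ξ (om (cf.q j) ξ x t) + W (cf.q j) (cf.d j) ξ x t *
        (cp gt j ξ (om (cf.q j) ξ x t) * W (cf.q j) (cf.qt j) ξ x t))

include h

lemma Drt_cc (g gt : E n) (j : Fin n) : CC (Drt cf m g gt j) := by
  refine continuous_paramInt (f := fun (z : ℝ × ℝ) ξ =>
    (Wt (cf.q j) (cf.qt j) (cf.d j) (cf.dt j) ξ z.1 z.2
      * cp g j ξ (om (cf.q j) ξ z.1 z.2) + W (cf.q j) (cf.d j) ξ z.1 z.2 *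
        (cp gt j ξ (om (cf.q j) ξ z.1 z.2) * W (cf.q j) (cf.qt j) ξ z.1 z.2)))
    ?_ continuous_const (cl_cont.comp continuous_fst)
  have ho : Continuous fun z : (ℝ × ℝ) × ℝ => om (cf.q j) z.2 z.1.1 z.1.2 :=
    om_cont (h.qok j) (by fun_prop) (by fun_prop) (by fun_prop)
  refine ((Wt_cont (h.qok j) (h.dTD j).c (h.dTD j).ct (by fun_prop) (by fun_prop)
    (by fun_prop)).mul ((cp_cc g j).comp (by fun_prop) ho)).add ?_
  refine (W_cont (h.qok j) (h.dTD j).c (by fun_prop) (by fun_prop) (by fun_prop)).mul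
    (((cp_cc gt j).comp (by fun_prop) ho).mul ?_)
  exact W_cont (h.qok j) (h.qXT j).ct (by fun_prop) (by fun_prop) (by fun_prop)

lemma Drt_le (g gt : E n) (j : Fin n) (x t : ℝ) :
    |Drt cf m g gt j x t| ≤ KD M * (‖g‖ + ‖gt‖) := by
  have hM := h.M1
  refine xs_cl_int_le (by have := KD_pos hM; positivity) (fun s => ?_) j x
  refine (abs_add_le _ _).trans ?_
  rw [abs_mul, abs_mul, abs_mul]
  have h1 := Wt_abs (h.qok j) (h.bd j) (h.bdt j) s x t
  have h2 : |W (cf.q j) (cf.d j) s x t| ≤ Real.exp M := W_abs (h.bd j) s x t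
  have h3 : |W (cf.q j) (cf.qt j) s x t| ≤ Real.exp M := W_abs (h.bqt j) s x t
  calc _ ≤ Real.exp M * (M * Real.exp M) * ‖g‖ + Real.exp M * (‖gt‖ * Real.exp M) := by
        gcongr
        · exact cp_le _ _ _ _
        · exact cp_le _ _ _ _
    _ ≤ KD M * (‖g‖ + ‖gt‖) := by
        unfold KD
        have : 0 ≤ Real.exp M * Real.exp M * ‖g‖ := by positivity
        have : 0 ≤ M * (Real.exp M * Real.exp M * ‖gt‖) := by positivity
        linarith

lemma Dop_dt {g gt : E n} (hg : Dt g gt) :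
    Dt (Dop h g) (mkE (Drt cf m g gt) (Drt_cc h g gt) _ (Drt_le h g gt)) := by
  intro j x t
  have h1 := (W_td (h.qok j) (h.dTD j) x).mul ((hg.td j).comp_om (h.qok j) x)
  exact h1.integral (xs m j) (cl x) t

lemma Dop_tame : Tame (KD M) (Dop h) where
  nn := (KD_pos h.M1).le
  b y := E_norm_le (by have := KD_pos h.M1; positivity) fun j x t =>
    (Dr_le h y j x t).trans (by gcongr; exact KD_ge h.M1)
  d y yt hy := ⟨_, Dop_dt h hy, E_norm_le (by have := KD_pos h.M1; positivity) (Drt_le h y yt)⟩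

/-- derivative of `C` -/
def Crt (cf : Cf n) (m : ℕ) (p : Fin n → Fin n → ℝ) (y yt : E n) (j : Fin n) (x t : ℝ) : ℝ :=
  Wt (cf.q j) (cf.qt j) (cf.d j) (cf.dt j) (xs m j) x t *
    (∑ k, p j k * cp y k (1 - xs m k) (om (cf.q j) (xs m j) x t)) +
  W (cf.q j) (cf.d j) (xs m j) x t *
    ∑ k, p j k * (cp yt k (1 - xs m k) (om (cf.q j) (xs m j) x t)
      * W (cf.q j) (cf.qt j) (xs m j) x t)

lemma Crt_cc (y yt : E n) (j : Fin n) : CC (Crt cf m p y yt j) := by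
  unfold CC Crt
  have ho : Continuous fun z : ℝ × ℝ => om (cf.q j) (xs m j) z.1 z.2 :=
    om_cont (h.qok j) (by fun_prop) (by fun_prop) (by fun_prop)
  refine ((Wt_cont (h.qok j) (h.dTD j).c (h.dTD j).ct (by fun_prop) (by fun_prop)
    (by fun_prop)).mul ?_).add ((W_cont (h.qok j) (h.dTD j).c (by fun_prop) (by fun_prop)
    (by fun_prop)).mul ?_)
  · exact continuous_finsetSum _ fun k _ => continuous_const.mul ((cp_cc y k).comp (by fun_prop) ho)
  · refine continuous_finsetSum _ fun k _ => continuous_const.mul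
      (((cp_cc yt k).comp (by fun_prop) ho).mul ?_)
    exact W_cont (h.qok j) (h.qXT j).ct (by fun_prop) (by fun_prop) (by fun_prop)

lemma Crt_le (y yt : E n) (j : Fin n) (x t : ℝ) :
    |Crt cf m p y yt j x t| ≤ pb p * KD M * (‖y‖ + ‖yt‖) := by
  have hM := h.M1
  have hp := pb_nonneg p
  refine (abs_add_le _ _).trans ?_
  rw [abs_mul, abs_mul]
  have h1 := Wt_abs (h.qok j) (h.bd j) (h.bdt j) (xs m j) x t
  have h2 : |W (cf.q j) (cf.d j) (xs m j) x t| ≤ Real.exp M := W_abs (h.bd j) _ x t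
  have h3 : |W (cf.q j) (cf.qt j) (xs m j) x t| ≤ Real.exp M := W_abs (h.bqt j) _ x t
  calc _ ≤ Real.exp M * (M * Real.exp M) * (pb p * ‖y‖) +
        Real.exp M * (pb p * (‖yt‖ * Real.exp M)) := by
        gcongr
        · exact psum_le (norm_nonneg _) (fun k => cp_le _ _ _ _) _
        · refine psum_le (by positivity) (fun k => ?_) _
          rw [abs_mul]
          exact mul_le_mul (cp_le _ _ _ _) h3 (abs_nonneg _) (norm_nonneg _)
    _ ≤ pb p * KD M * (‖y‖ + ‖yt‖) := by
        unfold KD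
        have : 0 ≤ pb p * (Real.exp M * Real.exp M * ‖y‖) := by positivity
        have : 0 ≤ pb p * (M * (Real.exp M * Real.exp M * ‖yt‖)) := by positivity
        linarith

lemma Cop_dt {y yt : E n} (hy : Dt y yt) :
    Dt (Cop h p y) (mkE (Crt cf m p y yt) (Crt_cc h p y yt) _ (Crt_le h p y yt)) := by
  intro j x t
  refine (W_dt (h.qok j) (h.dTD j) (xs m j) x t).mul ?_
  refine HasDerivAt.fun_sum fun k _ => ?_
  refine HasDerivAt.const_mul (p j k) ?_
  exact (hy k (1 - xs m k) _).comp t (om_dt (h.qok j) (xs m j) x t)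

lemma Cop_tame : Tame (pb p * KD M) (Cop h p) where
  nn := by have := KD_pos h.M1; have := pb_nonneg p; positivity
  b y := E_norm_le (by have := KD_pos h.M1; have := pb_nonneg p; positivity) fun j x t =>
    (Cr_le h p y j x t).trans (by
      have := KD_ge h.M1; have := pb_nonneg p; rw [mul_comm (Real.exp M)]; gcongr)
  d y yt hy := ⟨_, Cop_dt h p hy, E_norm_le
    (by have := KD_pos h.M1; have := pb_nonneg p; positivity) (Crt_le h p y yt)⟩

/-- derivative of `Mop` -/
def Mrt (cf : Cf n) (y yt : E n) (j : Fin n) (x t : ℝ) : ℝ :=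
  -∑ k, (cf.ct j k x t * cp y k x t + cf.c j k x t * cp yt k x t)

lemma Mrt_cc (y yt : E n) (j : Fin n) : CC (Mrt cf y yt j) := by
  unfold CC Mrt
  refine (continuous_finsetSum _ fun k _ => ?_).neg
  exact (Continuous.mul (h.cXT j k).ct (cp_cc y k)).add
    (Continuous.mul (h.cXT j k).c (cp_cc yt k))

lemma Mrt_le (y yt : E n) (j : Fin n) (x t : ℝ) : |Mrt cf y yt j x t| ≤ n * M * (‖y‖ + ‖yt‖) := by
  unfold Mrt; rw [abs_neg, Finset.sum_add_distrib]
  refine (abs_add_le _ _).trans ?_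
  have h1 := csum_le h.bct y j x t
  have h2 := csum_le h.bc yt j x t
  linarith

lemma Mop_dt {y yt : E n} (hy : Dt y yt) :
    Dt (Mop h y) (mkE (Mrt cf y yt) (Mrt_cc h y yt) _ (Mrt_le h y yt)) := by
  intro j x t
  refine HasDerivAt.neg ?_
  refine HasDerivAt.fun_sum fun k _ => ?_
  exact ((h.cXT j k).dt x t).mul (hy k x t)

lemma Mop_tame : Tame (n * M) (Mop h) where
  nn := by have := h.M1; positivity
  b y := E_norm_le (by have := h.M1; positivity) (Mr_le h y)
  d y yt hy := ⟨_, Mop_dt h hy, E_norm_le (by have := h.M1; positivity) (Mrt_le h y yt)⟩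

omit h in
/-- constants for powers -/
def Kpow (K : ℝ) : ℕ → ℝ
  | 0 => 1
  | i + 1 => 2 * K * Kpow K i

omit h in
lemma Tame.pow {K : ℝ} {L : E n →L[ℝ] E n} (hL : Tame K L) (i : ℕ) : Tame (Kpow K i) (L ^ i) := by
  induction i with
  | zero => rw [pow_zero]; exact Tame.one
  | succ i ih => rw [pow_succ']; exact hL.comp ih

omit h in
lemma Tame.geom {K : ℝ} {L : E n →L[ℝ] E n} (hL : Tame K L) (r : ℕ) :
    Tame (∑ i ∈ Finset.range r, Kpow K i) (∑ i ∈ Finset.range r, L ^ i) := by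
  induction r with
  | zero => simp only [Finset.range_zero, Finset.sum_empty]; exact Tame.zero
  | succ r ih => rw [Finset.sum_range_succ, Finset.sum_range_succ]; exact ih.add (hL.pow r)

omit h in
/-- constant of the geometric sum -/
def KG (p : Fin n → Fin n → ℝ) (M : ℝ) : ℝ := ∑ i ∈ Finset.range n, Kpow (pb p * KD M) i

/-- geometric sum of `C` -/
def Gop : E n →L[ℝ] E n := ∑ i ∈ Finset.range n, Cop h p ^ i

lemma Gop_tame : Tame (KG p M) (Gop h p) := (Cop_tame h p).geom n

lemma Sop_eq (g : E n) : Sop h p g = Gop h p (Dop h g) := rfl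

omit h in
/-- constant of `S` -/
def KS (p : Fin n → Fin n → ℝ) (M : ℝ) : ℝ := 2 * KG p M * KD M

lemma Sop_tame : Tame (KS p M) (Sop h p) := (Gop_tame h p).comp (Dop_tame h)

omit h in
/-- constant of `T` -/
def KT (p : Fin n → Fin n → ℝ) (M : ℝ) : ℝ := 2 * KS p M * (n * M)

lemma Top_tame : Tame (KT p M) (Top h p) := (Sop_tame h p).comp (Mop_tame h)

lemma Top_eq (u : E n) : Top h p u = Sop h p (Mop h u) := rfl

end ops
end QL
end

section
namespace QL
open scoped Topology
variable {n : ℕ}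

/-- `r` is the derivative of `y` along the characteristics of `q` -/
def Along (q y r : ℝ → ℝ → ℝ) : Prop := ∀ x t, ∀ ξ ∈ Icc (0:ℝ) 1,
  HasDerivWithinAt (fun s => y s (om q s x t)) (r ξ (om q ξ x t)) (Icc 0 1) ξ

lemma Along.dx {q qt y yt r : ℝ → ℝ → ℝ} {M : ℝ} (hq : Qok q qt M) (hy : TD y yt)
    (ha : Along q y r) {x : ℝ} (hx : x ∈ Icc (0:ℝ) 1) (t : ℝ) :
    HasDerivWithinAt (fun s => y s t) (r x t - q x t * yt x t) (Icc 0 1) x := by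
  have h := hy.dx_of_along (om_curve hq x t x hx) (ha x t x hx)
  simp only [om_self hq] at h
  exact h

lemma Along.of_xt {q qt y yx yt : ℝ → ℝ → ℝ} {M : ℝ} (hq : Qok q qt M) (hy : XT y yx yt)
    {r : ℝ → ℝ → ℝ} (hr : ∀ x ∈ Icc (0:ℝ) 1, ∀ t, yx x t + q x t * yt x t = r x t) :
    Along q y r := by
  intro x t ξ hξ
  have h := hy.chain hξ (om_curve hq x t ξ hξ)
  rw [hr ξ hξ] at h
  exact h

lemma Along.int {q qt y r : ℝ → ℝ → ℝ} {M : ℝ} (hq : Qok q qt M) (hr : CC r)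
    (ha : Along q y r) {x ξ : ℝ} (hx : x ∈ Icc (0:ℝ) 1) (hξ : ξ ∈ Icc (0:ℝ) 1) (t : ℝ) :
    y ξ (om q ξ x t) = y x t + ∫ s in x..ξ, r s (om q s x t) := by
  have hc : Continuous fun s => r s (om q s x t) :=
    hr.comp (by fun_prop) (om_cont hq (by fun_prop) (by fun_prop) (by fun_prop))
  rw [ftc_Icc (ha x t) hc.continuousOn hx hξ, om_self hq]; ring

/-- multiplying by the weight -/
lemma Along.mulW {q qt d y r : ℝ → ℝ → ℝ} {M : ℝ} (hq : Qok q qt M) (hd : CC d)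
    (ha : Along q y r) (x t : ℝ) {ξ : ℝ} (hξ : ξ ∈ Icc (0:ℝ) 1) :
    HasDerivWithinAt (fun s => W q d s x t * y s (om q s x t))
      (W q d ξ x t * (r ξ (om q ξ x t) + d ξ (om q ξ x t) * y ξ (om q ξ x t))) (Icc 0 1) ξ := by
  have h := (W_dξ hq hd hξ x t).mul (ha x t ξ hξ)
  refine HasDerivWithinAt.congr_deriv h ?_
  ring

/-- the converse -/
lemma along_of_mulW {q qt d y g : ℝ → ℝ → ℝ} {M : ℝ} (hq : Qok q qt M) (hd : CC d)
    (x t : ℝ) {ξ : ℝ} (hξ : ξ ∈ Icc (0:ℝ) 1)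
    (h : HasDerivWithinAt (fun s => W q d s x t * y s (om q s x t))
      (W q d ξ x t * g ξ (om q ξ x t)) (Icc 0 1) ξ) :
    HasDerivWithinAt (fun s => y s (om q s x t))
      (g ξ (om q ξ x t) - d ξ (om q ξ x t) * y ξ (om q ξ x t)) (Icc 0 1) ξ := by
  have hw := W_dξ hq hd hξ x t
  have hne : W q d ξ x t ≠ 0 := (W_pos _ _ _ _ _).ne'
  have h2 := h.div hw hne
  have e : ∀ s, y s (om q s x t) = W q d s x t * y s (om q s x t) / W q d s x t := by
    intro s
    have : W q d s x t ≠ 0 := (W_pos _ _ _ _ _).ne'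
    field_simp
  refine HasDerivWithinAt.congr_of_eventuallyEq (HasDerivWithinAt.congr_deriv h2 ?_)
    (Eventually.of_forall e) (e ξ)
  field_simp

/-- differentiation in `t` of the equation along characteristics -/
lemma Along.dt {q qt y yt r rt : ℝ → ℝ → ℝ} {M : ℝ} (hq : Qok q qt M) (hy : TD y yt)
    (hr : TD r rt) (ha : Along q y r) :
    Along q yt (fun x t => rt x t - qt x t * yt x t) := by
  intro x t ξ hξ
  apply along_of_mulW hq hq.td.ct x t hξ
  have key : ∀ s ∈ Icc (0:ℝ) 1, W q qt s x t * yt s (om q s x t)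
      = yt (cl x) t + ∫ s' in (cl x)..s, rt s' (om q s' x t) * W q qt s' x t := by
    intro s hs
    have e : ∀ t', y s (om q s x t') = y (cl x) t' + ∫ s' in (cl x)..s, r s' (om q s' x t') := by
      intro t'
      have := ha.int hq hr.c (cl_mem x) hs t'
      simpa only [om_cl2] using this
    have h1 : HasDerivAt (fun t' => y s (om q s x t')) (yt s (om q s x t) * W q qt s x t) t :=
      (hy.dt s _).comp t (om_dt hq s x t)
    have h2 : HasDerivAt (fun t' => y s (om q s x t')) (yt (cl x) t +
        ∫ s' in (cl x)..s, rt s' (om q s' x t) * W q qt s' x t) t := by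
      simp only [e]
      exact (hy.dt _ t).add ((hr.comp_om hq x).integral (cl x) s t)
    rw [← h1.unique h2]; ring
  have hc : Continuous fun s => rt s (om q s x t) * W q qt s x t :=
    (hr.ct.comp (by fun_prop) (om_cont hq (by fun_prop) (by fun_prop) (by fun_prop))).mul
      (W_cont hq hq.td.ct (by fun_prop) (by fun_prop) (by fun_prop))
  have h3 : HasDerivAt (fun s => yt (cl x) t +
      ∫ s' in (cl x)..s, rt s' (om q s' x t) * W q qt s' x t)
      (rt ξ (om q ξ x t) * W q qt ξ x t) ξ :=
    (intervalIntegral.integral_hasDerivAt_right (hc.intervalIntegrable _ _)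
      (hc.stronglyMeasurableAtFilter _ _) hc.continuousAt).const_add _
  rw [mul_comm]
  exact h3.hasDerivWithinAt.congr key (key ξ hξ)

/-- boundary conditions -/
def BCs (m : ℕ) (p : Fin n → Fin n → ℝ) (y : E n) : Prop :=
  ∀ j t, cp y j (xs m j) t = ∑ k, p j k * cp y k (1 - xs m k) t

/-- independent of `x` outside of the strip -/
def Clamped (y : E n) : Prop := ∀ j x t, cp y j (cl x) t = cp y j x t

/-- solutions of the diagonal problem -/
structure Sol (cf : Cf n) (m : ℕ) (p : Fin n → Fin n → ℝ) (y g : E n) : Prop where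
  clp : Clamped y
  bc : BCs m p y
  al : ∀ j, Along (cf.q j) (cp y j) (fun x t => cp g j x t - cf.d j x t * cp y j x t)

lemma W_cl1 (q d : ℝ → ℝ → ℝ) (ξ x t : ℝ) : W q d (cl ξ) x t = W q d ξ x t := by
  unfold W; rw [cl_cl]
lemma W_cl2 (q d : ℝ → ℝ → ℝ) (ξ x t : ℝ) : W q d ξ (cl x) t = W q d ξ x t := by
  unfold W; rw [cl_cl]; simp only [om_cl2]

section ops
variable {cf : Cf n} {m : ℕ} {M : ℝ} (h : cf.OK m M) (p : Fin n → Fin n → ℝ)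

include h

lemma sol_of_mild {y g : E n} (hy : y = Cop h p y + Dop h g) : Sol cf m p y g := by
  have e : ∀ j x t, cp y j x t = Cr cf m p y j x t + Dr cf m g j x t := by
    intro j x t
    nth_rw 1 [hy]; rfl
  have ew : ∀ j x t s, W (cf.q j) (cf.d j) s x t * cp y j s (om (cf.q j) s x t)
      = W (cf.q j) (cf.d j) (xs m j) x t *
        (∑ k, p j k * cp y k (1 - xs m k) (om (cf.q j) (xs m j) x t)) +
        ∫ ξ in (xs m j)..(cl s), W (cf.q j) (cf.d j) ξ x t * cp g j ξ (om (cf.q j) ξ x t) := by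
    intro j x t s
    rw [e]
    unfold Cr Dr
    simp only [om_om (h.qok j)]
    rw [mul_add, ← mul_assoc, mul_comm (W _ _ s x t), W_mul (h.qok j) (h.dTD j).c]
    congr 1
    rw [← intervalIntegral.integral_const_mul]
    congr 1; funext ξ
    rw [← W_mul (h.qok j) (h.dTD j).c ξ s x t]; ring
  refine ⟨?_, ?_, ?_⟩
  · intro j x t
    rw [e, e]
    unfold Cr Dr
    simp only [W_cl2, om_cl2, cl_cl]
  · intro j t
    have := ew j (xs m j) t (xs m j)
    simp only [W_self, om_self (h.qok j), cl_xs, intervalIntegral.integral_same, one_mul,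
      add_zero] at this
    exact this
  · intro j x t ξ hξ
    apply along_of_mulW (h.qok j) (h.dTD j).c x t hξ
    simp only [ew]
    have hc : Continuous fun ξ => W (cf.q j) (cf.d j) ξ x t * cp g j ξ (om (cf.q j) ξ x t) :=
      (Dr_integrand_cont h g j).comp (f := fun ξ : ℝ => ((x, t), ξ)) (by fun_prop)
    have h3 := (intervalIntegral.integral_hasDerivAt_right (hc.intervalIntegrable (xs m j) ξ)
      (hc.stronglyMeasurableAtFilter _ _) hc.continuousAt).const_add
      (W (cf.q j) (cf.d j) (xs m j) x t *
        (∑ k, p j k * cp y k (1 - xs m k) (om (cf.q j) (xs m j) x t)))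
    refine h3.hasDerivWithinAt.congr (fun s hs => ?_) ?_
    · rw [cl_eq hs]
    · rw [cl_eq hξ]

lemma mild_of_sol {y g : E n} (hy : Sol cf m p y g) : y = Cop h p y + Dop h g := by
  apply E_ext; intro j x t
  rw [cp_add, cp_Cop, cp_Dop]
  unfold Cr Dr
  rw [← hy.bc]
  have hc : Continuous fun ξ => W (cf.q j) (cf.d j) ξ x t * cp g j ξ (om (cf.q j) ξ x t) :=
    (Dr_integrand_cont h g j).comp (f := fun ξ : ℝ => ((x, t), ξ)) (by fun_prop)
  have hd : ∀ ξ ∈ Icc (0:ℝ) 1, HasDerivWithinAt (fun s => W (cf.q j) (cf.d j) s x t *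
      cp y j s (om (cf.q j) s x t)) (W (cf.q j) (cf.d j) ξ x t *
        cp g j ξ (om (cf.q j) ξ x t)) (Icc 0 1) ξ := by
    intro ξ hξ
    refine HasDerivWithinAt.congr_deriv ((hy.al j).mulW (h.qok j) (h.dTD j).c x t hξ) ?_
    ring
  rw [ftc_Icc hd hc.continuousOn (xs_mem m j) (cl_mem x), hy.clp, W_cl1, om_cl1, W_self,
    om_self (h.qok j)]
  ring

lemma sol_iff (hp : H3cond n p) {y g : E n} : Sol cf m p y g ↔ y = Sop h p g := by
  rw [mild_iff h p hp]
  exact ⟨mild_of_sol h p, sol_of_mild h p⟩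

end ops

/-- right-hand side along characteristics is continuous -/
lemma Sol.rcc {cf : Cf n} {m : ℕ} {M : ℝ} (h : cf.OK m M) (y g : E n) (j : Fin n) :
    CC (fun x t => cp g j x t - cf.d j x t * cp y j x t) :=
  Continuous.sub (cp_cc g j) (Continuous.mul (h.dTD j).c (cp_cc y j))

/-- classical regularity -/
lemma Sol.xt {cf : Cf n} {m : ℕ} {M : ℝ} (h : cf.OK m M) {p : Fin n → Fin n → ℝ} {y g yt : E n}
    (hy : Sol cf m p y g) (hyt : Dt y yt) (j : Fin n) :
    XT (cp y j) (fun x t => cp g j x t - cf.d j x t * cp y j x t - cf.q j x t * cp yt j x t)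
      (cp yt j) where
  toTD := hyt.td j
  cx := Continuous.sub (Sol.rcc h y g j) (Continuous.mul (h.qXT j).c (cp_cc yt j))
  dx x hx t := (hy.al j).dx (h.qok j) (hyt.td j) hx t

/-- classical solutions are solutions -/
lemma Sol.of_classical {cf : Cf n} {m : ℕ} {M : ℝ} (h : cf.OK m M) {p : Fin n → Fin n → ℝ}
    {y g : E n} {yx yt : Fin n → ℝ → ℝ → ℝ} (hc : Clamped y) (hb : BCs m p y)
    (hy : ∀ j, XT (cp y j) (yx j) (yt j))
    (he : ∀ j, ∀ x ∈ Icc (0:ℝ) 1, ∀ t, yx j x t + cf.q j x t * yt j x t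
      + cf.d j x t * cp y j x t = cp g j x t) : Sol cf m p y g where
  clp := hc
  bc := hb
  al j := Along.of_xt (h.qok j) (hy j) fun x hx t => by rw [← he j x hx t]; ring

end QL
end

section
namespace QL
open scoped Topology
variable {n : ℕ}

/-- integration by parts on `[0,1]` -/
lemma ibp {G Gd F Fd : ℝ → ℝ} (hG : ∀ s ∈ Icc (0:ℝ) 1, HasDerivWithinAt G (Gd s) (Icc 0 1) s)
    (hF : ∀ s ∈ Icc (0:ℝ) 1, HasDerivWithinAt F (Fd s) (Icc 0 1) s)
    (hGc : Continuous G) (hFc : Continuous F) (hGd : Continuous Gd) (hFd : Continuous Fd) {a b : ℝ}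
    (ha : a ∈ Icc (0:ℝ) 1) (hb : b ∈ Icc (0:ℝ) 1) :
    ∫ s in a..b, G s * Fd s = G b * F b - G a * F a - ∫ s in a..b, Gd s * F s := by
  have h := ftc_Icc (f := fun s => G s * F s) (f' := fun s => Gd s * F s + G s * Fd s)
    (fun s hs => (hG s hs).mul (hF s hs)) (by fun_prop) ha hb
  rw [intervalIntegral.integral_add (Continuous.intervalIntegrable (by fun_prop) _ _)
    (Continuous.intervalIntegrable (by fun_prop) _ _)] at h
  linarith

section ops
variable {cf : Cf n} {m : ℕ} {M : ℝ} (h : cf.OK m M) (p : Fin n → Fin n → ℝ)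
include h

/-- the basic smoothing estimate -/
lemma sm_key {j k : Fin n} (hjk : j ≠ k) {y yt r : ℝ → ℝ → ℝ} (hy : TD y yt)
    (hr : CC r) (ha : Along (cf.q k) y r) {Y R : ℝ} (hY : ∀ x t, |y x t| ≤ Y)
    (hR : ∀ x t, |r x t| ≤ R) (x t : ℝ) {a b : ℝ} (hx0 : a ∈ Icc (0:ℝ) 1) (hb0 : b ∈ Icc (0:ℝ) 1) :
    |∫ ξ in a..b, W (cf.q j) (cf.d j) ξ x t * W (cf.q j) (cf.qt j) ξ x t *
      cf.c j k ξ (om (cf.q j) ξ x t) * yt ξ (om (cf.q j) ξ x t)|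
      ≤ Real.exp M * Real.exp M * (10 * M ^ 5) * (Y + R) := by
  set o := fun ξ => om (cf.q j) ξ x t with ho
  have hoc : Continuous o := om_cont (h.qok j) (by fun_prop) (by fun_prop) (by fun_prop)
  have hM := h.M1
  have cq : ∀ i, Continuous fun s => cf.q i s (o s) := fun i =>
    (h.qXT i).c.comp (by fun_prop) hoc
  have cqx : ∀ i, Continuous fun s => cf.qx i s (o s) := fun i =>
    (h.qXT i).cx.comp (by fun_prop) hoc
  have cqt : ∀ i, Continuous fun s => cf.qt i s (o s) := fun i =>
    (h.qXT i).ct.comp (by fun_prop) hoc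
  have cc : Continuous fun s => cf.c j k s (o s) := (h.cXT j k).c.comp (by fun_prop) hoc
  have ccx : Continuous fun s => cf.cx j k s (o s) := (h.cXT j k).cx.comp (by fun_prop) hoc
  have cct : Continuous fun s => cf.ct j k s (o s) := (h.cXT j k).ct.comp (by fun_prop) hoc
  have cd : Continuous fun s => cf.d j s (o s) := (h.dTD j).c.comp (by fun_prop) hoc
  have cy : Continuous fun s => y s (o s) := hy.c.comp (by fun_prop) hoc
  have cyt : Continuous fun s => yt s (o s) := hy.ct.comp (by fun_prop) hoc
  have cr : Continuous fun s => r s (o s) := hr.comp (by fun_prop) hoc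
  have cw1 : Continuous fun s => W (cf.q j) (cf.d j) s x t :=
    W_cont (h.qok j) (h.dTD j).c (by fun_prop) (by fun_prop) (by fun_prop)
  have cw2 : Continuous fun s => W (cf.q j) (cf.qt j) s x t :=
    W_cont (h.qok j) (h.qXT j).ct (by fun_prop) (by fun_prop) (by fun_prop)
  have hne : ∀ s, cf.q j s (o s) - cf.q k s (o s) ≠ 0 := by
    intro s hs
    have := h.sep j k hjk s (o s)
    rw [hs] at this; simp at this; linarith
  have hinv : ∀ s, |(cf.q j s (o s) - cf.q k s (o s))⁻¹| ≤ M := by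
    intro s
    rw [abs_inv]
    have h1 := h.sep j k hjk s (o s)
    have h2 : 0 < |cf.q j s (o s) - cf.q k s (o s)| := abs_pos.2 (hne s)
    rw [inv_le_iff_one_le_mul₀ h2]; exact h1
  have cR : Continuous fun s => (cf.q j s (o s) - cf.q k s (o s))⁻¹ :=
    ((cq j).sub (cq k)).inv₀ hne
  have hcurve := om_curve (h.qok j) x t
  have hF : ∀ s ∈ Icc (0:ℝ) 1, HasDerivWithinAt (fun s => y s (o s))
      (r s (o s) + (cf.q j s (o s) - cf.q k s (o s)) * yt s (o s)) (Icc 0 1) s := by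
    intro s hs
    have hxt : XT y (fun x t => r x t - cf.q k x t * yt x t) yt :=
      { toTD := hy
        cx := Continuous.sub hr (Continuous.mul (h.qXT k).c hy.ct)
        dx := fun x hx t => ha.dx (h.qok k) hy hx t }
    refine HasDerivWithinAt.congr_deriv (hxt.chain hs (hcurve s hs)) ?_
    simp only [ho]; ring
  have hc : ∀ s ∈ Icc (0:ℝ) 1, HasDerivWithinAt (fun s => cf.c j k s (o s))
      (cf.cx j k s (o s) + cf.q j s (o s) * cf.ct j k s (o s)) (Icc 0 1) s := fun s hs =>
    (h.cXT j k).chain hs (hcurve s hs)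
  have hq : ∀ i, ∀ s ∈ Icc (0:ℝ) 1, HasDerivWithinAt (fun s => cf.q i s (o s))
      (cf.qx i s (o s) + cf.q j s (o s) * cf.qt i s (o s)) (Icc 0 1) s := fun i s hs =>
    (h.qXT i).chain hs (hcurve s hs)
  have hw1 : ∀ s ∈ Icc (0:ℝ) 1, HasDerivWithinAt (fun s => W (cf.q j) (cf.d j) s x t)
      (cf.d j s (o s) * W (cf.q j) (cf.d j) s x t) (Icc 0 1) s := fun s hs =>
    W_dξ (h.qok j) (h.dTD j).c hs x t
  have hw2 : ∀ s ∈ Icc (0:ℝ) 1, HasDerivWithinAt (fun s => W (cf.q j) (cf.qt j) s x t)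
      (cf.qt j s (o s) * W (cf.q j) (cf.qt j) s x t) (Icc 0 1) s := fun s hs =>
    W_dξ (h.qok j) (h.qXT j).ct hs x t
  have bw1 : ∀ s, |W (cf.q j) (cf.d j) s x t| ≤ Real.exp M := fun s => W_abs (h.bd j) _ _ _
  have bw2 : ∀ s, |W (cf.q j) (cf.qt j) s x t| ≤ Real.exp M := fun s => W_abs (h.bqt j) _ _ _
  -- the multiplier
  set w := fun s => W (cf.q j) (cf.d j) s x t * W (cf.q j) (cf.qt j) s x t with hw
  set z := fun s => cf.c j k s (o s) * (cf.q j s (o s) - cf.q k s (o s))⁻¹ with hz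
  set dz := fun s => (cf.cx j k s (o s) + cf.q j s (o s) * cf.ct j k s (o s)) *
      (cf.q j s (o s) - cf.q k s (o s))⁻¹ - cf.c j k s (o s) *
      ((cf.q j s (o s) - cf.q k s (o s))⁻¹ * (cf.q j s (o s) - cf.q k s (o s))⁻¹ *
      ((cf.qx j s (o s) + cf.q j s (o s) * cf.qt j s (o s)) -
        (cf.qx k s (o s) + cf.q j s (o s) * cf.qt k s (o s)))) with hdz
  set dw := fun s => (cf.d j s (o s) + cf.qt j s (o s)) * w s with hdw
  have hwd : ∀ s ∈ Icc (0:ℝ) 1, HasDerivWithinAt w (dw s) (Icc 0 1) s := by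
    intro s hs
    refine HasDerivWithinAt.congr_deriv ((hw1 s hs).mul (hw2 s hs)) ?_
    simp only [hdw, hw]; ring
  have hzd : ∀ s ∈ Icc (0:ℝ) 1, HasDerivWithinAt z (dz s) (Icc 0 1) s := by
    intro s hs
    refine HasDerivWithinAt.congr_deriv ((hc s hs).mul
      (((hq j s hs).sub (hq k s hs)).inv (hne s))) ?_
    simp only [hdz, Pi.sub_apply]
    have := hne s
    field_simp
    ring
  have hGd : ∀ s ∈ Icc (0:ℝ) 1, HasDerivWithinAt (fun s => w s * z s)
      (dw s * z s + w s * dz s) (Icc 0 1) s := fun s hs => (hwd s hs).mul (hzd s hs)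
  have cw : Continuous w := cw1.mul cw2
  have cz : Continuous z := cc.mul cR
  have cdz : Continuous dz := ((ccx.add ((cq j).mul cct)).mul cR).sub
    (cc.mul ((cR.mul cR).mul ((((cqx j).add ((cq j).mul (cqt j)))).sub
      ((cqx k).add ((cq j).mul (cqt k))))))
  have cdw : Continuous dw := (cd.add (cqt j)).mul cw
  have hI := ibp hGd hF (by fun_prop) cy (by fun_prop)
    (cr.add (((cq j).sub (cq k)).mul cyt)) hx0 hb0
  have e1 : ∀ s, w s * z s * (r s (o s) + (cf.q j s (o s) - cf.q k s (o s)) * yt s (o s))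
      = w s * z s * r s (o s) + W (cf.q j) (cf.d j) s x t * W (cf.q j) (cf.qt j) s x t *
      cf.c j k s (o s) * yt s (o s) := by
    intro s
    have := hne s
    simp only [hw, hz]; field_simp
  simp only [e1] at hI
  have j1 : Continuous fun s => w s * z s * r s (o s) := (cw.mul cz).mul cr
  have j2 : Continuous fun s => W (cf.q j) (cf.d j) s x t * W (cf.q j) (cf.qt j) s x t *
      cf.c j k s (o s) * yt s (o s) := ((cw1.mul cw2).mul cc).mul cyt
  rw [intervalIntegral.integral_add (j1.intervalIntegrable _ _) (j2.intervalIntegrable _ _)] at hI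
  have bw : ∀ s, |w s| ≤ Real.exp M * Real.exp M := fun s => by
    rw [hw, abs_mul]; exact mul_le_mul (bw1 s) (bw2 s) (abs_nonneg _) (Real.exp_pos _).le
  have bz : ∀ s, |z s| ≤ M * M := fun s => by
    rw [hz, abs_mul]; exact mul_le_mul (h.bc _ _ _ _) (hinv s) (abs_nonneg _) (by linarith)
  have bdw : ∀ s, |dw s| ≤ (2 * M) * (Real.exp M * Real.exp M) := fun s => by
    simp only [hdw]; rw [abs_mul]
    refine mul_le_mul ((abs_add_le _ _).trans ?_) (bw s) (abs_nonneg _) (by linarith)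
    linarith [h.bd j s (o s), h.bqt j s (o s)]
  have b1 : ∀ {u v w : ℝ}, |u| ≤ M → |v| ≤ M → |w| ≤ M → |u + v * w| ≤ 2 * (M * M) := by
    intro u v w hu hv hw
    refine (abs_add_le _ _).trans ?_
    rw [abs_mul]
    have := mul_le_mul hv hw (abs_nonneg _) (by linarith)
    nlinarith
  have bdz : ∀ s, |dz s| ≤ 6 * M ^ 5 := fun s => by
    simp only [hdz]
    refine (abs_sub _ _).trans ?_
    simp only [abs_mul]
    have t1 := b1 (h.bcx j k s (o s)) (h.bq j s (o s)) (h.bct j k s (o s))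
    have t2 := b1 (h.bqx j s (o s)) (h.bq j s (o s)) (h.bqt j s (o s))
    have t3 := b1 (h.bqx k s (o s)) (h.bq j s (o s)) (h.bqt k s (o s))
    have t4 := (abs_sub _ _).trans (add_le_add t2 t3)
    have u1 := mul_le_mul t1 (hinv s) (abs_nonneg _) (by positivity)
    have u2 := mul_le_mul (h.bc j k s (o s)) (mul_le_mul (mul_le_mul (hinv s) (hinv s)
      (abs_nonneg _) (by linarith)) t4 (abs_nonneg _) (by positivity)) (by positivity)
      (by linarith)
    refine (add_le_add u1 u2).trans ?_
    have hM2 : 1 ≤ M ^ 2 := one_le_pow₀ hM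
    have : M ^ 3 ≤ M ^ 5 := pow_le_pow_right₀ hM (by norm_num)
    nlinarith
  have hYn : 0 ≤ Y := (abs_nonneg _).trans (hY 0 0)
  have hRn : 0 ≤ R := (abs_nonneg _).trans (hR 0 0)
  have bG : ∀ s, |w s * z s| ≤ Real.exp M * Real.exp M * (M * M) := fun s => by
    rw [abs_mul]; exact mul_le_mul (bw s) (bz s) (abs_nonneg _) (by positivity)
  have bGy : ∀ s, |w s * z s * y s (o s)| ≤ Real.exp M * Real.exp M * (M * M) * Y := fun s => by
    rw [abs_mul]; exact mul_le_mul (bG s) (hY _ _) (abs_nonneg _) (by positivity)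
  have bGr : ∀ s, |w s * z s * r s (o s)| ≤ Real.exp M * Real.exp M * (M * M) * R := fun s => by
    rw [abs_mul]; exact mul_le_mul (bG s) (hR _ _) (abs_nonneg _) (by positivity)
  have bGd : ∀ s, |(dw s * z s + w s * dz s) * y s (o s)| ≤
      (Real.exp M * Real.exp M * (8 * M ^ 5)) * Y := fun s => by
    rw [abs_mul]
    refine mul_le_mul ?_ (hY _ _) (abs_nonneg _) (by positivity)
    refine (abs_add_le _ _).trans ?_
    rw [abs_mul (dw s), abs_mul (w s)]
    have u1 := mul_le_mul (bdw s) (bz s) (abs_nonneg _) (by positivity)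
    have u2 := mul_le_mul (bw s) (bdz s) (abs_nonneg _) (by positivity)
    refine (add_le_add u1 u2).trans ?_
    have : M ^ 3 ≤ M ^ 5 := pow_le_pow_right₀ hM (by norm_num)
    have he : 0 < Real.exp M * Real.exp M := by positivity
    nlinarith
  have i1 := abs_int_le (by positivity) bGr a b
  have i2 := abs_int_le (by positivity) bGd a b
  rw [cl_eq hx0, cl_eq hb0] at i1 i2
  have e2 : (∫ ξ in a..b, W (cf.q j) (cf.d j) ξ x t * W (cf.q j) (cf.qt j) ξ x t *
      cf.c j k ξ (om (cf.q j) ξ x t) * yt ξ (om (cf.q j) ξ x t)) =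
      w b * z b * y b (o b) - w a * z a * y a (o a)
      - (∫ s in a..b, (dw s * z s + w s * dz s) * y s (o s)) -
      ∫ s in a..b, w s * z s * r s (o s) := by
    rw [← hI]; ring
  rw [e2]
  have hM2 : M * M ≤ M ^ 5 := by
    have := pow_le_pow_right₀ hM (show 2 ≤ 5 by norm_num); nlinarith
  have he : 0 < Real.exp M * Real.exp M := by positivity
  refine (abs_sub _ _).trans ((add_le_add ((abs_sub _ _).trans (add_le_add ((abs_sub _ _).trans
    (add_le_add (bGy b) (bGy a))) i2)) i1).trans ?_)
  have k1 : Real.exp M * Real.exp M * (M * M) ≤ Real.exp M * Real.exp M * M ^ 5 := by gcongr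
  have k2 := mul_le_mul_of_nonneg_right k1 hYn
  have k3 := mul_le_mul_of_nonneg_right k1 hRn
  have k4 : 0 ≤ Real.exp M * Real.exp M * M ^ 5 * R := by positivity
  nlinarith

omit h in
/-- smoothing constant for `D` -/
def KM (n : ℕ) (M : ℝ) : ℝ :=
  n * (KD M * M * 2 + Real.exp M * Real.exp M * (10 * M ^ 5) * (1 + M))

omit h in
lemma KM_nonneg (n : ℕ) {M : ℝ} (hM : 1 ≤ M) : 0 ≤ KM n M := by
  have := KD_pos hM
  unfold KM; positivity

/-- `D M y` is smooth for solutions `y` -/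
lemma sm_D {y yt g : E n} (hy : Sol cf m p y g) (hyt : Dt y yt) :
    ∃ v, Dt (Dop h (Mop h y)) v ∧ ‖v‖ ≤ KM n M * (‖y‖ + ‖g‖) := by
  have hM := h.M1
  have hKD := KD_pos hM
  have hKM := KM_nonneg n hM
  refine ⟨_, Dop_dt h (Mop_dt h hyt), E_norm_le (by positivity) fun j x t => ?_⟩
  simp only [cp_mkE]
  set Y := ‖y‖
  set R := ‖g‖ + M * ‖y‖ with hR
  have hYn : 0 ≤ Y := norm_nonneg _
  have hRn : 0 ≤ R := by positivity
  set o := fun ξ => om (cf.q j) ξ x t with ho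
  have hoc : Continuous o := om_cont (h.qok j) (by fun_prop) (by fun_prop) (by fun_prop)
  have cc : ∀ k, Continuous fun s => cf.c j k s (o s) := fun k =>
    (h.cXT j k).c.comp (by fun_prop) hoc
  have cct : ∀ k, Continuous fun s => cf.ct j k s (o s) := fun k =>
    (h.cXT j k).ct.comp (by fun_prop) hoc
  have cy : ∀ k, Continuous fun s => cp y k s (o s) := fun k => (cp_cc y k).comp (by fun_prop) hoc
  have cyt : ∀ k, Continuous fun s => cp yt k s (o s) := fun k =>
    (cp_cc yt k).comp (by fun_prop) hoc
  have cw1 : Continuous fun s => W (cf.q j) (cf.d j) s x t :=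
    W_cont (h.qok j) (h.dTD j).c (by fun_prop) (by fun_prop) (by fun_prop)
  have cw2 : Continuous fun s => W (cf.q j) (cf.qt j) s x t :=
    W_cont (h.qok j) (h.qXT j).ct (by fun_prop) (by fun_prop) (by fun_prop)
  have cw3 : Continuous fun s => Wt (cf.q j) (cf.qt j) (cf.d j) (cf.dt j) s x t :=
    Wt_cont (h.qok j) (h.dTD j).c (h.dTD j).ct (by fun_prop) (by fun_prop) (by fun_prop)
  have bw1 : ∀ s, |W (cf.q j) (cf.d j) s x t| ≤ Real.exp M := fun s => W_abs (h.bd j) _ _ _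
  have bw2 : ∀ s, |W (cf.q j) (cf.qt j) s x t| ≤ Real.exp M := fun s => W_abs (h.bqt j) _ _ _
  have bw3 : ∀ s, |Wt (cf.q j) (cf.qt j) (cf.d j) (cf.dt j) s x t| ≤ KD M := fun s => by
    refine (Wt_abs (h.qok j) (h.bd j) (h.bdt j) s x t).trans ?_
    unfold KD
    have : 0 < Real.exp M * Real.exp M := by positivity
    nlinarith
  have bw4 : Real.exp M * Real.exp M ≤ KD M := by
    unfold KD
    have : 0 < Real.exp M * Real.exp M := by positivity
    nlinarith
  let P : Fin n → ℝ → ℝ := fun k s => Wt (cf.q j) (cf.qt j) (cf.d j) (cf.dt j) s x t *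
    (cf.c j k s (o s) * cp y k s (o s)) + W (cf.q j) (cf.d j) s x t *
    W (cf.q j) (cf.qt j) s x t * (cf.ct j k s (o s) * cp y k s (o s))
  let Q : Fin n → ℝ → ℝ := fun k s => W (cf.q j) (cf.d j) s x t *
    W (cf.q j) (cf.qt j) s x t * cf.c j k s (o s) * cp yt k s (o s)
  have cP : ∀ k, Continuous (P k) := fun k => (cw3.mul ((cc k).mul (cy k))).add
    ((cw1.mul cw2).mul ((cct k).mul (cy k)))
  have cQ : ∀ k, Continuous (Q k) := fun k => ((cw1.mul cw2).mul (cc k)).mul (cyt k)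
  have e : Drt cf m (Mop h y) (mkE (Mrt cf y yt) (Mrt_cc h y yt) _ (Mrt_le h y yt)) j x t
      = -∑ k, ∫ s in (xs m j)..(cl x), (P k s + Q k s) := by
    have cPQ : ∀ k, Continuous fun s => P k s + Q k s := fun k => (cP k).add (cQ k)
    rw [← intervalIntegral.integral_finsetSum
      (fun k _ => (cPQ k).intervalIntegrable _ _), ← intervalIntegral.integral_neg]
    unfold Drt
    congr 1; funext s
    simp only [cp_mkE, cp_Mop, Mr, Mrt, P, Q, ho]
    rw [mul_neg, neg_mul, mul_neg, ← neg_add, Finset.mul_sum, Finset.sum_mul, Finset.mul_sum,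
      ← Finset.sum_add_distrib]
    congr 1
    refine Finset.sum_congr rfl fun k _ => ?_
    ring
  rw [e, abs_neg]
  refine (Finset.abs_sum_le_sum_abs _ _).trans ?_
  have key : ∀ k, |∫ s in (xs m j)..(cl x), (P k s + Q k s)| ≤
      (KD M * M * 2 + Real.exp M * Real.exp M * (10 * M ^ 5) * (1 + M)) * (Y + ‖g‖) := by
    intro k
    rw [intervalIntegral.integral_add ((cP k).intervalIntegrable _ _)
      ((cQ k).intervalIntegrable _ _)]
    have b1 : |∫ s in (xs m j)..(cl x), P k s| ≤ KD M * M * 2 * Y := by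
      refine xs_cl_int_le (by positivity) (fun s => ?_) j x
      simp only [P]
      refine (abs_add_le _ _).trans ?_
      simp only [abs_mul]
      have u1 := mul_le_mul (bw3 s) (mul_le_mul (h.bc j k s (o s)) (cp_le y k s (o s))
        (abs_nonneg _) (by linarith)) (by positivity) hKD.le
      have u2 := mul_le_mul ((mul_le_mul (bw1 s) (bw2 s) (abs_nonneg _) (by positivity)).trans bw4)
        (mul_le_mul (h.bct j k s (o s)) (cp_le y k s (o s))
        (abs_nonneg _) (by linarith)) (by positivity) hKD.le
      refine (add_le_add u1 u2).trans (le_of_eq ?_)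
      simp only [Y]; ring
    have b2 : |∫ s in (xs m j)..(cl x), Q k s| ≤
        Real.exp M * Real.exp M * (10 * M ^ 5) * (Y + R) := by
      by_cases hjk : j = k
      · have : ∀ s, Q k s = 0 := fun s => by simp only [Q]; rw [← hjk, h.c0]; simp
        simp only [this]
        simp only [intervalIntegral.integral_zero, abs_zero]; positivity
      · refine sm_key h hjk (hyt.td k) (Sol.rcc h y g k) (hy.al k) (cp_le y k) ?_ x t
          (xs_mem m j) (cl_mem x)
        intro x t
        refine (abs_sub _ _).trans (add_le_add (cp_le _ _ _ _) ?_)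
        rw [abs_mul]
        exact mul_le_mul (h.bd _ _ _) (cp_le _ _ _ _) (abs_nonneg _) (by linarith)
    refine ((abs_add_le _ _).trans (add_le_add b1 b2)).trans ?_
    rw [add_mul]
    have hg : 0 ≤ ‖g‖ := norm_nonneg _
    refine add_le_add ?_ ?_
    · gcongr; linarith
    · rw [mul_assoc _ (1 + M)]
      refine mul_le_mul_of_nonneg_left ?_ (by positivity)
      rw [hR]; nlinarith
  refine (Finset.sum_le_sum fun k _ => key k).trans (le_of_eq ?_)
  simp only [Finset.sum_const, Finset.card_univ, Fintype.card_fin, nsmul_eq_mul, KM]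
  ring

omit h in
/-- smoothing constant -/
def KZ (p : Fin n → Fin n → ℝ) (M : ℝ) : ℝ := KG p M * (KD M * (n * M) + KM n M)

omit h in
lemma KG_nonneg (p : Fin n → Fin n → ℝ) {M : ℝ} (hM : 1 ≤ M) : 0 ≤ KG p M := by
  unfold KG
  refine Finset.sum_nonneg fun i _ => ?_
  have h1 := KD_pos hM; have h2 := pb_nonneg p
  have h3 : 0 ≤ pb p * KD M := by positivity
  clear * - h3
  induction i with
  | zero => simp [Kpow]
  | succ i ih => simp only [Kpow]; positivity

omit h in
lemma KZ_nonneg (p : Fin n → Fin n → ℝ) {M : ℝ} (hM : 1 ≤ M) : 0 ≤ KZ p M := by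
  have := KD_pos hM; have := KM_nonneg n hM; have := KG_nonneg p hM
  unfold KZ; positivity

/-- `T y` is smooth for solutions `y` -/
lemma sm_T {y yt g : E n} (hy : Sol cf m p y g) (hyt : Dt y yt) :
    ∃ v, Dt (Top h p y) v ∧ ‖v‖ ≤ KZ p M * (‖y‖ + ‖g‖) := by
  have hM := h.M1
  obtain ⟨v, hv, hb⟩ := sm_D h p hy hyt
  obtain ⟨w, hw, hb'⟩ := (Gop_tame h p).d _ _ hv
  have hKG := KG_nonneg p hM
  refine ⟨w, hw, hb'.trans ?_⟩
  have h1 := (Dop_tame h).b (Mop h y)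
  have h2 := (Mop_tame h).b y
  have h3 := KD_pos hM
  unfold KZ
  rw [mul_assoc]
  gcongr
  have hg : 0 ≤ ‖g‖ := norm_nonneg _
  have : ‖Dop h (Mop h y)‖ ≤ KD M * (n * M) * (‖y‖ + ‖g‖) := by
    refine h1.trans ?_
    rw [mul_assoc]
    gcongr
    refine h2.trans ?_
    gcongr; linarith
  rw [add_mul]; linarith

omit h in
/-- smoothing constant for `T²` -/
def K2 (p : Fin n → Fin n → ℝ) (M : ℝ) : ℝ := KZ p M * (KT p M + n * M)

omit h in
lemma KS_nonneg (p : Fin n → Fin n → ℝ) {M : ℝ} (hM : 1 ≤ M) : 0 ≤ KS p M := by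
  have := KD_pos hM; have := KG_nonneg p hM
  unfold KS; positivity

omit h in
lemma KT_nonneg (p : Fin n → Fin n → ℝ) {M : ℝ} (hM : 1 ≤ M) : 0 ≤ KT p M := by
  have := KS_nonneg p hM
  unfold KT; positivity

omit h in
lemma K2_nonneg (p : Fin n → Fin n → ℝ) {M : ℝ} (hM : 1 ≤ M) : 0 ≤ K2 p M := by
  have := KZ_nonneg p hM; have := KT_nonneg p hM
  unfold K2; positivity

lemma sm_T2 (hp : H3cond n p) {u ut : E n} (hu : Dt u ut) :
    ∃ v, Dt (Top h p (Top h p u)) v ∧ ‖v‖ ≤ K2 p M * ‖u‖ := by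
  have hM := h.M1
  obtain ⟨w, hw, -⟩ := (Top_tame h p).d _ _ hu
  have hs : Sol cf m p (Top h p u) (Mop h u) := (sol_iff h p hp).2 rfl
  obtain ⟨v, hv, hb⟩ := sm_T h p hs hw
  refine ⟨v, hv, hb.trans ?_⟩
  have := KZ_nonneg p hM
  unfold K2; rw [mul_assoc]; gcongr
  rw [add_mul]
  exact add_le_add ((Top_tame h p).b u) ((Mop_tame h).b u)

/-- extension by density -/
lemma sm_T2_lim (hp : H3cond n p) {u : E n} {us uts : ℕ → E n} (hu : ∀ i, Dt (us i) (uts i))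
    (hl : Tendsto us atTop (𝓝 u)) :
    ∃ v, Dt (Top h p (Top h p u)) v ∧ ‖v‖ ≤ K2 p M * ‖u‖ := by
  choose v hv hb using fun i => sm_T2 h p hp (hu i)
  have hK := K2_nonneg p h.M1
  have hd : ∀ i j, ‖v i - v j‖ ≤ K2 p M * ‖us i - us j‖ := by
    intro i j
    obtain ⟨w, hw, hwb⟩ := sm_T2 h p hp ((hu i).sub (hu j))
    have e : w = v i - v j := by
      refine hw.unique ?_
      rw [map_sub, map_sub]; exact (hv i).sub (hv j)
    rw [← e]; exact hwb
  have hc : CauchySeq v := by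
    have h0 := hl.cauchySeq
    rw [Metric.cauchySeq_iff] at h0 ⊢
    intro ε hε
    obtain ⟨N, hN⟩ := h0 (ε / (K2 p M + 1)) (by positivity)
    refine ⟨N, fun i hi j hj => ?_⟩
    have := hN i hi j hj
    rw [dist_eq_norm, lt_div_iff₀ (by positivity)] at this
    rw [dist_eq_norm]
    refine (hd i j).trans_lt (lt_of_le_of_lt ?_ this)
    nlinarith [norm_nonneg (us i - us j)]
  obtain ⟨v0, hv0⟩ := cauchySeq_tendsto_of_complete hc
  refine ⟨v0, Dt.lim hv ?_ hv0, ?_⟩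
  · exact (((Top h p).continuous.comp (Top h p).continuous).tendsto u).comp hl
  · exact le_of_tendsto_of_tendsto hv0.norm (hl.norm.const_mul _) (Eventually.of_forall hb)

end ops
end QL
end

section
namespace QL
open scoped Topology
variable {n : ℕ}

section fred
variable {X : Type*} [NormedAddCommGroup X] [NormedSpace ℝ X]

lemma riesz_seq {S : Module.End ℝ X} (hS_not_surj : ¬ Function.Surjective S)
    (hS_anti : Topology.IsClosedEmbedding S) :
    ∃ f : ℕ → X,
      (∀ n, ‖f n‖ ≤ 3) ∧ (∀ n, f n ∈ LinearMap.range (S ^ n)) ∧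
      (∀ n, ∀ y ∈ LinearMap.range (S ^ (n + 1)), 1 ≤ ‖f n - y‖) := by
  let V (n : ℕ) : Submodule ℝ X := S.iterateRange n
  have hV_succ (n : ℕ) : V (n + 1) = (V n).map (S : Module.End ℝ X) := LinearMap.iterateRange_succ
  have hV_closed (n : ℕ) : IsClosed (V n : Set X) := by
    induction n with
    | zero => simp [V, Module.End.one_eq_id]
    | succ n ih =>
      rw [hV_succ]
      apply hS_anti.isClosedMap _ ih
  have x (n : ℕ) : ∃ x ∈ V n, ‖x‖ ≤ 3 ∧ ∀ y ∈ V (n + 1), 1 ≤ ‖x - y‖ := by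
    have h₁ : IsClosed ((V (n + 1)).comap (V n).subtype : Set (V n)) := by
      simpa using! (hV_closed (n + 1)).preimage_val
    have h₂ : ∃ x : V n, x ∉ (V (n + 1)).comap (V n).subtype := by
      rw [Function.Surjective] at hS_not_surj
      push Not at hS_not_surj
      obtain ⟨z, hz⟩ := hS_not_surj
      refine ⟨⟨(S ^ n) z, ⟨z, rfl⟩⟩, ?_⟩
      rintro ⟨w, hw⟩
      refine hz w (Module.End.iterate_injective hS_anti.injective n ?_)
      have hw' : (S ^ (n + 1)) w = (S ^ n) z := hw
      rw [← hw', pow_succ]; rfl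
    obtain ⟨⟨x, hx⟩, hxn, hxy⟩ := riesz_lemma_of_norm_lt (c := (2:ℝ)) (by norm_num)
      (R := 3) (by norm_num) h₁ h₂
    simp only [Submodule.mem_comap, Submodule.subtype_apply, Subtype.forall] at hxn hxy
    exact ⟨x, hx, hxn,
      fun y hy ↦ hxy y (S.iterateRange.monotone (by simp) hy) hy⟩
  choose x hxv hxn hxy using x
  exact ⟨x, hxn, hxv, hxy⟩

/-- Fredholm alternative for an operator whose square is compact -/
theorem fredholm [CompleteSpace X] (T : X →L[ℝ] X) {c : ℝ} (hc : 0 < c)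
    (hb : ∀ x, c * ‖x‖ ≤ ‖x - T x‖)
    (hcpt : ∀ f : ℕ → X, (∀ i, ‖f i‖ ≤ 3) → ∃ ψ : ℕ → ℕ, StrictMono ψ ∧
      CauchySeq fun i => T (T (f (ψ i)))) :
    ∀ z, ∃ x, x - T x = z := by
  set S : X →L[ℝ] X := 1 - T with hS
  have hSa : ∀ x, S x = x - T x := fun x => rfl
  by_contra! hns
  have hns' : ¬ Function.Surjective (S : Module.End ℝ X) := by
    intro h
    obtain ⟨z, hz⟩ := hns
    obtain ⟨x, hx⟩ := h z
    exact hz x hx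
  have hanti : AntilipschitzWith (Real.toNNReal (1 / c)) S := by
    refine AddMonoidHomClass.antilipschitz_of_bound S fun x => ?_
    rw [Real.coe_toNNReal _ (by positivity), hSa]
    have := hb x
    rw [one_div, ← div_eq_inv_mul, le_div_iff₀ hc]; linarith
  obtain ⟨f, hf3, hfm, hff⟩ := riesz_seq hns' (hanti.isClosedEmbedding S.uniformContinuous)
  obtain ⟨ψ, hψ, hC⟩ := hcpt f hf3
  have mono : ∀ {a b : ℕ}, a ≤ b → ∀ v ∈ LinearMap.range ((S : Module.End ℝ X) ^ b),
      v ∈ LinearMap.range ((S : Module.End ℝ X) ^ a) := fun hab v hv =>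
    (S : Module.End ℝ X).iterateRange.monotone (by exact hab) hv
  have hSm : ∀ a v, v ∈ LinearMap.range ((S : Module.End ℝ X) ^ a) →
      S v ∈ LinearMap.range ((S : Module.End ℝ X) ^ (a + 1)) := by
    intro a v hv
    rw [Module.End.iterate_succ', LinearMap.range_comp]
    exact ⟨v, hv, rfl⟩
  have hTm : ∀ a v, v ∈ LinearMap.range ((S : Module.End ℝ X) ^ a) →
      T v ∈ LinearMap.range ((S : Module.End ℝ X) ^ a) := by
    intro a v hv
    have : T v = v - S v := by rw [hSa]; abel
    rw [this]
    exact Submodule.sub_mem _ hv (mono (Nat.le_succ a) _ (hSm a v hv))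
  have sep : ∀ a b, a < b → 1 ≤ ‖T (T (f a)) - T (T (f b))‖ := by
    intro a b hab
    have e : T (T (f a)) - T (T (f b)) = f a - (S (f a + T (f a)) + T (T (f b))) := by
      rw [hSa, map_add]; abel
    rw [e]
    apply hff
    refine Submodule.add_mem _ (hSm a _ (Submodule.add_mem _ (hfm a) (hTm a _ (hfm a)))) ?_
    exact mono hab _ (hTm b _ (hTm b _ (hfm b)))
  rw [Metric.cauchySeq_iff'] at hC
  obtain ⟨N, hN⟩ := hC 1 one_pos
  have h1 := hN (N + 1) (by simp)
  rw [dist_comm, dist_eq_norm] at h1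
  exact absurd (sep _ _ (hψ (Nat.lt_succ_self N))) (not_le.2 h1)

end fred

end QL
end

section
namespace QL
open scoped Topology
variable {n : ℕ}

/-! periodic functions -/
def Per (T : ℝ) (u : E n) : Prop := ∀ j x t, cp u j x (t + T) = cp u j x t

structure Cf.Per (cf : Cf n) (T : ℝ) : Prop where
  q : ∀ j x t, cf.q j x (t + T) = cf.q j x t
  d : ∀ j x t, cf.d j x (t + T) = cf.d j x t
  c : ∀ j k x t, cf.c j k x (t + T) = cf.c j k x t

def XP (n : ℕ) (T : ℝ) : Submodule ℝ (E n) where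
  carrier := {u | Clamped u ∧ QL.Per T u}
  add_mem' := by
    rintro u v ⟨a, b⟩ ⟨c, d⟩
    exact ⟨fun j x t => by simp [a j x t, c j x t], fun j x t => by simp [b j x t, d j x t]⟩
  zero_mem' := ⟨fun j x t => by simp, fun j x t => by simp⟩
  smul_mem' := by
    rintro r u ⟨a, b⟩
    exact ⟨fun j x t => by simp [a j x t], fun j x t => by simp [b j x t]⟩

lemma mem_XP {T : ℝ} {u : E n} : u ∈ XP n T ↔ Clamped u ∧ Per T u := Iff.rfl

lemma cp_continuous (j : Fin n) (x t : ℝ) : Continuous fun u : E n => cp u j x t :=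
  (continuous_apply (j, x, t)).comp BoundedContinuousFunction.continuous_coe

lemma XP_closed (T : ℝ) : IsClosed (XP n T : Set (E n)) := by
  have : (XP n T : Set (E n)) = (⋂ j, ⋂ x, ⋂ t, {u : E n | cp u j (cl x) t = cp u j x t}) ∩
      (⋂ j, ⋂ x, ⋂ t, {u : E n | cp u j x (t + T) = cp u j x t}) := by
    ext u; simp [mem_XP, Clamped, Per]
  rw [this]
  refine IsClosed.inter ?_ ?_
  all_goals
    refine isClosed_iInter fun j => isClosed_iInter fun x => isClosed_iInter fun t => ?_
    exact isClosed_eq (cp_continuous _ _ _) (cp_continuous _ _ _)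

section
variable {cf : Cf n} {m : ℕ} {M : ℝ} (h : cf.OK m M) (p : Fin n → Fin n → ℝ) {T : ℝ}

include h in
lemma Dop_per (hc : cf.Per T) {u : E n} (hu : Per T u) : Per T (Dop h u) := by
  intro j x t
  simp only [cp_Dop, Dr, W_per (h.qok j) (hc.q j) (hc.d j), om_per (h.qok j) (hc.q j), hu j]

lemma Cop_per (hc : cf.Per T) {u : E n} (hu : Per T u) : Per T (Cop h p u) := by
  intro j x t
  simp only [cp_Cop, Cr, W_per (h.qok j) (hc.q j) (hc.d j), om_per (h.qok j) (hc.q j), hu _]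

lemma Mop_per (hc : cf.Per T) {u : E n} (hu : Per T u) : Per T (Mop h u) := by
  intro j x t
  simp only [cp_Mop, Mr, hc.c, hu _]

lemma Sop_per (hc : cf.Per T) {u : E n} (hu : Per T u) : Per T (Sop h p u) := by
  have hk : ∀ i, Per T ((Cop h p ^ i) (Dop h u)) := by
    intro i
    induction i with
    | zero => exact Dop_per h hc hu
    | succ i ih => rw [pow_succ']; exact Cop_per h p hc ih
  have : Sop h p u = ∑ i ∈ Finset.range n, (Cop h p ^ i) (Dop h u) := by
    simp [Sop]
  rw [this]
  generalize Finset.range n = s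
  induction s using Finset.induction_on with
  | empty => intro j x t; simp
  | insert a s ha ih => rw [Finset.sum_insert ha]; intro j x t; rw [cp_add, cp_add, hk a j x t, ih j x t]

lemma Sop_XP (hp : H3cond n p) (hc : cf.Per T) {u : E n} (hu : Per T u) : Sop h p u ∈ XP n T :=
  ⟨((sol_iff h p hp).2 rfl).clp, Sop_per h p hc hu⟩

lemma Top_XP (hp : H3cond n p) (hc : cf.Per T) {u : E n} (hu : Per T u) : Top h p u ∈ XP n T :=
  Sop_XP h p hp hc (Mop_per h hc hu)

include h in
lemma Sol.lip_x {p : Fin n → Fin n → ℝ} {y g yt : E n}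
    (hy : Sol cf m p y g) (hyt : Dt y yt) (j : Fin n) (x x' t : ℝ) :
    |cp y j x t - cp y j x' t| ≤ (‖g‖ + M * ‖y‖ + M * ‖yt‖) * |x - x'| := by
  have hM : (0:ℝ) ≤ M := zero_le_one.trans h.M1
  have hb : ∀ s ∈ Icc (0:ℝ) 1, ‖cp g j s t - cf.d j s t * cp y j s t - cf.q j s t * cp yt j s t‖
      ≤ ‖g‖ + M * ‖y‖ + M * ‖yt‖ := by
    intro s _
    refine (norm_sub_le _ _).trans (add_le_add ((norm_sub_le _ _).trans (add_le_add (cp_le _ _ _ _) ?_)) ?_)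
    · rw [norm_mul]; exact mul_le_mul (h.bd _ _ _) (cp_le _ _ _ _) (norm_nonneg _) hM
    · rw [norm_mul]; exact mul_le_mul (h.bq _ _ _) (cp_le _ _ _ _) (norm_nonneg _) hM
  have := Convex.norm_image_sub_le_of_norm_hasDerivWithin_le (f := fun s => cp y j s t)
    (fun s hs => (Sol.xt h hy hyt j).dx s hs t) hb (convex_Icc _ _) (cl_mem x') (cl_mem x)
  rw [hy.clp, hy.clp] at this
  refine this.trans ?_
  have := cl_lip x x'
  have : 0 ≤ ‖g‖ + M * ‖y‖ + M * ‖yt‖ := by positivity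
  gcongr; assumption

lemma Dt.lip_t {y yt : E n} (hyt : Dt y yt) (j : Fin n) (x s t : ℝ) :
    |cp y j x s - cp y j x t| ≤ ‖yt‖ * |s - t| :=
  TD.lip (hyt.td j) (cp_le yt j) x s t
end

/-! uniform continuity and Steklov averages -/
lemma XP_uc {T : ℝ} (hT : 0 < T) {u : E n} (hu : u ∈ XP n T) {ε : ℝ} (hε : 0 < ε) :
    ∃ η > 0, ∀ j x s t, |s - t| < η → |cp u j x s - cp u j x t| < ε := by
  have hj : ∀ j, ∃ η > 0, ∀ x s t, |s - t| < η → |cp u j x s - cp u j x t| < ε := by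
    intro j
    have huc := (isCompact_Icc (a := (0:ℝ)) (b := 1)).prod (isCompact_Icc (a := (-1:ℝ)) (b := T + 1))
      |>.uniformContinuousOn_of_continuous (cp_cc u j).continuousOn
    rw [Metric.uniformContinuousOn_iff] at huc
    obtain ⟨η, h0, hη⟩ := huc ε hε
    refine ⟨min η 1, by positivity, fun x s t hst => ?_⟩
    have hper : Function.Periodic (fun τ => (cp u j x (τ + (s - t)), cp u j x τ)) T := by
      intro τ
      simp only [hu.2 j x τ, Prod.mk.injEq, and_true]
      rw [← hu.2 j x (τ + (s - t))]; ring_nf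
    obtain ⟨τ, hτ, hτe⟩ := hper.exists_mem_Ico₀ hT t
    simp only [Prod.mk.injEq, add_sub_cancel] at hτe
    rw [hτe.1, hτe.2, ← hu.1 j x, ← hu.1 j x]
    have a1 := lt_min_iff.1 hst
    have a2 := abs_lt.1 a1.2
    have := hη (cl x, τ + (s - t)) ⟨cl_mem x, by constructor <;> linarith [hτ.1, hτ.2]⟩
      (cl x, τ) ⟨cl_mem x, by constructor <;> linarith [hτ.1, hτ.2]⟩ (by
        rw [Prod.dist_eq]; simp [a1.1])
    simpa [Real.dist_eq] using this
  choose η h0 hη using hj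
  rcases isEmpty_or_nonempty (Fin n) with hn | hn
  · exact ⟨1, one_pos, fun j => isEmptyElim j⟩
  · refine ⟨Finset.univ.inf' Finset.univ_nonempty η, ?_, fun j x s t hst => ?_⟩
    · rw [gt_iff_lt, Finset.lt_inf'_iff]; exact fun j _ => h0 j
    · exact hη j x s t (hst.trans_le (Finset.inf'_le _ (Finset.mem_univ j)))

/-- Steklov average -/
def stk (u : E n) (a : ℝ) (j : Fin n) (x t : ℝ) : ℝ := ∫ θ in (0:ℝ)..1, cp u j x (t + θ * a)
lemma stk_cc (u : E n) (a : ℝ) (j : Fin n) : CC (stk u a j) :=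
  continuous_paramInt (f := fun (z : ℝ × ℝ) θ => cp u j z.1 (z.2 + θ * a))
    ((cp_cc u j).comp (by fun_prop) (by fun_prop)) continuous_const continuous_const
lemma stk_le (u : E n) (a : ℝ) (j : Fin n) (x t : ℝ) : |stk u a j x t| ≤ ‖u‖ := by
  have := intervalIntegral.norm_integral_le_of_norm_le_const (a := 0) (b := 1)
    (f := fun θ => cp u j x (t + θ * a)) (C := ‖u‖) (fun θ _ => cp_le u j _ _)
  simpa [stk] using this

lemma steklov {T : ℝ} (hT : 0 < T) {u : E n} (hu : u ∈ XP n T) :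
    ∃ us uts : ℕ → E n, (∀ i, us i ∈ XP n T ∧ Dt (us i) (uts i)) ∧ Tendsto us atTop (𝓝 u) := by
  set a : ℕ → ℝ := fun i => 1 / ((i : ℝ) + 1) with ha
  have ha0 : ∀ i, 0 < a i := fun i => by simp only [ha]; positivity
  have hsc : ∀ i j, CC fun x t => (cp u j x (t + a i) - cp u j x t) / a i := fun i j =>
    Continuous.div_const (((cp_cc u j).comp (by fun_prop) (by fun_prop)).sub (cp_cc u j)) _
  have hsb : ∀ i j x t, |(cp u j x (t + a i) - cp u j x t) / a i| ≤ 2 * ‖u‖ / a i := by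
    intro i j x t
    rw [abs_div, abs_of_pos (ha0 i)]
    have := ha0 i
    gcongr
    have h1 := cp_le u j x (t + a i)
    have h2 := cp_le u j x t
    rw [abs_le] at *; constructor <;> linarith
  refine ⟨fun i => mkE (stk u (a i)) (stk_cc u _) _ (stk_le u _), fun i => mkE _ (hsc i) _ (hsb i),
    fun i => ⟨⟨?_, ?_⟩, ?_⟩, ?_⟩
  · intro j x t; simp only [cp_mkE, stk, hu.1 j]
  · intro j x t; simp only [cp_mkE, stk]
    congr 1; funext θ
    rw [← hu.2 j x (t + θ * a i)]; ring_nf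
  · intro j x t
    simp only [cp_mkE']
    have e : stk u (a i) j x = fun t => (a i)⁻¹ * ((∫ s in (0:ℝ)..(t + a i), cp u j x s)
        - ∫ s in (0:ℝ)..t, cp u j x s) := by
      funext t
      have hc : Continuous (cp u j x) := (cp_cc u j).comp continuous_const continuous_id
      rw [intervalIntegral.integral_interval_sub_left (hc.intervalIntegrable _ _)
        (hc.intervalIntegrable _ _), stk]
      have := intervalIntegral.integral_comp_add_mul (cp u j x) (ha0 i).ne' t (a := 0) (b := 1)
      simp only [smul_eq_mul, mul_zero, add_zero, mul_one] at this
      rw [← this]; congr 1; funext θ; rw [mul_comm]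
    rw [e]
    have hc : Continuous (cp u j x) := (cp_cc u j).comp continuous_const continuous_id
    have hd : ∀ t, HasDerivAt (fun t => ∫ s in (0:ℝ)..t, cp u j x s) (cp u j x t) t := fun t =>
      intervalIntegral.integral_hasDerivAt_right (hc.intervalIntegrable _ _)
        (hc.stronglyMeasurableAtFilter _ _) hc.continuousAt
    have h1 : HasDerivAt (fun t => ∫ s in (0:ℝ)..(t + a i), cp u j x s) (cp u j x (t + a i)) t :=
      HasDerivAt.comp_add_const t (a i) (hd (t + a i))
    have := (h1.sub (hd t)).const_mul (a i)⁻¹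
    refine this.congr_deriv ?_
    rw [div_eq_inv_mul]
  · rw [Metric.tendsto_atTop]
    intro ε hε
    obtain ⟨η, h0, hη⟩ := XP_uc hT hu (half_pos hε)
    obtain ⟨N, hN⟩ := exists_nat_one_div_lt h0
    refine ⟨N, fun i hi => ?_⟩
    rw [dist_eq_norm]
    refine lt_of_le_of_lt (E_norm_le (half_pos hε).le fun j x t => ?_) (half_lt_self hε)
    rw [cp_sub, cp_mkE]
    have hai : a i < η := lt_of_le_of_lt (one_div_le_one_div_of_le (by positivity)
      (by have : (N:ℝ) ≤ i := by exact_mod_cast hi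
          linarith)) hN
    have hc : Continuous (fun θ => cp u j x (t + θ * a i)) :=
      (cp_cc u j).comp (by fun_prop) (by fun_prop)
    have e : stk u (a i) j x t - cp u j x t
        = ∫ θ in (0:ℝ)..1, (cp u j x (t + θ * a i) - cp u j x t) := by
      rw [intervalIntegral.integral_sub (hc.intervalIntegrable _ _) (by simp)]
      simp [stk]
    rw [e]
    have := intervalIntegral.norm_integral_le_of_norm_le_const (a := 0) (b := 1)
      (f := fun θ => cp u j x (t + θ * a i) - cp u j x t) (C := ε / 2) (fun θ hθ => ?_)
    · simpa using this
    · rw [uIoc_of_le zero_le_one] at hθ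
      refine (hη j x _ _ ?_).le
      rw [add_sub_cancel_left, abs_of_pos (mul_pos hθ.1 (ha0 i))]
      have := ha0 i
      nlinarith [hθ.2]

section
variable {cf : Cf n} {m : ℕ} {M : ℝ} (h : cf.OK m M) (p : Fin n → Fin n → ℝ) {T : ℝ}

abbrev KK (n : ℕ) (T : ℝ) := Fin n × Icc (0:ℝ) 1 × Icc (0:ℝ) T

def resK (T : ℝ) (u : E n) : BoundedContinuousFunction (KK n T) ℝ :=
  BoundedContinuousFunction.mkOfCompact ⟨fun z => u (z.1, z.2.1, z.2.2), by fun_prop⟩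

lemma resK_apply (T : ℝ) (u : E n) (z : KK n T) : resK T u z = cp u z.1 z.2.1 z.2.2 := rfl

lemma resK_norm (hT : 0 < T) {u : E n} (hu : u ∈ XP n T) : ‖u‖ ≤ ‖resK T u‖ := by
  refine E_norm_le (norm_nonneg _) fun j x t => ?_
  have hper : Function.Periodic (cp u j x) T := fun t => hu.2 j x t
  obtain ⟨τ, hτ, hτe⟩ := hper.exists_mem_Ico₀ hT t
  rw [hτe, ← hu.1]
  exact (resK T u).norm_coe_le_norm (j, ⟨cl x, cl_mem x⟩, ⟨τ, hτ.1, hτ.2.le⟩)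

lemma resK_sub (u v : E n) : resK T (u - v) = resK T u - resK T v := rfl

/-- equi-Lipschitz bounded sequences in `XP` have Cauchy subsequences -/
lemma XP_compact (hT : 0 < T) {v : ℕ → E n} (hv : ∀ i, v i ∈ XP n T) {C L : ℝ}
    (hC : ∀ i, ‖v i‖ ≤ C) (hL : ∀ i j x t x' t', |cp (v i) j x t - cp (v i) j x' t'|
      ≤ L * |x - x'| + L * |t - t'|) :
    ∃ ψ : ℕ → ℕ, StrictMono ψ ∧ CauchySeq fun i => v (ψ i) := by
  have hcp : IsCompact (closure (range fun i => resK T (v i))) := by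
    refine BoundedContinuousFunction.arzela_ascoli (Icc (-C) C) isCompact_Icc _ ?_ ?_
    · rintro f z ⟨i, rfl⟩
      exact abs_le.1 ((cp_le (v i) _ _ _).trans (hC i))
    · intro z
      rw [Metric.equicontinuousAt_iff_right]
      intro ε hε
      have hc : Tendsto (fun w : KK n T => L * |(w.2.1 : ℝ) - z.2.1| + L * |(w.2.2 : ℝ) - z.2.2|)
          (𝓝 z) (𝓝 0) := by
        have : Continuous (fun w : KK n T => L * |(w.2.1 : ℝ) - z.2.1| + L * |(w.2.2 : ℝ) - z.2.2|) := by
          fun_prop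
        have := this.tendsto z
        simpa using this
      have hj : ∀ᶠ w : KK n T in 𝓝 z, w.1 = z.1 :=
        (continuous_fst.tendsto z).eventually (eventually_of_mem ((isOpen_discrete {z.1}).mem_nhds rfl) fun _ h => h)
      filter_upwards [hc.eventually (gt_mem_nhds hε), hj] with w hw hwj
      rintro ⟨f, i, rfl⟩
      rw [dist_comm, Real.dist_eq]
      simp only [resK_apply, hwj]
      exact (hL i _ _ _ _ _).trans_lt hw
  obtain ⟨a, -, ψ, hψ, hl⟩ := hcp.tendsto_subseq
    (x := fun i => resK T (v i)) (fun i => subset_closure ⟨i, rfl⟩)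
  refine ⟨ψ, hψ, ?_⟩
  have := hl.cauchySeq
  rw [Metric.cauchySeq_iff] at this ⊢
  intro ε hε
  obtain ⟨N, hN⟩ := this ε hε
  refine ⟨N, fun i hi j hj => lt_of_le_of_lt ?_ (hN i hi j hj)⟩
  rw [dist_eq_norm, dist_eq_norm]
  exact resK_norm hT (Submodule.sub_mem _ (hv _) (hv _))

lemma T2_lip (hp : H3cond n p) (hT : 0 < T) {u : E n} (hu : u ∈ XP n T) :
    (∃ v, Dt (Top h p (Top h p u)) v ∧ ‖v‖ ≤ K2 p M * ‖u‖) := by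
  obtain ⟨us, uts, h1, h2⟩ := steklov hT hu
  exact sm_T2_lim h p hp (fun i => (h1 i).2) h2

lemma T2_cpt (hp : H3cond n p) (hT : 0 < T) (hc : cf.Per T) (f : ℕ → E n)
    (hfX : ∀ i, f i ∈ XP n T) (hf : ∀ i, ‖f i‖ ≤ 3) :
    ∃ ψ : ℕ → ℕ, StrictMono ψ ∧ CauchySeq fun i => Top h p (Top h p (f (ψ i))) := by
    have hM := h.M1
    choose v hv hvb using fun i => T2_lip h p hp hT (hfX i)
    have hn := hf
    have hKT := KT_nonneg p hM
    have hK2 := K2_nonneg p hM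
    have e1 : ∀ i, ‖Top h p (f i)‖ ≤ KT p M * 3 := fun i =>
      ((Top_tame h p).b _).trans (by gcongr; exact hn i)
    have e2 : ∀ i, ‖Top h p (Top h p (f i))‖ ≤ KT p M * (KT p M * 3) := fun i =>
      ((Top_tame h p).b _).trans (by gcongr; exact e1 i)
    have e3 : ∀ i, ‖Mop h (Top h p (f i))‖ ≤ n * M * (KT p M * 3) := fun i =>
      ((Mop_tame h).b _).trans (by gcongr; exact e1 i)
    have e4 : ∀ i, ‖v i‖ ≤ K2 p M * 3 := fun i => (hvb i).trans (by gcongr; exact hn i)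
    set L := n * M * (KT p M * 3) + M * (KT p M * (KT p M * 3)) + M * (K2 p M * 3) + K2 p M * 3
    obtain ⟨ψ, h1, h2⟩ := XP_compact hT (v := fun i => Top h p (Top h p (f i)))
      (fun i => Top_XP h p hp hc (Top_XP h p hp hc (hfX i).2).2) (C := KT p M * (KT p M * 3))
      (L := L) e2 (by
        intro i j x t x' t'
        have hS : Sol cf m p (Top h p (Top h p (f i))) (Mop h (Top h p (f i))) :=
          (sol_iff h p hp).2 rfl
        have a1 := Sol.lip_x h hS (hv i) j x x' t
        have a2 := Dt.lip_t (hv i) j x' t t'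
        have b1 : ‖Mop h (Top h p (f i))‖ + M * ‖Top h p (Top h p (f i))‖ + M * ‖v i‖ ≤ L := by
          have := e2 i; have := e3 i; have := e4 i
          have : 0 ≤ K2 p M * 3 := by positivity
          have : M * ‖Top h p (Top h p (f i))‖ ≤ M * (KT p M * (KT p M * 3)) := by gcongr
          have : M * ‖v i‖ ≤ M * (K2 p M * 3) := by gcongr
          simp only [L]; linarith
        have b2 : ‖v i‖ ≤ L := by
          have : 0 ≤ n * M * (KT p M * 3) + M * (KT p M * (KT p M * 3)) + M * (K2 p M * 3) := by
            positivity
          have := e4 i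
          simp only [L]; linarith
        have tri := abs_sub_le (cp (Top h p (Top h p (f i))) j x t)
          (cp (Top h p (Top h p (f i))) j x' t) (cp (Top h p (Top h p (f i))) j x' t')
        refine tri.trans (add_le_add (a1.trans ?_) (a2.trans ?_)) <;> gcongr)
    exact ⟨ψ, h1, h2⟩

/-- linear solvability in the periodic class -/
theorem per_solve (hp : H3cond n p) (hT : 0 < T) (hc : cf.Per T) {κ : ℝ} (hκ : 0 < κ)
    (hb : ∀ u ut : E n, u ∈ XP n T → Dt u ut → κ * ‖u‖ ≤ ‖u - Top h p u‖) :
    ∀ z ∈ XP n T, ∃ u ∈ XP n T, u - Top h p u = z := by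
  have hM := h.M1
  have hb' : ∀ u ∈ XP n T, κ * ‖u‖ ≤ ‖u - Top h p u‖ := by
    intro u hu
    obtain ⟨us, uts, h1, h2⟩ := steklov hT hu
    refine le_of_tendsto_of_tendsto (h2.norm.const_mul κ)
      ((h2.sub (((Top h p).continuous.tendsto u).comp h2)).norm)
      (Eventually.of_forall fun i => hb _ _ (h1 i).1 (h1 i).2)
  have : CompleteSpace (XP n T) := (XP_closed T).completeSpace_coe
  obtain ⟨TX, hTX⟩ : ∃ TX : XP n T →L[ℝ] XP n T, ∀ u, ((TX u : XP n T) : E n) = Top h p u :=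
    ⟨((Top h p).comp (XP n T).subtypeL).codRestrict (XP n T)
      (fun u => Top_XP h p hp hc u.2.2), fun u => rfl⟩
  have := fredholm (X := XP n T) TX hκ (fun u => ?_) ?_
  · intro z hz
    obtain ⟨u, hu⟩ := this ⟨z, hz⟩
    refine ⟨u, u.2, ?_⟩
    have := congrArg Subtype.val hu
    rw [Submodule.coe_sub, hTX] at this
    exact this
  · have := hb' u u.2
    rw [← hTX, ← Submodule.coe_sub] at this
    exact this
  · intro f hf
    obtain ⟨ψ, h1, h2⟩ := T2_cpt h p hp hT hc (fun i => (f i : E n)) (fun i => (f i).2) hf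
    refine ⟨ψ, h1, ?_⟩
    rw [Metric.cauchySeq_iff] at h2 ⊢
    intro ε hε
    obtain ⟨N, hN⟩ := h2 ε hε
    refine ⟨N, fun a ha b hb => ?_⟩
    have := hN a ha b hb
    rw [Subtype.dist_eq, hTX, hTX, hTX, hTX]
    exact this
end

end QL
end

section
namespace QL
open scoped Topology
variable {n : ℕ}

lemma gronwall_lin {e e' : ℝ → ℝ} {ν b s t : ℝ} (hst : s ≤ t) (hν : 0 ≤ ν) (hb : 0 ≤ b)
    (hd : ∀ τ, HasDerivAt e (e' τ) τ) (hle : ∀ τ ∈ Icc s t, e' τ ≤ ν * e τ + b) :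
    e t ≤ Real.exp (ν * (t - s)) * (e s + b * (t - s)) := by
  set F : ℝ → ℝ := fun τ => Real.exp (-(ν * (τ - s))) * e τ - b * (τ - s) with hF
  have hFd : ∀ τ, HasDerivAt F (Real.exp (-(ν * (τ - s))) * (e' τ - ν * e τ) - b) τ := by
    intro τ
    have h1 : HasDerivAt (fun τ => -(ν * (τ - s))) (-ν) τ := by
      exact ((((hasDerivAt_id τ).sub_const s).const_mul ν).fun_neg).congr_deriv (by simp)
    have h2 := (h1.exp.mul (hd τ)).sub (((hasDerivAt_id τ).sub_const s).const_mul b)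
    exact h2.congr_deriv (by ring)
  have hanti : AntitoneOn F (Icc s t) := by
    refine antitoneOn_of_deriv_nonpos (convex_Icc s t) (fun τ _ => (hFd τ).continuousAt.continuousWithinAt)
      (fun τ _ => (hFd τ).differentiableAt.differentiableWithinAt) fun τ hτ => ?_
    rw [interior_Icc] at hτ
    rw [(hFd τ).deriv]
    have h1 := hle τ ⟨hτ.1.le, hτ.2.le⟩
    have h2 : Real.exp (-(ν * (τ - s))) ≤ 1 := by
      rw [Real.exp_le_one_iff]; nlinarith [hτ.1]
    have h3 := Real.exp_pos (-(ν * (τ - s)))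
    have : Real.exp (-(ν * (τ - s))) * (e' τ - ν * e τ) ≤ Real.exp (-(ν * (τ - s))) * b := by
      gcongr; linarith
    nlinarith
  have := hanti (left_mem_Icc.2 hst) (right_mem_Icc.2 hst) hst
  simp only [hF, sub_self, mul_zero, neg_zero, Real.exp_zero, one_mul, sub_zero] at this
  have h4 : Real.exp (ν * (t - s)) * Real.exp (-(ν * (t - s))) = 1 := by
    rw [← Real.exp_add]; simp
  calc e t = Real.exp (ν * (t - s)) * (Real.exp (-(ν * (t - s))) * e t) := by
        rw [← mul_assoc, h4, one_mul]
    _ ≤ _ := by gcongr; linarith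

def Pq (p : Fin n → Fin n → ℝ) : ℝ := ∑ j, ∑ k, p j k ^ 2
lemma Pq_nonneg (p : Fin n → Fin n → ℝ) : 0 ≤ Pq p :=
  Finset.sum_nonneg fun _ _ => Finset.sum_nonneg fun _ _ => sq_nonneg _

def Hw (p : Fin n → Fin n → ℝ) (m : ℕ) (j : Fin n) (x : ℝ) : ℝ := 1 + Pq p * (xs m j + sg m j * x)

lemma sg_sq (m : ℕ) (j : Fin n) : sg m j * sg m j = 1 := by unfold sg; split_ifs <;> norm_num
lemma sg_abs (m : ℕ) (j : Fin n) : |sg m j| = 1 := by unfold sg; split_ifs <;> norm_num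

lemma Hw_bd (p : Fin n → Fin n → ℝ) (m : ℕ) (j : Fin n) {x : ℝ} (hx : x ∈ Icc (0:ℝ) 1) :
    1 ≤ Hw p m j x ∧ Hw p m j x ≤ 1 + Pq p := by
  have := Pq_nonneg p
  unfold Hw xs sg
  split_ifs <;> constructor <;> nlinarith [hx.1, hx.2]

def KE (p : Fin n → Fin n → ℝ) (M : ℝ) : ℝ := M * (1 + Pq p) * (M + n)
def νE (p : Fin n → Fin n → ℝ) (M : ℝ) : ℝ := (1 + Pq p) * (4 * M + 2 * M * n + 1) * M

def Isq (w : Fin n → ℝ → ℝ → ℝ) (t : ℝ) : ℝ := ∫ x in (0:ℝ)..1, ∑ j, w j x t ^ 2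

section
variable {cf : Cf n} {m : ℕ} {M : ℝ} (h : cf.OK m M) (p : Fin n → Fin n → ℝ)

lemma bdry_term {p : Fin n → Fin n → ℝ} {m : ℕ} (w0 w1 : Fin n → ℝ) (z wi : Fin n → ℝ)
    (hz : ∀ j, z j = if (j : ℕ) < m then w1 j else w0 j)
    (hwi : ∀ j, wi j = if (j : ℕ) < m then w0 j else w1 j)
    (hbc : ∀ j, wi j = ∑ k, p j k * z k) :
    0 ≤ ∑ j, sg m j * (Hw p m j 1 * w1 j ^ 2 - Hw p m j 0 * w0 j ^ 2) := by
  have e : ∀ j, sg m j * (Hw p m j 1 * w1 j ^ 2 - Hw p m j 0 * w0 j ^ 2)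
      = (1 + Pq p) * z j ^ 2 - wi j ^ 2 := by
    intro j
    rw [hz, hwi]; unfold Hw xs sg
    split_ifs <;> ring
  simp only [e]
  rw [Finset.sum_sub_distrib, ← Finset.mul_sum]
  have h1 : ∑ j, wi j ^ 2 ≤ ∑ j, (∑ k, p j k ^ 2) * ∑ k, z k ^ 2 := by
    refine Finset.sum_le_sum fun j _ => ?_
    rw [hbc]
    exact Finset.sum_mul_sq_le_sq_mul_sq _ _ _
  rw [← Finset.sum_mul] at h1
  have : 0 ≤ ∑ k, z k ^ 2 := Finset.sum_nonneg fun _ _ => sq_nonneg _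
  unfold Pq; linarith

lemma pt_ineq {M P : ℝ} (hM : 1 ≤ M) (hP : 0 ≤ P) (H σ qt w g d : Fin n → ℝ) (c : Fin n → Fin n → ℝ)
    (hH : ∀ j, 1 ≤ H j ∧ H j ≤ 1 + P) (hσ : ∀ j, |σ j| = 1) (hqt : ∀ j, |qt j| ≤ M)
    (hd : ∀ j, |d j| ≤ M) (hc : ∀ j k, |c j k| ≤ M) {G : ℝ} (hg : ∀ j, |g j| ≤ G) :
    ∑ j, (H j * σ j * qt j * w j ^ 2 + 2 * H j * σ j * w j * (g j - d j * w j - ∑ k, c j k * w k)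
      + P * w j ^ 2) ≤ (1 + P) * (4 * M + 2 * M * n + 1) * ∑ j, w j ^ 2 + (1 + P) * n * G ^ 2 := by
  have hM0 : 0 ≤ M := by linarith
  have key : ∀ j, (H j * σ j * qt j * w j ^ 2 + 2 * H j * σ j * w j * (g j - d j * w j - ∑ k, c j k * w k)
      + P * w j ^ 2) ≤ (1 + P) * (4 * M + 1) * w j ^ 2 + (1 + P) * G ^ 2
        + 2 * (1 + P) * M * (|w j| * ∑ k, |w k|) := by
    intro j
    have hs : |∑ k, c j k * w k| ≤ M * ∑ k, |w k| := by
      rw [Finset.mul_sum]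
      refine (Finset.abs_sum_le_sum_abs _ _).trans (Finset.sum_le_sum fun k _ => ?_)
      rw [abs_mul]; gcongr; exact hc j k
    set S := ∑ k, |w k|
    have hS : 0 ≤ S := Finset.sum_nonneg fun _ _ => abs_nonneg _
    obtain ⟨h1, h2⟩ := hH j
    have hH0 : 0 ≤ H j := by linarith
    have t1 : H j * σ j * qt j * w j ^ 2 ≤ (1 + P) * M * w j ^ 2 := by
      refine (le_abs_self _).trans ?_
      rw [abs_mul, abs_mul, abs_mul, hσ, abs_of_nonneg hH0, abs_of_nonneg (sq_nonneg (w j)), mul_one]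
      gcongr; exact hqt j
    have t2 : 2 * H j * σ j * w j * (g j - d j * w j - ∑ k, c j k * w k)
        ≤ 2 * (1 + P) * |w j| * (G + M * |w j| + M * S) := by
      refine (le_abs_self _).trans ?_
      rw [abs_mul, abs_mul, abs_mul, abs_mul, hσ, abs_of_nonneg hH0, mul_one, abs_two]
      have : |g j - d j * w j - ∑ k, c j k * w k| ≤ G + M * |w j| + M * S := by
        refine (abs_sub _ _).trans (add_le_add ((abs_sub _ _).trans (add_le_add (hg j) ?_)) hs)
        rw [abs_mul]; gcongr; exact hd j
      have : 0 ≤ G := (abs_nonneg _).trans (hg j)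
      gcongr
    have t3 : 2 * |w j| * G ≤ w j ^ 2 + G ^ 2 := by
      have := sq_nonneg (|w j| - G); rw [← sq_abs (w j)]; nlinarith
    have t4 : P * w j ^ 2 ≤ (1 + P) * M * w j ^ 2 := by
      gcongr; nlinarith
    have t5 : 2 * (1 + P) * |w j| * (G + M * |w j| + M * S) =
      (1 + P) * (2 * |w j| * G) + 2 * (1 + P) * M * w j ^ 2 + 2 * (1 + P) * M * (|w j| * S) := by
      rw [← sq_abs (w j)]; ring
    have t6 : (1 + P) * (2 * |w j| * G) ≤ (1 + P) * (w j ^ 2 + G ^ 2) := by gcongr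
    nlinarith
  refine (Finset.sum_le_sum fun j _ => key j).trans ?_
  rw [Finset.sum_add_distrib, Finset.sum_add_distrib, ← Finset.mul_sum, ← Finset.mul_sum,
    ← Finset.mul_sum, ← Finset.sum_mul]
  have cs : (∑ k, |w k|) * (∑ k, |w k|) ≤ n * ∑ k, w k ^ 2 := by
    have := Finset.sum_mul_sq_le_sq_mul_sq Finset.univ (fun _ : Fin n => (1:ℝ)) (fun k => |w k|)
    simp only [one_mul, one_pow, sq_abs, Finset.sum_const, Finset.card_univ, Fintype.card_fin,
      nsmul_eq_mul, mul_one] at this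
    rw [← sq]; exact this
  simp only [Finset.sum_const, Finset.card_univ, Fintype.card_fin, nsmul_eq_mul]
  have : 2 * (1 + P) * M * ((∑ k, |w k|) * (∑ k, |w k|)) ≤ 2 * (1 + P) * M * (n * ∑ k, w k ^ 2) := by
    gcongr
  nlinarith

lemma TD.sum {f ft : Fin n → ℝ → ℝ → ℝ} (hf : ∀ j, TD (f j) (ft j)) :
    TD (fun x t => ∑ j, f j x t) (fun x t => ∑ j, ft j x t) where
  c := continuous_finsetSum _ fun j _ => (hf j).c
  ct := continuous_finsetSum _ fun j _ => (hf j).ct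
  dt x t := HasDerivAt.fun_sum fun j _ => (hf j).dt x t

lemma Hw_cont (p : Fin n → Fin n → ℝ) (m : ℕ) (j : Fin n) : Continuous (Hw p m j) := by
  unfold Hw; fun_prop

include h in
/-- energy estimate -/
theorem energy {w wx wt : Fin n → ℝ → ℝ → ℝ} (hw : ∀ j, XT (w j) (wx j) (wt j))
    (hbc : ∀ j t, w j (xs m j) t = ∑ k, p j k * w k (1 - xs m k) t) {s t G : ℝ} (hst : s ≤ t)
    (hg : ∀ j, ∀ x ∈ Icc (0:ℝ) 1, ∀ τ ∈ Icc s t, |wx j x τ + cf.q j x τ * wt j x τ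
      + cf.d j x τ * w j x τ + ∑ k, cf.c j k x τ * w k x τ| ≤ G) :
    Isq w t ≤ KE p M * Real.exp (νE p M * (t - s)) * (Isq w s + (t - s) * G ^ 2) := by
  have hM := h.M1
  have hM0 : (0:ℝ) ≤ M := by linarith
  have hP := Pq_nonneg p
  set F : ℝ → ℝ → ℝ := fun x t => ∑ j, Hw p m j x * sg m j * (cf.q j x t * (w j x t * w j x t)) with hF
  set Ft : ℝ → ℝ → ℝ := fun x t => ∑ j, Hw p m j x * sg m j * (cf.qt j x t * (w j x t * w j x t)
    + cf.q j x t * (wt j x t * w j x t + w j x t * wt j x t)) with hFt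
  have hTD : TD F Ft := by
    refine TD.sum fun j => ?_
    have h1 := (h.qXT j).toTD.mul ((hw j).toTD.mul (hw j).toTD)
    have hHc : Continuous fun z : ℝ × ℝ => Hw p m j z.1 * sg m j :=
      ((Hw_cont p m j).comp continuous_fst).mul continuous_const
    exact ⟨hHc.mul h1.c, hHc.mul h1.ct, fun x t => (h1.dt x t).const_mul _⟩
  have sl : ∀ {f : ℝ → ℝ → ℝ}, CC f → ∀ t, Continuous fun x => f x t := fun hf t =>
    hf.comp continuous_id continuous_const
  have hIc : ∀ t, Continuous fun x => ∑ j, w j x t ^ 2 := fun t =>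
    continuous_finsetSum _ fun j _ => (sl (hw j).c t).pow 2
  -- energy comparison
  have hF1 : ∀ t, ∀ x ∈ Icc (0:ℝ) 1, ∑ j, w j x t ^ 2 ≤ M * F x t := by
    intro t x hx
    rw [hF, Finset.mul_sum]
    refine Finset.sum_le_sum fun j _ => ?_
    have h1 := h.sgn j x t
    have h2 := (Hw_bd p m j hx).1
    have h3 : 0 ≤ w j x t ^ 2 := sq_nonneg _
    have h4 : 1 ≤ Hw p m j x * (M * (sg m j * cf.q j x t)) := by nlinarith
    nlinarith
  have hF2 : ∀ t, ∀ x ∈ Icc (0:ℝ) 1, F x t ≤ (1 + Pq p) * M * ∑ j, w j x t ^ 2 := by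
    intro t x hx
    rw [hF, Finset.mul_sum]
    refine Finset.sum_le_sum fun j _ => ?_
    have h2 := Hw_bd p m j hx
    have h3 : 0 ≤ w j x t ^ 2 := sq_nonneg _
    have h5 : sg m j * cf.q j x t ≤ M := (le_abs_self _).trans (by
      rw [abs_mul, sg_abs, one_mul]; exact h.bq j x t)
    have h6 : 0 ≤ sg m j * cf.q j x t := by
      have := h.sgn j x t
      by_contra hc; push Not at hc; nlinarith
    have h4 : Hw p m j x * (sg m j * cf.q j x t) ≤ (1 + Pq p) * M :=
      mul_le_mul h2.2 h5 h6 (by linarith)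
    nlinarith
  have imono : ∀ {f g : ℝ → ℝ}, Continuous f → Continuous g → (∀ x ∈ Icc (0:ℝ) 1, f x ≤ g x) →
      ∫ x in (0:ℝ)..1, f x ≤ ∫ x in (0:ℝ)..1, g x := fun hf hg hfg =>
    intervalIntegral.integral_mono_on zero_le_one (hf.intervalIntegrable _ _)
      (hg.intervalIntegrable _ _) hfg
  set e : ℝ → ℝ := fun t => ∫ x in (0:ℝ)..1, F x t with he
  have hIe : ∀ t, Isq w t ≤ M * e t := by
    intro t
    have := imono (hIc t) (g := fun x => M * F x t) (continuous_const.mul (sl hTD.c t)) (hF1 t)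
    rw [intervalIntegral.integral_const_mul] at this
    exact this
  have heI : ∀ t, e t ≤ (1 + Pq p) * M * Isq w t := by
    intro t
    have := imono (sl hTD.c t) (g := fun x => (1 + Pq p) * M * ∑ j, w j x t ^ 2)
      (continuous_const.mul (hIc t)) (hF2 t)
    rw [intervalIntegral.integral_const_mul] at this
    exact this
  have hle : ∀ τ ∈ Icc s t, (∫ x in (0:ℝ)..1, Ft x τ) ≤ νE p M * e τ + (1 + Pq p) * n * G ^ 2 := by
    intro τ hτ
    set Z : ℝ → ℝ := fun x => ∑ j, sg m j * (Pq p * sg m j * w j x τ ^ 2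
      + Hw p m j x * (2 * w j x τ * wx j x τ)) with hZ
    have hZc : Continuous Z := by
      refine continuous_finsetSum _ fun j _ => continuous_const.mul ?_
      exact (continuous_const.mul ((sl (hw j).c τ).pow 2)).add
        ((Hw_cont p m j).mul ((continuous_const.mul (sl (hw j).c τ)).mul (sl (hw j).cx τ)))
    have hZi : ∫ x in (0:ℝ)..1, Z x = ∑ j, sg m j * (Hw p m j 1 * w j 1 τ ^ 2 - Hw p m j 0 * w j 0 τ ^ 2) := by
      have := ftc_Icc (f := fun x => ∑ j, sg m j * (Hw p m j x * w j x τ ^ 2)) (f' := Z)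
        (fun x hx => by
          refine HasDerivWithinAt.fun_sum fun j _ => ?_
          refine HasDerivWithinAt.const_mul (sg m j) ?_
          have hH : HasDerivWithinAt (Hw p m j) (Pq p * sg m j) (Icc 0 1) x := by
            have : HasDerivAt (Hw p m j) (Pq p * sg m j) x := by
              have := ((((hasDerivAt_id x).const_mul (sg m j)).const_add (xs m j)).const_mul
                (Pq p)).const_add 1
              exact this.congr_deriv (by simp)
            exact this.hasDerivWithinAt
          have hw2 := ((hw j).dx x hx τ).pow 2
          refine (hH.mul hw2).congr_deriv ?_
          simp) hZc.continuousOn (a := 0) (b := 1)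
        (left_mem_Icc.2 zero_le_one) (right_mem_Icc.2 zero_le_one)
      rw [this, ← Finset.sum_sub_distrib]
      exact Finset.sum_congr rfl fun j _ => by ring
    have hB : 0 ≤ ∫ x in (0:ℝ)..1, Z x := by
      rw [hZi]
      refine bdry_term (fun j => w j 0 τ) (fun j => w j 1 τ) (fun j => w j (1 - xs m j) τ)
        (fun j => w j (xs m j) τ) ?_ ?_ (fun j => hbc j τ)
      · intro j; simp only [xs]; split_ifs <;> simp
      · intro j; simp only [xs]; split_ifs <;> simp
    have hpt : ∀ x ∈ Icc (0:ℝ) 1, Ft x τ + Z x ≤ νE p M * F x τ + (1 + Pq p) * n * G ^ 2 := by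
      intro x hx
      have h1 := pt_ineq hM hP (fun j => Hw p m j x) (sg m) (fun j => cf.qt j x τ) (fun j => w j x τ)
        (fun j => wx j x τ + cf.q j x τ * wt j x τ
          + cf.d j x τ * w j x τ + ∑ k, cf.c j k x τ * w k x τ) (fun j => cf.d j x τ)
        (fun j k => cf.c j k x τ) (fun j => Hw_bd p m j hx) (sg_abs m) (fun j => h.bqt j x τ)
        (fun j => h.bd j x τ) (fun j k => h.bc j k x τ) (fun j => hg j x hx τ hτ)
      have e1 : Ft x τ + Z x = ∑ j, (Hw p m j x * sg m j * cf.qt j x τ * w j x τ ^ 2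
          + 2 * Hw p m j x * sg m j * w j x τ * ((wx j x τ + cf.q j x τ * wt j x τ
          + cf.d j x τ * w j x τ + ∑ k, cf.c j k x τ * w k x τ) - cf.d j x τ * w j x τ
            - ∑ k, cf.c j k x τ * w k x τ) + Pq p * w j x τ ^ 2) := by
        rw [hFt, hZ, ← Finset.sum_add_distrib]
        refine Finset.sum_congr rfl fun j _ => ?_
        have := sg_sq m j
        linear_combination (Pq p * w j x τ ^ 2) * this
      rw [e1]
      refine h1.trans ?_
      have h2 := hF1 τ x hx
      have h3 : (1 + Pq p) * (4 * M + 2 * M * n + 1) * ∑ j, w j x τ ^ 2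
          ≤ (1 + Pq p) * (4 * M + 2 * M * n + 1) * (M * F x τ) := by gcongr
      have h4 : νE p M * F x τ = (1 + Pq p) * (4 * M + 2 * M * n + 1) * (M * F x τ) := by
        unfold νE; ring
      rw [h4]; gcongr
    have i1 : (∫ x in (0:ℝ)..1, (Ft x τ + Z x)) = (∫ x in (0:ℝ)..1, Ft x τ) + ∫ x in (0:ℝ)..1, Z x :=
      intervalIntegral.integral_add ((sl hTD.ct τ).intervalIntegrable _ _)
        (hZc.intervalIntegrable _ _)
    have i2 := imono (f := fun x => Ft x τ + Z x) (g := fun x => νE p M * F x τ + (1 + Pq p) * n * G ^ 2)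
      ((sl hTD.ct τ).add hZc)
      ((continuous_const.mul (sl hTD.c τ)).add continuous_const) hpt
    have i3 : (∫ x in (0:ℝ)..1, (νE p M * F x τ + (1 + Pq p) * n * G ^ 2))
        = νE p M * e τ + (1 + Pq p) * n * G ^ 2 := by
      have j1 : Continuous fun x => νE p M * F x τ := continuous_const.mul (sl hTD.c τ)
      rw [intervalIntegral.integral_add (j1.intervalIntegrable _ _)
        (continuous_const.intervalIntegrable _ _), intervalIntegral.integral_const_mul]
      simp [he]
    linarith
  have hν : 0 ≤ νE p M := by unfold νE; positivity
  have hgr := gronwall_lin hst hν (b := (1 + Pq p) * n * G ^ 2) (by positivity)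
    (fun τ => hTD.integral 0 1 τ) hle
  have hts : 0 ≤ t - s := by linarith
  have hI0 : 0 ≤ Isq w s := intervalIntegral.integral_nonneg zero_le_one fun x _ =>
    Finset.sum_nonneg fun _ _ => sq_nonneg _
  calc Isq w t ≤ M * e t := hIe t
    _ ≤ M * (Real.exp (νE p M * (t - s)) * ((1 + Pq p) * M * Isq w s + (1 + Pq p) * n * G ^ 2 * (t - s))) := by
        refine mul_le_mul_of_nonneg_left (hgr.trans ?_) hM0
        gcongr
        exact heI s
    _ ≤ KE p M * Real.exp (νE p M * (t - s)) * (Isq w s + (t - s) * G ^ 2) := by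
        have : KE p M * Real.exp (νE p M * (t - s)) * (Isq w s + (t - s) * G ^ 2) -
          M * (Real.exp (νE p M * (t - s)) * ((1 + Pq p) * M * Isq w s + (1 + Pq p) * n * G ^ 2 * (t - s)))
          = Real.exp (νE p M * (t - s)) * (M * (1 + Pq p) * (n * Isq w s + M * ((t - s) * G ^ 2))) := by
          unfold KE; ring
        have : 0 ≤ Real.exp (νE p M * (t - s)) * (M * (1 + Pq p) * (n * Isq w s + M * ((t - s) * G ^ 2))) := by
          positivity
        linarith
end

end QL
end

section
namespace QL
open scoped Topology
variable {n : ℕ}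

lemma om_int {q qt : ℝ → ℝ → ℝ} {M : ℝ} (hq : Qok q qt M) (ξ x t : ℝ) :
    om q ξ x t = t + ∫ s in (cl x)..(cl ξ), q s (om q s x t) := by
  have := ftc_Icc (om_curve hq x t) (Continuous.continuousOn
    (hq.td.c.comp continuous_id (om_cont hq continuous_id continuous_const continuous_const)))
    (cl_mem x) (cl_mem ξ)
  have e : (∫ s in (cl x)..(cl ξ), q s (om q s x t)) = om q (cl ξ) x t - om q (cl x) x t := this
  rw [e, om_cl1, om_cl1, om_self hq]; ring

lemma W_shift {q qt d : ℝ → ℝ → ℝ} {M : ℝ} (hq : Qok q qt M) (hd : CC d) (l ξ x t : ℝ) :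
    W q (fun x t => d x t + l * q x t) ξ x t = W q d ξ x t * Real.exp (l * (om q ξ x t - t)) := by
  have c1 : Continuous fun s => d s (om q s x t) :=
    hd.comp continuous_id (om_cont hq continuous_id continuous_const continuous_const)
  have c2 : Continuous fun s => q s (om q s x t) :=
    hq.td.c.comp continuous_id (om_cont hq continuous_id continuous_const continuous_const)
  have c3 : Continuous fun s => l * q s (om q s x t) := continuous_const.mul c2
  rw [W, W, ← Real.exp_add]
  congr 1
  rw [intervalIntegral.integral_add (c1.intervalIntegrable _ _) (c3.intervalIntegrable _ _),
    intervalIntegral.integral_const_mul, om_int hq ξ x t]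
  ring

lemma Cf.OK.mono {cf : Cf n} {m : ℕ} {M M' : ℝ} (h : cf.OK m M) (hM : M ≤ M') : cf.OK m M' where
  M1 := h.M1.trans hM
  qXT := h.qXT
  cXT := h.cXT
  dTD := h.dTD
  c0 := h.c0
  bq j x t := (h.bq j x t).trans hM
  bqx j x t := (h.bqx j x t).trans hM
  bqt j x t := (h.bqt j x t).trans hM
  bd j x t := (h.bd j x t).trans hM
  bdt j x t := (h.bdt j x t).trans hM
  bc j k x t := (h.bc j k x t).trans hM
  bcx j k x t := (h.bcx j k x t).trans hM
  bct j k x t := (h.bct j k x t).trans hM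
  sgn j x t := by
    have h1 := h.sgn j x t
    have : 0 < M := by linarith [h.M1]
    have : 0 < sg m j * cf.q j x t := by
      by_contra hc; push Not at hc; nlinarith
    nlinarith
  sep j k hjk x t := by
    have h1 := h.sep j k hjk x t
    have := abs_nonneg (cf.q j x t - cf.q k x t)
    nlinarith

def cfl (cf : Cf n) (l : ℝ) : Cf n :=
  { cf with d := fun j x t => cf.d j x t + l * cf.q j x t
            dt := fun j x t => cf.dt j x t + l * cf.qt j x t }

section
variable {cf : Cf n} {m : ℕ} {M : ℝ} (h : cf.OK m M) (p : Fin n → Fin n → ℝ)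

include h in
lemma cfl_ok {l : ℝ} (hl : 0 ≤ l) : (cfl cf l).OK m (M + l * M) := by
  have hM := h.M1
  have h' := h.mono (M' := M + l * M) (by nlinarith)
  exact { M1 := h'.M1, qXT := h'.qXT, cXT := h'.cXT, c0 := h'.c0, bq := h'.bq, bqx := h'.bqx,
          bqt := h'.bqt, bc := h'.bc, bcx := h'.bcx, bct := h'.bct, sgn := h'.sgn, sep := h'.sep
          dTD := fun j => ⟨(h.dTD j).c.add (continuous_const.mul (h.qXT j).c),
            (h.dTD j).ct.add (continuous_const.mul (h.qXT j).ct),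
            fun x t => ((h.dTD j).dt x t).add (((h.qXT j).dt x t).const_mul l)⟩
          bd := fun j x t => by
            refine (abs_add_le _ _).trans (add_le_add (h.bd j x t) ?_)
            rw [abs_mul, abs_of_nonneg hl]; gcongr; exact h.bq j x t
          bdt := fun j x t => by
            refine (abs_add_le _ _).trans (add_le_add (h.bdt j x t) ?_)
            rw [abs_mul, abs_of_nonneg hl]; gcongr; exact h.bqt j x t }

include h in
lemma om_drop (j : Fin n) (x t : ℝ) {ξ : ℝ} (hξ : ξ ∈ uIcc (xs m j) (cl x)) :
    |cl x - ξ| ≤ M * (t - om (cf.q j) ξ x t) := by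
  have hM := h.M1
  have hcx := cl_mem x
  have hc2 : Continuous fun s => cf.q j s (om (cf.q j) s x t) :=
    (h.qXT j).c.comp continuous_id (om_cont (h.qok j) continuous_id continuous_const continuous_const)
  have hs := fun s => h.sgn j s (om (cf.q j) s x t)
  rw [om_int (h.qok j)]
  unfold xs at hξ; unfold sg at hs
  split_ifs at hξ hs with hj
  · rw [uIcc_of_le hcx.1] at hξ
    have hξ1 : cl ξ = ξ := cl_eq ⟨hξ.1, hξ.2.trans hcx.2⟩
    rw [hξ1, abs_of_nonneg (by linarith [hξ.2]), intervalIntegral.integral_symm]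
    have := intervalIntegral.integral_mono_on (μ := volume) hξ.2 (f := fun _ => (1:ℝ))
      (g := fun s => M * cf.q j s (om (cf.q j) s x t)) (continuous_const.intervalIntegrable _ _)
      ((continuous_const.mul hc2).intervalIntegrable _ _) (fun s _ => by simpa using hs s)
    rw [intervalIntegral.integral_const_mul] at this
    simp only [intervalIntegral.integral_const, smul_eq_mul, mul_one] at this
    linarith
  · rw [uIcc_of_ge hcx.2] at hξ
    have hξ1 : cl ξ = ξ := cl_eq ⟨hcx.1.trans hξ.1, hξ.2⟩
    rw [hξ1, abs_of_nonpos (by linarith [hξ.1])]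
    have := intervalIntegral.integral_mono_on (μ := volume) hξ.1 (f := fun _ => (1:ℝ))
      (g := fun s => M * -cf.q j s (om (cf.q j) s x t)) (continuous_const.intervalIntegrable _ _)
      ((continuous_const.mul hc2.neg).intervalIntegrable _ _) (fun s _ => by simpa using hs s)
    rw [intervalIntegral.integral_const_mul, intervalIntegral.integral_neg] at this
    simp only [intervalIntegral.integral_const, smul_eq_mul, mul_one] at this
    linarith

include h in
lemma Wl_le {l : ℝ} (hl : 0 ≤ l) (j : Fin n) (x t : ℝ) {ξ : ℝ} (hξ : ξ ∈ uIcc (xs m j) (cl x)) :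
    |W ((cfl cf l).q j) ((cfl cf l).d j) ξ x t| ≤ Real.exp M * Real.exp (-(l / M) * |cl x - ξ|) := by
  have hM : 0 < M := by linarith [h.M1]
  have e : W ((cfl cf l).q j) ((cfl cf l).d j) ξ x t
      = W (cf.q j) (cf.d j) ξ x t * Real.exp (l * (om (cf.q j) ξ x t - t)) :=
    W_shift (h.qok j) (h.dTD j).c l ξ x t
  rw [e, abs_mul, Real.abs_exp]
  have h1 := W_abs (q := cf.q j) (h.bd j) ξ x t
  have h2 := om_drop h j x t hξ
  have h3 : l * (om (cf.q j) ξ x t - t) ≤ -(l / M) * |cl x - ξ| := by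
    have : l / M * |cl x - ξ| ≤ l / M * (M * (t - om (cf.q j) ξ x t)) := by gcongr
    have e2 : l / M * (M * (t - om (cf.q j) ξ x t)) = l * (t - om (cf.q j) ξ x t) := by field_simp
    linarith
  gcongr

lemma exp_int {a : ℝ} (ha : 0 < a) {b c : ℝ} (hbc : b ≤ c) :
    (∫ ξ in b..c, Real.exp (-a * (c - ξ))) ≤ 1 / a ∧ (∫ ξ in b..c, Real.exp (-a * (ξ - b))) ≤ 1 / a := by
  constructor
  · have : ∀ ξ ∈ uIcc b c, HasDerivAt (fun ξ => Real.exp (-a * (c - ξ)) / a) (Real.exp (-a * (c - ξ))) ξ := by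
      intro ξ _
      have h1 : HasDerivAt (fun ξ => -a * (c - ξ)) a ξ :=
        (((hasDerivAt_id ξ).const_sub c).const_mul (-a)).congr_deriv (by simp)
      refine (h1.exp.div_const a).congr_deriv ?_
      field_simp
    rw [intervalIntegral.integral_eq_sub_of_hasDerivAt this (by
      apply Continuous.intervalIntegrable; fun_prop)]
    have : 0 ≤ Real.exp (-a * (c - b)) / a := by positivity
    simp only [sub_self, mul_zero, Real.exp_zero]; linarith
  · have : ∀ ξ ∈ uIcc b c, HasDerivAt (fun ξ => -(Real.exp (-a * (ξ - b)) / a)) (Real.exp (-a * (ξ - b))) ξ := by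
      intro ξ _
      have h1 : HasDerivAt (fun ξ => -a * (ξ - b)) (-a) ξ :=
        (((hasDerivAt_id ξ).sub_const b).const_mul (-a)).congr_deriv (by simp)
      refine ((h1.exp.div_const a).fun_neg).congr_deriv ?_
      field_simp
    rw [intervalIntegral.integral_eq_sub_of_hasDerivAt this (by
      apply Continuous.intervalIntegrable; fun_prop)]
    have : 0 ≤ Real.exp (-a * (c - b)) / a := by positivity
    simp only [sub_self, mul_zero, Real.exp_zero]; linarith

include h in
lemma Dl_le {l : ℝ} (hl : 0 < l) (g : E n) : ‖Dop (cfl_ok h hl.le) g‖ ≤ Real.exp M * (M / l) * ‖g‖ := by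
  have hM : 0 < M := by linarith [h.M1]
  refine E_norm_le (by positivity) fun j x t => ?_
  rw [cp_Dop, Dr]
  have hcx := cl_mem x
  have hpt : ∀ ξ ∈ uIcc (xs m j) (cl x), ‖W ((cfl cf l).q j) ((cfl cf l).d j) ξ x t
      * cp g j ξ (om ((cfl cf l).q j) ξ x t)‖
      ≤ Real.exp M * ‖g‖ * Real.exp (-(l / M) * |cl x - ξ|) := by
    intro ξ hξ
    rw [norm_mul]
    have h1 := Wl_le h hl.le j x t hξ
    have h2 := cp_le g j ξ (om ((cfl cf l).q j) ξ x t)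
    calc _ ≤ (Real.exp M * Real.exp (-(l / M) * |cl x - ξ|)) * ‖g‖ :=
          mul_le_mul h1 h2 (abs_nonneg _) (by positivity)
      _ = _ := by ring
  have ha : 0 < l / M := by positivity
  have e1 : 1 / (l / M) = M / l := by field_simp
  have hfin : ∀ {I : ℝ}, I ≤ 1 / (l / M) → Real.exp M * ‖g‖ * I ≤ Real.exp M * (M / l) * ‖g‖ := by
    intro I hI
    rw [e1] at hI
    calc _ ≤ Real.exp M * ‖g‖ * (M / l) := by gcongr
      _ = _ := by ring
  rw [← Real.norm_eq_abs]
  have hxs : xs m j = 0 ∨ xs m j = 1 := by unfold xs; split_ifs <;> simp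
  rcases hxs with hx0 | hx0
  · rw [hx0] at hpt ⊢
    rw [uIcc_of_le hcx.1] at hpt
    refine (intervalIntegral.norm_integral_le_of_norm_le (g := fun ξ =>
      Real.exp M * ‖g‖ * Real.exp (-(l / M) * (cl x - ξ))) hcx.1
      (Eventually.of_forall fun ξ hξ => ?_) (by apply Continuous.intervalIntegrable; fun_prop)).trans ?_
    · have := hpt ξ ⟨hξ.1.le, hξ.2⟩
      rwa [abs_of_nonneg (by linarith [hξ.2])] at this
    · rw [intervalIntegral.integral_const_mul]
      exact hfin (exp_int ha hcx.1).1
  · rw [hx0] at hpt ⊢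
    rw [uIcc_of_ge hcx.2] at hpt
    rw [intervalIntegral.integral_symm, norm_neg]
    refine (intervalIntegral.norm_integral_le_of_norm_le (g := fun ξ =>
      Real.exp M * ‖g‖ * Real.exp (-(l / M) * (ξ - cl x))) hcx.2
      (Eventually.of_forall fun ξ hξ => ?_) (by apply Continuous.intervalIntegrable; fun_prop)).trans ?_
    · have := hpt ξ ⟨hξ.1.le, hξ.2⟩
      rwa [abs_of_nonpos (by linarith [hξ.1]), neg_sub] at this
    · rw [intervalIntegral.integral_const_mul]
      exact hfin (exp_int ha hcx.2).2

lemma Cl_le {l : ℝ} (hl : 0 < l) (y : E n) :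
    ‖Cop (cfl_ok h hl.le) p y‖ ≤ Real.exp M * pb p * ‖y‖ := by
  have hM : 0 < M := by linarith [h.M1]
  have := pb_nonneg p
  refine E_norm_le (by positivity) fun j x t => ?_
  rw [cp_Cop, Cr, abs_mul, mul_assoc]
  have h1 := Wl_le h hl.le j x t (left_mem_uIcc (a := xs m j) (b := cl x))
  have h2 : Real.exp M * Real.exp (-(l / M) * |cl x - xs m j|) ≤ Real.exp M := by
    have : Real.exp (-(l / M) * |cl x - xs m j|) ≤ 1 := by
      rw [Real.exp_le_one_iff]
      have : 0 ≤ l / M * |cl x - xs m j| := by positivity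
      linarith
    nlinarith [Real.exp_pos M]
  exact mul_le_mul (h1.trans h2) (psum_le (norm_nonneg _) (fun k => cp_le y k _ _) j)
    (abs_nonneg _) (Real.exp_pos _).le

def KGl (p : Fin n → Fin n → ℝ) (M : ℝ) : ℝ := ∑ i ∈ Finset.range n, (Real.exp M * pb p) ^ i

lemma KGl_nonneg (p : Fin n → Fin n → ℝ) (M : ℝ) : 0 ≤ KGl p M :=
  Finset.sum_nonneg fun _ _ => pow_nonneg (mul_nonneg (Real.exp_pos _).le (pb_nonneg p)) _

lemma Tl_le {l : ℝ} (hl : 0 < l) (y : E n) :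
    ‖Top (cfl_ok h hl.le) p y‖ ≤ KGl p M * (Real.exp M * (M / l)) * (n * M) * ‖y‖ := by
  have hM : 0 < M := by linarith [h.M1]
  have hpb := pb_nonneg p
  have hC : ∀ (i : ℕ) (z : E n), ‖(Cop (cfl_ok h hl.le) p ^ i) z‖ ≤ (Real.exp M * pb p) ^ i * ‖z‖ := by
    intro i z
    induction i with
    | zero => simp
    | succ i ih =>
      rw [pow_succ', pow_succ']
      refine (Cl_le h p hl _).trans ?_
      calc _ ≤ Real.exp M * pb p * ((Real.exp M * pb p) ^ i * ‖z‖) := by gcongr; exact ih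
        _ = _ := by ring
  have hMy : ‖Mop (cfl_ok h hl.le) y‖ ≤ n * M * ‖y‖ :=
    E_norm_le (by positivity) fun j x t => by
      rw [cp_Mop]; exact Mr_le h y j x t
  have e : Top (cfl_ok h hl.le) p y = ∑ i ∈ Finset.range n, (Cop (cfl_ok h hl.le) p ^ i)
      (Dop (cfl_ok h hl.le) (Mop (cfl_ok h hl.le) y)) := by
    rw [Top_eq, Sop_eq, Gop]; simp
  rw [e]
  set z := Dop (cfl_ok h hl.le) (Mop (cfl_ok h hl.le) y)
  have hz : ‖z‖ ≤ Real.exp M * (M / l) * (n * M * ‖y‖) :=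
    (Dl_le h hl _).trans (by gcongr)
  calc _ ≤ ∑ i ∈ Finset.range n, (Real.exp M * pb p) ^ i * ‖z‖ := norm_sum_le_of_le _ fun i _ => hC i z
    _ = KGl p M * ‖z‖ := by rw [KGl, Finset.sum_mul]
    _ ≤ KGl p M * (Real.exp M * (M / l) * (n * M * ‖y‖)) := by
      have := KGl_nonneg p M; gcongr
    _ = _ := by ring

/-- functions vanishing on a backward region -/
def VZ (n : ℕ) (H : ℝ → ℝ) (M t0 : ℝ) : Submodule ℝ (E n) where
  carrier := {u | ∀ j x t, M * (t - t0) ≤ H (cl x) → cp u j x t = 0}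
  add_mem' := fun {u v} hu hv j x t ht => by simp [hu j x t ht, hv j x t ht]
  zero_mem' := fun j x t _ => by simp
  smul_mem' := fun r u hu j x t ht => by simp [hu j x t ht]

lemma mem_VZ {H : ℝ → ℝ} {M t0 : ℝ} {u : E n} :
    u ∈ VZ n H M t0 ↔ ∀ j x t, M * (t - t0) ≤ H (cl x) → cp u j x t = 0 := Iff.rfl

lemma VZ_closed (H : ℝ → ℝ) (M t0 : ℝ) : IsClosed (VZ n H M t0 : Set (E n)) := by
  have : (VZ n H M t0 : Set (E n)) = ⋂ j, ⋂ x, ⋂ t, ⋂ (_ : M * (t - t0) ≤ H (cl x)),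
      {u : E n | cp u j x t = 0} := by
    ext u; simp only [SetLike.mem_coe, mem_VZ, mem_iInter, Set.mem_ofPred_eq]
  rw [this]
  refine isClosed_iInter fun j => isClosed_iInter fun x => isClosed_iInter fun t =>
    isClosed_iInter fun _ => isClosed_eq (cp_continuous _ _ _) continuous_const

lemma Dl_VZ {H : ℝ → ℝ} (hH : ∀ x y, H x - H y ≤ |x - y|) (t0 : ℝ) {l : ℝ} (hl : 0 < l) {u : E n}
    (hu : u ∈ VZ n H M t0) : Dop (cfl_ok h hl.le) u ∈ VZ n H M t0 := by
  intro j x t ht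
  rw [cp_Dop, Dr]
  have : ∀ ξ ∈ uIcc (xs m j) (cl x), W ((cfl cf l).q j) ((cfl cf l).d j) ξ x t
      * cp u j ξ (om ((cfl cf l).q j) ξ x t) = 0 := by
    intro ξ hξ
    have h1 := om_drop h j x t hξ
    have hξc : cl ξ = ξ := cl_eq (Set.uIcc_subset_Icc (xs_mem m j) (cl_mem x) hξ)
    have h2 := hH (cl x) ξ
    have : cp u j ξ (om (cf.q j) ξ x t) = 0 := hu j ξ _ (by
      rw [hξc]; nlinarith)
    show _ * cp u j ξ (om (cf.q j) ξ x t) = 0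
    rw [this, mul_zero]
  rw [intervalIntegral.integral_congr this]; simp

lemma Cl_VZ {H : ℝ → ℝ} (hH : ∀ x y, H x - H y ≤ |x - y|) (hH01 : H 0 = H 1) (t0 : ℝ) {l : ℝ}
    (hl : 0 < l) {u : E n}
    (hu : u ∈ VZ n H M t0) : Cop (cfl_ok h hl.le) p u ∈ VZ n H M t0 := by
  intro j x t ht
  rw [cp_Cop, Cr]
  refine mul_eq_zero_of_right _ (Finset.sum_eq_zero fun k _ => mul_eq_zero_of_right _ ?_)
  have h1 := om_drop h j x t (left_mem_uIcc (a := xs m j) (b := cl x))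
  have h2 := hH (cl x) (xs m j)
  have h3 : H (xs m j) = H (cl (1 - xs m k)) := by
    rw [cl_xs']; unfold xs; split_ifs <;> simp [hH01]
  exact hu k _ _ (by rw [← h3]; show M * (om (cf.q j) (xs m j) x t - t0) ≤ _; nlinarith)

lemma Ml_VZ {H : ℝ → ℝ} (t0 : ℝ) {l : ℝ} (hl : 0 < l) {u : E n}
    (hu : u ∈ VZ n H M t0) : Mop (cfl_ok h hl.le) u ∈ VZ n H M t0 := by
  intro j x t ht
  rw [cp_Mop, Mr]
  rw [Finset.sum_eq_zero fun k _ => mul_eq_zero_of_right _ (hu k x t ht), neg_zero]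

lemma Sl_VZ {H : ℝ → ℝ} (hH : ∀ x y, H x - H y ≤ |x - y|) (hH01 : H 0 = H 1) (t0 : ℝ) {l : ℝ}
    (hl : 0 < l) {u : E n}
    (hu : u ∈ VZ n H M t0) : Sop (cfl_ok h hl.le) p u ∈ VZ n H M t0 := by
  have e : Sop (cfl_ok h hl.le) p u = ∑ i ∈ Finset.range n, (Cop (cfl_ok h hl.le) p ^ i)
      (Dop (cfl_ok h hl.le) u) := by
    rw [Sop_eq, Gop]; simp
  rw [e]
  have hi : ∀ i : ℕ, (Cop (cfl_ok h hl.le) p ^ i) (Dop (cfl_ok h hl.le) u) ∈ VZ n H M t0 := by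
    intro i
    induction i with
    | zero => exact Dl_VZ h hH t0 hl hu
    | succ i ih => rw [pow_succ']; exact Cl_VZ h p hH hH01 t0 hl ih
  exact Submodule.sum_mem _ fun i _ => hi i

theorem lam_solve (hp : H3cond n p) : ∃ l : ℝ, ∃ hl : 0 < l, ∀ g gt : E n, Dt g gt →
    ∃ w wt : E n, Dt w wt ∧ Sol (cfl cf l) m p w (Mop (cfl_ok h hl.le) w + g) ∧
      ∀ H : ℝ → ℝ, (∀ x y, H x - H y ≤ |x - y|) → H 0 = H 1 → ∀ t0, g ∈ VZ n H M t0 →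
        w ∈ VZ n H M t0 := by
  have hM := h.M1
  have hM0 : 0 < M := by linarith
  have hK := KGl_nonneg p M
  set B := KGl p M * (Real.exp M * M) * (n * M) with hB
  have hB0 : 0 ≤ B := by positivity
  refine ⟨2 * (B + 1), by positivity, fun g gt hg => ?_⟩
  set l := 2 * (B + 1) with hl'
  have hl : 0 < l := by positivity
  set hc := cfl_ok h hl.le
  set S := Sop hc p with hS
  set T := Top hc p with hT
  have hTle : ∀ y, ‖T y‖ ≤ 1 / 2 * ‖y‖ := by
    intro y
    refine (Tl_le h p hl y).trans ?_
    gcongr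
    have : KGl p M * (Real.exp M * (M / l)) * (n * M) = B / l := by rw [hB]; ring
    rw [this, div_le_iff₀ hl, hl']; linarith
  set us : ℕ → E n := fun i => Nat.rec 0 (fun _ u => S g + T u) i with hus
  have us0 : us 0 = 0 := rfl
  have uss : ∀ i, us (i + 1) = S g + T (us i) := fun i => rfl
  have hd : ∀ i, dist (us i) (us (i + 1)) ≤ ‖S g‖ * (1 / 2) ^ i := by
    intro i
    induction i with
    | zero => simp [us0, uss, dist_eq_norm]
    | succ i ih =>
      rw [uss i, uss (i + 1), dist_add_left, dist_eq_norm, ← map_sub]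
      refine (hTle _).trans ?_
      rw [dist_eq_norm] at ih
      rw [pow_succ]; linarith
  obtain ⟨w, hw⟩ := cauchySeq_tendsto_of_complete
    (cauchySeq_of_le_geometric (1 / 2) ‖S g‖ (by norm_num) hd)
  have hfix : w = S g + T w := by
    refine tendsto_nhds_unique ((tendsto_add_atTop_iff_nat 1).2 hw) ?_
    simp only [uss]
    exact (((T.continuous.tendsto w).comp hw).const_add (S g))
  obtain ⟨sgt, hsgt, -⟩ := (Sop_tame hc p).d g gt hg
  have hDt : ∀ i, ∃ v, Dt (us i) v := by
    intro i
    induction i with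
    | zero => exact ⟨0, by rw [us0]; exact Dt.zero⟩
    | succ i ih =>
      obtain ⟨v, hv⟩ := ih
      obtain ⟨v', hv', -⟩ := (Top_tame hc p).d _ _ hv
      exact ⟨_, by rw [uss]; exact hsgt.add hv'⟩
  choose uts huts using hDt
  obtain ⟨v2, hv2, -⟩ := sm_T2_lim hc p hp huts hw
  obtain ⟨v1, hv1, -⟩ := (Top_tame hc p).d _ _ hsgt
  have hfix2 : w = S g + (T (S g) + T (T w)) := by
    rw [← map_add, ← hfix]; exact hfix
  refine ⟨w, sgt + (v1 + v2), ?_, ?_, ?_⟩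
  · have h0 : Dt (S g + (T (S g) + T (T w))) (sgt + (v1 + v2)) := hsgt.add (hv1.add hv2)
    rwa [← hfix2] at h0
  · rw [sol_iff hc p hp, map_add, ← Top_eq, add_comm]
    exact hfix
  · intro H hH hH01 t0 hgV
    refine (VZ_closed H M t0).mem_of_tendsto hw (Eventually.of_forall fun i => ?_)
    induction i with
    | zero => exact Submodule.zero_mem _
    | succ i ih =>
      rw [uss]
      exact Submodule.add_mem _ (Sl_VZ h p hH hH01 t0 hl hgV)
        (Sl_VZ h p hH hH01 t0 hl (Ml_VZ h t0 hl ih))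
end

end QL
end

section
namespace QL
open scoped Topology
variable {n : ℕ}

lemma bdd_of_zero_off {f : ℝ → ℝ} (hf : Continuous f) {a b : ℝ} (h0 : ∀ x, x ∉ Icc a b → f x = 0) :
    ∃ K, 0 ≤ K ∧ ∀ x, |f x| ≤ K := by
  obtain ⟨K, hK⟩ := isCompact_Icc.exists_bound_of_continuousOn (s := Icc a b) hf.continuousOn
  refine ⟨max K 0, le_max_right _ _, fun x => ?_⟩
  by_cases hx : x ∈ Icc a b
  · exact (hK x hx).trans (le_max_left _ _)
  · rw [h0 x hx]; simp

lemma step_fn {a b : ℝ} (hab : a < b) : ∃ X X1 X2 : ℝ → ℝ, (∀ t, HasDerivAt X (X1 t) t) ∧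
    (∀ t, HasDerivAt X1 (X2 t) t) ∧ Continuous X2 ∧ (∀ t, 0 ≤ X t) ∧ (∀ t, X t ≤ 1) ∧
    (∀ t ≤ a, X t = 0) ∧ (∀ t, b ≤ t → X t = 1) ∧ (∀ t ≤ a, X1 t = 0) ∧ (∀ t, b ≤ t → X1 t = 0) ∧
    (∀ t, t ∉ Icc a b → X2 t = 0) := by
  set X : ℝ → ℝ := fun t => Real.smoothTransition ((t - a) / (b - a)) with hX
  have hba : 0 < b - a := by linarith
  have hc : ContDiff ℝ 2 X := by
    have h1 : ContDiff ℝ 2 Real.smoothTransition :=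
      Real.smoothTransition.contDiff (n := 2)
    exact h1.comp (by fun_prop)
  have hc1 : ContDiff ℝ 1 (deriv X) := by
    have : ContDiff ℝ (1 + 1) X := by simpa [one_add_one_eq_two] using hc
    exact (contDiff_succ_iff_deriv.1 this).2.2
  have z0 : ∀ t ≤ a, X t = 0 := fun t ht =>
    Real.smoothTransition.zero_of_nonpos (div_nonpos_of_nonpos_of_nonneg (by linarith) hba.le)
  have z1 : ∀ t, b ≤ t → X t = 1 := fun t ht =>
    Real.smoothTransition.one_of_one_le ((one_le_div hba).2 (by linarith))
  have d0 : ∀ t ≤ a, deriv X t = 0 := fun t ht => by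
    apply IsLocalMin.deriv_eq_zero
    refine Eventually.of_forall fun y => ?_
    rw [z0 t ht]; exact Real.smoothTransition.nonneg _
  have d1 : ∀ t, b ≤ t → deriv X t = 0 := fun t ht => by
    apply IsLocalMax.deriv_eq_zero
    refine Eventually.of_forall fun y => ?_
    rw [z1 t ht]; exact Real.smoothTransition.le_one _
  refine ⟨X, deriv X, deriv (deriv X), fun t => (hc.differentiable (by norm_num) t).hasDerivAt,
    fun t => (hc1.differentiable (by norm_num) t).hasDerivAt, hc1.continuous_deriv le_rfl,
    fun t => Real.smoothTransition.nonneg _, fun t => Real.smoothTransition.le_one _, z0, z1, d0, d1,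
    fun t ht => ?_⟩
  rw [mem_Icc, not_and_or, not_le, not_le] at ht
  rcases ht with ht | ht
  · have : deriv X =ᶠ[𝓝 t] fun _ => 0 := by
      filter_upwards [Iio_mem_nhds ht] with y hy using d0 y (le_of_lt hy)
    rw [this.deriv_eq]; simp
  · have : deriv X =ᶠ[𝓝 t] fun _ => 0 := by
      filter_upwards [Ioi_mem_nhds ht] with y hy using d1 y (le_of_lt hy)
    rw [this.deriv_eq]; simp

/-- full operator in x-form -/
def Lx (cf : Cf n) (w wx wt : Fin n → ℝ → ℝ → ℝ) (j : Fin n) (x t : ℝ) : ℝ :=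
  wx j x t + cf.q j x t * wt j x t + cf.d j x t * w j x t + ∑ k, cf.c j k x t * w k x t

section
variable {cf : Cf n} {m : ℕ} {M : ℝ} (h : cf.OK m M) (p : Fin n → Fin n → ℝ)

include h in
theorem ivp0 (hp : H3cond n p) {φ φx : Fin n → ℝ → ℝ} (hφc : ∀ j, Continuous (φ j))
    (hφxc : ∀ j, Continuous (φx j))
    (hφ : ∀ j, ∀ x ∈ Icc (0:ℝ) 1, HasDerivWithinAt (φ j) (φx j x) (Icc 0 1) x) {ρ : ℝ} (hρ : 0 < ρ)
    (hρ1 : ρ ≤ 1 / 2)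
    (hφ0 : ∀ j x, x ≤ ρ ∨ 1 - ρ ≤ x → φ j x = 0) (s : ℝ) {ε : ℝ} (hε : 0 < ε) :
    ∃ w wx wt : Fin n → ℝ → ℝ → ℝ, (∀ j, XT (w j) (wx j) (wt j)) ∧
      (∀ j t, w j (xs m j) t = ∑ k, p j k * w k (1 - xs m k) t) ∧
      (∀ j, ∀ x ∈ Icc (0:ℝ) 1, ∀ t, s ≤ t → Lx cf w wx wt j x t = 0) ∧
      (∀ j x, x ≤ ρ / 2 ∨ 1 - ρ / 2 ≤ x → w j x s = 0) ∧
      ∫ x in (0:ℝ)..1, ∑ j, (w j x s - φ j x) ^ 2 ≤ ε := by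
  have hM := h.M1
  have hM0 : 0 < M := by linarith
  obtain ⟨l, hl, hsol⟩ := lam_solve h p hp
  -- bounds for φ, φx
  have hφb : ∃ Kφ, 0 ≤ Kφ ∧ ∀ j x, |φ j x| ≤ Kφ := by
    choose K hK0 hK using fun j => bdd_of_zero_off (hφc j) (a := ρ) (b := 1 - ρ) (fun x hx => by
      rw [mem_Icc, not_and_or, not_le, not_le] at hx
      exact hφ0 j x (hx.imp le_of_lt le_of_lt))
    exact ⟨∑ j, K j, Finset.sum_nonneg fun j _ => hK0 j, fun j x => (hK j x).trans
      (Finset.single_le_sum (fun j _ => hK0 j) (Finset.mem_univ j))⟩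
  obtain ⟨Kφ, hKφ0, hKφ⟩ := hφb
  have hφxb : ∃ K, 0 ≤ K ∧ ∀ j, ∀ x ∈ Icc (0:ℝ) 1, |φx j x| ≤ K := by
    choose K hK using fun j => isCompact_Icc.exists_bound_of_continuousOn (s := Icc (0:ℝ) 1)
      (hφxc j).continuousOn
    refine ⟨∑ j, |K j|, Finset.sum_nonneg fun j _ => abs_nonneg _, fun j x hx => ?_⟩
    exact ((hK j x hx).trans (le_abs_self _)).trans
      (Finset.single_le_sum (f := fun j => |K j|) (fun j _ => abs_nonneg _) (Finset.mem_univ j))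
  obtain ⟨Kx, hKx0, hKx⟩ := hφxb
  set G := Kx + M * Kφ + n * (M * Kφ) with hG
  have hG0 : 0 ≤ G := by positivity
  have hKE : 0 ≤ KE p M := by
    unfold KE; have := Pq_nonneg p; positivity
  have hνE : 0 ≤ νE p M := by
    unfold νE; have := Pq_nonneg p; positivity
  set Cτ := KE p M * Real.exp (νE p M) * G ^ 2 with hCτ
  have hCτ0 : 0 ≤ Cτ := by positivity
  set τ := min (min 1 (ρ / (2 * M))) (ε / (Cτ + 1)) with hτ
  have hτ0 : 0 < τ := by rw [hτ]; positivity
  have hτ1 : τ ≤ 1 := (min_le_left _ _).trans (min_le_left _ _)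
  have hτ2 : M * τ ≤ ρ / 2 := by
    have : τ ≤ ρ / (2 * M) := (min_le_left _ _).trans (min_le_right _ _)
    calc M * τ ≤ M * (ρ / (2 * M)) := by gcongr
      _ = ρ / 2 := by field_simp
  have hτ3 : Cτ * τ ≤ ε := by
    have : τ ≤ ε / (Cτ + 1) := min_le_right _ _
    calc Cτ * τ ≤ (Cτ + 1) * (ε / (Cτ + 1)) := by gcongr; linarith
      _ = ε := by field_simp
  obtain ⟨X, X1, X2, hX, hX1, hX2c, hX0, hXle, hXa, hXb, hX1a, hX1b, hX2z⟩ :=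
    step_fn (show s - τ < s by linarith)
  have hX1c : Continuous X1 := continuous_iff_continuousAt.2 fun t => (hX1 t).continuousAt
  have hXc : Continuous X := continuous_iff_continuousAt.2 fun t => (hX t).continuousAt
  set e : ℝ → ℝ := fun t => Real.exp (-(l * (t - s))) with he
  have hed : ∀ t, HasDerivAt e (-l * e t) t := by
    intro t
    have h1 : HasDerivAt (fun t => -(l * (t - s))) (-l) t :=
      ((((hasDerivAt_id t).sub_const s).const_mul l).fun_neg).congr_deriv (by simp)
    refine h1.exp.congr_deriv ?_
    simp only [he]; ring
  have hec : Continuous e := by simp only [he]; fun_prop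
  set ψ : ℝ → ℝ := fun t => e t * X1 t with hψ
  set ψ1 : ℝ → ℝ := fun t => -l * e t * X1 t + e t * X2 t with hψ1
  have hψd : ∀ t, HasDerivAt ψ (ψ1 t) t := fun t => (hed t).mul (hX1 t)
  have hψc : Continuous ψ := hec.mul hX1c
  have hψc1 : Continuous ψ1 := ((continuous_const.mul hec).mul hX1c).add (hec.mul hX2c)
  have hX1z : ∀ t, t ∉ Icc (s - τ) s → X1 t = 0 := fun t ht => by
    rw [mem_Icc, not_and_or, not_le, not_le] at ht
    rcases ht with ht | ht
    · exact hX1a t ht.le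
    · exact hX1b t ht.le
  obtain ⟨Kψ, hKψ0, hKψ⟩ := bdd_of_zero_off hψc (a := s - τ) (b := s) (fun t ht => by
    simp [hψ, hX1z t ht])
  obtain ⟨Kψ1, hKψ10, hKψ1⟩ := bdd_of_zero_off hψc1 (a := s - τ) (b := s) (fun t ht => by
    simp [hψ1, hX1z t ht, hX2z t ht])
  have htd0 : ∀ j, TD (fun x t => ψ t * φ j x) (fun x t => ψ1 t * φ j x) := fun j =>
    ⟨(hψc.comp continuous_snd).mul ((hφc j).comp continuous_fst),
      (hψc1.comp continuous_snd).mul ((hφc j).comp continuous_fst),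
      fun x t => (hψd t).mul_const _⟩
  have htd := fun j => (h.qXT j).toTD.mul (htd0 j)
  have hb0 : ∀ j x t, |ψ t * φ j x| ≤ Kψ * Kφ := fun j x t => by
    rw [abs_mul]; exact mul_le_mul (hKψ t) (hKφ j x) (abs_nonneg _) hKψ0
  have hb1 : ∀ j x t, |ψ1 t * φ j x| ≤ Kψ1 * Kφ := fun j x t => by
    rw [abs_mul]; exact mul_le_mul (hKψ1 t) (hKφ j x) (abs_nonneg _) hKψ10
  set g : E n := mkE (fun j x t => cf.q j x t * (ψ t * φ j x)) (fun j => (htd j).c) (M * (Kψ * Kφ))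
    (fun j x t => by
      rw [abs_mul]; exact mul_le_mul (h.bq j x t) (hb0 j x t) (abs_nonneg _) hM0.le) with hg
  set gt : E n := mkE _ (fun j => (htd j).ct) (M * (Kψ * Kφ) + M * (Kψ1 * Kφ))
    (fun j x t => by
      refine (abs_add_le _ _).trans (add_le_add ?_ ?_)
      · rw [abs_mul]; exact mul_le_mul (h.bqt j x t) (hb0 j x t) (abs_nonneg _) hM0.le
      · rw [abs_mul]; exact mul_le_mul (h.bq j x t) (hb1 j x t) (abs_nonneg _) hM0.le) with hgt
  have hgd : Dt g gt := fun j x t => (htd j).dt x t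
  obtain ⟨y, yt, hyt, hy, hV⟩ := hsol g gt hgd
  set H : ℝ → ℝ := fun x => max 0 (ρ - min x (1 - x)) with hH
  have hHl : ∀ x y, H x - H y ≤ |x - y| := by
    intro x y
    refine (le_abs_self _).trans ((abs_max_sub_max_le_max _ _ _ _).trans (max_le (by simp) ?_))
    have : ρ - min x (1 - x) - (ρ - min y (1 - y)) = -(min x (1 - x) - min y (1 - y)) := by ring
    rw [this, abs_neg]
    refine (abs_min_sub_min_le_max _ _ _ _).trans (max_le le_rfl ?_)
    rw [show 1 - x - (1 - y) = -(x - y) by ring, abs_neg]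
  have hyV := hV H hHl (by simp [hH]) (s - τ) (by
    rw [mem_VZ]
    intro j x t ht
    show cf.q j x t * (ψ t * φ j x) = 0
    by_cases hx : x ≤ ρ ∨ 1 - ρ ≤ x
    · rw [hφ0 j x hx]; simp
    · push Not at hx
      have hcx : cl x = x := cl_eq ⟨by linarith, by linarith⟩
      have : H (cl x) = 0 := by
        rw [hcx]; simp only [hH]
        refine max_eq_left ?_
        have : ρ ≤ min x (1 - x) := le_min (by linarith) (by linarith)
        linarith
      have : t ≤ s - τ := by
        rw [this] at ht
        by_contra hc; push Not at hc
        nlinarith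
      simp [hψ, hX1a t this])
  rw [mem_VZ] at hyV
  have hyx := fun j => hy.xt (cfl_ok h hl.le) hyt j
  set f : ℝ → ℝ := fun t => Real.exp (l * (t - s)) with hf
  have hfd : ∀ t, HasDerivAt f (l * f t) t := by
    intro t
    have h1 : HasDerivAt (fun t => l * (t - s)) l t :=
      (((hasDerivAt_id t).sub_const s).const_mul l).congr_deriv (by simp)
    refine h1.exp.congr_deriv ?_
    simp only [hf]; ring
  have hfc : Continuous f := by simp only [hf]; fun_prop
  have hfe : ∀ t, f t * e t = 1 := fun t => by
    simp only [hf, he]; rw [← Real.exp_add]; simp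
  set w : Fin n → ℝ → ℝ → ℝ := fun j x t => f t * cp y j x t with hw
  set yx : Fin n → ℝ → ℝ → ℝ := fun j x t => cp (Mop (cfl_ok h hl.le) y + g) j x t
    - (cfl cf l).d j x t * cp y j x t - (cfl cf l).q j x t * cp yt j x t with hyxd
  have hwxt : ∀ j, XT (w j) (fun x t => f t * yx j x t)
      (fun x t => l * f t * cp y j x t + f t * cp yt j x t) := fun j =>
    { c := (hfc.comp continuous_snd).mul (hyx j).c
      ct := ((continuous_const.mul (hfc.comp continuous_snd)).mul (hyx j).c).add
        ((hfc.comp continuous_snd).mul (hyx j).ct)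
      dt := fun x t => (hfd t).mul ((hyx j).dt x t)
      cx := (hfc.comp continuous_snd).mul (hyx j).cx
      dx := fun x hx t => ((hyx j).dx x hx t).const_mul (f t) }
  have hbc : ∀ j t, w j (xs m j) t = ∑ k, p j k * w k (1 - xs m k) t := by
    intro j t
    simp only [hw]
    rw [hy.bc j t, Finset.mul_sum]
    exact Finset.sum_congr rfl fun k _ => by ring
  have hL : ∀ j x t, Lx cf w (fun j x t => f t * yx j x t)
      (fun j x t => l * f t * cp y j x t + f t * cp yt j x t) j x t = cf.q j x t * (X1 t * φ j x) := by
    intro j x t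
    have e1 : yx j x t = -(∑ k, cf.c j k x t * cp y k x t) + cf.q j x t * (e t * X1 t * φ j x)
        - (cf.d j x t + l * cf.q j x t) * cp y j x t - cf.q j x t * cp yt j x t := rfl
    have e2 : ∑ k, cf.c j k x t * (f t * cp y k x t) = f t * ∑ k, cf.c j k x t * cp y k x t := by
      rw [Finset.mul_sum]; exact Finset.sum_congr rfl fun k _ => by ring
    simp only [Lx, hw]
    rw [e1, e2]
    linear_combination (cf.q j x t * (X1 t * φ j x)) * hfe t
  have hHs : ∀ x ∈ Icc (0:ℝ) 1, (x ≤ ρ / 2 ∨ 1 - ρ / 2 ≤ x) → ρ / 2 ≤ H x := by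
    intro x hx hx'
    refine le_max_of_le_right ?_
    rcases hx' with hx' | hx'
    · have := min_le_left x (1 - x); linarith
    · have := min_le_right x (1 - x); linarith
  refine ⟨w, _, _, hwxt, hbc, ?_, ?_, ?_⟩
  · intro j x _ t ht
    rw [hL, hX1b t ht]; ring
  · intro j x hx
    have h1 : cp y j x s = 0 := by
      rw [← hy.clp]
      refine hyV j (cl x) s ?_
      rw [cl_cl]
      have h2 := hHs (cl x) (cl_mem x) (by
        rcases hx with hx | hx
        · left; unfold cl
          exact max_le (by linarith) ((min_le_right _ _).trans hx)
        · right; unfold cl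
          exact le_max_of_le_right (le_min (by linarith) hx))
      have : s - (s - τ) = τ := by ring
      rw [this]; linarith
    simp [hw, h1]
  · set v : Fin n → ℝ → ℝ → ℝ := fun j x t => w j x t - X t * φ j x with hv
    have hvx : ∀ j, XT (v j) (fun x t => f t * yx j x t - X t * φx j x)
        (fun x t => l * f t * cp y j x t + f t * cp yt j x t - X1 t * φ j x) := fun j =>
      { c := (hwxt j).c.sub ((hXc.comp continuous_snd).mul ((hφc j).comp continuous_fst))
        ct := (hwxt j).ct.sub ((hX1c.comp continuous_snd).mul ((hφc j).comp continuous_fst))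
        dt := fun x t => ((hwxt j).dt x t).sub ((hX t).mul_const _)
        cx := (hwxt j).cx.sub ((hXc.comp continuous_snd).mul ((hφxc j).comp continuous_fst))
        dx := fun x hx t => ((hwxt j).dx x hx t).sub ((hφ j x hx).const_mul _) }
    have hvb : ∀ j t, v j (xs m j) t = ∑ k, p j k * v k (1 - xs m k) t := by
      intro j t
      have z1 : ∀ k, φ k (xs m k) = 0 := fun k => hφ0 k _ (by
        unfold xs; split_ifs
        · left; linarith
        · right; linarith)
      have z2 : ∀ k, φ k (1 - xs m k) = 0 := fun k => hφ0 k _ (by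
        unfold xs; split_ifs
        · right; linarith
        · left; linarith)
      simp only [hv, z1, z2, mul_zero, sub_zero]
      exact hbc j t
    have hen := energy h p hvx hvb (s := s - τ) (t := s) (G := G) (by linarith) (by
      intro j x hx t ht
      have e1 := hL j x t
      simp only [Lx] at e1
      have e2 : ∑ k, cf.c j k x t * v k x t
          = ∑ k, cf.c j k x t * w k x t - X t * ∑ k, cf.c j k x t * φ k x := by
        rw [Finset.mul_sum, ← Finset.sum_sub_distrib]
        exact Finset.sum_congr rfl fun k _ => by simp only [hv]; ring
      have e3 : f t * yx j x t - X t * φx j x + cf.q j x t * (l * f t * cp y j x t + f t * cp yt j x t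
          - X1 t * φ j x) + cf.d j x t * v j x t + ∑ k, cf.c j k x t * v k x t
          = -(X t * (φx j x + cf.d j x t * φ j x + ∑ k, cf.c j k x t * φ k x)) := by
        rw [e2]; simp only [hv]
        linear_combination e1
      rw [e3, abs_neg, abs_mul, abs_of_nonneg (hX0 t)]
      have b1 : |φx j x + cf.d j x t * φ j x + ∑ k, cf.c j k x t * φ k x| ≤ G := by
        refine (abs_add_le _ _).trans (add_le_add ((abs_add_le _ _).trans (add_le_add (hKx j x hx) ?_)) ?_)
        · rw [abs_mul]; exact mul_le_mul (h.bd j x t) (hKφ j x) (abs_nonneg _) hM0.le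
        · refine (Finset.abs_sum_le_sum_abs _ _).trans ?_
          refine (Finset.sum_le_card_nsmul _ _ (M * Kφ) fun k _ => ?_).trans (by simp)
          rw [abs_mul]; exact mul_le_mul (h.bc j k x t) (hKφ k x) (abs_nonneg _) hM0.le
      nlinarith [hXle t, hX0 t, abs_nonneg (φx j x + cf.d j x t * φ j x + ∑ k, cf.c j k x t * φ k x)])
    have hs0 : Isq v (s - τ) = 0 := by
      unfold Isq
      rw [intervalIntegral.integral_congr (g := fun _ => (0:ℝ))]
      · simp
      · intro x hx
        refine Finset.sum_eq_zero fun j _ => ?_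
        have h1 : cp y j x (s - τ) = 0 := hyV j x _ (by
          simp only [sub_self, mul_zero]; exact le_max_left _ _)
        simp [hv, hw, h1, hXa (s - τ) le_rfl]
    have hs1 : Isq v s = ∫ x in (0:ℝ)..1, ∑ j, (w j x s - φ j x) ^ 2 := by
      unfold Isq; simp [hv, hXb s le_rfl]
    rw [← hs1]
    refine hen.trans ?_
    rw [hs0]
    have h1 : Real.exp (νE p M * (s - (s - τ))) ≤ Real.exp (νE p M) := by
      rw [Real.exp_le_exp]
      have : s - (s - τ) = τ := by ring
      rw [this]; nlinarith
    calc _ ≤ KE p M * Real.exp (νE p M) * (0 + (s - (s - τ)) * G ^ 2) := by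
          have : 0 ≤ s - (s - τ) := by linarith
          gcongr
      _ = Cτ * τ := by rw [hCτ]; ring
      _ ≤ ε := hτ3
end

end QL
end

section
namespace QL
open scoped Topology
variable {n : ℕ}

/-- abstract discrete dichotomy estimate -/
lemma dich_abs {X : Type*} [NormedAddCommGroup X] [NormedSpace ℝ X] {U : ℝ → ℝ → X →L[ℝ] X}
    (hU1 : ∀ t, U t t = ContinuousLinearMap.id ℝ X) {α M : ℝ} (hα : 0 < α) (hM : 1 ≤ M)
    (hd : HasExpDichotomy U α M) : ∃ N : ℝ, 0 < N ∧ ∀ (ζ : ℝ → X) (B R : ℝ),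
      (∀ t, ‖ζ t‖ ≤ B) → (∀ t, ‖ζ (t + N) - U (t + N) t (ζ t)‖ ≤ R) →
      ∀ t, ‖ζ t‖ ≤ 2 * (M + 1) * R := by
  obtain ⟨P, W, -, -, -, hcomm, hW1, -, -, hb1, hb2⟩ := hd
  obtain ⟨N, hN0, hN⟩ : ∃ N : ℝ, 0 < N ∧ M * Real.exp (-α * N) ≤ 1 / 4 := by
    refine ⟨4 * M / α, by positivity, ?_⟩
    have e : -α * (4 * M / α) = -(4 * M) := by field_simp
    rw [e, Real.exp_neg, ← div_eq_mul_inv, div_le_iff₀ (Real.exp_pos _)]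
    have := Real.add_one_le_exp (4 * M)
    linarith
  refine ⟨N, hN0, fun ζ B R hB hR => ?_⟩
  have hR0 : 0 ≤ R := (norm_nonneg _).trans (hR 0)
  have hPb : ∀ t, ‖P t‖ ≤ M := fun t => by
    have := hb1 t t le_rfl
    rw [hU1 t, ContinuousLinearMap.id_comp] at this
    simpa using this
  set S := ⨆ t, ‖ζ t‖ with hS
  have hbdd : BddAbove (range fun t => ‖ζ t‖) := ⟨B, by rintro _ ⟨t, rfl⟩; exact hB t⟩
  have hle : ∀ t, ‖ζ t‖ ≤ S := fun t => le_ciSup hbdd t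
  have hS0 : 0 ≤ S := (norm_nonneg _).trans (hle 0)
  have key : ∀ t, ‖ζ t‖ ≤ S / 2 + (M + 1) * R := by
    intro t
    have h1 : ‖P t (ζ t)‖ ≤ S / 4 + M * R := by
      have e0 : t - N + N = t := by ring
      have hr := hR (t - N)
      rw [e0] at hr
      have e : P t (ζ t) = (U t (t - N)).comp (P (t - N)) (ζ (t - N))
          + P t (ζ t - U t (t - N) (ζ (t - N))) := by
        rw [hcomm _ _ (by linarith)]; simp
      rw [e]
      refine (norm_add_le _ _).trans (add_le_add ?_ ?_)
      · refine (ContinuousLinearMap.le_opNorm _ _).trans ?_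
        have h2 := hb1 (t - N) t (by linarith)
        rw [show t - (t - N) = N by ring] at h2
        calc _ ≤ 1 / 4 * S := mul_le_mul (h2.trans hN) (hle _) (norm_nonneg _) (by norm_num)
          _ = S / 4 := by ring
      · refine (ContinuousLinearMap.le_opNorm _ _).trans ?_
        exact mul_le_mul (hPb t) hr (norm_nonneg _) (by linarith)
    have h2 : ‖ζ t - P t (ζ t)‖ ≤ 1 / 4 * (S + R) := by
      have e : ζ t - P t (ζ t) = (W t (t + N)).comp (ContinuousLinearMap.id ℝ X - P (t + N))
          (ζ (t + N) - (ζ (t + N) - U (t + N) t (ζ t))) := by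
        rw [← hW1 t (t + N) (by linarith) (ζ t)]
        have := congrArg (fun L => L (ζ t)) (hcomm t (t + N) (by linarith))
        simp only [ContinuousLinearMap.comp_apply] at this
        simp [this]
      rw [e]
      refine (ContinuousLinearMap.le_opNorm _ _).trans ?_
      have h3 := hb2 t (t + N) (by linarith)
      rw [show t + N - t = N by ring] at h3
      refine mul_le_mul (h3.trans hN) ?_ (norm_nonneg _) (by norm_num)
      exact (norm_sub_le _ _).trans (add_le_add (hle _) (hR t))
    calc ‖ζ t‖ = ‖P t (ζ t) + (ζ t - P t (ζ t))‖ := by congr 1; abel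
      _ ≤ _ := norm_add_le _ _
      _ ≤ S / 4 + M * R + 1 / 4 * (S + R) := add_le_add h1 h2
      _ ≤ _ := by linarith
  have : S ≤ S / 2 + (M + 1) * R := ciSup_le key
  intro t
  linarith [hle t]

/-- vector valued version -/
def vec (ζ : Fin n → ℝ → ℝ) (x : ℝ) : Vn n := WithLp.toLp 2 (fun j => ζ j x)

lemma vec_cont {ζ : Fin n → ℝ → ℝ} (h : ∀ j, Continuous (ζ j)) : Continuous (vec ζ) := by
  unfold vec
  exact (PiLp.continuous_toLp 2 _).comp (continuous_pi h)

lemma vec_memLp {ζ : Fin n → ℝ → ℝ} (h : ∀ j, Continuous (ζ j)) : MemLp (vec ζ) 2 μ01 := by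
  obtain ⟨K, hK⟩ := isCompact_Icc.exists_bound_of_continuousOn (s := Icc (0:ℝ) 1)
    (vec_cont h).continuousOn
  refine MemLp.of_bound (vec_cont h).aestronglyMeasurable K ?_
  refine (ae_restrict_iff' measurableSet_Ioo).2 (Eventually.of_forall fun x hx => hK x ⟨hx.1.le, hx.2.le⟩)

def l2 (ζ : Fin n → ℝ → ℝ) (h : ∀ j, Continuous (ζ j)) : L2 n := (vec_memLp h).toLp _

lemma l2_sub {ζ η : Fin n → ℝ → ℝ} (h : ∀ j, Continuous (ζ j)) (h' : ∀ j, Continuous (η j)) :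
    l2 ζ h - l2 η h' = l2 (fun j x => ζ j x - η j x) (fun j => (h j).sub (h' j)) := by
  unfold l2
  rw [← MemLp.toLp_sub]
  congr 1

lemma l2_norm {ζ : Fin n → ℝ → ℝ} (h : ∀ j, Continuous (ζ j)) :
    ‖l2 ζ h‖ ^ 2 = ∫ x in (0:ℝ)..1, ∑ j, ζ j x ^ 2 := by
  rw [← real_inner_self_eq_norm_sq, L2.inner_def, intervalIntegral.integral_of_le zero_le_one,
    integral_Ioc_eq_integral_Ioo]
  refine integral_congr_ae ?_
  filter_upwards [(vec_memLp h).coeFn_toLp] with x hx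
  have : (l2 ζ h) x = vec ζ x := hx
  rw [this, real_inner_self_eq_norm_sq, EuclideanSpace.norm_sq_eq]
  simp [vec]

lemma XT.c1 {f fx ft : ℝ → ℝ → ℝ} (h : XT f fx ft) (t : ℝ) : Continuous fun x => f x t :=
  h.c.comp continuous_id continuous_const

/-- solution operator property -/
def UCl (cf : Cf n) (m : ℕ) (p : Fin n → Fin n → ℝ) (U : ℝ → ℝ → L2 n →L[ℝ] L2 n) : Prop :=
  ∀ (w wx wt : Fin n → ℝ → ℝ → ℝ) (hw : ∀ j, XT (w j) (wx j) (wt j)) (s ρ : ℝ), 0 < ρ →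
    (∀ j t, w j (xs m j) t = ∑ k, p j k * w k (1 - xs m k) t) →
    (∀ j, ∀ x ∈ Icc (0:ℝ) 1, ∀ t, s ≤ t → Lx cf w wx wt j x t = 0) →
    (∀ j x, x ≤ ρ ∨ 1 - ρ ≤ x → w j x s = 0) →
    ∀ t, s ≤ t → U t s (l2 (fun j x => w j x s) fun j => (hw j).c1 s)
      = l2 (fun j x => w j x t) fun j => (hw j).c1 t

/-- cutoff of a function on `[0,1]` -/
lemma cut_fn (z zx : Fin n → ℝ → ℝ) (hzc : ∀ j, Continuous (z j)) (hzxc : ∀ j, Continuous (zx j))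
    (hz : ∀ j, ∀ x ∈ Icc (0:ℝ) 1, HasDerivWithinAt (z j) (zx j x) (Icc 0 1) x) {ε : ℝ} (hε : 0 < ε) :
    ∃ φ φx : Fin n → ℝ → ℝ, ∃ ρ : ℝ, 0 < ρ ∧ ρ ≤ 1 / 2 ∧ (∀ j, Continuous (φ j)) ∧
      (∀ j, Continuous (φx j)) ∧
      (∀ j, ∀ x ∈ Icc (0:ℝ) 1, HasDerivWithinAt (φ j) (φx j x) (Icc 0 1) x) ∧
      (∀ j x, x ≤ ρ ∨ 1 - ρ ≤ x → φ j x = 0) ∧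
      ∫ x in (0:ℝ)..1, ∑ j, (φ j x - z j x) ^ 2 ≤ ε := by
  obtain ⟨K, hK0, hK⟩ : ∃ K, 0 ≤ K ∧ ∀ j, ∀ x ∈ Icc (0:ℝ) 1, |z j x| ≤ K := by
    choose K hK using fun j => isCompact_Icc.exists_bound_of_continuousOn (s := Icc (0:ℝ) 1)
      (hzc j).continuousOn
    refine ⟨∑ j, |K j|, Finset.sum_nonneg fun j _ => abs_nonneg _, fun j x hx => ?_⟩
    exact ((hK j x hx).trans (le_abs_self _)).trans
      (Finset.single_le_sum (f := fun j => |K j|) (fun j _ => abs_nonneg _) (Finset.mem_univ j))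
  set ρ := min (1 / 8) (ε / (4 * (n * K ^ 2) + 1)) with hρ
  have hρ0 : 0 < ρ := by rw [hρ]; positivity
  have hρ1 : ρ ≤ 1 / 8 := min_le_left _ _
  have hρ2 : 4 * ρ * (n * K ^ 2) ≤ ε := by
    have : ρ ≤ ε / (4 * (n * K ^ 2) + 1) := min_le_right _ _
    rw [le_div_iff₀ (by positivity)] at this
    nlinarith
  obtain ⟨X, X1, X2, hX, hX1, -, hX0, hXle, hXa, hXb, -, -, -⟩ := step_fn (show ρ < 2 * ρ by linarith)
  have hX1c : Continuous X1 := continuous_iff_continuousAt.2 fun t => (hX1 t).continuousAt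
  have hXc : Continuous X := continuous_iff_continuousAt.2 fun t => (hX t).continuousAt
  set χ : ℝ → ℝ := fun x => X x * X (1 - x) with hχ
  set χ1 : ℝ → ℝ := fun x => X1 x * X (1 - x) + X x * (-X1 (1 - x)) with hχ1
  have hχd : ∀ x, HasDerivAt χ (χ1 x) x := fun x => by
    refine (hX x).mul ?_
    have h1 : HasDerivAt (fun x : ℝ => 1 - x) (-1) x := (hasDerivAt_id x).const_sub 1
    have := (hX (1 - x)).comp x h1
    exact this.congr_deriv (by ring)
  have hχ0 : ∀ x, 0 ≤ χ x := fun x => mul_nonneg (hX0 _) (hX0 _)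
  have hχle : ∀ x, χ x ≤ 1 := fun x => mul_le_one₀ (hXle _) (hX0 _) (hXle _)
  have hχc : Continuous χ := hXc.mul (hXc.comp (by fun_prop))
  have hχc1 : Continuous χ1 := (hX1c.mul (hXc.comp (by fun_prop))).add
    (hXc.mul (hX1c.comp (by fun_prop)).neg)
  refine ⟨fun j x => χ x * z j x, fun j x => χ1 x * z j x + χ x * zx j x, ρ, hρ0, by linarith,
    fun j => hχc.mul (hzc j), fun j => (hχc1.mul (hzc j)).add (hχc.mul (hzxc j)),
    fun j x hx => (hχd x).hasDerivWithinAt.mul (hz j x hx), ?_, ?_⟩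
  · intro j x hx
    have : χ x = 0 := by
      rcases hx with hx | hx
      · simp [hχ, hXa x hx]
      · simp [hχ, hXa (1 - x) (by linarith)]
    simp [this]
  · set f : ℝ → ℝ := fun x => ∑ j, (χ x * z j x - z j x) ^ 2 with hf
    have hfc : Continuous f := continuous_finsetSum _ fun j _ => ((hχc.mul (hzc j)).sub (hzc j)).pow 2
    have hInt : ∀ a b, IntervalIntegrable f volume a b := fun a b => hfc.intervalIntegrable _ _
    have hfb : ∀ x ∈ Icc (0:ℝ) 1, ‖f x‖ ≤ n * K ^ 2 := by
      intro x hx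
      rw [Real.norm_of_nonneg (Finset.sum_nonneg fun j _ => sq_nonneg _)]
      refine (Finset.sum_le_card_nsmul _ _ (K ^ 2) fun j _ => ?_).trans (by simp)
      have h1 := abs_le.1 (hK j x hx)
      have h2 : (χ x * z j x - z j x) ^ 2 = (1 - χ x) ^ 2 * z j x ^ 2 := by ring
      have h3 : (1 - χ x) ^ 2 ≤ 1 := by nlinarith [hχ0 x, hχle x]
      have h4 : z j x ^ 2 ≤ K ^ 2 := sq_le_sq' h1.1 h1.2
      rw [h2]; nlinarith [sq_nonneg (z j x), sq_nonneg (1 - χ x)]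
    have hmid : ∫ x in (2 * ρ)..(1 - 2 * ρ), f x = 0 := by
      rw [intervalIntegral.integral_congr (g := fun _ => (0:ℝ))]
      · simp
      · intro x hx
        rw [uIcc_of_le (by linarith)] at hx
        have : χ x = 1 := by simp [hχ, hXb x hx.1, hXb (1 - x) (by linarith [hx.2])]
        simp [hf, this]
    have h1 : ∫ x in (0:ℝ)..(2 * ρ), f x ≤ n * K ^ 2 * (2 * ρ) := by
      refine (le_abs_self _).trans ?_
      have := intervalIntegral.norm_integral_le_of_norm_le_const (a := 0) (b := 2 * ρ) (f := f)
        (C := n * K ^ 2) (fun x hx => by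
          rw [uIoc_of_le (by linarith)] at hx
          exact hfb x ⟨hx.1.le, by linarith [hx.2]⟩)
      rwa [sub_zero, abs_of_pos (by linarith)] at this
    have h2 : ∫ x in (1 - 2 * ρ)..(1:ℝ), f x ≤ n * K ^ 2 * (2 * ρ) := by
      refine (le_abs_self _).trans ?_
      have := intervalIntegral.norm_integral_le_of_norm_le_const (a := 1 - 2 * ρ) (b := 1) (f := f)
        (C := n * K ^ 2) (fun x hx => by
          rw [uIoc_of_le (by linarith)] at hx
          exact hfb x ⟨by linarith [hx.1], hx.2⟩)
      rwa [sub_sub_cancel, abs_of_pos (by linarith)] at this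
    have e1 := intervalIntegral.integral_add_adjacent_intervals (hInt 0 (2 * ρ)) (hInt (2 * ρ) (1 - 2 * ρ))
    have e2 := intervalIntegral.integral_add_adjacent_intervals (hInt 0 (1 - 2 * ρ)) (hInt (1 - 2 * ρ) 1)
    rw [← e2, ← e1, hmid]
    linarith

section
variable {cf : Cf n} {m : ℕ} {M : ℝ} (h : cf.OK m M) (p : Fin n → Fin n → ℝ)

include h in
lemma step_est (hp : H3cond n p) {U : ℝ → ℝ → L2 n →L[ℝ] L2 n} (hU : UCl cf m p U)
    {N : ℝ} (hN : 0 < N) {z zx zt : Fin n → ℝ → ℝ → ℝ} (hz : ∀ j, XT (z j) (zx j) (zt j))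
    (hbc : ∀ j t, z j (xs m j) t = ∑ k, p j k * z k (1 - xs m k) t) {G : ℝ} (hG : 0 ≤ G)
    (hg : ∀ j, ∀ x ∈ Icc (0:ℝ) 1, ∀ t, |Lx cf z zx zt j x t| ≤ G) (s : ℝ) :
    ‖l2 (fun j x => z j x (s + N)) (fun j => (hz j).c1 _)
      - U (s + N) s (l2 (fun j x => z j x s) (fun j => (hz j).c1 _))‖
      ≤ Real.sqrt (KE p M * Real.exp (νE p M * N) * N) * G := by
  have hM := h.M1
  have hKE : 0 ≤ KE p M := by
    unfold KE; have := Pq_nonneg p; positivity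
  set C := KE p M * Real.exp (νE p M * N) with hC
  have hC0 : 0 ≤ C := by positivity
  have main : ∀ ε : ℝ, 0 < ε → ‖l2 (fun j x => z j x (s + N)) (fun j => (hz j).c1 _)
      - U (s + N) s (l2 (fun j x => z j x s) (fun j => (hz j).c1 _))‖
      ≤ Real.sqrt (C * ((2 * ε) ^ 2 + N * G ^ 2)) + ‖U (s + N) s‖ * (2 * ε) := by
    intro ε hε
    obtain ⟨φ, φx, ρ, hρ, hρ1, hφc, hφxc, hφ, hφ0, hφe⟩ := cut_fn (fun j x => z j x s)
      (fun j x => zx j x s) (fun j => (hz j).c1 s)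
      (fun j => (hz j).cx.comp continuous_id continuous_const) (fun j x hx => (hz j).dx x hx s)
      (pow_pos hε 2)
    obtain ⟨w, wx, wt, hw, hwb, hwL, hw0, hwe⟩ := ivp0 h p hp hφc hφxc hφ hρ hρ1 hφ0 s (pow_pos hε 2)
    have hUw := hU w wx wt hw s (ρ / 2) (by positivity) hwb hwL hw0 (s + N) (by linarith)
    have n1 : ‖l2 (fun j x => w j x s) (fun j => (hw j).c1 _) - l2 φ hφc‖ ≤ ε := by
      refine le_of_sq_le_sq ?_ hε.le
      rw [l2_sub, l2_norm]; exact hwe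
    have n2 : ‖l2 φ hφc - l2 (fun j x => z j x s) (fun j => (hz j).c1 _)‖ ≤ ε := by
      refine le_of_sq_le_sq ?_ hε.le
      rw [l2_sub, l2_norm]; exact hφe
    have n3 : ‖l2 (fun j x => w j x s) (fun j => (hw j).c1 _)
        - l2 (fun j x => z j x s) (fun j => (hz j).c1 _)‖ ≤ 2 * ε := by
      rw [← sub_add_sub_cancel _ (l2 φ hφc)]
      exact (norm_add_le _ _).trans (by linarith)
    set v : Fin n → ℝ → ℝ → ℝ := fun j x t => z j x t - w j x t with hv
    have hvx : ∀ j, XT (v j) (fun x t => zx j x t - wx j x t) (fun x t => zt j x t - wt j x t) := fun j =>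
      { c := (hz j).c.sub (hw j).c
        ct := (hz j).ct.sub (hw j).ct
        dt := fun x t => ((hz j).dt x t).sub ((hw j).dt x t)
        cx := (hz j).cx.sub (hw j).cx
        dx := fun x hx t => ((hz j).dx x hx t).sub ((hw j).dx x hx t) }
    have hen := energy h p hvx (fun j t => by
      simp only [hv, hbc j t, hwb j t, mul_sub, Finset.sum_sub_distrib])
      (s := s) (t := s + N) (G := G) (by linarith) (by
      intro j x hx t ht
      have e1 := hwL j x hx t ht.1
      have e2 := hg j x hx t
      refine le_of_eq_of_le ?_ e2
      congr 1
      simp only [Lx] at e1 ⊢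
      simp only [hv, mul_sub, Finset.sum_sub_distrib]
      linear_combination (-1 : ℝ) * e1)
    have n4 : ‖l2 (fun j x => z j x (s + N)) (fun j => (hz j).c1 _)
        - l2 (fun j x => w j x (s + N)) (fun j => (hw j).c1 _)‖
        ≤ Real.sqrt (C * ((2 * ε) ^ 2 + N * G ^ 2)) := by
      refine Real.le_sqrt_of_sq_le ?_
      rw [l2_sub, l2_norm]
      refine hen.trans ?_
      rw [add_sub_cancel_left]
      have n5 : Isq v s ≤ (2 * ε) ^ 2 := by
        have e : Isq v s = ‖l2 (fun j x => z j x s) (fun j => (hz j).c1 _)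
            - l2 (fun j x => w j x s) (fun j => (hw j).c1 _)‖ ^ 2 := by
          rw [l2_sub, l2_norm]; rfl
        rw [e, norm_sub_rev]; gcongr
      gcongr
    have n6 : ‖U (s + N) s (l2 (fun j x => w j x s) (fun j => (hw j).c1 _)
        - l2 (fun j x => z j x s) (fun j => (hz j).c1 _))‖ ≤ ‖U (s + N) s‖ * (2 * ε) :=
      ((U (s + N) s).le_opNorm _).trans (by gcongr)
    rw [map_sub, hUw] at n6
    refine le_trans ?_ (add_le_add n4 n6)
    refine le_trans (le_of_eq ?_) (norm_add_le _ _)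
    congr 1; abel
  have hlim : Tendsto (fun ε : ℝ => Real.sqrt (C * ((2 * ε) ^ 2 + N * G ^ 2)) + ‖U (s + N) s‖ * (2 * ε))
      (𝓝[>] 0) (𝓝 (Real.sqrt (C * N) * G)) := by
    have hc : Continuous fun ε : ℝ =>
        Real.sqrt (C * ((2 * ε) ^ 2 + N * G ^ 2)) + ‖U (s + N) s‖ * (2 * ε) := by fun_prop
    have := (hc.tendsto 0).mono_left (nhdsWithin_le_nhds (s := Ioi 0))
    refine this.trans (le_of_eq ?_)
    congr 1
    have e : C * ((2 * 0) ^ 2 + N * G ^ 2) = C * N * G ^ 2 := by ring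
    rw [e, Real.sqrt_mul (by positivity), Real.sqrt_sq hG]; simp
  exact ge_of_tendsto hlim (eventually_nhdsWithin_of_forall fun ε hε => main ε hε)

include h in
/-- The a priori L² estimate from the dichotomy. -/
theorem dich (hp : H3cond n p) {U : ℝ → ℝ → L2 n →L[ℝ] L2 n} (hU : UCl cf m p U)
    (hU1 : ∀ t, U t t = ContinuousLinearMap.id ℝ _) {α M' : ℝ} (hα : 0 < α) (hM' : 1 ≤ M')
    (hd : HasExpDichotomy U α M') : ∃ K : ℝ, 0 ≤ K ∧ ∀ (z zx zt : Fin n → ℝ → ℝ → ℝ),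
      (∀ j, XT (z j) (zx j) (zt j)) →
      (∀ j t, z j (xs m j) t = ∑ k, p j k * z k (1 - xs m k) t) →
      ∀ B G : ℝ, (∀ j, ∀ x ∈ Icc (0:ℝ) 1, ∀ t, |z j x t| ≤ B) → 0 ≤ G →
      (∀ j, ∀ x ∈ Icc (0:ℝ) 1, ∀ t, |Lx cf z zx zt j x t| ≤ G) →
      ∀ t, Isq z t ≤ (K * G) ^ 2 := by
  obtain ⟨N, hN, hest⟩ := dich_abs hU1 hα hM' hd
  refine ⟨2 * (M' + 1) * Real.sqrt (KE p M * Real.exp (νE p M * N) * N), by positivity, ?_⟩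
  intro z zx zt hz hbc B G hB hG hg t
  have hnorm : ∀ t, ‖l2 (fun j x => z j x t) (fun j => (hz j).c1 t)‖ ^ 2 = Isq z t := fun t => by
    rw [l2_norm]; rfl
  have hbd : ∀ t, ‖l2 (fun j x => z j x t) (fun j => (hz j).c1 t)‖ ≤ Real.sqrt (n * B ^ 2) := by
    intro t
    refine Real.le_sqrt_of_sq_le ?_
    rw [hnorm, Isq]
    have hc : Continuous fun x => ∑ j, z j x t ^ 2 :=
      continuous_finsetSum _ fun j _ => ((hz j).c1 t).pow 2
    have := intervalIntegral.integral_mono_on (μ := volume) zero_le_one (f := fun x => ∑ j, z j x t ^ 2)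
      (g := fun _ => n * B ^ 2) (hc.intervalIntegrable _ _) (continuous_const.intervalIntegrable _ _)
      (fun x hx => by
        refine (Finset.sum_le_card_nsmul _ _ (B ^ 2) fun j _ => ?_).trans (by simp)
        have := abs_le.1 (hB j x hx t)
        exact sq_le_sq' this.1 this.2)
    simpa using this
  have := hest (fun t => l2 (fun j x => z j x t) (fun j => (hz j).c1 t)) _ _ hbd
    (fun t => step_est h p hp hU hN hz hbc hG hg t) t
  rw [← hnorm, mul_assoc]
  gcongr
end

end QL
end

section
namespace QL
open scoped Topology
variable {n : ℕ}

lemma contDiff_zero_ext {f fx : ℝ → ℝ} (hfx : Continuous fx)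
    (hd : ∀ x ∈ Icc (0:ℝ) 1, HasDerivWithinAt f (fx x) (Icc 0 1) x) {ρ : ℝ} (hρ : 0 < ρ)
    (h0 : ∀ x, x ≤ ρ ∨ 1 - ρ ≤ x → f x = 0) : ContDiff ℝ 1 f := by
  have hin : ∀ x ∈ Ioo (0:ℝ) 1, HasDerivAt f (fx x) x := fun x hx =>
    (hd x ⟨hx.1.le, hx.2.le⟩).hasDerivAt (Icc_mem_nhds hx.1 hx.2)
  have hout : ∀ x, x ∉ Ioo (0:ℝ) 1 → f =ᶠ[𝓝 x] fun _ => 0 := by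
    intro x hx
    rw [mem_Ioo, not_and_or, not_lt, not_lt] at hx
    rcases hx with hx | hx
    · filter_upwards [Iio_mem_nhds (show x < ρ by linarith)] with y hy using h0 y (Or.inl (le_of_lt hy))
    · filter_upwards [Ioi_mem_nhds (show 1 - ρ < x by linarith)] with y hy using h0 y (Or.inr (le_of_lt hy))
  rw [contDiff_one_iff_deriv]
  constructor
  · intro x
    by_cases hx : x ∈ Ioo (0:ℝ) 1
    · exact (hin x hx).differentiableAt
    · exact (differentiableAt_const (0:ℝ)).congr_of_eventuallyEq (hout x hx)
  · rw [continuous_iff_continuousAt]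
    intro x
    by_cases hx : x ∈ Ioo (0:ℝ) 1
    · refine hfx.continuousAt.congr ?_
      filter_upwards [isOpen_Ioo.mem_nhds hx] with y hy using (hin y hy).deriv.symm
    · have : deriv f =ᶠ[𝓝 x] fun _ => 0 := by
        filter_upwards [(hout x hx).eventuallyEq_nhds] with y hy
        rw [hy.deriv_eq]; simp
      exact continuousAt_const.congr this.symm

lemma BCrel_iff {m : ℕ} {p : Fin n → Fin n → ℝ} (w0 w1 : Fin n → ℝ) :
    BCrel n m p (WithLp.toLp 2 w0) (WithLp.toLp 2 w1) ↔
      ∀ j : Fin n, (if (j : ℕ) < m then w0 j else w1 j) = ∑ k, p j k * (if (k : ℕ) < m then w1 k else w0 k) := by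
  have e : ∀ j : Fin n, (∑ k : Fin n, if m ≤ (k : ℕ) then p j k * (WithLp.toLp 2 w0 : Vn n) k else p j k *
      (WithLp.toLp 2 w1 : Vn n) k) = ∑ k, p j k * (if (k : ℕ) < m then w1 k else w0 k) := by
    intro j
    refine Finset.sum_congr rfl fun k _ => ?_
    by_cases hk : (k : ℕ) < m
    · rw [if_neg (by omega), if_pos hk]
    · rw [if_pos (by omega), if_neg hk]
  unfold BCrel
  refine forall_congr' fun j => ?_
  rw [e]
  by_cases hj : (j : ℕ) < m
  · simp [hj]
  · simp [hj, not_lt.1 hj]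

lemma bc_xs {m : ℕ} {p : Fin n → Fin n → ℝ} (w : Fin n → ℝ → ℝ) :
    BCrel n m p (WithLp.toLp 2 fun j => w j 0) (WithLp.toLp 2 fun j => w j 1) ↔
      ∀ j, w j (xs m j) = ∑ k, p j k * w k (1 - xs m k) := by
  rw [BCrel_iff]
  refine forall_congr' fun j => ?_
  have e1 : w j (xs m j) = if (j : ℕ) < m then w j 0 else w j 1 := by unfold xs; split_ifs <;> rfl
  have e2 : ∀ k, w k (1 - xs m k) = if (k : ℕ) < m then w k 1 else w k 0 := fun k => by
    unfold xs; split_ifs <;> simp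
  simp only [e1, e2]

/-- relation between the coefficients in t-form and in x-form -/
def CfRel (cf : Cf n) (a : ℝ → ℝ → Fin n → ℝ) (b : ℝ → ℝ → Fin n → Fin n → ℝ) : Prop :=
  ∀ x ∈ Icc (0:ℝ) 1, ∀ t j, cf.q j x t * a x t j = 1 ∧
    ∀ u : Fin n → ℝ, ∑ k, b x t j k * u k
      = a x t j * (cf.d j x t * u j + ∑ k, cf.c j k x t * u k)

theorem UCl_of_gen {cf : Cf n} {m : ℕ} {p : Fin n → Fin n → ℝ}
    {a : ℝ → ℝ → Fin n → ℝ} {b : ℝ → ℝ → Fin n → Fin n → ℝ} (hr : CfRel cf a b)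
    {U : ℝ → ℝ → L2 n →L[ℝ] L2 n} (hU : GeneratedBy n m p a b U) : UCl cf m p U := by
  intro w wx wt hw s ρ hρ hbc hL h0 t hst
  obtain ⟨-, -, -, hgen⟩ := hU
  have hv : ∀ {f : Fin n → ℝ → ℝ → ℝ}, (∀ j, CC (f j)) →
      Continuous fun q : ℝ × ℝ => (WithLp.toLp 2 (fun j => f j q.1 q.2) : Vn n) := fun hf =>
    (PiLp.continuous_toLp 2 _).comp (continuous_pi hf)
  have := hgen s (vec fun j x => w j x s) ?_ ?_
    (l2 (fun j x => w j x s) fun j => (hw j).c1 s) (vec_memLp fun j => (hw j).c1 s).coeFn_toLp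
    (fun x t => vec (fun j x => w j x t) x) (fun x t => vec (fun j x => wx j x t) x)
    (fun x t => vec (fun j x => wt j x t) x) ?_ t hst
  · refine Lp.ext ?_
    filter_upwards [this, (vec_memLp fun j => (hw j).c1 t).coeFn_toLp] with x h1 h2
    rw [h1]; exact h2.symm
  · rw [contDiff_euclidean]
    exact fun j => contDiff_zero_ext ((hw j).cx.comp continuous_id continuous_const)
      (fun x hx => (hw j).dx x hx s) hρ (h0 j)
  · refine (closure_minimal (t := Icc ρ (1 - ρ)) ?_ isClosed_Icc).trans ?_
    · intro x hx
      by_contra hc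
      rw [mem_Icc, not_and_or, not_le, not_le] at hc
      refine hx ?_
      have : ∀ j, w j x s = 0 := fun j => h0 j x (hc.imp le_of_lt le_of_lt)
      simp only [vec, this]; rfl
    · exact fun x hx => ⟨by linarith [hx.1], by linarith [hx.2]⟩
  · refine ⟨(hv fun j => (hw j).c).continuousOn, (hv fun j => (hw j).cx).continuousOn,
      (hv fun j => (hw j).ct).continuousOn, fun x hx t ht j => ⟨(hw j).dx x hx t,
        ((hw j).dt x t).hasDerivWithinAt⟩, ?_, ?_, fun x hx => rfl⟩
    · intro x hx t ht j
      obtain ⟨h1, h2⟩ := hr x hx t j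
      have h3 := hL j x hx t ht
      simp only [vec, Lx] at h3 ⊢
      rw [h2]
      linear_combination (a x t j) * h3 - wt j x t * h1
    · intro t ht
      exact (bc_xs fun j x => w j x t).2 fun j => hbc j t

end QL
end

section
namespace QL
open scoped Topology
variable {n : ℕ}

lemma interp {f : ℝ → ℝ} (hc : Continuous f) {Λ I θ : ℝ} (hθ : 0 < θ) (hθ2 : θ ≤ 1 / 2)
    (hΛ : 0 ≤ Λ) (hI : 0 ≤ I)
    (hl : ∀ x y, |f x - f y| ≤ Λ * |x - y|) (hi : ∫ x in (0:ℝ)..1, f x ^ 2 ≤ I ^ 2)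
    {x : ℝ} (hx : x ∈ Icc (0:ℝ) 1) : |f x| ≤ Λ * θ ^ 2 + I / θ := by
  by_contra hcon
  push Not at hcon
  have hθs : θ ^ 2 ≤ 1 / 2 := by nlinarith
  obtain ⟨a, ha0, ha1, hax⟩ : ∃ a : ℝ, 0 ≤ a ∧ a + θ ^ 2 ≤ 1 ∧ ∀ y ∈ Icc a (a + θ ^ 2), |x - y| ≤ θ ^ 2 := by
    by_cases h : x ≤ 1 / 2
    · refine ⟨x, hx.1, by linarith, fun y hy => ?_⟩
      rw [abs_le]; constructor <;> linarith [hy.1, hy.2]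
    · push Not at h
      refine ⟨x - θ ^ 2, by linarith, by linarith [hx.2], fun y hy => ?_⟩
      rw [abs_le]; constructor <;> linarith [hy.1, hy.2]
  have hs : 0 < θ ^ 2 := by positivity
  set A := |f x| - Λ * θ ^ 2 with hA
  have hAI : I / θ < A := by rw [hA]; linarith
  have hA0 : 0 < A := lt_of_le_of_lt (by positivity) hAI
  have hAI2 : I < θ * A := by rw [div_lt_iff₀ hθ] at hAI; linarith
  have hlow : ∀ y ∈ Icc a (a + θ ^ 2), A ^ 2 ≤ f y ^ 2 := by
    intro y hy
    have h1 := hl x y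
    have h2 : Λ * |x - y| ≤ Λ * θ ^ 2 := by gcongr; exact hax y hy
    have h3 := abs_sub_abs_le_abs_sub (f x) (f y)
    have h4 : A ≤ |f y| := by rw [hA]; linarith
    rw [← sq_abs (f y)]
    exact pow_le_pow_left₀ hA0.le h4 2
  have hcf : Continuous fun x => f x ^ 2 := hc.pow 2
  have h1 : ∫ y in a..(a + θ ^ 2), f y ^ 2 ≤ ∫ y in (0:ℝ)..1, f y ^ 2 :=
    intervalIntegral.integral_mono_interval ha0 (by linarith) ha1
      (Eventually.of_forall fun y => sq_nonneg _) (hcf.intervalIntegrable _ _)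
  have h2 : ∫ _y in a..(a + θ ^ 2), A ^ 2 ≤ ∫ y in a..(a + θ ^ 2), f y ^ 2 :=
    intervalIntegral.integral_mono_on (μ := volume) (by linarith)
      (continuous_const.intervalIntegrable _ _) (hcf.intervalIntegrable _ _) hlow
  rw [intervalIntegral.integral_const, smul_eq_mul] at h2
  nlinarith

/-- `cf` is close to `cf0` -/
structure Close (cf cf0 : Cf n) (δ : ℝ) : Prop where
  q : ∀ j, ∀ x ∈ Icc (0:ℝ) 1, ∀ t, |cf.q j x t - cf0.q j x t| ≤ δ
  d : ∀ j, ∀ x ∈ Icc (0:ℝ) 1, ∀ t, |cf.d j x t - cf0.d j x t| ≤ δ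
  c : ∀ j k, ∀ x ∈ Icc (0:ℝ) 1, ∀ t, |cf.c j k x t - cf0.c j k x t| ≤ δ

/-- `L²` bound by the right hand side -/
def DB (cf : Cf n) (m : ℕ) (p : Fin n → Fin n → ℝ) (K : ℝ) : Prop :=
  ∀ (z zx zt : Fin n → ℝ → ℝ → ℝ),
      (∀ j, XT (z j) (zx j) (zt j)) →
      (∀ j t, z j (xs m j) t = ∑ k, p j k * z k (1 - xs m k) t) →
      ∀ B G : ℝ, (∀ j, ∀ x ∈ Icc (0:ℝ) 1, ∀ t, |z j x t| ≤ B) → 0 ≤ G →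
      (∀ j, ∀ x ∈ Icc (0:ℝ) 1, ∀ t, |Lx cf z zx zt j x t| ≤ G) →
      ∀ t, Isq z t ≤ (K * G) ^ 2

/-- the a priori estimate property -/
def AP (cf : Cf n) (m : ℕ) (p : Fin n → Fin n → ℝ) (M : ℝ) (K1 : ℝ) : Prop :=
  ∀ (h : cf.OK m M) (y yt g : E n), Dt y yt → Sol cf m p y (Mop h y + g) → ‖y‖ ≤ K1 * ‖g‖

theorem ap_close {cf0 : Cf n} {m : ℕ} {p : Fin n → Fin n → ℝ} (hp : H3cond n p) {K : ℝ}
    (hK : 0 ≤ K) (hdb : DB cf0 m p K) {M : ℝ} (hM : 1 ≤ M) :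
    ∃ δ1 > 0, ∃ K1, 0 ≤ K1 ∧ ∀ cf : Cf n, Close cf cf0 δ1 → AP cf m p M K1 := by
  have hKS := KS_nonneg p hM
  have hKZ := KZ_nonneg p hM
  set C := 1 + KS p M + KZ p M * (1 + n * M) with hC
  have hC0 : 0 ≤ C := by positivity
  set C4 := n * M + 2 * M * C with hC4
  have hC40 : 0 ≤ C4 := by positivity
  obtain ⟨θ, hθ, hθ2, hθ3⟩ : ∃ θ : ℝ, 0 < θ ∧ θ ≤ 1 / 2 ∧ C4 * θ ^ 2 ≤ 1 / 4 := by
    refine ⟨1 / (2 * (1 + C4)), by positivity, ?_, ?_⟩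
    · rw [div_le_div_iff₀ (by positivity) (by norm_num)]; linarith
    · rw [div_pow, one_pow, mul_one_div, div_le_div_iff₀ (by positivity) (by norm_num)]; nlinarith
  obtain ⟨δ1, hδ1, hδ2⟩ : ∃ δ1 : ℝ, 0 < δ1 ∧ K * (δ1 * ((n + 2) * C)) / θ ≤ 1 / 4 := by
    refine ⟨θ / (4 * (K * ((n + 2) * C) + 1)), by positivity, ?_⟩
    have hP : 0 ≤ K * ((n + 2) * C) := by positivity
    set P := K * ((n + 2) * C) with hP'
    have : K * (θ / (4 * (P + 1)) * ((n + 2) * C)) / θ = P / (4 * (P + 1)) := by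
      rw [hP']; field_simp
    rw [this, div_le_div_iff₀ (by positivity) (by norm_num)]; linarith
  refine ⟨δ1, hδ1, 1 + 2 * (K * (n * M * KS p M) / θ + KS p M), by positivity, ?_⟩
  intro cf hcl h y yt g hyt hy
  set Y := ‖y‖ with hY
  set γ := ‖g‖ with hγ
  have hY0 : 0 ≤ Y := norm_nonneg _
  have hγ0 : 0 ≤ γ := norm_nonneg _
  set z := Top h p y with hz
  set s := Sop h p g with hs
  have hyz : y = z + s := by
    have := (sol_iff h p hp).1 hy
    rw [this, map_add]; rfl
  obtain ⟨v, hv, hvb⟩ := sm_T h p hy hyt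
  have hMy : ‖Mop h y‖ ≤ n * M * Y := (Mop_tame h).b y
  have hsb : ‖s‖ ≤ KS p M * γ := (Sop_tame h p).b g
  have hzb : ‖z‖ ≤ C * (Y + γ) := by
    have e : z = y - s := by rw [hyz]; abel
    have := norm_sub_le y s
    rw [← e] at this
    have h1 : 0 ≤ KZ p M * (1 + n * M) * (Y + γ) := by positivity
    have h2 : 0 ≤ KS p M * Y := by positivity
    rw [hC]; linarith
  have hvb : ‖v‖ ≤ C * (Y + γ) := by
    refine hvb.trans ?_
    have h1 := norm_add_le (Mop h y) g
    have h2 : ‖y‖ + ‖Mop h y + g‖ ≤ (1 + n * M) * (Y + γ) := by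
      have : 0 ≤ n * M * γ := by positivity
      linarith
    have h3 := mul_le_mul_of_nonneg_left h2 hKZ
    have h4 : 0 ≤ (1 + KS p M) * (Y + γ) := by positivity
    rw [hC]; linarith
  have hsz : Sol cf m p z (Mop h y) := (sol_iff h p hp).2 rfl
  have hxt := fun j => hsz.xt h hv j
  set G := δ1 * ((n + 2) * C) * (Y + γ) + n * M * KS p M * γ with hG
  have hG0 : 0 ≤ G := by positivity
  have hL : ∀ j, ∀ x ∈ Icc (0:ℝ) 1, ∀ t, |Lx cf0 (cp z) (fun j x t => cp (Mop h y) j x t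
      - cf.d j x t * cp z j x t - cf.q j x t * cp v j x t) (cp v) j x t| ≤ G := by
    intro j x hx t
    have e : Lx cf0 (cp z) (fun j x t => cp (Mop h y) j x t
      - cf.d j x t * cp z j x t - cf.q j x t * cp v j x t) (cp v) j x t
      = -(cf.d j x t - cf0.d j x t) * cp z j x t - (cf.q j x t - cf0.q j x t) * cp v j x t
        - ∑ k, (cf.c j k x t - cf0.c j k x t) * cp z k x t - ∑ k, cf.c j k x t * cp s k x t := by
      unfold Lx
      rw [cp_Mop]
      unfold Mr
      have : ∑ k, cf.c j k x t * cp y k x t = ∑ k, cf.c j k x t * cp z k x t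
          + ∑ k, cf.c j k x t * cp s k x t := by
        rw [← Finset.sum_add_distrib]
        refine Finset.sum_congr rfl fun k _ => ?_
        rw [hyz, cp_add]; ring
      simp only [sub_mul, Finset.sum_sub_distrib]
      linear_combination -this
    rw [e]
    have b1 : |-(cf.d j x t - cf0.d j x t) * cp z j x t| ≤ δ1 * ‖z‖ := by
      rw [abs_mul, abs_neg]
      exact mul_le_mul (hcl.d j x hx t) (cp_le _ _ _ _) (abs_nonneg _) hδ1.le
    have b2 : |(cf.q j x t - cf0.q j x t) * cp v j x t| ≤ δ1 * ‖v‖ := by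
      rw [abs_mul]
      exact mul_le_mul (hcl.q j x hx t) (cp_le _ _ _ _) (abs_nonneg _) hδ1.le
    have b3 : |∑ k, (cf.c j k x t - cf0.c j k x t) * cp z k x t| ≤ n * (δ1 * ‖z‖) := by
      refine (Finset.abs_sum_le_sum_abs _ _).trans ((Finset.sum_le_card_nsmul _ _ (δ1 * ‖z‖) fun k _ => ?_).trans (by simp))
      rw [abs_mul]
      exact mul_le_mul (hcl.c j k x hx t) (cp_le _ _ _ _) (abs_nonneg _) hδ1.le
    have b4 : |∑ k, cf.c j k x t * cp s k x t| ≤ n * M * ‖s‖ := csum_le h.bc s j x t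
    have b5 : n * M * ‖s‖ ≤ n * M * (KS p M * γ) := by gcongr
    have b6 : δ1 * ‖z‖ ≤ δ1 * (C * (Y + γ)) := by gcongr
    have b7 : δ1 * ‖v‖ ≤ δ1 * (C * (Y + γ)) := by gcongr
    have b8 : n * (δ1 * ‖z‖) ≤ n * (δ1 * (C * (Y + γ))) := by gcongr
    have t1 := abs_sub (-(cf.d j x t - cf0.d j x t) * cp z j x t - (cf.q j x t - cf0.q j x t) * cp v j x t
        - ∑ k, (cf.c j k x t - cf0.c j k x t) * cp z k x t) (∑ k, cf.c j k x t * cp s k x t)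
    have t2 := abs_sub (-(cf.d j x t - cf0.d j x t) * cp z j x t - (cf.q j x t - cf0.q j x t) * cp v j x t)
        (∑ k, (cf.c j k x t - cf0.c j k x t) * cp z k x t)
    have t3 := abs_sub (-(cf.d j x t - cf0.d j x t) * cp z j x t) ((cf.q j x t - cf0.q j x t) * cp v j x t)
    rw [hG]
    linarith
  have hI := hdb (cp z) _ _ hxt hsz.bc ‖z‖ G (fun j x _ t => cp_le z j x t) hG0 hL
  have hz2 : ‖z‖ ≤ C4 * (Y + γ) * θ ^ 2 + K * G / θ := by
    refine E_norm_le (by positivity) fun j x t => ?_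
    rw [← hsz.clp j x t]
    have hcz : ∀ k, Continuous fun x => cp z k x t := fun k =>
      (cp_cc z k).comp continuous_id continuous_const
    refine interp (f := fun x => cp z j x t) (hcz j) hθ hθ2 (by positivity) (by positivity)
      (fun x x' => (Sol.lip_x h hsz hv j x x' t).trans ?_) ?_ (cl_mem x)
    · gcongr
      have a1 : M * ‖z‖ ≤ M * (C * (Y + γ)) := by gcongr
      have a2 : M * ‖v‖ ≤ M * (C * (Y + γ)) := by gcongr
      have a3 : 0 ≤ n * M * γ := by positivity
      rw [hC4]; linarith
    · refine le_trans ?_ (hI t)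
      unfold Isq
      refine intervalIntegral.integral_mono_on (μ := volume) zero_le_one
        (((hcz j).pow 2).intervalIntegrable _ _)
        ((continuous_finsetSum _ fun k _ => (hcz k).pow 2).intervalIntegrable _ _) fun x _ => ?_
      exact Finset.single_le_sum (f := fun k => cp z k x t ^ 2) (fun k _ => sq_nonneg _) (Finset.mem_univ j)
  have hyn : Y ≤ ‖z‖ + ‖s‖ := by rw [hY, hyz]; exact norm_add_le _ _
  have f1 : C4 * (Y + γ) * θ ^ 2 ≤ 1 / 4 * (Y + γ) := by
    have := mul_le_mul_of_nonneg_right hθ3 (add_nonneg hY0 hγ0)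
    linarith
  have f2 : K * G / θ ≤ 1 / 4 * (Y + γ) + K * (n * M * KS p M) / θ * γ := by
    have := mul_le_mul_of_nonneg_right hδ2 (add_nonneg hY0 hγ0)
    have e : K * G / θ = K * (δ1 * ((n + 2) * C)) / θ * (Y + γ) + K * (n * M * KS p M) / θ * γ := by
      rw [hG]; ring
    rw [e]; linarith
  linarith

end QL
end

section
namespace QL
open scoped Topology
variable {n : ℕ}

lemma Dt.clamped {y yt : E n} (h : Dt y yt) (hc : Clamped y) : Clamped yt := fun j x t => by
  refine (h j (cl x) t).unique ?_
  have : cp y j (cl x) = cp y j x := funext fun t => hc j x t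
  rw [this]; exact h j x t

lemma Dt.per {y yt : E n} {T : ℝ} (h : Dt y yt) (hc : Per T y) : Per T yt := fun j x t => by
  have h1 := (h j x (t + T)).comp_add_const t T
  have : (fun s => cp y j x (s + T)) = cp y j x := funext fun t => hc j x t
  rw [this] at h1
  exact h1.unique (h j x t)

lemma Dt.bcs {y yt : E n} {m : ℕ} {p : Fin n → Fin n → ℝ} (h : Dt y yt) (hc : BCs m p y) :
    BCs m p yt := fun j t => by
  have h1 : HasDerivAt (fun t => ∑ k, p j k * cp y k (1 - xs m k) t)
      (∑ k, p j k * cp yt k (1 - xs m k) t) t :=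
    HasDerivAt.fun_sum fun k _ => (h k _ t).const_mul _
  have : (fun t => ∑ k, p j k * cp y k (1 - xs m k) t) = cp y j (xs m j) :=
    funext fun t => (hc j t).symm
  rw [this] at h1
  exact (h j _ t).unique h1

/-- second derivatives of the coefficients -/
structure Cf.OK2 (cf : Cf n) (M : ℝ) (qtt dtt : Fin n → ℝ → ℝ → ℝ)
    (ctt : Fin n → Fin n → ℝ → ℝ → ℝ) : Prop where
  q : ∀ j, TD (cf.qt j) (qtt j)
  d : ∀ j, TD (cf.dt j) (dtt j)
  c : ∀ j k, TD (cf.ct j k) (ctt j k)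
  bq : ∀ j x t, |qtt j x t| ≤ M
  bd : ∀ j x t, |dtt j x t| ≤ M
  bc : ∀ j k x t, |ctt j k x t| ≤ M

/-- coefficients of the differentiated equation -/
def cfd (cf : Cf n) (qtt : Fin n → ℝ → ℝ → ℝ) : Cf n :=
  { cf with
    d := fun j x t => cf.d j x t + cf.qt j x t
    dt := fun j x t => cf.dt j x t + qtt j x t }

lemma cfd_ok {cf : Cf n} {m : ℕ} {M : ℝ} (h : cf.OK m M) {qtt dtt ctt} (h2 : cf.OK2 M qtt dtt ctt) :
    (cfd cf qtt).OK m (2 * M) := by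
  have hM := h.M1
  have h' : cf.OK m (2 * M) := h.mono (by linarith)
  exact { h' with
    dTD := fun j => ⟨(h.dTD j).c.add (h.qXT j).ct, (h.dTD j).ct.add (h2.q j).ct,
      fun x t => ((h.dTD j).dt x t).add ((h2.q j).dt x t)⟩
    bd := fun j x t => (abs_add_le _ _).trans (by linarith [h.bd j x t, h.bqt j x t])
    bdt := fun j x t => (abs_add_le _ _).trans (by linarith [h.bdt j x t, h2.bq j x t]) }

/-- constant of `gain` -/
def KV (p : Fin n → Fin n → ℝ) (M : ℝ) : ℝ := K2 p M + 2 * KT p M * KS p M + KS p M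

lemma KV_nonneg (p : Fin n → Fin n → ℝ) {M : ℝ} (hM : 1 ≤ M) : 0 ≤ KV p M := by
  have := K2_nonneg p hM; have := KT_nonneg p hM; have := KS_nonneg p hM
  unfold KV; positivity

/-- regularity gain in time -/
lemma gain {cf : Cf n} {m : ℕ} {M : ℝ} (h : cf.OK m M) {p : Fin n → Fin n → ℝ} (hp : H3cond n p)
    {T : ℝ} (hT : 0 < T) {u g gt : E n} (hu : u ∈ XP n T) (he : u = Top h p u + Sop h p g)
    (hg : Dt g gt) : ∃ ut, Dt u ut ∧ ‖ut‖ ≤ KV p M * (‖u‖ + ‖g‖ + ‖gt‖) := by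
  have hM := h.M1
  have k1 := K2_nonneg p hM
  have k2 := KT_nonneg p hM
  have k3 := KS_nonneg p hM
  obtain ⟨w, hw, hwb⟩ := T2_lip h p hp hT hu
  obtain ⟨s, hs, hsb⟩ := (Sop_tame h p).d _ _ hg
  obtain ⟨r, hr, hrb⟩ := (Top_tame h p).d _ _ hs
  have hb := (Sop_tame h p).b g
  have e : u = Top h p (Top h p u) + Top h p (Sop h p g) + Sop h p g := by
    rw [← map_add, ← he, ← he]
  refine ⟨w + r + s, ?_, ?_⟩
  · rw [e]; exact (hw.add hr).add hs
  · have t1 := norm_add_le (w + r) s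
    have t2 := norm_add_le w r
    have t3 : KT p M * (‖Sop h p g‖ + ‖s‖) ≤ KT p M * (KS p M * ‖g‖ + KS p M * (‖g‖ + ‖gt‖)) := by
      gcongr
    have q1 : 0 ≤ KT p M * KS p M * ‖gt‖ := by positivity
    have q2 : 0 ≤ K2 p M * (‖g‖ + ‖gt‖) := by positivity
    have q3 : 0 ≤ 2 * KT p M * KS p M * ‖u‖ := by positivity
    have q4 : 0 ≤ KS p M * ‖u‖ := by positivity
    unfold KV
    linarith

/-- bounded below, hence solvable -/
lemma lin_solve0 {cf : Cf n} {m : ℕ} {M K1 : ℝ} (h : cf.OK m M) {p : Fin n → Fin n → ℝ}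
    (hp : H3cond n p) {T : ℝ} (hT : 0 < T) (hc : cf.Per T) (hK1 : 0 ≤ K1) (hap : AP cf m p M K1)
    {g : E n} (hg : Per T g) : ∃ u ∈ XP n T, u = Top h p u + Sop h p g := by
  have hM := h.M1
  have hκ : 0 < 1 / (K1 * (n * M) + 1) := by positivity
  obtain ⟨u, hu, he⟩ := per_solve h p hp hT hc hκ (fun u ut hu hut => by
    set r := u - Top h p u with hr
    obtain ⟨v, hv, -⟩ := (Top_tame h p).d _ _ hut
    have hs : Sol cf m p (Top h p u) (Mop h (Top h p u) + Mop h r) := by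
      rw [← map_add, hr, add_sub_cancel]
      exact (sol_iff h p hp).2 rfl
    have h1 := hap h _ _ _ hv hs
    have h2 := (Mop_tame h).b r
    have h3 : ‖u‖ ≤ ‖Top h p u‖ + ‖r‖ := by
      calc ‖u‖ = ‖Top h p u + r‖ := by rw [hr, add_sub_cancel]
        _ ≤ _ := norm_add_le _ _
    have h4 : K1 * ‖Mop h r‖ ≤ K1 * (n * M * ‖r‖) := by gcongr
    rw [one_div, inv_mul_le_iff₀ (by positivity)]
    linarith) (Sop h p g) (Sop_XP h p hp hc hg)
  exact ⟨u, hu, by rw [← he]; abel⟩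

/-- right-hand side of the differentiated equation -/
def gd (cf : Cf n) (y gt : E n) (j : Fin n) (x t : ℝ) : ℝ :=
  cp gt j x t - ∑ k, cf.ct j k x t * cp y k x t - cf.dt j x t * cp y j x t

def gdt (cf : Cf n) (dtt : Fin n → ℝ → ℝ → ℝ) (ctt : Fin n → Fin n → ℝ → ℝ → ℝ)
    (y yt gtt : E n) (j : Fin n) (x t : ℝ) : ℝ :=
  cp gtt j x t - ∑ k, (ctt j k x t * cp y k x t + cf.ct j k x t * cp yt k x t)
    - (dtt j x t * cp y j x t + cf.dt j x t * cp yt j x t)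

section
variable {cf : Cf n} {m : ℕ} {M : ℝ} (h : cf.OK m M)
include h

lemma gd_cc (y gt : E n) (j : Fin n) : CC (gd cf y gt j) :=
  Continuous.sub (Continuous.sub (cp_cc gt j)
    (continuous_finsetSum _ fun k _ => Continuous.mul (h.cXT j k).ct (cp_cc y k)))
    (Continuous.mul (h.dTD j).ct (cp_cc y j))

lemma gd_le (y gt : E n) (j : Fin n) (x t : ℝ) : |gd cf y gt j x t| ≤ ‖gt‖ + (n + 1) * M * ‖y‖ := by
  have hM : 0 ≤ M := zero_le_one.trans h.M1
  have t1 := abs_sub (cp gt j x t - ∑ k, cf.ct j k x t * cp y k x t) (cf.dt j x t * cp y j x t)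
  have t2 := abs_sub (cp gt j x t) (∑ k, cf.ct j k x t * cp y k x t)
  have b1 : |∑ k, cf.ct j k x t * cp y k x t| ≤ n * M * ‖y‖ := csum_le h.bct y j x t
  have b2 : |cf.dt j x t * cp y j x t| ≤ M * ‖y‖ := by
    rw [abs_mul]; exact mul_le_mul (h.bdt _ _ _) (cp_le _ _ _ _) (abs_nonneg _) hM
  have b3 := cp_le gt j x t
  unfold gd; linarith

lemma gdt_cc {qtt dtt ctt} (h2 : cf.OK2 M qtt dtt ctt) (y yt gtt : E n) (j : Fin n) :
    CC (gdt cf dtt ctt y yt gtt j) :=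
  Continuous.sub (Continuous.sub (cp_cc gtt j)
    (continuous_finsetSum _ fun k _ => (Continuous.mul (h2.c j k).ct (cp_cc y k)).add
      (Continuous.mul (h.cXT j k).ct (cp_cc yt k))))
    ((Continuous.mul (h2.d j).ct (cp_cc y j)).add (Continuous.mul (h.dTD j).ct (cp_cc yt j)))

lemma gdt_le {qtt dtt ctt} (h2 : cf.OK2 M qtt dtt ctt) (y yt gtt : E n) (j : Fin n) (x t : ℝ) :
    |gdt cf dtt ctt y yt gtt j x t| ≤ ‖gtt‖ + (n + 1) * M * (‖y‖ + ‖yt‖) := by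
  have hM : 0 ≤ M := zero_le_one.trans h.M1
  unfold gdt
  rw [Finset.sum_add_distrib]
  have t1 := abs_sub (cp gtt j x t - (∑ k, ctt j k x t * cp y k x t + ∑ k, cf.ct j k x t * cp yt k x t))
    (dtt j x t * cp y j x t + cf.dt j x t * cp yt j x t)
  have t2 := abs_sub (cp gtt j x t) (∑ k, ctt j k x t * cp y k x t + ∑ k, cf.ct j k x t * cp yt k x t)
  have t3 := abs_add_le (∑ k, ctt j k x t * cp y k x t) (∑ k, cf.ct j k x t * cp yt k x t)
  have t4 := abs_add_le (dtt j x t * cp y j x t) (cf.dt j x t * cp yt j x t)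
  have b1 : |∑ k, cf.ct j k x t * cp yt k x t| ≤ n * M * ‖yt‖ := csum_le h.bct yt j x t
  have b1' : |∑ k, ctt j k x t * cp y k x t| ≤ n * M * ‖y‖ := csum_le h2.bc y j x t
  have b2 : |cf.dt j x t * cp yt j x t| ≤ M * ‖yt‖ := by
    rw [abs_mul]; exact mul_le_mul (h.bdt _ _ _) (cp_le _ _ _ _) (abs_nonneg _) hM
  have b2' : |dtt j x t * cp y j x t| ≤ M * ‖y‖ := by
    rw [abs_mul]; exact mul_le_mul (h2.bd _ _ _) (cp_le _ _ _ _) (abs_nonneg _) hM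
  have b3 := cp_le gtt j x t
  linarith

/-- the differentiated equation -/
lemma Sol.dt {qtt dtt ctt} (h2 : cf.OK2 M qtt dtt ctt) {p : Fin n → Fin n → ℝ} {y yt g gt g' : E n}
    (hy : Sol cf m p y (Mop h y + g)) (hyt : Dt y yt) (hg : Dt g gt) (hg' : cp g' = gd cf y gt) :
    Sol (cfd cf qtt) m p yt (Mop (cfd_ok h h2) yt + g') where
  clp := hyt.clamped hy.clp
  bc := hyt.bcs hy.bc
  al j := by
    have hr : TD (fun x t => cp (Mop h y + g) j x t - cf.d j x t * cp y j x t)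
        (fun x t => (Mrt cf y yt j x t + cp gt j x t) -
          (cf.dt j x t * cp y j x t + cf.d j x t * cp yt j x t)) :=
      ⟨Sol.rcc h y _ j, Continuous.sub (Continuous.add (Mrt_cc h y yt j) (cp_cc gt j))
        ((h.dTD j).mul (hyt.td j)).ct, fun x t =>
          (((Mop_dt h hyt).add hg) j x t).sub (((h.dTD j).mul (hyt.td j)).dt x t)⟩
    have := (hy.al j).dt (h.qok j) (hyt.td j) hr
    have e : (fun x t => cp (Mop (cfd_ok h h2) yt + g') j x t - (cfd cf qtt).d j x t * cp yt j x t)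
      = fun x t => (Mrt cf y yt j x t + cp gt j x t) -
          (cf.dt j x t * cp y j x t + cf.d j x t * cp yt j x t) - cf.qt j x t * cp yt j x t := by
      funext x t
      rw [cp_add, cp_Mop, hg']
      simp only [Mr, Mrt, gd, cfd, Finset.sum_add_distrib]
      ring
    rw [e]; exact this
end

/-- linear periodic problem with second order estimates -/
theorem lin_solve (p : Fin n → Fin n → ℝ) (hp : H3cond n p) {M K1 : ℝ} (hM : 1 ≤ M) (hK1 : 0 ≤ K1) :
    ∃ K3, 0 ≤ K3 ∧ ∀ (m : ℕ) (cf : Cf n) (h : cf.OK m M) (qtt dtt ctt) (_ : cf.OK2 M qtt dtt ctt)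
      (T : ℝ) (_ : 0 < T) (_ : cf.Per T) (_ : AP cf m p M K1) (g gt gtt : E n) (G : ℝ),
      Per T g → Dt g gt → Dt gt gtt → ‖g‖ ≤ G → ‖gt‖ ≤ G → ‖gtt‖ ≤ G →
      ∃ y yt ytt : E n, Per T y ∧ Dt y yt ∧ Dt yt ytt ∧ Sol cf m p y (Mop h y + g) ∧
        ‖y‖ ≤ K3 * G ∧ ‖yt‖ ≤ K3 * G ∧ ‖ytt‖ ≤ K3 * G := by
  have hv := KV_nonneg p hM
  have hv2 := KV_nonneg p (M := 2 * M) (by linarith)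
  set k1 := KV p M * (K1 + 2) with hk1
  set k2 := KV p (2 * M) * (k1 + (1 + (n + 1) * M * K1) + (1 + (n + 1) * M * (K1 + k1))) with hk2
  have hk10 : 0 ≤ k1 := by positivity
  have hk20 : 0 ≤ k2 := by positivity
  refine ⟨K1 + k1 + k2, by positivity, ?_⟩
  intro m cf h qtt dtt ctt h2 T hT hc hap g gt gtt G hgp hg hgt b0 b1 b2
  have hG : 0 ≤ G := (norm_nonneg _).trans b0
  obtain ⟨y, hyX, he⟩ := lin_solve0 h hp hT hc hK1 hap hgp
  obtain ⟨yt, hyt, hytb⟩ := gain h hp hT hyX he hg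
  have hs : Sol cf m p y (Mop h y + g) := (sol_iff h p hp).2 (by rw [map_add]; exact he)
  have c0 : ‖y‖ ≤ K1 * G := (hap h _ _ _ hyt hs).trans (by gcongr)
  have c1 : ‖yt‖ ≤ k1 * G := by
    refine hytb.trans ?_
    rw [hk1, mul_assoc]
    gcongr
    linarith
  set g' := mkE (gd cf y gt) (gd_cc h y gt) _ (gd_le h y gt) with hg'
  set g'' := mkE (gdt cf dtt ctt y yt gtt) (gdt_cc h h2 y yt gtt) _ (gdt_le h h2 y yt gtt) with hg''
  have hd : Dt g' g'' := fun j x t => by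
    refine HasDerivAt.sub (HasDerivAt.sub (hgt j x t) (HasDerivAt.fun_sum fun k _ => ?_)) ?_
    · exact ((h2.c j k).dt x t).mul (hyt k x t)
    · exact ((h2.d j).dt x t).mul (hyt j x t)
  have hs' := Sol.dt h h2 hs hyt hg (g' := g') rfl
  have he' := (sol_iff (cfd_ok h h2) p hp).1 hs'
  rw [map_add] at he'
  have hX' : yt ∈ XP n T := ⟨hyt.clamped hyX.1, hyt.per hyX.2⟩
  obtain ⟨ytt, hytt, hyttb⟩ := gain (cfd_ok h h2) hp hT hX' he' hd
  have n1 : ‖g'‖ ≤ (1 + (n + 1) * M * K1) * G := by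
    refine (E_norm_le (by positivity) (gd_le h y gt)).trans ?_
    have : (n + 1) * M * ‖y‖ ≤ (n + 1) * M * (K1 * G) := by gcongr
    linarith
  have n2 : ‖g''‖ ≤ (1 + (n + 1) * M * (K1 + k1)) * G := by
    refine (E_norm_le (by positivity) (gdt_le h h2 y yt gtt)).trans ?_
    have : (n + 1) * M * (‖y‖ + ‖yt‖) ≤ (n + 1) * M * (K1 * G + k1 * G) := by gcongr
    linarith
  have c2 : ‖ytt‖ ≤ k2 * G := by
    refine hyttb.trans ?_
    rw [hk2, mul_assoc]
    gcongr
    linarith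
  refine ⟨y, yt, ytt, hyX.2, hyt, hytt, hs, ?_, ?_, ?_⟩
  · have : 0 ≤ (k1 + k2) * G := by positivity
    linarith
  · have : 0 ≤ (K1 + k2) * G := by positivity
    linarith
  · have : 0 ≤ (K1 + k1) * G := by positivity
    linarith

end QL
end

section
namespace QL
open scoped Topology
variable {n : ℕ}

/-- smooth bounded functions; second time derivative only under `P` -/
def SX (P : Prop) (M : ℝ) (h : ℝ → ℝ → ℝ) : Prop :=
  ∃ hx ht, XT h hx ht ∧ (∀ x t, |h x t| ≤ M ∧ |hx x t| ≤ M ∧ |ht x t| ≤ M) ∧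
    (P → ∃ htt, TD ht htt ∧ ∀ x t, |htt x t| ≤ M)

lemma mul_bd {a b M M' : ℝ} (h : |a| ≤ M) (h' : |b| ≤ M') : |a * b| ≤ M * M' := by
  rw [abs_mul]; exact mul_le_mul h h' (abs_nonneg _) ((abs_nonneg _).trans h)

lemma SX.mono {P : Prop} {M M' : ℝ} {h : ℝ → ℝ → ℝ} (H : SX P M h) (hM : M ≤ M') : SX P M' h := by
  obtain ⟨hx, ht, h1, h2, h3⟩ := H
  refine ⟨hx, ht, h1, fun x t => ⟨(h2 x t).1.trans hM, (h2 x t).2.1.trans hM, (h2 x t).2.2.trans hM⟩,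
    fun hP => ?_⟩
  obtain ⟨htt, h4, h5⟩ := h3 hP
  exact ⟨htt, h4, fun x t => (h5 x t).trans hM⟩

lemma SX.zero (P : Prop) {M : ℝ} (hM : 0 ≤ M) : SX P M (fun _ _ => 0) :=
  ⟨fun _ _ => 0, fun _ _ => 0, ⟨⟨continuous_const, continuous_const, fun _ _ => hasDerivAt_const _ _⟩,
    continuous_const, fun _ _ _ => hasDerivWithinAt_const _ _ _⟩, by simp [hM],
    fun _ => ⟨fun _ _ => 0, ⟨continuous_const, continuous_const, fun _ _ => hasDerivAt_const _ _⟩, by simp [hM]⟩⟩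

lemma TD.add' {f ft g gt : ℝ → ℝ → ℝ} (hf : TD f ft) (hg : TD g gt) :
    TD (fun x t => f x t + g x t) (fun x t => ft x t + gt x t) where
  c := Continuous.add hf.c hg.c
  ct := Continuous.add hf.ct hg.ct
  dt x t := (hf.dt x t).add (hg.dt x t)

lemma TD.neg' {f ft : ℝ → ℝ → ℝ} (hf : TD f ft) :
    TD (fun x t => -f x t) (fun x t => -ft x t) where
  c := Continuous.neg hf.c
  ct := Continuous.neg hf.ct
  dt x t := (hf.dt x t).neg

lemma XT.mul' {f fx ft g gx gt : ℝ → ℝ → ℝ} (hf : XT f fx ft) (hg : XT g gx gt) :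
    XT (fun x t => f x t * g x t) (fun x t => fx x t * g x t + f x t * gx x t)
      (fun x t => ft x t * g x t + f x t * gt x t) where
  toTD := hf.toTD.mul hg.toTD
  cx := Continuous.add (Continuous.mul hf.cx hg.c) (Continuous.mul hf.c hg.cx)
  dx x hx t := (hf.dx x hx t).mul (hg.dx x hx t)

lemma SX.mul {P : Prop} {M M' : ℝ} {f g : ℝ → ℝ → ℝ} (hf : SX P M f) (hg : SX P M' g) :
    SX P (4 * M * M') (fun x t => f x t * g x t) := by
  obtain ⟨fx, ft, f1, f2, f3⟩ := hf
  obtain ⟨gx, gt, g1, g2, g3⟩ := hg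
  have hM : 0 ≤ M := (abs_nonneg _).trans (f2 0 0).1
  have hM' : 0 ≤ M' := (abs_nonneg _).trans (g2 0 0).1
  have hMM : 0 ≤ M * M' := by positivity
  refine ⟨_, _, f1.mul' g1, fun x t => ⟨?_, ?_, ?_⟩, fun hP => ?_⟩
  · have := mul_bd (f2 x t).1 (g2 x t).1
    linarith
  · have a1 := mul_bd (f2 x t).2.1 (g2 x t).1
    have a2 := mul_bd (f2 x t).1 (g2 x t).2.1
    refine (abs_add_le _ _).trans ?_
    linarith
  · have a1 := mul_bd (f2 x t).2.2 (g2 x t).1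
    have a2 := mul_bd (f2 x t).1 (g2 x t).2.2
    refine (abs_add_le _ _).trans ?_
    linarith
  · obtain ⟨ftt, f4, f5⟩ := f3 hP
    obtain ⟨gtt, g4, g5⟩ := g3 hP
    refine ⟨_, (f4.mul g1.toTD).add' (f1.toTD.mul g4), fun x t => ?_⟩
    have a1 := mul_bd (f5 x t) (g2 x t).1
    have a2 := mul_bd (f2 x t).2.2 (g2 x t).2.2
    have a3 := mul_bd (f2 x t).1 (g5 x t)
    refine (abs_add_le _ _).trans ?_
    have b1 := abs_add_le (ftt x t * g x t) (ft x t * gt x t)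
    have b2 := abs_add_le (ft x t * gt x t) (f x t * gtt x t)
    linarith

lemma SX.inv {P : Prop} {M R : ℝ} {f : ℝ → ℝ → ℝ} (hf : SX P M f) (hM : 1 ≤ M) (hR : 1 ≤ R)
    (hl : ∀ x t, 1 ≤ R * |f x t|) : SX P (3 * M ^ 2 * R ^ 3) (fun x t => (f x t)⁻¹) := by
  obtain ⟨fx, ft, f1, f2, f3⟩ := hf
  have h0 : ∀ x t, f x t ≠ 0 := fun x t e => by have := hl x t; rw [e] at this; norm_num at this
  have hr : ∀ x t, |(f x t)⁻¹| ≤ R := fun x t => by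
    rw [abs_inv, inv_le_iff_one_le_mul₀ (abs_pos.2 (h0 x t))]; exact hl x t
  have hc : CC fun x t => (f x t)⁻¹ := Continuous.inv₀ f1.c fun z => h0 _ _
  have hXT : XT (fun x t => (f x t)⁻¹) (fun x t => -(fx x t * ((f x t)⁻¹ * (f x t)⁻¹)))
      (fun x t => -(ft x t * ((f x t)⁻¹ * (f x t)⁻¹))) :=
    ⟨⟨hc, (Continuous.mul f1.ct (Continuous.mul hc hc)).neg, fun x t => by
      refine ((f1.dt x t).fun_inv (h0 x t)).congr_deriv ?_
      have := h0 x t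
      field_simp⟩, (Continuous.mul f1.cx (Continuous.mul hc hc)).neg, fun x hx t => by
      refine ((f1.dx x hx t).fun_inv (h0 x t)).congr_deriv ?_
      have := h0 x t
      field_simp⟩
  have e1 : M * (R * R) ≤ M ^ 2 * R ^ 3 := by
    have : 0 ≤ M * (R * R) := by positivity
    have h2 : 1 ≤ M * R := by nlinarith
    nlinarith
  have e2 : R ≤ M ^ 2 * R ^ 3 := by
    refine le_trans ?_ e1
    have : 1 ≤ M * R := by nlinarith
    nlinarith
  have e0 : 0 ≤ M ^ 2 * R ^ 3 := by positivity
  have b1 : ∀ x t, |-(ft x t * ((f x t)⁻¹ * (f x t)⁻¹))| ≤ M * (R * R) := fun x t => by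
    rw [abs_neg]; exact mul_bd (f2 x t).2.2 (mul_bd (hr x t) (hr x t))
  refine ⟨_, _, hXT, fun x t => ⟨?_, ?_, ?_⟩, fun hP => ?_⟩
  · linarith [hr x t]
  · rw [abs_neg]
    have := mul_bd (f2 x t).2.1 (mul_bd (hr x t) (hr x t))
    linarith
  · linarith [b1 x t]
  · obtain ⟨ftt, f4, f5⟩ := f3 hP
    refine ⟨_, (f4.mul (hXT.toTD.mul hXT.toTD)).neg', fun x t => ?_⟩
    rw [abs_neg]
    have a1 := mul_bd (f5 x t) (mul_bd (hr x t) (hr x t))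
    have a2 := mul_bd (b1 x t) (hr x t)
    have a3 := mul_bd (hr x t) (b1 x t)
    have a4 := mul_bd (f2 x t).2.2 ((abs_add_le _ _).trans (add_le_add a2 a3))
    refine (abs_add_le _ _).trans ((add_le_add a1 a4).trans ?_)
    have : M * (M * (R * R) * R + R * (M * (R * R))) = 2 * (M ^ 2 * R ^ 3) := by ring
    rw [this]; linarith

/-- paths in a domain -/
structure Pth {X : Type*} [NormedAddCommGroup X] [NormedSpace ℝ X] (D : Set X)
    (γ γx γt : ℝ → ℝ → X) : Prop where
  mem : ∀ x t, γ x t ∈ D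
  c : Continuous fun z : ℝ × ℝ => γ z.1 z.2
  cx : Continuous fun z : ℝ × ℝ => γx z.1 z.2
  ct : Continuous fun z : ℝ × ℝ => γt z.1 z.2
  dt : ∀ x t, HasDerivAt (γ x) (γt x t) t
  dx : ∀ x ∈ Icc (0:ℝ) 1, ∀ t, HasDerivWithinAt (fun y => γ y t) (γx x t) (Icc 0 1) x
  bx : ∀ x t, ‖γx x t‖ ≤ 1
  bt : ∀ x t, ‖γt x t‖ ≤ 1

/-- second derivative of the path -/
structure Pth2 {X : Type*} [NormedAddCommGroup X] [NormedSpace ℝ X]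
    (γt γtt : ℝ → ℝ → X) : Prop where
  c : Continuous fun z : ℝ × ℝ => γtt z.1 z.2
  dt : ∀ x t, HasDerivAt (γt x) (γtt x t) t
  b : ∀ x t, ‖γtt x t‖ ≤ 1

/-- `C²` with bounds -/
def B2 {X : Type*} [NormedAddCommGroup X] [NormedSpace ℝ X] (D : Set X) (F : X → ℝ) (C : ℝ) : Prop :=
  ContDiffOn ℝ 2 F D ∧ ∀ i : ℕ, i ≤ 2 → ∀ q ∈ D, ‖iteratedFDerivWithin ℝ i F D q‖ ≤ C

lemma B2.sx {X : Type*} [NormedAddCommGroup X] [NormedSpace ℝ X] {D : Set X} {F : X → ℝ} {C : ℝ}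
    (hD : UniqueDiffOn ℝ D) (hF : B2 D F C) {γ γx γt : ℝ → ℝ → X} (hγ : Pth D γ γx γt) :
    SX (∃ γtt, Pth2 γt γtt) (2 * C) (fun x t => F (γ x t)) := by
  obtain ⟨hs, hb⟩ := hF
  have b0 : ∀ q ∈ D, |F q| ≤ C := fun q hq => by
    have := hb 0 (by norm_num) q hq
    rwa [norm_iteratedFDerivWithin_zero] at this
  have b1 : ∀ q ∈ D, ‖fderivWithin ℝ F D q‖ ≤ C := fun q hq => by
    have := hb 1 (by norm_num) q hq
    rwa [norm_iteratedFDerivWithin_one _ (hD q hq)] at this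
  have b2 : ∀ q ∈ D, ‖fderivWithin ℝ (fderivWithin ℝ F D) D q‖ ≤ C := fun q hq => by
    have := hb 2 (by norm_num) q hq
    rw [← norm_iteratedFDerivWithin_fderivWithin hD hq,
      norm_iteratedFDerivWithin_one _ (hD q hq)] at this
    exact this
  have hC : 0 ≤ C := (abs_nonneg _).trans (b0 _ (hγ.mem 0 0))
  have hs1 : ContDiffOn ℝ 1 (fderivWithin ℝ F D) D := hs.fderivWithin hD (by norm_num)
  have hs2 : ContDiffOn ℝ 0 (fderivWithin ℝ (fderivWithin ℝ F D) D) D := hs1.fderivWithin hD (by norm_num)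
  have d1 : ∀ q ∈ D, HasFDerivWithinAt F (fderivWithin ℝ F D q) D q := fun q hq =>
    (hs.differentiableOn (by norm_num) q hq).hasFDerivWithinAt
  have d2 : ∀ q ∈ D, HasFDerivWithinAt (fderivWithin ℝ F D) (fderivWithin ℝ (fderivWithin ℝ F D) D q) D q :=
    fun q hq => (hs1.differentiableOn (by norm_num) q hq).hasFDerivWithinAt
  have c0 : Continuous fun z : ℝ × ℝ => F (γ z.1 z.2) :=
    hs.continuousOn.comp_continuous hγ.c fun z => hγ.mem _ _
  have c1 : Continuous fun z : ℝ × ℝ => fderivWithin ℝ F D (γ z.1 z.2) :=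
    hs1.continuousOn.comp_continuous hγ.c fun z => hγ.mem _ _
  have c2 : Continuous fun z : ℝ × ℝ => fderivWithin ℝ (fderivWithin ℝ F D) D (γ z.1 z.2) :=
    hs2.continuousOn.comp_continuous hγ.c fun z => hγ.mem _ _
  have n1 : ∀ x t v, ‖v‖ ≤ 1 → |fderivWithin ℝ F D (γ x t) v| ≤ C := fun x t v hv => by
    refine ((fderivWithin ℝ F D (γ x t)).le_opNorm v).trans ?_
    have := mul_le_mul (b1 _ (hγ.mem x t)) hv (norm_nonneg _) hC
    linarith
  refine ⟨fun x t => fderivWithin ℝ F D (γ x t) (γx x t), fun x t => fderivWithin ℝ F D (γ x t) (γt x t),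
    ⟨⟨c0, c1.clm_apply hγ.ct, fun x t => ?_⟩, c1.clm_apply hγ.cx, fun x hx t => ?_⟩,
    fun x t => ⟨?_, ?_, ?_⟩, ?_⟩
  · have := (d1 _ (hγ.mem x t)).comp_hasDerivWithinAt t (hγ.dt x t).hasDerivWithinAt
      (s := univ) (fun s _ => hγ.mem x s)
    exact this.hasDerivAt univ_mem
  · exact (d1 _ (hγ.mem x t)).comp_hasDerivWithinAt x (hγ.dx x hx t) (fun s _ => hγ.mem s t)
  · linarith [b0 _ (hγ.mem x t)]
  · linarith [n1 x t _ (hγ.bx x t)]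
  · linarith [n1 x t _ (hγ.bt x t)]
  · rintro ⟨γtt, h2⟩
    refine ⟨fun x t => fderivWithin ℝ (fderivWithin ℝ F D) D (γ x t) (γt x t) (γt x t)
      + fderivWithin ℝ F D (γ x t) (γtt x t), ⟨c1.clm_apply hγ.ct,
      ((c2.clm_apply hγ.ct).clm_apply hγ.ct).add (c1.clm_apply h2.c), fun x t => ?_⟩, fun x t => ?_⟩
    · have := (d2 _ (hγ.mem x t)).comp_hasDerivWithinAt t (hγ.dt x t).hasDerivWithinAt
        (s := univ) (fun s _ => hγ.mem x s)
      exact (this.hasDerivAt univ_mem).clm_apply (h2.dt x t)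
    · refine (abs_add_le _ _).trans ?_
      have a1 := n1 x t _ (h2.b x t)
      have a2 : |fderivWithin ℝ (fderivWithin ℝ F D) D (γ x t) (γt x t) (γt x t)| ≤ C := by
        refine ((fderivWithin ℝ (fderivWithin ℝ F D) D (γ x t)).le_opNorm₂ _ _).trans ?_
        have h3 := mul_le_mul (b2 _ (hγ.mem x t)) (hγ.bt x t) (norm_nonneg _) hC
        have h4 := mul_le_mul h3 (hγ.bt x t) (norm_nonneg _) (by linarith)
        linarith
      linarith

lemma B2.lip {X : Type*} [NormedAddCommGroup X] [NormedSpace ℝ X] {D : Set X} {F : X → ℝ} {C : ℝ}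
    (hD : UniqueDiffOn ℝ D) (hcv : Convex ℝ D) (hF : B2 D F C) {a b : X} (ha : a ∈ D) (hb : b ∈ D) :
    |F a - F b| ≤ C * ‖a - b‖ := by
  refine hcv.norm_image_sub_le_of_norm_fderivWithin_le (hF.1.differentiableOn (by norm_num))
    (fun q hq => ?_) hb ha
  have := hF.2 1 (by norm_num) q hq
  rwa [norm_iteratedFDerivWithin_one _ (hD q hq)] at this

end QL
end

section
namespace QL
open scoped Topology
variable {n : ℕ}

lemma strip_convex : Convex ℝ strip := (convex_Icc (0:ℝ) 1).prod convex_univ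

lemma strip_ud : UniqueDiffOn ℝ strip :=
  (uniqueDiffOn_Icc zero_lt_one).prod uniqueDiffOn_univ

lemma qdom_convex (δ₀ : ℝ) : Convex ℝ (qdom n δ₀) :=
  (convex_Icc (0:ℝ) 1).prod (convex_univ.prod (convex_closedBall _ _))

lemma qdom_ud {δ₀ : ℝ} (h : 0 < δ₀) : UniqueDiffOn ℝ (qdom n δ₀) := by
  refine (uniqueDiffOn_Icc zero_lt_one).prod (uniqueDiffOn_univ.prod ?_)
  refine uniqueDiffOn_convex (convex_closedBall _ _) ?_
  exact ⟨0, Metric.ball_subset_interior_closedBall (Metric.mem_ball_self h)⟩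

/-- vector of values -/
def vc (u : E n) (x t : ℝ) : Vn n := WithLp.toLp 2 fun j => cp u j x t

@[simp] lemma vc_apply (u : E n) (x t : ℝ) (j : Fin n) : vc u x t j = cp u j x t := rfl

lemma vc_sub (u v : E n) (x t : ℝ) : vc u x t - vc v x t = vc (u - v) x t := rfl

lemma norm_le_sum (v : Vn n) : ‖v‖ ≤ ∑ j, |v j| := by
  rw [EuclideanSpace.norm_eq]
  refine Real.sqrt_le_iff.2 ⟨Finset.sum_nonneg fun _ _ => abs_nonneg _, ?_⟩
  simp only [Real.norm_eq_abs]
  exact Finset.sum_sq_le_sq_sum_of_nonneg fun _ _ => abs_nonneg _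

lemma vc_le (u : E n) (x t : ℝ) : ‖vc u x t‖ ≤ n * ‖u‖ :=
  (norm_le_sum _).trans ((Finset.sum_le_card_nsmul _ _ ‖u‖ fun k _ => cp_le u k x t).trans (by simp))

lemma cp_le_vc (u : E n) (x t : ℝ) (j : Fin n) : |cp u j x t| ≤ ‖vc u x t‖ :=
  PiLp.norm_apply_le (vc u x t) j

lemma vc_cont (u : E n) : Continuous fun z : ℝ × ℝ => vc u z.1 z.2 :=
  (PiLp.continuous_toLp 2 _).comp (continuous_pi fun j => cp_cc u j)

lemma hasDerivWithinAt_vc {f : ℝ → Vn n} {f' : Vn n} {s : Set ℝ} {x : ℝ}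
    (h : ∀ j, HasDerivWithinAt (fun y => f y j) (f' j) s x) : HasDerivWithinAt f f' s x := by
  rw [hasDerivWithinAt_iff_hasFDerivWithinAt]
  rw [hasFDerivWithinAt_euclidean]
  intro j
  refine (h j).hasFDerivWithinAt.congr_fderiv ?_
  ext; simp

/-- the data of a `C¹` function -/
structure Dat (δ₀ : ℝ) (u ux ut : E n) : Prop where
  clp : Clamped u
  dt : Dt u ut
  dx : ∀ j, ∀ x ∈ Icc (0:ℝ) 1, ∀ t, HasDerivWithinAt (fun y => cp u j y t) (cp ux j x t) (Icc 0 1) x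
  b : ∀ x t, ‖vc u x t‖ ≤ δ₀
  bx : ∀ x t, ‖vc ux (cl x) t‖ ≤ 1
  bt : ∀ x t, ‖vc ut (cl x) t‖ ≤ 1

lemma Dat.zero {δ₀ : ℝ} (h : 0 ≤ δ₀) : Dat δ₀ (0 : E n) 0 0 where
  clp _ _ _ := rfl
  dt := Dt.zero
  dx _ _ _ _ := hasDerivWithinAt_const _ _ _
  b x t := (vc_le 0 x t).trans (by simpa using h)
  bx x t := (vc_le 0 _ t).trans (by simp)
  bt x t := (vc_le 0 _ t).trans (by simp)

lemma hasDerivWithinAt_prodMk {F G : Type*} [NormedAddCommGroup F] [NormedSpace ℝ F]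
    [NormedAddCommGroup G] [NormedSpace ℝ G] {f : ℝ → F} {g : ℝ → G} {f' g'} {s : Set ℝ} {x : ℝ}
    (hf : HasDerivWithinAt f f' s x) (hg : HasDerivWithinAt g g' s x) :
    HasDerivWithinAt (fun y => (f y, g y)) (f', g') s x := hf.prodMk hg

lemma cl_deriv {x : ℝ} (hx : x ∈ Icc (0:ℝ) 1) : HasDerivWithinAt cl 1 (Icc 0 1) x :=
  (hasDerivWithinAt_id x _).congr (fun _ hy => cl_eq hy) (cl_eq hx)

/-- the path -/
def gm (u : E n) (x t : ℝ) : ℝ × ℝ × Vn n := (cl x, t, vc u (cl x) t)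

lemma Dat.pth {δ₀ : ℝ} {u ux ut : E n} (h : Dat δ₀ u ux ut) :
    Pth (qdom n δ₀) (gm u) (fun x t => (1, 0, vc ux (cl x) t)) (fun x t => (0, 1, vc ut (cl x) t)) where
  mem x t := ⟨cl_mem x, mem_univ _, by
    change vc u (cl x) t ∈ _
    rw [mem_closedBall_zero_iff]; exact h.b _ _⟩
  c := (cl_cont.comp continuous_fst).prodMk (continuous_snd.prodMk
    ((vc_cont u).comp ((cl_cont.comp continuous_fst).prodMk continuous_snd)))
  cx := continuous_const.prodMk (continuous_const.prodMk
    ((vc_cont ux).comp ((cl_cont.comp continuous_fst).prodMk continuous_snd)))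
  ct := continuous_const.prodMk (continuous_const.prodMk
    ((vc_cont ut).comp ((cl_cont.comp continuous_fst).prodMk continuous_snd)))
  dt x t := by
    have h1 : HasDerivWithinAt (fun s => vc u (cl x) s) (vc ut (cl x) t) univ t :=
      hasDerivWithinAt_vc fun j => (h.dt j (cl x) t).hasDerivWithinAt
    have := hasDerivWithinAt_prodMk (hasDerivWithinAt_const t univ (cl x))
      (hasDerivWithinAt_prodMk (hasDerivWithinAt_id t univ) h1)
    exact this.hasDerivAt univ_mem
  dx x hx t := by
    have h1 : HasDerivWithinAt (fun y => vc u (cl y) t) (vc ux (cl x) t) (Icc 0 1) x :=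
      hasDerivWithinAt_vc fun j => by
        have e : (fun y => vc u (cl y) t j) = fun y => cp u j y t := funext fun y => h.clp j y t
        rw [e, vc_apply, cl_eq hx]
        exact h.dx j x hx t
    exact hasDerivWithinAt_prodMk (cl_deriv hx)
      (hasDerivWithinAt_prodMk (hasDerivWithinAt_const x _ t) h1)
  bx x t := by
    refine norm_prod_le_iff.2 ⟨by simp, norm_prod_le_iff.2 ⟨by simp, h.bx x t⟩⟩
  bt x t := by
    refine norm_prod_le_iff.2 ⟨by simp, norm_prod_le_iff.2 ⟨by simp, h.bt x t⟩⟩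

lemma pth2 {ut utt : E n} (h : Dt ut utt) (hb : ∀ x t, ‖vc utt x t‖ ≤ 1) :
    Pth2 (X := ℝ × ℝ × Vn n) (fun x t => (0, 1, vc ut (cl x) t)) (fun x t => (0, 0, vc utt (cl x) t)) where
  c := continuous_const.prodMk (continuous_const.prodMk
    ((vc_cont utt).comp ((cl_cont.comp continuous_fst).prodMk continuous_snd)))
  dt x t := by
    have h1 : HasDerivWithinAt (fun s => vc ut (cl x) s) (vc utt (cl x) t) univ t :=
      hasDerivWithinAt_vc fun j => (h j (cl x) t).hasDerivWithinAt
    have := hasDerivWithinAt_prodMk (hasDerivWithinAt_const t univ (0:ℝ))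
      (hasDerivWithinAt_prodMk (hasDerivWithinAt_const t univ (1:ℝ)) h1)
    exact this.hasDerivAt univ_mem
  b x t := norm_prod_le_iff.2 ⟨by simp, norm_prod_le_iff.2 ⟨by simp, hb _ t⟩⟩

lemma pth_strip : Pth strip (fun x t => (cl x, t)) (fun _ _ => (1, 0)) (fun _ _ => (0, 1)) where
  mem x t := ⟨cl_mem x, mem_univ _⟩
  c := (cl_cont.comp continuous_fst).prodMk continuous_snd
  cx := continuous_const
  ct := continuous_const
  dt x t := (hasDerivWithinAt_prodMk (hasDerivWithinAt_const t univ (cl x))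
      (hasDerivWithinAt_id t univ)).hasDerivAt univ_mem
  dx x hx t := hasDerivWithinAt_prodMk (cl_deriv hx) (hasDerivWithinAt_const x _ t)
  bx x t := norm_prod_le_iff.2 ⟨by simp, by simp⟩
  bt x t := norm_prod_le_iff.2 ⟨by simp, by simp⟩

lemma pth_strip2 : Pth2 (X := ℝ × ℝ) (fun _ _ => (0, 1)) (fun _ _ => 0) where
  c := continuous_const
  dt _ _ := hasDerivAt_const _ _
  b _ _ := by simp

/-- standing hypotheses on the coefficients -/
structure Hyp (m : ℕ) (A : ℝ → ℝ → Vn n → Fin n → ℝ) (B : ℝ → ℝ → Vn n → Fin n → Fin n → ℝ)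
    (δ₀ C R : ℝ) : Prop where
  hδ : 0 < δ₀
  C1 : 1 ≤ C
  R1 : 1 ≤ R
  hA : ∀ j, B2 (qdom n δ₀) (fun z => A z.1 z.2.1 z.2.2 j) C
  hB : ∀ j k, B2 (qdom n δ₀) (fun z => B z.1 z.2.1 z.2.2 j k) C
  hsg : ∀ x ∈ Icc (0:ℝ) 1, ∀ t v, ‖v‖ ≤ δ₀ → ∀ j, 1 ≤ R * (sg m j * A x t v j)
  sep : ∀ x ∈ Icc (0:ℝ) 1, ∀ t v, ‖v‖ ≤ δ₀ → ∀ j k, j ≠ k → 1 ≤ R * |A x t v j - A x t v k|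

/-- final bound of the coefficients -/
def MH (C R : ℝ) : ℝ := 96 * C ^ 3 * R ^ 3

/-- `cf` are the coefficients at `u` -/
structure CfOf (A : ℝ → ℝ → Vn n → Fin n → ℝ) (B : ℝ → ℝ → Vn n → Fin n → Fin n → ℝ)
    (u : E n) (cf : Cf n) : Prop where
  q : ∀ j x t, cf.q j x t = (A (cl x) t (vc u (cl x) t) j)⁻¹
  d : ∀ j x t, cf.d j x t = B (cl x) t (vc u (cl x) t) j j * (A (cl x) t (vc u (cl x) t) j)⁻¹
  c : ∀ j k x t, cf.c j k x t = if j = k then 0 else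
    B (cl x) t (vc u (cl x) t) j k * (A (cl x) t (vc u (cl x) t) j)⁻¹


section
variable {m : ℕ} {A : ℝ → ℝ → Vn n → Fin n → ℝ} {B : ℝ → ℝ → Vn n → Fin n → Fin n → ℝ}
  {δ₀ C R : ℝ} (H : Hyp m A B δ₀ C R)
include H

lemma Hyp.Rabs {x : ℝ} (hx : x ∈ Icc (0:ℝ) 1) (t : ℝ) {v : Vn n} (hv : ‖v‖ ≤ δ₀) (j : Fin n) :
    1 ≤ R * |A x t v j| := by
  refine (H.hsg x hx t v hv j).trans ?_
  have := H.R1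
  gcongr
  refine (le_abs_self _).trans ?_
  rw [abs_mul, sg_abs, one_mul]

lemma Hyp.Ab {x : ℝ} (hx : x ∈ Icc (0:ℝ) 1) (t : ℝ) {v : Vn n} (hv : ‖v‖ ≤ δ₀) (j : Fin n) :
    |A x t v j| ≤ C := by
  have := (H.hA j).2 0 (by norm_num) (x, t, v) ⟨hx, mem_univ _, mem_closedBall_zero_iff.2 hv⟩
  rwa [norm_iteratedFDerivWithin_zero] at this

lemma Hyp.Bb {x : ℝ} (hx : x ∈ Icc (0:ℝ) 1) (t : ℝ) {v : Vn n} (hv : ‖v‖ ≤ δ₀) (j k : Fin n) :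
    |B x t v j k| ≤ C := by
  have := (H.hB j k).2 0 (by norm_num) (x, t, v) ⟨hx, mem_univ _, mem_closedBall_zero_iff.2 hv⟩
  rwa [norm_iteratedFDerivWithin_zero] at this

lemma Hyp.A0 {x : ℝ} (hx : x ∈ Icc (0:ℝ) 1) (t : ℝ) {v : Vn n} (hv : ‖v‖ ≤ δ₀) (j : Fin n) :
    A x t v j ≠ 0 := fun e => by have := H.Rabs hx t hv j; rw [e] at this; norm_num at this

lemma Hyp.MH1 : 1 ≤ MH C R ∧ C ^ 2 * R ^ 2 ≤ MH C R / 96 ∧ 3 * (2 * C) ^ 2 * R ^ 3 ≤ MH C R := by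
  have h1 := H.C1; have h2 := H.R1
  have a : 1 ≤ C ^ 2 * R ^ 2 := by
    have := one_le_pow₀ h1 (n := 2); have := one_le_pow₀ h2 (n := 2); nlinarith
  have b : 1 ≤ C * R := by nlinarith
  have c : C ^ 2 * R ^ 2 ≤ (C ^ 2 * R ^ 2) * (C * R) := le_mul_of_one_le_right (by linarith) b
  have d : C ^ 2 * R ^ 3 ≤ (C ^ 2 * R ^ 3) * C := le_mul_of_one_le_right (by positivity) h1
  unfold MH
  refine ⟨?_, ?_, ?_⟩
  · nlinarith
  · nlinarith
  · nlinarith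

lemma Hyp.sxA {u ux ut : E n} (hu : Dat δ₀ u ux ut) (j : Fin n) :
    SX (∃ utt, Dt ut utt ∧ ∀ x t, ‖vc utt x t‖ ≤ 1) (3 * (2 * C) ^ 2 * R ^ 3)
      (fun x t => (A (cl x) t (vc u (cl x) t) j)⁻¹) := by
  have h1 := (H.hA j).sx (qdom_ud H.hδ) hu.pth
  obtain ⟨hx, ht, a1, a2, a3⟩ := h1
  have h2 : SX (∃ utt, Dt ut utt ∧ ∀ x t, ‖vc utt x t‖ ≤ 1) (2 * C)
      (fun x t => A (cl x) t (vc u (cl x) t) j) :=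
    ⟨hx, ht, a1, a2, fun ⟨utt, e1, e2⟩ => a3 ⟨_, pth2 e1 e2⟩⟩
  exact h2.inv (by linarith [H.C1]) H.R1 fun x t => H.Rabs (cl_mem x) t (hu.b _ _) j

lemma Hyp.sxB {u ux ut : E n} (hu : Dat δ₀ u ux ut) (j k : Fin n) :
    SX (∃ utt, Dt ut utt ∧ ∀ x t, ‖vc utt x t‖ ≤ 1) (MH C R)
      (fun x t => B (cl x) t (vc u (cl x) t) j k * (A (cl x) t (vc u (cl x) t) j)⁻¹) := by
  have h1 := (H.hB j k).sx (qdom_ud H.hδ) hu.pth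
  obtain ⟨hx, ht, a1, a2, a3⟩ := h1
  have h2 : SX (∃ utt, Dt ut utt ∧ ∀ x t, ‖vc utt x t‖ ≤ 1) (2 * C)
      (fun x t => B (cl x) t (vc u (cl x) t) j k) :=
    ⟨hx, ht, a1, a2, fun ⟨utt, e1, e2⟩ => a3 ⟨_, pth2 e1 e2⟩⟩
  refine (h2.mul (H.sxA hu j)).mono (le_of_eq ?_)
  unfold MH; ring

theorem Hyp.cf {u ux ut : E n} (hu : Dat δ₀ u ux ut) :
    ∃ cf : Cf n, cf.OK m (MH C R) ∧ CfOf A B u cf ∧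
      ((∃ utt, Dt ut utt ∧ ∀ x t, ‖vc utt x t‖ ≤ 1) → ∃ qtt dtt ctt, cf.OK2 (MH C R) qtt dtt ctt) := by
  obtain ⟨m1, m2, m3⟩ := H.MH1
  have sq := fun j => (H.sxA hu j).mono m3
  have sd := fun j => H.sxB hu j j
  have sc : ∀ j k, SX (∃ utt, Dt ut utt ∧ ∀ x t, ‖vc utt x t‖ ≤ 1) (MH C R)
      (fun x t => if j = k then 0 else
        B (cl x) t (vc u (cl x) t) j k * (A (cl x) t (vc u (cl x) t) j)⁻¹) := by
    intro j k
    by_cases e : j = k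
    · simp only [e, if_true]; exact SX.zero _ (by linarith)
    · simp only [e, if_false]; exact H.sxB hu j k
  choose qx qt q1 q2 q3 using sq
  choose dx dt d1 d2 d3 using sd
  choose cx ct c1 c2 c3 using sc
  refine ⟨⟨_, qx, qt, _, dt, _, cx, ct⟩, ⟨m1, q1, c1, fun j => (d1 j).toTD, ?_, fun j x t => (q2 j x t).1,
    fun j x t => (q2 j x t).2.1, fun j x t => (q2 j x t).2.2, fun j x t => (d2 j x t).1,
    fun j x t => (d2 j x t).2.2, fun j k x t => (c2 j k x t).1, fun j k x t => (c2 j k x t).2.1,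
    fun j k x t => (c2 j k x t).2.2, ?_, ?_⟩, ⟨fun _ _ _ => rfl, fun _ _ _ => rfl, fun _ _ _ _ => rfl⟩, ?_⟩
  · intro j x t; exact if_pos rfl
  · intro j x t
    have hx := cl_mem x
    have hv := hu.b (cl x) t
    have a0 := H.A0 hx t hv j
    have a1 := H.Ab hx t hv j
    have a2 := H.hsg _ hx t _ hv j
    have hR := H.R1; have hC := H.C1
    have hs : sg m j * sg m j = 1 := by rw [← abs_mul_abs_self, sg_abs]; norm_num
    set a := A (cl x) t (vc u (cl x) t) j with ha
    have hsa : 0 < sg m j * a := by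
      by_contra hcon; push Not at hcon
      have : R * (sg m j * a) ≤ 0 := mul_nonpos_of_nonneg_of_nonpos (by linarith) hcon
      linarith
    have e : sg m j * a⁻¹ = (sg m j * a)⁻¹ := by
      rw [mul_inv, ← eq_inv_of_mul_eq_one_left hs]
    change 1 ≤ MH C R * (sg m j * a⁻¹)
    rw [e, ← div_eq_mul_inv, le_div_iff₀ hsa, one_mul]
    have b1 : sg m j * a ≤ C := (le_abs_self _).trans (by rw [abs_mul, sg_abs, one_mul]; exact a1)
    have b2 : C ≤ C ^ 2 * R ^ 2 := by
      have := one_le_pow₀ hR (n := 2); nlinarith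
    linarith
  · intro j k hjk x t
    have hx := cl_mem x
    have hv := hu.b (cl x) t
    have a0 := H.A0 hx t hv j
    have b0 := H.A0 hx t hv k
    have a1 := H.Ab hx t hv j
    have b1 := H.Ab hx t hv k
    have a2 := H.sep _ hx t _ hv j k hjk
    have hR := H.R1; have hC := H.C1
    set a := A (cl x) t (vc u (cl x) t) j with ha
    set b := A (cl x) t (vc u (cl x) t) k with hb
    change 1 ≤ MH C R * |a⁻¹ - b⁻¹|
    rw [inv_sub_inv a0 b0, abs_div, ← mul_div_assoc, le_div_iff₀ (abs_pos.2 (mul_ne_zero a0 b0)), one_mul,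
      abs_sub_comm]
    have e1 := mul_bd a1 b1
    have e2 : C * C * R ≤ MH C R := by
      have : C * C * R ≤ C ^ 2 * R ^ 2 := by
        have : 0 ≤ C * C * R := by positivity
        nlinarith
      linarith
    have e3 : C * C * R * |a - b| ≤ MH C R * |a - b| := by gcongr
    have e4 : C * C ≤ C * C * (R * |a - b|) := le_mul_of_one_le_right (by positivity) a2
    linarith
  · intro hP
    choose qtt q4 q5 using fun j => q3 j hP
    choose dtt d4 d5 using fun j => d3 j hP
    choose ctt c4 c5 using fun j k => c3 j k hP
    exact ⟨qtt, dtt, ctt, q4, d4, c4, q5, d5, c5⟩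

lemma Hyp.inv_diff {x : ℝ} (hx : x ∈ Icc (0:ℝ) 1) (t : ℝ) {v w : Vn n} (hv : ‖v‖ ≤ δ₀) (hw : ‖w‖ ≤ δ₀)
    (j : Fin n) : |(A x t v j)⁻¹ - (A x t w j)⁻¹| ≤ C * R ^ 2 * ‖v - w‖ ∧ |(A x t v j)⁻¹| ≤ R := by
  have a0 := H.A0 hx t hv j
  have b0 := H.A0 hx t hw j
  have a1 := H.Rabs hx t hv j
  have b1 := H.Rabs hx t hw j
  have hR := H.R1; have hC := H.C1
  have hi : ∀ a : ℝ, a ≠ 0 → 1 ≤ R * |a| → |a⁻¹| ≤ R := fun a h0 h => by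
    rw [abs_inv, inv_le_iff_one_le_mul₀ (abs_pos.2 h0)]; exact h
  have hl := (H.hA j).lip (qdom_ud H.hδ) (qdom_convex δ₀) (a := (x, t, w)) (b := (x, t, v))
    ⟨hx, mem_univ _, mem_closedBall_zero_iff.2 hw⟩ ⟨hx, mem_univ _, mem_closedBall_zero_iff.2 hv⟩
  have hn : ‖((x, t, w) : ℝ × ℝ × Vn n) - (x, t, v)‖ = ‖v - w‖ := by
    simp [Prod.norm_def, norm_sub_rev w v]
  rw [hn] at hl
  refine ⟨?_, hi _ a0 a1⟩
  have e : (A x t v j)⁻¹ - (A x t w j)⁻¹ = (A x t w j - A x t v j) * ((A x t v j)⁻¹ * (A x t w j)⁻¹) := by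
    field_simp
  rw [e]
  refine (mul_bd hl (mul_bd (hi _ a0 a1) (hi _ b0 b1))).trans (le_of_eq (by ring))

lemma Hyp.B_diff {x : ℝ} (hx : x ∈ Icc (0:ℝ) 1) (t : ℝ) {v w : Vn n} (hv : ‖v‖ ≤ δ₀) (hw : ‖w‖ ≤ δ₀)
    (j k : Fin n) : |B x t v j k * (A x t v j)⁻¹ - B x t w j k * (A x t w j)⁻¹| ≤ MH C R * ‖v - w‖ := by
  obtain ⟨h1, h2⟩ := H.inv_diff hx t hv hw j
  have h3 := H.Bb hx t hw j k
  have hR := H.R1; have hC := H.C1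
  have hl := (H.hB j k).lip (qdom_ud H.hδ) (qdom_convex δ₀) (a := (x, t, v)) (b := (x, t, w))
    ⟨hx, mem_univ _, mem_closedBall_zero_iff.2 hv⟩ ⟨hx, mem_univ _, mem_closedBall_zero_iff.2 hw⟩
  have hn : ‖((x, t, v) : ℝ × ℝ × Vn n) - (x, t, w)‖ = ‖v - w‖ := by
    simp [Prod.norm_def]
  rw [hn] at hl
  have e : B x t v j k * (A x t v j)⁻¹ - B x t w j k * (A x t w j)⁻¹
    = (B x t v j k - B x t w j k) * (A x t v j)⁻¹ + B x t w j k * ((A x t v j)⁻¹ - (A x t w j)⁻¹) := by ring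
  rw [e]
  have f1 := mul_bd hl h2
  have f2 := mul_bd h3 h1
  refine (abs_add_le _ _).trans ((add_le_add f1 f2).trans ?_)
  obtain ⟨m1, m2, m3⟩ := H.MH1
  have f3 : C * R ≤ C ^ 2 * R ^ 2 := by
    have : 1 ≤ C * R := by nlinarith
    nlinarith
  have f4 : C * R + C ^ 2 * R ^ 2 ≤ MH C R := by linarith
  have := mul_le_mul_of_nonneg_right f4 (norm_nonneg (v - w))
  linarith

lemma Hyp.inv_diff' {x : ℝ} (hx : x ∈ Icc (0:ℝ) 1) (t : ℝ) {v w : Vn n} (hv : ‖v‖ ≤ δ₀) (hw : ‖w‖ ≤ δ₀)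
    (j : Fin n) : |(A x t v j)⁻¹ - (A x t w j)⁻¹| ≤ MH C R * ‖v - w‖ := by
  refine (H.inv_diff hx t hv hw j).1.trans ?_
  obtain ⟨m1, m2, m3⟩ := H.MH1
  have hR := H.R1; have hC := H.C1
  gcongr
  have : C * R ^ 2 ≤ C ^ 2 * R ^ 2 := by
    have := sq_nonneg R
    gcongr
    nlinarith
  linarith

lemma Hyp.close {u w : E n} (hu : ∀ x t, ‖vc u x t‖ ≤ δ₀) (hw : ∀ x t, ‖vc w x t‖ ≤ δ₀) {cf cf' : Cf n}
    (h1 : CfOf A B u cf) (h2 : CfOf A B w cf') : Close cf cf' (MH C R * (n * ‖u - w‖)) := by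
  have hM := H.MH1.1
  have hb : ∀ x t, MH C R * ‖vc u (cl x) t - vc w (cl x) t‖ ≤ MH C R * (n * ‖u - w‖) := by
    intro x t
    rw [vc_sub]
    gcongr
    exact vc_le _ _ _
  constructor
  · intro j x hx t
    rw [h1.q, h2.q]
    exact (H.inv_diff' (cl_mem x) t (hu _ _) (hw _ _) j).trans (hb x t)
  · intro j x hx t
    rw [h1.d, h2.d]
    exact (H.B_diff (cl_mem x) t (hu _ _) (hw _ _) j j).trans (hb x t)
  · intro j k x hx t
    rw [h1.c, h2.c]
    split_ifs with e
    · simp; positivity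
    · exact (H.B_diff (cl_mem x) t (hu _ _) (hw _ _) j k).trans (hb x t)

end

lemma CfOf.per {A : ℝ → ℝ → Vn n → Fin n → ℝ} {B : ℝ → ℝ → Vn n → Fin n → Fin n → ℝ} {δ₀ T : ℝ}
    (hper : ∀ x ∈ Set.Icc (0:ℝ) 1, ∀ t : ℝ, ∀ v : Vn n, ‖v‖ ≤ δ₀ →
      (∀ j : Fin n, A x (t + T) v j = A x t v j) ∧
      (∀ j k : Fin n, B x (t + T) v j k = B x t v j k))
    {u : E n} (hu : ∀ x t, ‖vc u x t‖ ≤ δ₀) (hp : Per T u) {cf : Cf n}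
    (h1 : CfOf A B u cf) : cf.Per T := by
  have e : ∀ x t, vc u (cl x) (t + T) = vc u (cl x) t := fun x t => by
    unfold vc; congr 1; funext j; exact hp j _ t
  constructor
  · intro j x t
    rw [h1.q, h1.q, e, (hper _ (cl_mem x) t _ (hu _ _)).1]
  · intro j x t
    rw [h1.d, h1.d, e, (hper _ (cl_mem x) t _ (hu _ _)).1, (hper _ (cl_mem x) t _ (hu _ _)).2]
  · intro j k x t
    rw [h1.c, h1.c, e, (hper _ (cl_mem x) t _ (hu _ _)).1, (hper _ (cl_mem x) t _ (hu _ _)).2]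

end QL
end

section
namespace QL
open scoped Topology
variable {n : ℕ}

lemma CfOf.rel {A : ℝ → ℝ → Vn n → Fin n → ℝ} {B : ℝ → ℝ → Vn n → Fin n → Fin n → ℝ} {u : E n} {cf : Cf n}
    (h : CfOf A B u cf) {x : ℝ} (hx : x ∈ Icc (0:ℝ) 1) {t : ℝ} {j : Fin n} (h0 : A x t (vc u x t) j ≠ 0) :
    cf.q j x t * A x t (vc u x t) j = 1 ∧ ∀ w : Fin n → ℝ, ∑ k, B x t (vc u x t) j k * w k
      = A x t (vc u x t) j * (cf.d j x t * w j + ∑ k, cf.c j k x t * w k) := by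
  constructor
  · rw [h.q, cl_eq hx, inv_mul_cancel₀ h0]
  · intro w
    rw [h.d, cl_eq hx, mul_add]
    have e1 : A x t (vc u x t) j * (B x t (vc u x t) j j * (A x t (vc u x t) j)⁻¹ * w j)
        = B x t (vc u x t) j j * w j := by field_simp
    rw [e1, Finset.mul_sum, ← Finset.add_sum_erase _ _ (Finset.mem_univ j)]
    congr 1
    rw [← Finset.add_sum_erase (a := j) _ (fun k => A x t (vc u x t) j * (cf.c j k x t * w k)) (Finset.mem_univ j)]
    rw [h.c, if_pos rfl]
    simp only [zero_mul, mul_zero, zero_add]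
    refine Finset.sum_congr rfl fun k hk => ?_
    rw [h.c, if_neg (Finset.ne_of_mem_erase hk).symm, cl_eq hx]
    field_simp

/-- the right hand side at `u` -/
def GOf (A : ℝ → ℝ → Vn n → Fin n → ℝ) (f : ℝ → ℝ → Fin n → ℝ) (u g : E n) : Prop :=
  ∀ j x t, cp g j x t = f (cl x) t j * (A (cl x) t (vc u (cl x) t) j)⁻¹

/-- the two forms of the equation -/
lemma eq_iff {A : ℝ → ℝ → Vn n → Fin n → ℝ} {B : ℝ → ℝ → Vn n → Fin n → Fin n → ℝ} {f : ℝ → ℝ → Fin n → ℝ}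
    {u g : E n} {cf : Cf n}
    (h : CfOf A B u cf) (hg : GOf A f u g) {x : ℝ} (hx : x ∈ Icc (0:ℝ) 1) {t : ℝ} {j : Fin n}
    (h0 : A x t (vc u x t) j ≠ 0) (w : Fin n → ℝ) (wx wt : ℝ) :
    (wt + A x t (vc u x t) j * wx + ∑ k, B x t (vc u x t) j k * w k = f x t j) ↔
      wx = -∑ k, cf.c j k x t * w k + cp g j x t - cf.d j x t * w j - cf.q j x t * wt := by
  obtain ⟨h1, h2⟩ := h.rel hx h0
  rw [h2, hg, cl_eq hx]
  have h3 : A x t (vc u x t) j * (A x t (vc u x t) j)⁻¹ = 1 := mul_inv_cancel₀ h0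
  constructor
  · intro e
    apply mul_left_cancel₀ h0
    linear_combination e - f x t j * h3 + wt * h1
  · intro e
    rw [e]
    linear_combination f x t j * h3 - wt * h1

lemma sol_diff {cf cf' : Cf n} {m : ℕ} {M : ℝ} (h : cf.OK m M) (h' : cf'.OK m M) {p : Fin n → Fin n → ℝ}
    {K1 D G : ℝ} (hK : 0 ≤ K1) (hA : AP cf m p M K1) (hc : Close cf cf' D) {y yt z zt g g' : E n} (hg : ‖g - g'‖ ≤ G)
    (hy : Sol cf m p y (Mop h y + g)) (hyt : Dt y yt) (hz : Sol cf' m p z (Mop h' z + g')) (hzt : Dt z zt)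
    (hD : 0 ≤ D) :
    ‖y - z‖ ≤ K1 * (G + D * ((n + 1) * ‖z‖ + ‖zt‖)) := by
  set r0 : Fin n → ℝ → ℝ → ℝ := fun j x t => cp (g - g') j x t - (cf.q j x t - cf'.q j x t) * cp zt j x t
    - (cf.d j x t - cf'.d j x t) * cp z j x t - ∑ k, (cf.c j k x t - cf'.c j k x t) * cp z k x t with hr0
  have hb : ∀ j x t, |r0 j (cl x) t| ≤ G + D * ((n + 1) * ‖z‖ + ‖zt‖) := by
    intro j x t
    have hx := cl_mem x
    have b1 := (cp_le (g - g') j (cl x) t).trans hg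
    have b2 := mul_bd (hc.q j _ hx t) (cp_le zt j (cl x) t)
    have b3 := mul_bd (hc.d j _ hx t) (cp_le z j (cl x) t)
    have b4 : |∑ k, (cf.c j k (cl x) t - cf'.c j k (cl x) t) * cp z k (cl x) t| ≤ n * (D * ‖z‖) :=
      (Finset.abs_sum_le_sum_abs _ _).trans ((Finset.sum_le_card_nsmul _ _ (D * ‖z‖) fun k _ =>
        mul_bd (hc.c j k _ hx t) (cp_le z k (cl x) t)).trans (by simp))
    have e1 := abs_sub (cp (g - g') j (cl x) t - (cf.q j (cl x) t - cf'.q j (cl x) t) * cp zt j (cl x) t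
      - (cf.d j (cl x) t - cf'.d j (cl x) t) * cp z j (cl x) t)
      (∑ k, (cf.c j k (cl x) t - cf'.c j k (cl x) t) * cp z k (cl x) t)
    have e2 := abs_sub (cp (g - g') j (cl x) t - (cf.q j (cl x) t - cf'.q j (cl x) t) * cp zt j (cl x) t)
      ((cf.d j (cl x) t - cf'.d j (cl x) t) * cp z j (cl x) t)
    have e3 := abs_sub (cp (g - g') j (cl x) t) ((cf.q j (cl x) t - cf'.q j (cl x) t) * cp zt j (cl x) t)
    simp only [hr0]
    linarith
  have hcc : ∀ j, CC fun x t => r0 j x t := fun j => by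
    refine Continuous.sub (Continuous.sub (Continuous.sub (cp_cc _ j) ?_) ?_) ?_
    · exact Continuous.mul (Continuous.sub (h.qXT j).c (h'.qXT j).c) (cp_cc zt j)
    · exact Continuous.mul (Continuous.sub (h.dTD j).c (h'.dTD j).c) (cp_cc z j)
    · exact continuous_finsetSum _ fun k _ =>
        Continuous.mul (Continuous.sub (h.cXT j k).c (h'.cXT j k).c) (cp_cc z k)
  obtain ⟨r, hr⟩ : ∃ r : E n, ∀ j x t, cp r j x t = r0 j (cl x) t :=
    ⟨mkE (fun j x t => r0 j (cl x) t) (fun j => (hcc j).comp (cl_cont.comp continuous_fst) continuous_snd)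
      _ hb, fun _ _ _ => rfl⟩
  have hrn : ‖r‖ ≤ G + D * ((n + 1) * ‖z‖ + ‖zt‖) := by
    refine E_norm_le ?_ fun j x t => by rw [hr]; exact hb j x t
    have : 0 ≤ G := (norm_nonneg _).trans hg
    positivity
  have hxy := fun j => hy.xt h hyt j
  have hxz := fun j => hz.xt h' hzt j
  have key : Sol cf m p (y - z) (Mop h (y - z) + r) := by
    refine Sol.of_classical h (yx := fun j x t =>
      (cp (Mop h y + g) j x t - cf.d j x t * cp y j x t - cf.q j x t * cp yt j x t)
        - (cp (Mop h' z + g') j x t - cf'.d j x t * cp z j x t - cf'.q j x t * cp zt j x t)) (yt := fun j => cp (yt - zt) j)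
      (fun j x t => by simp [hy.clp j x t, hz.clp j x t]) (fun j t => ?_) (fun j =>
        ⟨⟨cp_cc _ j, cp_cc _ j, (hyt.sub hzt) j⟩, Continuous.sub (hxy j).cx (hxz j).cx,
          fun x hx t => ((hxy j).dx x hx t).sub ((hxz j).dx x hx t)⟩) ?_
    · simp [hy.bc j t, hz.bc j t, mul_sub]
    · intro j x hx t
      simp only [cp_add, cp_sub, cp_Mop, hr, cl_eq hx, hr0, Mr, mul_sub, sub_mul, Finset.sum_sub_distrib]
      ring
  exact (hA h _ _ _ (hyt.sub hzt) key).trans (mul_le_mul_of_nonneg_left hrn hK)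

section
variable {m : ℕ} {A : ℝ → ℝ → Vn n → Fin n → ℝ} {B : ℝ → ℝ → Vn n → Fin n → Fin n → ℝ}
  {δ₀ C R : ℝ} (H : Hyp m A B δ₀ C R) {f : ℝ → ℝ → Fin n → ℝ} {ε : ℝ}

lemma f_bd (hf : ∀ j, B2 strip (fun q : ℝ × ℝ => f q.1 q.2 j) ε) {x : ℝ} (hx : x ∈ Icc (0:ℝ) 1) (t : ℝ) (j : Fin n) :
    |f x t j| ≤ ε := by
  have := (hf j).2 0 (by norm_num) (x, t) ⟨hx, mem_univ _⟩
  rwa [norm_iteratedFDerivWithin_zero] at this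

include H

theorem Hyp.g (hε : 0 ≤ ε) (hf : ∀ j, B2 strip (fun q : ℝ × ℝ => f q.1 q.2 j) ε)
    {u ux ut : E n} (hu : Dat δ₀ u ux ut) :
    ∃ g gt : E n, GOf A f u g ∧ Dt g gt ∧ ‖g‖ ≤ MH C R * ε ∧ ‖gt‖ ≤ MH C R * ε ∧
      ((∃ utt, Dt ut utt ∧ ∀ x t, ‖vc utt x t‖ ≤ 1) → ∃ gtt, Dt gt gtt ∧ ‖gtt‖ ≤ MH C R * ε) := by
  have hMe : 0 ≤ MH C R * ε := mul_nonneg (zero_le_one.trans H.MH1.1) hε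
  have s : ∀ j, SX (∃ utt, Dt ut utt ∧ ∀ x t, ‖vc utt x t‖ ≤ 1) (MH C R * ε)
      (fun x t => f (cl x) t j * (A (cl x) t (vc u (cl x) t) j)⁻¹) := by
    intro j
    obtain ⟨hx, ht, a1, a2, a3⟩ := (hf j).sx strip_ud pth_strip
    have h2 : SX (∃ utt, Dt ut utt ∧ ∀ x t, ‖vc utt x t‖ ≤ 1) (2 * ε) (fun x t => f (cl x) t j) :=
      ⟨hx, ht, a1, a2, fun _ => a3 ⟨_, pth_strip2⟩⟩
    refine (h2.mul (H.sxA hu j)).mono ?_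
    have := H.C1; have := H.R1
    have e : 0 ≤ ε * (C ^ 2 * R ^ 3) := by positivity
    have e2 : ε * (C ^ 2 * R ^ 3) ≤ ε * (C ^ 2 * R ^ 3) * C := le_mul_of_one_le_right e H.C1
    unfold MH
    linarith
  choose gx gt g1 g2 g3 using s
  refine ⟨mkE _ (fun j => (g1 j).c) (MH C R * ε) fun j x t => (g2 j x t).1,
    mkE gt (fun j => (g1 j).ct) (MH C R * ε) fun j x t => (g2 j x t).2.2, fun _ _ _ => rfl,
    fun j => (g1 j).dt, E_norm_le hMe fun j x t => (g2 j x t).1, E_norm_le hMe fun j x t => (g2 j x t).2.2,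
    fun hP => ?_⟩
  choose gtt g4 g5 using fun j => g3 j hP
  exact ⟨mkE gtt (fun j => (g4 j).ct) _ g5, fun j => (g4 j).dt, E_norm_le hMe g5⟩

lemma Hyp.g_diff (hε : 0 ≤ ε) (hf : ∀ j, B2 strip (fun q : ℝ × ℝ => f q.1 q.2 j) ε)
    {u w g g' : E n} (hu : ∀ x t, ‖vc u x t‖ ≤ δ₀) (hw : ∀ x t, ‖vc w x t‖ ≤ δ₀)
    (h1 : GOf A f u g) (h2 : GOf A f w g') : ‖g - g'‖ ≤ ε * (MH C R * (n * ‖u - w‖)) := by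
  have hM := H.MH1.1
  refine E_norm_le (by positivity) fun j x t => ?_
  rw [cp_sub, h1, h2, ← mul_sub]
  refine mul_bd (f_bd hf (cl_mem x) t j) ((H.inv_diff' (cl_mem x) t (hu _ _) (hw _ _) j).trans ?_)
  rw [vc_sub]
  gcongr
  exact vc_le _ _ _

end

lemma GOf.per {A : ℝ → ℝ → Vn n → Fin n → ℝ} {B : ℝ → ℝ → Vn n → Fin n → Fin n → ℝ} {δ₀ T : ℝ}
    (hper : ∀ x ∈ Set.Icc (0:ℝ) 1, ∀ t : ℝ, ∀ v : Vn n, ‖v‖ ≤ δ₀ →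
      (∀ j : Fin n, A x (t + T) v j = A x t v j) ∧
      (∀ j k : Fin n, B x (t + T) v j k = B x t v j k)) {f : ℝ → ℝ → Fin n → ℝ}
    (hf : ∀ x ∈ Set.Icc (0:ℝ) 1, ∀ t : ℝ, ∀ j : Fin n, f x (t + T) j = f x t j)
    {u g : E n} (hu : ∀ x t, ‖vc u x t‖ ≤ δ₀) (hp : Per T u)
    (h1 : GOf A f u g) : Per T g := by
  have e : ∀ x t, vc u (cl x) (t + T) = vc u (cl x) t := fun x t => by
    unfold vc; congr 1; funext j; exact hp j _ t
  intro j x t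
  rw [h1, h1, e, (hper _ (cl_mem x) t _ (hu _ _)).1, hf _ (cl_mem x)]

/-- interpolation in time -/
lemma Dt.interp {w wt wtt : E n} (h : Dt w wt) (h' : Dt wt wtt) {s : ℝ} (hs : 0 < s) :
    ‖wt‖ ≤ 2 * ‖w‖ / s + s * ‖wtt‖ := by
  refine E_norm_le (by positivity) fun j x t => ?_
  obtain ⟨c, hc, e⟩ := exists_hasDerivAt_eq_slope (cp w j x) (cp wt j x) (a := t) (b := t + s) (by linarith)
    (fun a _ => (h j x a).continuousAt.continuousWithinAt) fun a _ => h j x a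
  have h1 := h'.lip_t j x t c
  have h2 : |t - c| ≤ s := by rw [abs_le]; constructor <;> linarith [hc.1, hc.2]
  have h3 : |cp wt j x c| ≤ 2 * ‖w‖ / s := by
    rw [e, add_sub_cancel_left, abs_div, abs_of_pos hs]
    gcongr
    refine (abs_sub _ _).trans ?_
    linarith [cp_le w j x t, cp_le w j x (t + s)]
  have h4 : ‖wtt‖ * |t - c| ≤ ‖wtt‖ * s := by gcongr
  have h5 := abs_sub_abs_le_abs_sub (cp wt j x t) (cp wt j x c)
  linarith

end QL
end

section
namespace QL
open scoped Topology
variable {n : ℕ}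

lemma cc_of_strip {u : ℝ → ℝ → Vn n} (h : ContinuousOn (fun q : ℝ × ℝ => u q.1 q.2) strip) (j : Fin n) :
    CC fun x t => u (cl x) t j := by
  have h1 : Continuous fun q : ℝ × ℝ => u (cl q.1) q.2 :=
    h.comp_continuous (f := fun q : ℝ × ℝ => (cl q.1, q.2))
      ((cl_cont.comp continuous_fst).prodMk continuous_snd) fun q => ⟨cl_mem q.1, mem_univ _⟩
  exact ((PiLp.continuous_ofLp 2 _).comp h1 |> fun h => (continuous_apply j).comp h)

section
variable {m : ℕ} {p : Fin n → Fin n → ℝ} {A : ℝ → ℝ → Vn n → Fin n → ℝ}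
  {B : ℝ → ℝ → Vn n → Fin n → Fin n → ℝ}
  {δ₀ C R : ℝ} (H : Hyp m A B δ₀ C R) {f : ℝ → ℝ → Fin n → ℝ} {ε : ℝ}
include H

lemma ql_E {u ux ut : ℝ → ℝ → Vn n} {δ : ℝ} (hs : IsQLSol n m p A B f u ux ut) (hb : BC1le n u ux ut δ)
    (h1 : δ ≤ δ₀) (h2 : δ ≤ 1) : ∃ U Ux Ut : E n, Dat δ₀ U Ux Ut ∧ (∀ x t, vc U x t = u (cl x) t) ∧
      ‖U‖ ≤ δ ∧ ‖Ut‖ ≤ δ ∧ ∀ (cf : Cf n) (h : cf.OK m (MH C R)) (g : E n), CfOf A B U cf → GOf A f U g →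
        Sol cf m p U (Mop h U + g) := by
  obtain ⟨c1, c2, c3, hd, he, hbc⟩ := hs
  have hδ : 0 ≤ δ := (norm_nonneg _).trans (hb 0 (by simp) 0).1
  have hn : ∀ (v : Vn n) (j : Fin n), |v j| ≤ ‖v‖ := fun v j => PiLp.norm_apply_le v j
  have b1 : ∀ (j : Fin n) x t, |u (cl x) t j| ≤ δ := fun j x t => (hn _ j).trans (hb _ (cl_mem x) t).1
  have b2 : ∀ (j : Fin n) x t, |ux (cl x) t j| ≤ δ := fun j x t => (hn _ j).trans (hb _ (cl_mem x) t).2.1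
  have b3 : ∀ (j : Fin n) x t, |ut (cl x) t j| ≤ δ := fun j x t => (hn _ j).trans (hb _ (cl_mem x) t).2.2
  obtain ⟨U, hU⟩ : ∃ U : E n, ∀ j x t, cp U j x t = u (cl x) t j :=
    ⟨mkE (fun j x t => u (cl x) t j) (cc_of_strip c1) δ b1, fun _ _ _ => rfl⟩
  obtain ⟨Ux, hUx⟩ : ∃ U : E n, ∀ j x t, cp U j x t = ux (cl x) t j :=
    ⟨mkE (fun j x t => ux (cl x) t j) (cc_of_strip c2) δ b2, fun _ _ _ => rfl⟩
  obtain ⟨Ut, hUt⟩ : ∃ U : E n, ∀ j x t, cp U j x t = ut (cl x) t j :=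
    ⟨mkE (fun j x t => ut (cl x) t j) (cc_of_strip c3) δ b3, fun _ _ _ => rfl⟩
  have v1 : ∀ x t, vc U x t = u (cl x) t := fun x t => by ext j; exact hU j x t
  have v2 : ∀ x t, vc Ux x t = ux (cl x) t := fun x t => by ext j; exact hUx j x t
  have v3 : ∀ x t, vc Ut x t = ut (cl x) t := fun x t => by ext j; exact hUt j x t
  have hdt : Dt U Ut := fun j x t => by
    have e : cp U j x = fun t => u (cl x) t j := funext fun t => hU j x t
    rw [e, hUt]
    exact (hd _ (cl_mem x) t j).2
  have hdx : ∀ j, ∀ x ∈ Icc (0:ℝ) 1, ∀ t,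
      HasDerivWithinAt (fun y => cp U j y t) (cp Ux j x t) (Icc 0 1) x := fun j x hx t => by
    rw [hUx, cl_eq hx]
    exact (hd x hx t j).1.congr (fun y hy => by rw [hU, cl_eq hy]) (by rw [hU, cl_eq hx])
  have hcl : Clamped U := fun j x t => by rw [hU, hU, cl_cl]
  have hdat : Dat δ₀ U Ux Ut := ⟨hcl, hdt, hdx, fun x t => by rw [v1]; exact (hb _ (cl_mem x) t).1.trans h1,
      fun x t => by rw [v2, cl_cl]; exact (hb _ (cl_mem x) t).2.1.trans h2,
      fun x t => by rw [v3, cl_cl]; exact (hb _ (cl_mem x) t).2.2.trans h2⟩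
  refine ⟨U, Ux, Ut, hdat, v1, E_norm_le hδ fun j x t => by rw [hU]; exact b1 j x t,
    E_norm_le hδ fun j x t => by rw [hUt]; exact b3 j x t, ?_⟩
  intro cf h g hcf hg
  refine Sol.of_classical h (yx := fun j => cp Ux j) (yt := fun j => cp Ut j) hcl ?_
    (fun j => ⟨hdt.td j, cp_cc Ux j, hdx j⟩) ?_
  · intro j t
    refine (bc_xs (fun j x => cp U j x t)).1 ?_ j
    have e0 : (WithLp.toLp 2 fun j => cp U j 0 t : Vn n) = u 0 t := by
      have := v1 0 t; rwa [cl_eq (by simp)] at this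
    have e1 : (WithLp.toLp 2 fun j => cp U j 1 t : Vn n) = u 1 t := by
      have := v1 1 t; rwa [cl_eq (by simp)] at this
    rw [e0, e1]; exact hbc t
  · intro j x hx t
    have hv : vc U x t = u x t := by rw [v1, cl_eq hx]
    have := (eq_iff hcf hg hx (t := t) (j := j) (H.A0 hx t (hdat.b x t) j) (fun k => cp U k x t)
      (cp Ux j x t) (cp Ut j x t)).1 (by
        rw [hv]; simp only [hU, hUt, hUx, cl_eq hx]; exact he x hx t j)
    rw [this, cp_add, cp_Mop, Mr]
    ring

/-- uniform a priori estimate -/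
def UAP (m : ℕ) (p : Fin n → Fin n → ℝ) (A : ℝ → ℝ → Vn n → Fin n → ℝ)
    (B : ℝ → ℝ → Vn n → Fin n → Fin n → ℝ) (M δ₀ δ K1 : ℝ) : Prop :=
  ∀ u : E n, ‖u‖ ≤ δ → (∀ x t, ‖vc u x t‖ ≤ δ₀) → ∀ cf : Cf n, CfOf A B u cf → AP cf m p M K1

theorem ql_unique {δ K1 : ℝ} (hK : 0 ≤ K1) (hU : UAP m p A B (MH C R) δ₀ δ K1)
    (h1 : δ ≤ δ₀) (h2 : δ ≤ 1) (hε : 0 ≤ ε) (hf : ∀ j, B2 strip (fun q : ℝ × ℝ => f q.1 q.2 j) ε)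
    (hs : K1 * (MH C R * n * (ε + (n + 2) * δ)) ≤ 1 / 2)
    {u ux ut : ℝ → ℝ → Vn n} (hu : IsQLSol n m p A B f u ux ut) (hub : BC1le n u ux ut δ)
    {w wx wt : ℝ → ℝ → Vn n} (hw : IsQLSol n m p A B f w wx wt) (hwb : BC1le n w wx wt δ) :
    ∀ x ∈ Icc (0:ℝ) 1, ∀ t, u x t = w x t := by
  obtain ⟨Y, Yx, Yt, y1, y2, y3, y4, y5⟩ := ql_E H hu hub h1 h2
  obtain ⟨Z, Zx, Zt, z1, z2, z3, z4, z5⟩ := ql_E H hw hwb h1 h2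
  obtain ⟨cf, a1, a2, -⟩ := H.cf y1
  obtain ⟨cf', b1, b2, -⟩ := H.cf z1
  obtain ⟨g, gt, a3, -⟩ := H.g hε hf y1
  obtain ⟨g', gt', b3, -⟩ := H.g hε hf z1
  have hM := H.MH1.1
  have key := sol_diff a1 b1 hK (hU Y y3 y1.b cf a2) (H.close y1.b z1.b a2 b2)
    (H.g_diff hε hf y1.b z1.b a3 b3) (y5 cf a1 g a2 a3) y1.dt (z5 cf' b1 g' b2 b3) z1.dt (by positivity)
  have e : K1 * (ε * (MH C R * (n * ‖Y - Z‖)) + MH C R * (n * ‖Y - Z‖) * ((n + 1) * ‖Z‖ + ‖Zt‖))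
      ≤ K1 * (ε * (MH C R * (n * ‖Y - Z‖)) + MH C R * (n * ‖Y - Z‖) * ((n + 1) * δ + δ)) := by gcongr
  have e2 := mul_le_mul_of_nonneg_right hs (norm_nonneg (Y - Z))
  have e3 : ‖Y - Z‖ ≤ 0 := by
    have : K1 * (ε * (MH C R * (n * ‖Y - Z‖)) + MH C R * (n * ‖Y - Z‖) * ((n + 1) * δ + δ))
      = K1 * (MH C R * n * (ε + (n + 2) * δ)) * ‖Y - Z‖ := by ring
    linarith
  have e4 : Y = Z := by
    rw [← sub_eq_zero]; exact norm_le_zero_iff.1 e3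
  intro x hx t
  have e5 := y2 x t
  have e6 := z2 x t
  rw [cl_eq hx] at e5 e6
  rw [← e5, ← e6, e4]

end

/-- iterates -/
structure Good (T η : ℝ) (y yx yt ytt : E n) : Prop where
  per : Per T y
  clp : Clamped y
  dt : Dt y yt
  dtt : Dt yt ytt
  dx : ∀ j, ∀ x ∈ Icc (0:ℝ) 1, ∀ t, HasDerivWithinAt (fun s => cp y j s t) (cp yx j x t) (Icc 0 1) x
  b : ‖y‖ ≤ η
  bx : ‖yx‖ ≤ η
  bt : ‖yt‖ ≤ η
  btt : ‖ytt‖ ≤ η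

lemma vc_le' {u : E n} {η δ : ℝ} (h : ‖u‖ ≤ η) (hd : n * η ≤ δ) (x t : ℝ) : ‖vc u x t‖ ≤ δ :=
  (vc_le u x t).trans ((mul_le_mul_of_nonneg_left h (Nat.cast_nonneg n)).trans hd)

lemma Good.dat {T η δ₀ : ℝ} {y yx yt ytt : E n} (h : Good T η y yx yt ytt) (h1 : n * η ≤ δ₀) (h2 : n * η ≤ 1) :
    Dat δ₀ y yx yt ∧ ∃ utt, Dt yt utt ∧ ∀ x t, ‖vc utt x t‖ ≤ 1 :=
  ⟨⟨h.clp, h.dt, h.dx, vc_le' h.b h1, fun _ t => vc_le' h.bx h2 _ t, fun _ t => vc_le' h.bt h2 _ t⟩,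
    ytt, h.dtt, vc_le' h.btt h2⟩

lemma Good.zero {T η : ℝ} (hη : 0 ≤ η) : Good T η (0 : E n) 0 0 0 where
  per _ _ _ := rfl
  clp _ _ _ := rfl
  dt := Dt.zero
  dtt := Dt.zero
  dx _ _ _ _ := hasDerivWithinAt_const _ _ _
  b := by simpa using hη
  bx := by simpa using hη
  bt := by simpa using hη
  btt := by simpa using hη

/-- linear solvability -/
def LS (p : Fin n → Fin n → ℝ) (M K1 K3 : ℝ) : Prop :=
  ∀ (m : ℕ) (cf : Cf n) (h : cf.OK m M) (qtt dtt ctt) (_ : cf.OK2 M qtt dtt ctt)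
      (T : ℝ) (_ : 0 < T) (_ : cf.Per T) (_ : AP cf m p M K1) (g gt gtt : E n) (G : ℝ),
      Per T g → Dt g gt → Dt gt gtt → ‖g‖ ≤ G → ‖gt‖ ≤ G → ‖gtt‖ ≤ G →
      ∃ y yt ytt : E n, Per T y ∧ Dt y yt ∧ Dt yt ytt ∧ Sol cf m p y (Mop h y + g) ∧
        ‖y‖ ≤ K3 * G ∧ ‖yt‖ ≤ K3 * G ∧ ‖ytt‖ ≤ K3 * G

/-- one step -/
def St (m : ℕ) (p : Fin n → Fin n → ℝ) (A : ℝ → ℝ → Vn n → Fin n → ℝ)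
    (B : ℝ → ℝ → Vn n → Fin n → Fin n → ℝ) (f : ℝ → ℝ → Fin n → ℝ) (M : ℝ) (y y' yx' yt' : E n) : Prop :=
  ∃ (cf : Cf n) (h : cf.OK m M) (g : E n), CfOf A B y cf ∧ GOf A f y g ∧ Sol cf m p y' (Mop h y' + g) ∧
    ∀ j x t, cp yx' j x t = cp (Mop h y' + g) j x t - cf.d j x t * cp y' j x t - cf.q j x t * cp yt' j x t

section
variable {m : ℕ} {p : Fin n → Fin n → ℝ} {A : ℝ → ℝ → Vn n → Fin n → ℝ}
  {B : ℝ → ℝ → Vn n → Fin n → Fin n → ℝ}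
  {δ₀ C R : ℝ} (H : Hyp m A B δ₀ C R) {f : ℝ → ℝ → Fin n → ℝ} {ε T η K1 K3 : ℝ}
  (hK1 : 0 ≤ K1) (hK3 : 0 ≤ K3) (hU : UAP m p A B (MH C R) δ₀ η K1) (h1 : n * η ≤ δ₀) (h2 : n * η ≤ 1)
  (hε : 0 ≤ ε) (hf : ∀ j, B2 strip (fun q : ℝ × ℝ => f q.1 q.2 j) ε)
include H h1 h2 hε hf hU

include hK3 in
theorem step (hT : 0 < T) (hper : ∀ x ∈ Set.Icc (0:ℝ) 1, ∀ t : ℝ, ∀ v : Vn n, ‖v‖ ≤ δ₀ →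
      (∀ j : Fin n, A x (t + T) v j = A x t v j) ∧
      (∀ j k : Fin n, B x (t + T) v j k = B x t v j k))
    (hfp : ∀ x ∈ Set.Icc (0:ℝ) 1, ∀ t : ℝ, ∀ j : Fin n, f x (t + T) j = f x t j)
    (hLS : LS p (MH C R) K1 K3)
    (hη : (1 + K3 + (n + 2) * MH C R * K3) * (MH C R * ε) ≤ η) {y yx yt ytt : E n} (hy : Good T η y yx yt ytt) :
    ∃ y' yx' yt' ytt', Good T η y' yx' yt' ytt' ∧ St m p A B f (MH C R) y y' yx' yt' := by
  obtain ⟨hd, hP⟩ := hy.dat h1 h2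
  obtain ⟨cf, a1, a2, a3⟩ := H.cf hd
  obtain ⟨qtt, dtt, ctt, a4⟩ := a3 hP
  obtain ⟨g, gt, b1, b2, b3, b4, b5⟩ := H.g hε hf hd
  obtain ⟨gtt, b6, b7⟩ := b5 hP
  obtain ⟨y', yt', ytt', c1, c2, c3, c4, c5, c6, c7⟩ := hLS m cf a1 qtt dtt ctt a4 T hT
    (a2.per hper hd.b hy.per) (hU y hy.b hd.b cf a2) g gt gtt (MH C R * ε)
    (b1.per hper hfp hd.b hy.per) b2 b6 b3 b4 b7
  have hM := H.MH1.1
  have hG : 0 ≤ MH C R * ε := by positivity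
  have hxt := fun j => c4.xt a1 c2 j
  have hbx : ∀ j x t, |cp (Mop a1 y' + g) j x t - cf.d j x t * cp y' j x t - cf.q j x t * cp yt' j x t|
      ≤ (1 + (n + 2) * MH C R * K3) * (MH C R * ε) := by
    intro j x t
    rw [cp_add, cp_Mop, Mr]
    have d1 : |∑ k, cf.c j k x t * cp y' k x t| ≤ n * (MH C R * (K3 * (MH C R * ε))) :=
      (Finset.abs_sum_le_sum_abs _ _).trans ((Finset.sum_le_card_nsmul _ _ _ fun k _ =>
        mul_bd (a1.bc j k x t) ((cp_le y' k x t).trans c5)).trans (by simp))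
    have d2 := mul_bd (a1.bd j x t) ((cp_le y' j x t).trans c5)
    have d3 := mul_bd (a1.bq j x t) ((cp_le yt' j x t).trans c6)
    have d4 := (cp_le g j x t).trans b3
    have e1 := abs_sub (-∑ k, cf.c j k x t * cp y' k x t + cp g j x t - cf.d j x t * cp y' j x t)
      (cf.q j x t * cp yt' j x t)
    have e2 := abs_sub (-∑ k, cf.c j k x t * cp y' k x t + cp g j x t) (cf.d j x t * cp y' j x t)
    have e3 := abs_add_le (-∑ k, cf.c j k x t * cp y' k x t) (cp g j x t)
    rw [abs_neg] at e3
    linarith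
  have hK : K3 * (MH C R * ε) ≤ η := by
    have : 0 ≤ (1 + (n + 2) * MH C R * K3) * (MH C R * ε) := by positivity
    linarith
  have hK' : (1 + (n + 2) * MH C R * K3) * (MH C R * ε) ≤ η := by
    have : 0 ≤ K3 * (MH C R * ε) := by positivity
    linarith
  refine ⟨y', mkE _ (fun j => (hxt j).cx) _ hbx, yt', ytt', ⟨c1, c4.clp, c2, c3, fun j => (hxt j).dx,
    c5.trans hK, ?_, c6.trans hK, c7.trans hK⟩, cf, a1, g, a2, b1, c4, fun _ _ _ => rfl⟩
  exact (E_norm_le (by positivity) hbx).trans hK'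

omit h2 in
include hK1 in
lemma contr (hs : K1 * (MH C R * n * (ε + (n + 2) * η)) ≤ 1 / 2)
    {y y' y'' yx' yt' yx'' yt'' : E n} (hy : ‖y‖ ≤ η) (hy' : ‖y'‖ ≤ η) (hyt : ‖yt'‖ ≤ η) (hdt : Dt y' yt')
    (hdt' : Dt y'' yt'')
    (s1 : St m p A B f (MH C R) y y' yx' yt') (s2 : St m p A B f (MH C R) y' y'' yx'' yt'') :
    ‖y'' - y'‖ ≤ 1 / 2 * ‖y' - y‖ := by
  obtain ⟨cf', b1, g', b2, b3, b4, -⟩ := s1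
  obtain ⟨cf, a1, g, a2, a3, a4, -⟩ := s2
  have hM := H.MH1.1
  have d := vc_le' hy h1
  have d' := vc_le' hy' h1
  have key := sol_diff a1 b1 hK1 (hU y' hy' d' cf a2) (H.close d' d a2 b2)
    (H.g_diff hε hf d' d a3 b3) a4 hdt' b4 hdt (by positivity)
  have e : K1 * (ε * (MH C R * (n * ‖y' - y‖)) + MH C R * (n * ‖y' - y‖) * ((n + 1) * ‖y'‖ + ‖yt'‖))
      ≤ K1 * (ε * (MH C R * (n * ‖y' - y‖)) + MH C R * (n * ‖y' - y‖) * ((n + 1) * η + η)) := by gcongr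
  have e2 := mul_le_mul_of_nonneg_right hs (norm_nonneg (y' - y))
  have : K1 * (ε * (MH C R * (n * ‖y' - y‖)) + MH C R * (n * ‖y' - y‖) * ((n + 1) * η + η))
      = K1 * (MH C R * n * (ε + (n + 2) * η)) * ‖y' - y‖ := by ring
  linarith

omit hU h2 in
lemma yx_diff {y y' yx' yt' z z' zx' zt' : E n} (hy : ‖y‖ ≤ η) (hz : ‖z‖ ≤ η)
    (hz' : ‖z'‖ ≤ η) (hzt : ‖zt'‖ ≤ η)
    (s1 : St m p A B f (MH C R) y y' yx' yt') (s2 : St m p A B f (MH C R) z z' zx' zt') :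
    ‖yx' - zx'‖ ≤ (MH C R * n * (ε + (n + 2) * η)) * ‖y - z‖ + (n + 1) * MH C R * ‖y' - z'‖
      + MH C R * ‖yt' - zt'‖ := by
  obtain ⟨cf, a1, g, a2, a3, a4, a5⟩ := s1
  obtain ⟨cf', b1, g', b2, b3, b4, b5⟩ := s2
  have hM := H.MH1.1
  have hη : 0 ≤ η := (norm_nonneg _).trans hy
  have d := vc_le' hy h1
  have d' := vc_le' hz h1
  have hc := H.close d d' a2 b2
  have hg := H.g_diff hε hf d d' a3 b3
  set D := MH C R * (n * ‖y - z‖) with hD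
  have hc1 : ∀ j x t, |cf.q j x t - cf'.q j x t| ≤ D := fun j x t => by
    have := hc.q j _ (cl_mem x) t; rw [a2.q, b2.q, cl_cl] at this; rwa [a2.q, b2.q]
  have hc2 : ∀ j x t, |cf.d j x t - cf'.d j x t| ≤ D := fun j x t => by
    have := hc.d j _ (cl_mem x) t; rw [a2.d, b2.d, cl_cl] at this; rwa [a2.d, b2.d]
  have hc3 : ∀ j k x t, |cf.c j k x t - cf'.c j k x t| ≤ D := fun j k x t => by
    have := hc.c j k _ (cl_mem x) t; rw [a2.c, b2.c, cl_cl] at this; rwa [a2.c, b2.c]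
  refine E_norm_le (by positivity) fun j x t => ?_
  have pr : ∀ {a b u v K U w : ℝ}, |a| ≤ K → |u - v| ≤ w → |a - b| ≤ D → |v| ≤ U →
      |a * u - b * v| ≤ K * w + D * U := by
    intro a b u v K U w h1 h2 h3 h4
    have e : a * u - b * v = a * (u - v) + (a - b) * v := by ring
    rw [e]
    exact (abs_add_le _ _).trans (add_le_add (mul_bd h1 h2) (mul_bd h3 h4))
  have f1 : |∑ k, (cf.c j k x t * cp y' k x t - cf'.c j k x t * cp z' k x t)|
      ≤ n * (MH C R * ‖y' - z'‖ + D * η) :=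
    (Finset.abs_sum_le_sum_abs _ _).trans ((Finset.sum_le_card_nsmul _ _ _ fun k _ =>
      pr (a1.bc j k x t) (cp_le (y' - z') k x t) (hc3 j k x t) ((cp_le z' k x t).trans hz')).trans (by simp [mul_add]))
  have f2 : |cf.d j x t * cp y' j x t - cf'.d j x t * cp z' j x t| ≤ _ := pr (a1.bd j x t) (cp_le (y' - z') j x t) (hc2 j x t) ((cp_le z' j x t).trans hz')
  have f3 : |cf.q j x t * cp yt' j x t - cf'.q j x t * cp zt' j x t| ≤ _ := pr (a1.bq j x t) (cp_le (yt' - zt') j x t) (hc1 j x t) ((cp_le zt' j x t).trans hzt)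
  have f4 := (cp_le (g - g') j x t).trans hg
  rw [cp_sub] at f4
  rw [cp_sub, a5, b5, cp_add, cp_add, cp_Mop, cp_Mop, Mr, Mr]
  rw [Finset.sum_sub_distrib] at f1
  rw [abs_le] at f1 f2 f3 f4 ⊢
  have e : MH C R * n * (ε + (n + 2) * η) * ‖y - z‖ = ε * D + n * (D * η) + D * η + D * η := by rw [hD]; ring
  constructor <;> rw [e] <;> linarith [f1.1, f1.2, f2.1, f2.2, f3.1, f3.2, f4.1, f4.2]

end

end QL
end

section
namespace QL
open scoped Topology
variable {n : ℕ}

lemma cp_lim {u : ℕ → E n} {u0 : E n} (h : Tendsto u atTop (𝓝 u0)) (j : Fin n) (x t : ℝ) :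
    Tendsto (fun i => cp (u i) j x t) atTop (𝓝 (cp u0 j x t)) := by
  rw [tendsto_iff_norm_sub_tendsto_zero] at h ⊢
  exact squeeze_zero (fun _ => norm_nonneg _) (fun i => cp_le (u i - u0) j x t) h

lemma dx_lim {u ux : ℕ → E n} {u0 v0 : E n}
    (h : ∀ i, ∀ j, ∀ x ∈ Icc (0:ℝ) 1, ∀ t,
      HasDerivWithinAt (fun s => cp (u i) j s t) (cp (ux i) j x t) (Icc 0 1) x)
    (hu : Tendsto u atTop (𝓝 u0)) (hv : Tendsto ux atTop (𝓝 v0)) (j : Fin n) {x : ℝ} (hx : x ∈ Icc (0:ℝ) 1)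
    (t : ℝ) : HasDerivWithinAt (fun s => cp u0 j s t) (cp v0 j x t) (Icc 0 1) x := by
  have hcx : ∀ w : E n, Continuous fun s => cp w j s t := fun w =>
    (cp_cc w j).comp continuous_id continuous_const
  have key : ∀ s ∈ Icc (0:ℝ) 1, cp u0 j s t = cp u0 j 0 t + ∫ r in (0:ℝ)..s, cp v0 j r t := by
    intro s hs
    have h1 : ∀ i, cp (u i) j s t - cp (u i) j 0 t = ∫ r in (0:ℝ)..s, cp (ux i) j r t := fun i =>
      (ftc_Icc (fun x hx => h i j x hx t) (hcx _).continuousOn (by simp) hs).symm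
    have h2 : Tendsto (fun i => ∫ r in (0:ℝ)..s, cp (ux i) j r t) atTop (𝓝 (∫ r in (0:ℝ)..s, cp v0 j r t)) := by
      rw [tendsto_iff_norm_sub_tendsto_zero] at hv ⊢
      refine squeeze_zero (fun _ => norm_nonneg _) (fun i => ?_) hv
      rw [← intervalIntegral.integral_sub ((hcx _).intervalIntegrable _ _) ((hcx _).intervalIntegrable _ _)]
      refine (intervalIntegral.norm_integral_le_of_norm_le_const (C := ‖ux i - v0‖) fun r _ =>
        cp_le (ux i - v0) j r t).trans ?_
      rw [sub_zero, abs_of_nonneg hs.1]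
      exact mul_le_of_le_one_right (norm_nonneg _) hs.2
    have h3 := (cp_lim hu j s t).sub (cp_lim hu j 0 t)
    simp only [h1] at h3
    linarith [tendsto_nhds_unique h3 h2]
  have hd : HasDerivAt (fun s => cp u0 j 0 t + ∫ r in (0:ℝ)..s, cp v0 j r t) (cp v0 j x t) x :=
    (intervalIntegral.integral_hasDerivAt_right ((hcx v0).intervalIntegrable _ _)
      ((hcx v0).stronglyMeasurableAtFilter _ _) (hcx v0).continuousAt).const_add _
  exact hd.hasDerivWithinAt.congr key (key x hx)

lemma cauchy_t {η : ℝ} {y yt ytt : ℕ → E n} (h1 : ∀ i, Dt (y i) (yt i)) (h2 : ∀ i, Dt (yt i) (ytt i))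
    (hb : ∀ i, ‖ytt i‖ ≤ η) (hc : CauchySeq y) : CauchySeq yt := by
  have hη : 0 ≤ η := (norm_nonneg _).trans (hb 0)
  rw [Metric.cauchySeq_iff] at hc ⊢
  intro e he
  set s := e / (4 * (η + 1)) with hs
  have hs0 : 0 < s := by positivity
  obtain ⟨N, hN⟩ := hc (e * s / 4) (by positivity)
  refine ⟨N, fun k hk l hl => ?_⟩
  have a := hN k hk l hl
  rw [dist_eq_norm] at a ⊢
  refine (((h1 k).sub (h1 l)).interp ((h2 k).sub (h2 l)) hs0).trans_lt ?_
  have b : ‖ytt k - ytt l‖ ≤ 2 * η := (norm_sub_le _ _).trans (by linarith [hb k, hb l])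
  have c : 2 * ‖y k - y l‖ / s ≤ e / 2 := by
    rw [div_le_iff₀ hs0]; linarith
  have d : s * ‖ytt k - ytt l‖ ≤ s * (2 * η) := by gcongr
  have f : s * (4 * (η + 1)) = e := by rw [hs]; field_simp
  nlinarith

section
variable {m : ℕ} {p : Fin n → Fin n → ℝ} {A : ℝ → ℝ → Vn n → Fin n → ℝ}
  {B : ℝ → ℝ → Vn n → Fin n → Fin n → ℝ}
  {δ₀ C R : ℝ} (H : Hyp m A B δ₀ C R) {f : ℝ → ℝ → Fin n → ℝ} {ε T η K1 K3 : ℝ}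
include H

lemma F_lim {F : ℝ × ℝ × Vn n → ℝ} (hF : B2 (qdom n δ₀) F C) {x : ℝ} (hx : x ∈ Icc (0:ℝ) 1) (t : ℝ)
    {v : ℕ → Vn n} {w : Vn n} (hv : ∀ i, ‖v i‖ ≤ δ₀) (hw : ‖w‖ ≤ δ₀)
    (h : Tendsto (fun i => ‖v i - w‖) atTop (𝓝 0)) :
    Tendsto (fun i => F (x, t, v i)) atTop (𝓝 (F (x, t, w))) := by
  rw [tendsto_iff_norm_sub_tendsto_zero]
  have h2 : Tendsto (fun i => C * ‖v i - w‖) atTop (𝓝 0) := by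
    simpa using h.const_mul C
  refine squeeze_zero (fun _ => norm_nonneg _) (fun i => ?_) h2
  have hl := hF.lip (qdom_ud H.hδ) (qdom_convex δ₀) (a := (x, t, v i)) (b := (x, t, w))
    ⟨hx, mem_univ _, mem_closedBall_zero_iff.2 (hv i)⟩ ⟨hx, mem_univ _, mem_closedBall_zero_iff.2 hw⟩
  have hn : ‖((x, t, v i) : ℝ × ℝ × Vn n) - (x, t, w)‖ = ‖v i - w‖ := by
    simp [Prod.norm_def]
  rw [hn] at hl
  exact hl

lemma AB_lim {y : ℕ → E n} {Y : E n} (hy : Tendsto y atTop (𝓝 Y)) (hb : ∀ i x t, ‖vc (y i) x t‖ ≤ δ₀)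
    (hb0 : ∀ x t, ‖vc Y x t‖ ≤ δ₀) {x : ℝ} (hx : x ∈ Icc (0:ℝ) 1) (t : ℝ) (j : Fin n) :
    Tendsto (fun i => A x t (vc (y i) x t) j) atTop (𝓝 (A x t (vc Y x t) j)) ∧
      ∀ k, Tendsto (fun i => B x t (vc (y i) x t) j k) atTop (𝓝 (B x t (vc Y x t) j k)) := by
  have h3 : Tendsto (fun i => ‖vc (y i) x t - vc Y x t‖) atTop (𝓝 0) := by
    rw [tendsto_iff_norm_sub_tendsto_zero] at hy
    have h2 : Tendsto (fun i => n * ‖y i - Y‖) atTop (𝓝 0) := by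
      simpa using hy.const_mul (n:ℝ)
    refine squeeze_zero (fun _ => norm_nonneg _) (fun i => ?_) h2
    rw [vc_sub]
    exact vc_le _ _ _
  exact ⟨F_lim H (H.hA j) hx t (fun i => hb i x t) (hb0 x t) h3,
    fun k => F_lim H (H.hB j k) hx t (fun i => hb i x t) (hb0 x t) h3⟩

theorem ql_exists {δ : ℝ}
    (hK1 : 0 ≤ K1) (hK3 : 0 ≤ K3) (hU : UAP m p A B (MH C R) δ₀ η K1) (h1 : n * η ≤ δ₀) (h2 : n * η ≤ 1)
    (h3 : n * η ≤ δ)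
    (hε : 0 ≤ ε) (hf : ∀ j, B2 strip (fun q : ℝ × ℝ => f q.1 q.2 j) ε)
    (hT : 0 < T) (hper : ∀ x ∈ Set.Icc (0:ℝ) 1, ∀ t : ℝ, ∀ v : Vn n, ‖v‖ ≤ δ₀ →
      (∀ j : Fin n, A x (t + T) v j = A x t v j) ∧
      (∀ j k : Fin n, B x (t + T) v j k = B x t v j k))
    (hfp : ∀ x ∈ Set.Icc (0:ℝ) 1, ∀ t : ℝ, ∀ j : Fin n, f x (t + T) j = f x t j)
    (hLS : LS p (MH C R) K1 K3)
    (hη : (1 + K3 + (n + 2) * MH C R * K3) * (MH C R * ε) ≤ η)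
    (hs : K1 * (MH C R * n * (ε + (n + 2) * η)) ≤ 1 / 2) :
    ∃ u ux ut : ℝ → ℝ → Vn n, IsQLSol n m p A B f u ux ut ∧ BC1le n u ux ut δ := by
  have hM := H.MH1.1
  have hη0 : 0 ≤ η := le_trans (by positivity) hη
  obtain ⟨y, yx, yt, ytt, hG, hS⟩ : ∃ y yx yt ytt : ℕ → E n, (∀ i, Good T η (y i) (yx i) (yt i) (ytt i)) ∧
      ∀ i, St m p A B f (MH C R) (y i) (y (i + 1)) (yx (i + 1)) (yt (i + 1)) := by
    have hst : ∀ s : {s : E n × E n × E n × E n // Good T η s.1 s.2.1 s.2.2.1 s.2.2.2},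
        ∃ s' : {s : E n × E n × E n × E n // Good T η s.1 s.2.1 s.2.2.1 s.2.2.2},
          St m p A B f (MH C R) s.1.1 s'.1.1 s'.1.2.1 s'.1.2.2.1 := fun s => by
      obtain ⟨a, b, c, d, e, e'⟩ := step H hK3 hU h1 h2 hε hf hT hper hfp hLS hη s.2
      exact ⟨⟨(a, b, c, d), e⟩, e'⟩
    choose F hF using hst
    let s0 : {s : E n × E n × E n × E n // Good T η s.1 s.2.1 s.2.2.1 s.2.2.2} :=
      ⟨(0, 0, 0, 0), Good.zero hη0⟩
    let sq : ℕ → {s : E n × E n × E n × E n // Good T η s.1 s.2.1 s.2.2.1 s.2.2.2} :=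
      fun i => F^[i] s0
    refine ⟨fun i => (sq i).1.1, fun i => (sq i).1.2.1, fun i => (sq i).1.2.2.1, fun i => (sq i).1.2.2.2,
      fun i => (sq i).2, fun i => ?_⟩
    have : sq (i + 1) = F (sq i) := Function.iterate_succ_apply' F i s0
    change St m p A B f (MH C R) (sq i).1.1 (sq (i+1)).1.1 (sq (i+1)).1.2.1 (sq (i+1)).1.2.2.1
    rw [this]
    exact hF _
  -- convergence
  have hgeo : ∀ i, ‖y (i + 1) - y i‖ ≤ (2 * η) * (1 / 2) ^ i := by
    intro i
    induction i with
    | zero =>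
      have := norm_sub_le (y 1) (y 0)
      simp only [pow_zero, mul_one]
      linarith [(hG 0).b, (hG 1).b]
    | succ i ih =>
      have := contr H hK1 hU h1 hε hf hs (hG i).b (hG (i + 1)).b (hG (i + 1)).bt (hG (i + 1)).dt
        (hG (i + 1 + 1)).dt (hS i) (hS (i + 1))
      rw [pow_succ]
      linarith
  have hcy : CauchySeq y := cauchySeq_of_le_geometric (1 / 2) (2 * η) (by norm_num) fun i => by
    rw [dist_comm, dist_eq_norm]; exact hgeo i
  have hcyt : CauchySeq yt := cauchy_t (fun i => (hG i).dt) (fun i => (hG i).dtt) (fun i => (hG i).btt) hcy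
  have hsh : Tendsto (fun i : ℕ => i + 1) atTop atTop := tendsto_add_atTop_nat 1
  have hcyx : CauchySeq fun i => yx (i + 1) := by
    have c1 := cauchySeq_iff_tendsto_dist_atTop_0.1 hcy
    have c2 := cauchySeq_iff_tendsto_dist_atTop_0.1 (hcy.comp_tendsto hsh)
    have c3 := cauchySeq_iff_tendsto_dist_atTop_0.1 (hcyt.comp_tendsto hsh)
    rw [cauchySeq_iff_tendsto_dist_atTop_0]
    have c4 := ((c1.const_mul (MH C R * n * (ε + (n + 2) * η))).add (c2.const_mul ((n + 1) * MH C R))).add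
      (c3.const_mul (MH C R))
    simp only [mul_zero, add_zero] at c4
    refine squeeze_zero (fun _ => dist_nonneg) (fun i => ?_) c4
    simp only [dist_eq_norm, Function.comp]
    exact yx_diff H h1 hε hf (hG i.1).b (hG i.2).b (hG (i.2 + 1)).b (hG (i.2 + 1)).bt (hS i.1) (hS i.2)
  obtain ⟨Y, hY⟩ := cauchySeq_tendsto_of_complete hcy
  obtain ⟨Yt, hYt⟩ := cauchySeq_tendsto_of_complete hcyt
  obtain ⟨Yx, hYx⟩ := cauchySeq_tendsto_of_complete hcyx
  have hY1 : Tendsto (fun i => y (i + 1)) atTop (𝓝 Y) := hY.comp hsh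
  have hYt1 : Tendsto (fun i => yt (i + 1)) atTop (𝓝 Yt) := hYt.comp hsh
  have bY : ‖Y‖ ≤ η := le_of_tendsto' hY.norm fun i => (hG i).b
  have bYt : ‖Yt‖ ≤ η := le_of_tendsto' hYt.norm fun i => (hG i).bt
  have bYx : ‖Yx‖ ≤ η := le_of_tendsto' hYx.norm fun i => (hG (i + 1)).bx
  have hdt : Dt Y Yt := Dt.lim (fun i => (hG i).dt) hY hYt
  refine ⟨vc Y, vc Yx, vc Yt, ⟨(vc_cont Y).continuousOn, (vc_cont Yx).continuousOn, (vc_cont Yt).continuousOn,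
    fun x hx t j => ⟨?_, hdt j x t⟩, fun x hx t j => ?_, fun t => ?_⟩,
    fun x _ t => ⟨vc_le' bY h3 x t, vc_le' bYx h3 x t, vc_le' bYt h3 x t⟩⟩
  · exact dx_lim (fun i => (hG (i + 1)).dx) hY1 hYx j hx t
  · obtain ⟨l1, l2⟩ := AB_lim H hY (fun i => vc_le' (hG i).b h1) (vc_le' bY h1) hx t j
    have hl : Tendsto (fun i => cp (yt (i + 1)) j x t + A x t (vc (y i) x t) j * cp (yx (i + 1)) j x t
        + ∑ k, B x t (vc (y i) x t) j k * cp (y (i + 1)) k x t) atTop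
        (𝓝 (cp Yt j x t + A x t (vc Y x t) j * cp Yx j x t + ∑ k, B x t (vc Y x t) j k * cp Y k x t)) :=
      ((cp_lim hYt1 j x t).add (l1.mul (cp_lim hYx j x t))).add
        (tendsto_finsetSum _ fun k _ => (l2 k).mul (cp_lim hY1 k x t))
    refine tendsto_nhds_unique hl (tendsto_const_nhds.congr fun i => ?_)
    obtain ⟨cf, a1, g, a2, a3, a4, a5⟩ := hS i
    refine ((eq_iff a2 a3 hx (H.A0 hx t (vc_le' (hG i).b h1 x t) j) (fun k => cp (y (i + 1)) k x t)
      (cp (yx (i + 1)) j x t) (cp (yt (i + 1)) j x t)).2 ?_).symm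
    rw [a5, cp_add, cp_Mop, Mr]
  · refine (bc_xs (fun j x => cp Y j x t)).2 fun j => ?_
    refine tendsto_nhds_unique (cp_lim hY1 j (xs m j) t) ?_
    have : Tendsto (fun i => ∑ k, p j k * cp (y (i + 1)) k (1 - xs m k) t) atTop
        (𝓝 (∑ k, p j k * cp Y k (1 - xs m k) t)) :=
      tendsto_finsetSum _ fun k _ => (cp_lim hY1 k _ t).const_mul _
    refine this.congr fun i => ?_
    obtain ⟨cf, a1, g, a2, a3, a4, a5⟩ := hS i
    exact (a4.bc j t).symm

end

end QL
end

section
namespace QL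
open scoped Topology
variable {n : ℕ}

lemma small {X c : ℝ} (hX : 0 ≤ X) (hc : 0 < c) : ∃ e : ℝ, 0 < e ∧ ∀ d, d ≤ e → X * d ≤ c := by
  refine ⟨c / (X + 1), by positivity, fun d hd => ?_⟩
  have h1 : X * d ≤ X * (c / (X + 1)) := by gcongr
  refine h1.trans ?_
  rw [mul_div_assoc', div_le_iff₀ (by positivity)]
  nlinarith

lemma mkHyp {m : ℕ} {A : ℝ → ℝ → Vn n → Fin n → ℝ} {B : ℝ → ℝ → Vn n → Fin n → Fin n → ℝ}
    {δ₀ Λ₀ : ℝ} (hδ₀ : 0 < δ₀) (hΛ₀ : 0 < Λ₀)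
    (hH1s : ∃ C : ℝ, ∀ j : Fin n, H1smooth n δ₀ (fun x t v => A x t v j) C ∧
      ∀ k : Fin n, H1smooth n δ₀ (fun x t v => B x t v j k) C)
    (hH1 : H1sign n m δ₀ Λ₀ A) : ∃ C R, Hyp m A B δ₀ C R := by
  obtain ⟨C, hC⟩ := hH1s
  have hR : ∀ a : ℝ, Λ₀ ≤ a → 1 ≤ max (1 / Λ₀) 1 * a := fun a ha => by
    have h1 : 1 / Λ₀ * Λ₀ = 1 := by field_simp
    calc (1:ℝ) = 1 / Λ₀ * Λ₀ := h1.symm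
      _ ≤ max (1 / Λ₀) 1 * a := by gcongr; exact le_max_left _ _
  refine ⟨max C 1, max (1 / Λ₀) 1, hδ₀, le_max_right _ _, le_max_right _ _, fun j => ?_, fun j k => ?_,
    fun x hx t v hv j => ?_, fun x hx t v hv j k hjk => hR _ ((hH1 x hx t v hv).2 j k hjk)⟩
  · exact ⟨(hC j).1.1, fun i hi q hq => ((hC j).1.2 i hi q hq).trans (le_max_left _ _)⟩
  · exact ⟨((hC j).2 k).1, fun i hi q hq => (((hC j).2 k).2 i hi q hq).trans (le_max_left _ _)⟩
  · refine hR _ ?_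
    obtain ⟨h1, h2⟩ := (hH1 x hx t v hv).1 j
    unfold sg
    split_ifs with h
    · rw [one_mul]; exact h1 h
    · have := h2 (not_lt.1 h); linarith

lemma shift_sol {m : ℕ} {p : Fin n → Fin n → ℝ} {A : ℝ → ℝ → Vn n → Fin n → ℝ}
    {B : ℝ → ℝ → Vn n → Fin n → Fin n → ℝ} {δ₀ T δ : ℝ} {f : ℝ → ℝ → Fin n → ℝ} (h1 : δ ≤ δ₀)
    (hper : ∀ x ∈ Set.Icc (0:ℝ) 1, ∀ t : ℝ, ∀ v : Vn n, ‖v‖ ≤ δ₀ →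
      (∀ j : Fin n, A x (t + T) v j = A x t v j) ∧
      (∀ j k : Fin n, B x (t + T) v j k = B x t v j k))
    (hfp : ∀ x ∈ Set.Icc (0:ℝ) 1, ∀ t : ℝ, ∀ j : Fin n, f x (t + T) j = f x t j)
    {u ux ut : ℝ → ℝ → Vn n} (hu : IsQLSol n m p A B f u ux ut) (hub : BC1le n u ux ut δ) :
    IsQLSol n m p A B f (fun x t => u x (t + T)) (fun x t => ux x (t + T)) (fun x t => ut x (t + T)) := by
  obtain ⟨c1, c2, c3, hd, he, hb⟩ := hu
  have hc : ContinuousOn (fun q : ℝ × ℝ => (q.1, q.2 + T)) strip := by fun_prop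
  have hm : MapsTo (fun q : ℝ × ℝ => (q.1, q.2 + T)) strip strip := fun q hq => ⟨hq.1, mem_univ _⟩
  refine ⟨c1.comp hc hm, c2.comp hc hm, c3.comp hc hm, fun x hx t j => ⟨(hd x hx (t + T) j).1, ?_⟩,
    fun x hx t j => ?_, fun t => hb (t + T)⟩
  · exact (hd x hx (t + T) j).2.comp_add_const t T
  · have := he x hx (t + T) j
    obtain ⟨p1, p2⟩ := hper x hx t (u x (t + T)) ((hub x hx (t + T)).1.trans h1)
    rw [hfp x hx t j, p1] at this
    simp only [p2] at this
    exact this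

theorem main
    (n m : ℕ) (hn : 1 ≤ n)
    (p : Fin n → Fin n → ℝ) (hH3 : H3cond n p)
    (A : ℝ → ℝ → Vn n → Fin n → ℝ) (B : ℝ → ℝ → Vn n → Fin n → Fin n → ℝ)
    (δ₀ Λ₀ : ℝ) (hδ₀ : 0 < δ₀) (hΛ₀ : 0 < Λ₀)
    (hH1s : ∃ C : ℝ, ∀ j : Fin n, H1smooth n δ₀ (fun x t v => A x t v j) C ∧
      ∀ k : Fin n, H1smooth n δ₀ (fun x t v => B x t v j k) C)
    (hH1 : H1sign n m δ₀ Λ₀ A)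
    (U : ℝ → ℝ → L2 n →L[ℝ] L2 n)
    (hU : GeneratedBy n m p (fun x t => A x t 0) (fun x t => B x t 0) U)
    (hdich : ∃ α : ℝ, 0 < α ∧ ∃ M : ℝ, 1 ≤ M ∧ HasExpDichotomy U α M)
    (T : ℝ) (hT : 0 < T)
    (hper : ∀ x ∈ Set.Icc (0:ℝ) 1, ∀ t : ℝ, ∀ v : Vn n, ‖v‖ ≤ δ₀ →
      (∀ j : Fin n, A x (t + T) v j = A x t v j) ∧
      (∀ j k : Fin n, B x (t + T) v j k = B x t v j k)) :
    ∃ ε : ℝ, 0 < ε ∧ ∃ δ : ℝ, 0 < δ ∧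
      ∀ f : ℝ → ℝ → Fin n → ℝ, FBC2le n f ε →
        (∀ x ∈ Set.Icc (0:ℝ) 1, ∀ t : ℝ, ∀ j : Fin n, f x (t + T) j = f x t j) →
        (∃ u ux ut : ℝ → ℝ → Vn n,
          (IsQLSol n m p A B f u ux ut ∧ BC1le n u ux ut δ) ∧
          ∀ u' ux' ut' : ℝ → ℝ → Vn n,
            IsQLSol n m p A B f u' ux' ut' → BC1le n u' ux' ut' δ →
            ∀ x ∈ Set.Icc (0:ℝ) 1, ∀ t : ℝ, u' x t = u x t) ∧
        ∀ u ux ut : ℝ → ℝ → Vn n,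
          IsQLSol n m p A B f u ux ut → BC1le n u ux ut δ →
          ∀ x ∈ Set.Icc (0:ℝ) 1, ∀ t : ℝ, u x (t + T) = u x t := by
  obtain ⟨C, R, H⟩ := mkHyp hδ₀ hΛ₀ hH1s hH1
  have hM := H.MH1.1
  have hM0 : 0 ≤ MH C R := by linarith
  have hD0 : Dat δ₀ (0 : E n) 0 0 := Dat.zero hδ₀.le
  obtain ⟨cf0, h0, hcf0, -⟩ := H.cf hD0
  have v0 : ∀ x t, vc (0 : E n) x t = 0 := fun x t => rfl
  have hrel : CfRel cf0 (fun x t => A x t 0) (fun x t => B x t 0) := fun x hx t j => by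
    have := hcf0.rel hx (t := t) (j := j) (H.A0 hx t (hD0.b x t) j)
    simp only [v0] at this
    exact this
  obtain ⟨α, hα, M', hM', hd⟩ := hdich
  obtain ⟨K, hK, hdb⟩ := dich h0 p hH3 (UCl_of_gen hrel hU) hU.1.1 hα hM' hd
  obtain ⟨δ1, hδ1, K1, hK1, hcl⟩ := ap_close hH3 hK hdb hM
  obtain ⟨K3, hK3, hLS⟩ := lin_solve p hH3 hM hK1
  have hn0 : (0:ℝ) < n := by exact_mod_cast hn
  have hn1 : (1:ℝ) ≤ n := by exact_mod_cast hn
  obtain ⟨e1, he1, s1⟩ := small (X := MH C R * n) (by positivity) hδ1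
  obtain ⟨e2, he2, s2⟩ := small (X := K1 * (MH C R * n * (n + 2))) (c := 1 / 4) (by positivity) (by norm_num)
  obtain ⟨δ, hδ, d0, d1, d2, d3⟩ : ∃ δ : ℝ, 0 < δ ∧ δ ≤ δ₀ ∧ δ ≤ 1 ∧ δ ≤ e1 ∧ δ ≤ e2 :=
    ⟨min (min δ₀ 1) (min e1 e2), by positivity, by simp, by simp, by simp, by simp⟩
  have hη : 0 < δ / n := by positivity
  have hnη : n * (δ / n) = δ := by field_simp
  have hηδ : δ / n ≤ δ := div_le_self hδ.le hn1
  obtain ⟨e3, he3, s3⟩ := small (X := (1 + K3 + (n + 2) * MH C R * K3) * MH C R) (by positivity) hη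
  obtain ⟨e4, he4, s4⟩ := small (X := K1 * (MH C R * n)) (c := 1 / 4) (by positivity) (by norm_num)
  have hUAP : UAP m p A B (MH C R) δ₀ δ K1 := fun u hu hub cf hcf => by
    have hc := H.close hub hD0.b hcf hcf0
    rw [sub_zero] at hc
    have hle : MH C R * (n * ‖u‖) ≤ δ1 := by
      refine le_trans ?_ (s1 ‖u‖ (hu.trans d2))
      rw [mul_assoc]
    exact hcl cf ⟨fun j x hx t => (hc.q j x hx t).trans hle, fun j x hx t => (hc.d j x hx t).trans hle,
      fun j k x hx t => (hc.c j k x hx t).trans hle⟩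
  have hUAP' : UAP m p A B (MH C R) δ₀ (δ / n) K1 := fun u hu => hUAP u (hu.trans hηδ)
  have hε : 0 < min e3 e4 := by positivity
  have t1 := s2 δ d3
  have t4 := s4 _ (min_le_right e3 e4)
  have t3 := s3 _ (min_le_left e3 e4)
  refine ⟨min e3 e4, hε, δ, hδ, ?_⟩
  generalize min e3 e4 = ε at hε t4 t3
  intro f hf hfp
  have hf' : ∀ j, B2 strip (fun q : ℝ × ℝ => f q.1 q.2 j) ε := fun j => ⟨hf.1 j, hf.2 j⟩
  have hs : K1 * (MH C R * n * (ε + (n + 2) * δ)) ≤ 1 / 2 := by linarith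
  have t2 := s2 (δ / n) (hηδ.trans d3)
  have hs' : K1 * (MH C R * n * (ε + (n + 2) * (δ / n))) ≤ 1 / 2 := by linarith
  have huniq := fun {u ux ut : ℝ → ℝ → Vn n} (hu : IsQLSol n m p A B f u ux ut) (hub : BC1le n u ux ut δ)
    {w wx wt : ℝ → ℝ → Vn n} (hw : IsQLSol n m p A B f w wx wt) (hwb : BC1le n w wx wt δ) =>
    ql_unique H hK1 hUAP d0 d1 hε.le hf' hs hu hub hw hwb
  obtain ⟨u, ux, ut, hu, hub⟩ := ql_exists H hK1 hK3 hUAP' (hnη.trans_le d0) (hnη.trans_le d1) hnη.le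
    hε.le hf' hT hper hfp hLS (by rw [← mul_assoc]; exact t3) hs'
  refine ⟨⟨u, ux, ut, ⟨hu, hub⟩, fun u' ux' ut' hu' hub' => huniq hu' hub' hu hub⟩, ?_⟩
  intro w wx wt hw hwb
  exact huniq (shift_sol d0 hper hfp hw hwb) (fun x hx t => hwb x hx (t + T)) hw hwb

end QL
end

/- STATEMENT 1: if moreover `A`, `B`, `f` are `T`-periodic in `t`, then the
unique small bounded classical solution is `T`-periodic in `t`. -/
theorem stmt_1
    (n m : ℕ) (hn : 1 ≤ n) (hmn : m ≤ n)
    (p : Fin n → Fin n → ℝ) (hH3 : H3cond n p)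
    (A : ℝ → ℝ → Vn n → Fin n → ℝ) (B : ℝ → ℝ → Vn n → Fin n → Fin n → ℝ)
    (δ₀ Λ₀ : ℝ) (hδ₀ : 0 < δ₀) (hΛ₀ : 0 < Λ₀)
    -- (H1): smoothness and boundedness of `A`, `B` ...
    (hH1s : ∃ C : ℝ, ∀ j : Fin n, H1smooth n δ₀ (fun x t v => A x t v j) C ∧
      ∀ k : Fin n, H1smooth n δ₀ (fun x t v => B x t v j k) C)
    -- ... and the sign/separation conditions on `A`
    (hH1 : H1sign n m δ₀ Λ₀ A)
    -- the evolution family generated by the linearized problem ...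
    (U : ℝ → ℝ → L2 n →L[ℝ] L2 n)
    (hU : GeneratedBy n m p (fun x t => A x t 0) (fun x t => B x t 0) U)
    -- ... has an exponential dichotomy on ℝ
    (hdich : ∃ α : ℝ, 0 < α ∧ ∃ M : ℝ, 1 ≤ M ∧ HasExpDichotomy U α M)
    (T : ℝ) (hT : 0 < T)
    -- `A` and `B` are `T`-periodic in `t`
    (hper : ∀ x ∈ Set.Icc (0:ℝ) 1, ∀ t : ℝ, ∀ v : Vn n, ‖v‖ ≤ δ₀ →
      (∀ j : Fin n, A x (t + T) v j = A x t v j) ∧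
      (∀ j k : Fin n, B x (t + T) v j k = B x t v j k)) :
    ∃ ε : ℝ, 0 < ε ∧ ∃ δ : ℝ, 0 < δ ∧
      ∀ f : ℝ → ℝ → Fin n → ℝ, FBC2le n f ε →
        (∀ x ∈ Set.Icc (0:ℝ) 1, ∀ t : ℝ, ∀ j : Fin n, f x (t + T) j = f x t j) →
        (∃ u ux ut : ℝ → ℝ → Vn n,
          (IsQLSol n m p A B f u ux ut ∧ BC1le n u ux ut δ) ∧
          ∀ u' ux' ut' : ℝ → ℝ → Vn n,
            IsQLSol n m p A B f u' ux' ut' → BC1le n u' ux' ut' δ →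
            ∀ x ∈ Set.Icc (0:ℝ) 1, ∀ t : ℝ, u' x t = u x t) ∧
        ∀ u ux ut : ℝ → ℝ → Vn n,
          IsQLSol n m p A B f u ux ut → BC1le n u ux ut δ →
          ∀ x ∈ Set.Icc (0:ℝ) 1, ∀ t : ℝ, u x (t + T) = u x t := by
  exact QL.main n m hn p hH3 A B δ₀ Λ₀ hδ₀ hΛ₀ hH1s hH1 U hU hdich T hT hper
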